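/- Let Γ ⊂ ℂ be a bounded quasicircle with interior Ω and let f : 𝔻 → Ω be a conformal bijection. Then ∬_𝔻 |f''(z)/f'(z)|² dA(z) < ∞ (Γ is a Weil–Petersson quasicircle) if and only if Γ is a chord-arc curve (Γ is rectifiable and there is C > 0 with ℓ(x,y) ≤ C|x−y| for all x, y ∈ Γ) and its arclength parametrization w belongs to the Sobolev space H^{3/2}(S¹), i.e., the derivative w' has finite Ḣ^{1/2}(S¹) seminorm (Bishop). -/

import Mathlib

/-!
STATEMENT 8 (Bishop): a bounded quasicircle `Γ` is Weil–Petersson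
(`∬_𝔻 |f''/f'|² dA < ∞` for the interior Riemann map `f`) if and only if `Γ` is a chord-arc
curve (rectifiable with arclength distance comparable to chord distance) whose arclength
parametrization `w` belongs to `H^{3/2}(S¹)`, i.e. `w'` has finite `Ḣ^{1/2}(S¹)` seminorm.
-/

open MeasureTheory Metric Real

/-- The homogeneous `Ḣ^s(S¹)` seminorm (squared) of a `2π`-periodic function of the angle:
`∬ |u(θ)−u(σ)|²/|e^{iθ}−e^{iσ}|^{1+2s} dθ dσ` over one period in each variable. -/
noncomputable def sobolevSeminorm (s : ℝ) (u : ℝ → ℂ) : ENNReal :=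
  ∫⁻ θ in Set.Ioc 0 (2 * π), ∫⁻ σ in Set.Ioc 0 (2 * π),
    ENNReal.ofReal
      (‖u θ - u σ‖ ^ 2 /
        ‖Complex.exp (θ * Complex.I) - Complex.exp (σ * Complex.I)‖ ^ (1 + 2 * s))

namespace WeilPetersson

open Set Filter Topology

theorem not_eventually_const_of_injOn {f : ℂ → ℂ} {U : Set ℂ} {z : ℂ} (hU : U ∈ 𝓝 z)
    (hi : InjOn f U) : ¬ ∀ᶠ y in 𝓝 z, f y = f z := by
  intro h
  have h2 : ∀ᶠ y in 𝓝[≠] z, f y = f z ∧ y ∈ U :=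
    (h.and hU).filter_mono nhdsWithin_le_nhds
  obtain ⟨y, ⟨hy1, hy2⟩, hy3⟩ := (h2.and self_mem_nhdsWithin).exists
  exact hy3 (hi hy2 (mem_of_mem_nhds hU) hy1)

theorem nhds_le_map_of_injOn {f : ℂ → ℂ} {U : Set ℂ} (hU : IsOpen U)
    (hf : DifferentiableOn ℂ f U) (hi : InjOn f U) {z : ℂ} (hz : z ∈ U) :
    𝓝 (f z) ≤ map f (𝓝 z) :=
  ((hf.analyticOnNhd hU z hz).eventually_constant_or_nhds_le_map_nhds).resolve_left
    (not_eventually_const_of_injOn (hU.mem_nhds hz) hi)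

theorem isOpen_image_of_injOn {f : ℂ → ℂ} {U : Set ℂ} (hU : IsOpen U)
    (hf : DifferentiableOn ℂ f U) (hi : InjOn f U) : IsOpen (f '' U) := by
  rw [isOpen_iff_mem_nhds]
  rintro _ ⟨z, hz, rfl⟩
  exact nhds_le_map_of_injOn hU hf hi hz (image_mem_map (hU.mem_nhds hz))

theorem continuousAt_leftInverse_of_injOn {f g : ℂ → ℂ} {U : Set ℂ} (hU : IsOpen U)
    (hf : DifferentiableOn ℂ f U) (hi : InjOn f U) (hg : LeftInvOn g f U) {z : ℂ} (hz : z ∈ U) :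
    ContinuousAt g (f z) := by
  have h : map g (𝓝 (f z)) ≤ 𝓝 (g (f z)) := by
    calc map g (𝓝 (f z)) ≤ map g (map f (𝓝 z)) := map_mono (nhds_le_map_of_injOn hU hf hi hz)
      _ = map (g ∘ f) (𝓝 z) := by rw [map_map]
      _ = map id (𝓝 z) := by
          apply Filter.map_congr
          filter_upwards [hU.mem_nhds hz] with y hy using hg hy
      _ = 𝓝 (g (f z)) := by rw [map_id, hg hz]
  exact h

theorem hasDerivAt_leftInverse_of_deriv_ne_zero {f g : ℂ → ℂ} {U : Set ℂ} (hU : IsOpen U)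
    (hf : DifferentiableOn ℂ f U) (hi : InjOn f U) (hg : LeftInvOn g f U) {z : ℂ} (hz : z ∈ U)
    (h0 : deriv f z ≠ 0) : HasDerivAt g (deriv f z)⁻¹ (f z) := by
  apply HasDerivAt.of_local_left_inverse (f := f)
    (continuousAt_leftInverse_of_injOn hU hf hi hg hz)
  · rw [hg hz]; exact (hf.differentiableAt (hU.mem_nhds hz)).hasDerivAt
  · exact h0
  · filter_upwards [(isOpen_image_of_injOn hU hf hi).mem_nhds (mem_image_of_mem f hz)] with y hy
    obtain ⟨x, hx, rfl⟩ := hy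
    rw [hg hx]

theorem deriv_ne_zero_of_injOn {f : ℂ → ℂ} {U : Set ℂ} (hU : IsOpen U)
    (hf : DifferentiableOn ℂ f U) (hi : InjOn f U) {z : ℂ} (hz : z ∈ U) : deriv f z ≠ 0 := by
  classical
  set g := Function.invFunOn f U
  have hg : LeftInvOn g f U := hi.leftInvOn_invFunOn
  have hfa : AnalyticAt ℂ f z := hf.analyticOnNhd hU z hz
  have hne : ∀ᶠ y in 𝓝[≠] z, deriv f y ≠ 0 := by
    refine (hfa.deriv.eventually_eq_zero_or_eventually_ne_zero).resolve_left fun h => ?_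
    obtain ⟨r, hr, hb⟩ := Metric.eventually_nhds_iff_ball.1 (h.and (hU.mem_nhds hz))
    refine not_eventually_const_of_injOn (hU.mem_nhds hz) hi ?_
    filter_upwards [ball_mem_nhds z hr] with y hy
    exact isOpen_ball.is_const_of_deriv_eq_zero (convex_ball z r).isPreconnected
      (hf.mono fun x hx => (hb x hx).2) (fun x hx => (hb x hx).1) hy (mem_ball_self hr)
  obtain ⟨r, hr, hb⟩ := Metric.eventually_nhds_iff_ball.1
    ((eventually_nhdsWithin_iff.1 hne).and (hU.mem_nhds hz))
  have hbU : ball z r ⊆ U := fun x hx => (hb x hx).2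
  have hs : f '' ball z r ∈ 𝓝 (f z) :=
    (isOpen_image_of_injOn isOpen_ball (hf.mono hbU) (hi.mono hbU)).mem_nhds
      (mem_image_of_mem f (mem_ball_self hr))
  have hgd : DifferentiableOn ℂ g (f '' ball z r) := by
    refine (Complex.differentiableOn_compl_singleton_and_continuousAt_iff hs).1
      ⟨?_, continuousAt_leftInverse_of_injOn hU hf hi hg hz⟩
    rintro _ ⟨⟨x, hx, rfl⟩, hxz⟩
    have hxne : x ≠ z := fun h => hxz (by rw [h]; rfl)
    exact (hasDerivAt_leftInverse_of_deriv_ne_zero hU hf hi hg (hbU hx)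
      ((hb x hx).1 hxne)).differentiableAt.differentiableWithinAt
  have h1 : HasDerivAt g (deriv g (f z)) (f z) := (hgd.differentiableAt hs).hasDerivAt
  have h2 := h1.comp z (hf.differentiableAt (hU.mem_nhds hz)).hasDerivAt
  have h3 : HasDerivAt (g ∘ f) 1 z := by
    refine (hasDerivAt_id z).congr_of_eventuallyEq ?_
    filter_upwards [hU.mem_nhds hz] with y hy using hg hy
  intro h0
  rw [h0, mul_zero] at h2
  exact zero_ne_one (h2.unique h3)

theorem differentiableOn_leftInverse {f g : ℂ → ℂ} {U : Set ℂ} (hU : IsOpen U)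
    (hf : DifferentiableOn ℂ f U) (hi : InjOn f U) (hg : LeftInvOn g f U) :
    DifferentiableOn ℂ g (f '' U) := by
  rintro _ ⟨x, hx, rfl⟩
  exact (hasDerivAt_leftInverse_of_deriv_ne_zero hU hf hi hg hx
    (deriv_ne_zero_of_injOn hU hf hi hx)).differentiableAt.differentiableWithinAt

theorem lintegral_image_holomorphic {g g' : ℂ → ℂ} {S : Set ℂ} (hS : MeasurableSet S)
    (hg : ∀ z ∈ S, HasDerivAt g (g' z) z) (hi : InjOn g S) (u : ℂ → ENNReal) :
    ∫⁻ w in g '' S, u w = ∫⁻ z in S, ENNReal.ofReal (‖g' z‖ ^ 2) * u (g z) := by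
  have h := lintegral_image_eq_lintegral_abs_det_fderiv_mul volume hS
    (f' := fun z => ((ContinuousLinearMap.toSpanSingleton ℂ (g' z)).restrictScalars ℝ))
    (fun z hz => ((hg z hz).hasFDerivAt.restrictScalars ℝ).hasFDerivWithinAt) hi u
  rw [h]
  refine setLIntegral_congr_fun hS fun z _ => ?_
  have : |((ContinuousLinearMap.toSpanSingleton ℂ (g' z)).restrictScalars ℝ).det| = ‖g' z‖ ^ 2 := by
    have hd : ((ContinuousLinearMap.toSpanSingleton ℂ (g' z)).restrictScalars ℝ).det =
        LinearMap.det
          ((ContinuousLinearMap.toSpanSingleton ℂ (g' z)).toLinearMap.restrictScalars ℝ) := rfl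
    rw [hd, LinearMap.det_restrictScalars]
    have : LinearMap.det (ContinuousLinearMap.toSpanSingleton ℂ (g' z)).toLinearMap = g' z := by
      rw [LinearMap.det_ring]; simp
    rw [this, Algebra.norm_complex_apply, Complex.normSq_eq_norm_sq, abs_of_nonneg (by positivity)]
  simp only [this]

/-- The covering map `ζ ↦ exp (i ζ)` from the upper half-plane onto the punctured unit disk. -/
noncomputable def toDisk (ζ : ℂ) : ℂ := Complex.exp (Complex.I * ζ)

theorem norm_toDisk (ζ : ℂ) : ‖toDisk ζ‖ = Real.exp (-ζ.im) := by
  simp [toDisk, Complex.norm_exp]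

theorem toDisk_mem_ball {ζ : ℂ} (h : 0 < ζ.im) : toDisk ζ ∈ ball (0 : ℂ) 1 := by
  rw [mem_ball_zero_iff, norm_toDisk]
  rw [Real.exp_lt_one_iff]; linarith

theorem toDisk_add_two_pi (ζ : ℂ) : toDisk (ζ + 2 * π) = toDisk ζ := by
  rw [toDisk, toDisk, mul_add, Complex.exp_add]
  have : Complex.I * (2 * π) = 2 * π * Complex.I := by ring
  rw [this, Complex.exp_two_pi_mul_I, mul_one]

theorem hasDerivAt_toDisk (ζ : ℂ) : HasDerivAt toDisk (Complex.I * toDisk ζ) ζ := by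
  have h := ((hasDerivAt_id ζ).const_mul Complex.I).cexp
  simp only [id, mul_one] at h
  rw [mul_comm]
  exact h

theorem toDisk_surj {z : ℂ} (hz : z ≠ 0) :
    ∃ ζ : ℂ, ζ.re ∈ Ioc 0 (2 * π) ∧ ζ.im = -Real.log ‖z‖ ∧ toDisk ζ = z := by
  refine ⟨⟨toIocMod two_pi_pos 0 (Complex.arg z), -Real.log ‖z‖⟩, ?_, rfl, ?_⟩
  · have := toIocMod_mem_Ioc two_pi_pos 0 (Complex.arg z)
    simpa using this
  · have h1 : toIocMod two_pi_pos 0 (Complex.arg z) =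
      Complex.arg z - toIocDiv two_pi_pos 0 (Complex.arg z) * (2 * π) := by
      rw [toIocMod]; simp
    have h2 : Complex.I * (⟨toIocMod two_pi_pos 0 (Complex.arg z), -Real.log ‖z‖⟩ : ℂ) =
        Complex.log z - (toIocDiv two_pi_pos 0 (Complex.arg z) : ℤ) * (2 * π * Complex.I) := by
      rw [h1]
      apply Complex.ext
      · simp [Complex.log_re]
      · simp [Complex.log_im]
    rw [toDisk, h2, Complex.exp_sub, Complex.exp_int_mul_two_pi_mul_I, div_one, Complex.exp_log hz]

theorem toDisk_injOn {a : ℝ} : InjOn toDisk {ζ | ζ.re ∈ Ioc a (a + 2 * π)} := by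
  intro z hz w hw h
  rw [toDisk, toDisk, Complex.exp_eq_exp_iff_exists_int] at h
  obtain ⟨n, hn⟩ := h
  have h1 : z = w + n * (2 * π) := by
    have : Complex.I * z = Complex.I * (w + n * (2 * π)) := by rw [hn]; ring
    exact mul_left_cancel₀ Complex.I_ne_zero this
  have h2 : z.re = w.re + n * (2 * π) := by rw [h1]; simp
  have hn0 : n = 0 := by
    have hp := pi_pos
    simp only [mem_ofPred_eq, mem_Ioc] at hz hw
    have h3 : (n : ℝ) < 1 := by
      by_contra hc; push Not at hc; nlinarith
    have h4 : (-1 : ℝ) < n := by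
      by_contra hc; push Not at hc; nlinarith
    have h5 : n < 1 := by exact_mod_cast h3
    have h6 : -1 < n := by exact_mod_cast h4
    omega
  rw [h1, hn0]; simp

/-- A holomorphic map of the upper half-plane which is periodic and whose derivative is
`exp ∘ L` with `L'` periodic. -/
structure IsLift (Ψ L : ℂ → ℂ) : Prop where
  hasDerivAt : ∀ ζ : ℂ, 0 < ζ.im → HasDerivAt Ψ (Complex.exp (L ζ)) ζ
  diff : ∀ ζ : ℂ, 0 < ζ.im → HasDerivAt L (deriv L ζ) ζ
  per : ∀ ζ : ℂ, 0 < ζ.im → Ψ (ζ + 2 * π) = Ψ ζ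
  perL : ∀ ζ : ℂ, 0 < ζ.im → deriv L (ζ + 2 * π) = deriv L ζ

theorem isOpen_upper : IsOpen {ζ : ℂ | 0 < ζ.im} := isOpen_lt continuous_const Complex.continuous_im

theorem exists_log_deriv {F : ℂ → ℂ} (hF : DifferentiableOn ℂ F (ball (0 : ℂ) 1))
    (hi : InjOn F (ball (0 : ℂ) 1)) :
    ∃ φ : ℂ → ℂ, ∀ z ∈ ball (0 : ℂ) 1, HasDerivAt φ (deriv (deriv F) z / deriv F z) z ∧
      Complex.exp (φ z) = deriv F z := by
  have hF' : DifferentiableOn ℂ (deriv F) (ball (0 : ℂ) 1) := hF.deriv isOpen_ball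
  have hne : ∀ z ∈ ball (0 : ℂ) 1, deriv F z ≠ 0 := fun z hz =>
    deriv_ne_zero_of_injOn isOpen_ball hF hi hz
  have hq : DifferentiableOn ℂ (fun z => deriv (deriv F) z / deriv F z) (ball (0 : ℂ) 1) :=
    (hF'.deriv isOpen_ball).div hF' hne
  obtain ⟨g, hg⟩ := hq.isExactOn_ball
  have h0 : (0 : ℂ) ∈ ball (0 : ℂ) 1 := mem_ball_self one_pos
  have hder : ∀ z ∈ ball (0 : ℂ) 1,
      HasDerivAt (fun z => deriv F z * Complex.exp (-g z)) 0 z := by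
    intro z hz
    have h1 := (hF'.differentiableAt (isOpen_ball.mem_nhds hz)).hasDerivAt.mul (hg z hz).neg.cexp
    refine h1.congr_deriv ?_
    have := hne z hz
    field_simp
    ring
  refine ⟨fun z => g z + (Complex.log (deriv F 0) - g 0), fun z hz => ⟨(hg z hz).add_const _, ?_⟩⟩
  have hc := isOpen_ball.is_const_of_deriv_eq_zero (convex_ball (0 : ℂ) 1).isPreconnected
    (fun z hz => (hder z hz).differentiableAt.differentiableWithinAt)
    (fun z hz => (hder z hz).deriv) hz h0
  rw [Complex.exp_add, Complex.exp_sub, Complex.exp_log (hne 0 h0)]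
  rw [Complex.exp_neg, Complex.exp_neg] at hc
  have h1 := Complex.exp_ne_zero (g z)
  have h2 := Complex.exp_ne_zero (g 0)
  field_simp at hc ⊢
  linear_combination -hc

/-- The lift of `F` to the upper half-plane, with logarithm of its derivative. -/
theorem exists_isLift {F : ℂ → ℂ} (hF : DifferentiableOn ℂ F (ball (0 : ℂ) 1))
    (hi : InjOn F (ball (0 : ℂ) 1)) :
    ∃ L : ℂ → ℂ, IsLift (fun ζ => F (toDisk ζ)) L ∧
      (∀ ζ : ℂ, 0 < ζ.im → Complex.exp (L ζ) = Complex.I * toDisk ζ * deriv F (toDisk ζ)) ∧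
      ∀ ζ : ℂ, 0 < ζ.im → deriv L ζ = Complex.I *
        (toDisk ζ * (deriv (deriv F) (toDisk ζ) / deriv F (toDisk ζ)) + 1) := by
  obtain ⟨φ, hφ⟩ := exists_log_deriv hF hi
  have hd : ∀ ζ : ℂ, 0 < ζ.im → HasDerivAt (fun ζ => φ (toDisk ζ) + (Complex.I * ζ +
      Complex.log Complex.I)) (Complex.I * (toDisk ζ * (deriv (deriv F) (toDisk ζ) /
        deriv F (toDisk ζ)) + 1)) ζ := by
    intro ζ hζ
    have h1 := ((hφ _ (toDisk_mem_ball hζ)).1.comp ζ (hasDerivAt_toDisk ζ)).add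
      (((hasDerivAt_id ζ).const_mul Complex.I).add_const (Complex.log Complex.I))
    refine h1.congr_deriv ?_
    ring
  have he : ∀ ζ : ℂ, 0 < ζ.im → Complex.exp (φ (toDisk ζ) + (Complex.I * ζ +
      Complex.log Complex.I)) = Complex.I * toDisk ζ * deriv F (toDisk ζ) := by
    intro ζ hζ
    rw [Complex.exp_add, Complex.exp_add, Complex.exp_log Complex.I_ne_zero,
      (hφ _ (toDisk_mem_ball hζ)).2, toDisk]
    ring
  refine ⟨_, ⟨fun ζ hζ => ?_, fun ζ hζ => (hd ζ hζ).differentiableAt.hasDerivAt,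
    fun ζ _ => by simp only [toDisk_add_two_pi], fun ζ hζ => ?_⟩, he, fun ζ hζ => (hd ζ hζ).deriv⟩
  · have h1 := (hF.differentiableAt (isOpen_ball.mem_nhds
      (toDisk_mem_ball hζ))).hasDerivAt.comp ζ (hasDerivAt_toDisk ζ)
    refine h1.congr_deriv ?_
    rw [he ζ hζ]; ring
  · have hζ' : 0 < (ζ + 2 * π).im := by simpa using hζ
    rw [(hd ζ hζ).deriv, (hd _ hζ').deriv, toDisk_add_two_pi]

theorem measurableSet_reProdIm {s t : Set ℝ} (hs : MeasurableSet s) (ht : MeasurableSet t) :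
    MeasurableSet (s ×ℂ t) :=
  (Complex.measurable_re hs).inter (Complex.measurable_im ht)

theorem lintegral_reProdIm {s t : Set ℝ} (hs : MeasurableSet s) (ht : MeasurableSet t)
    {u : ℂ → ENNReal} (hu : Measurable u) :
    ∫⁻ z in s ×ℂ t, u z = ∫⁻ x in s, ∫⁻ y in t, u (x + y * Complex.I) := by
  have h1 : MeasurePreserving Complex.measurableEquivRealProd.symm volume volume :=
    Complex.volume_preserving_equiv_real_prod.symm
  rw [← h1.setLIntegral_comp_preimage (measurableSet_reProdIm hs ht) hu]
  have h2 : Complex.measurableEquivRealProd.symm ⁻¹' (s ×ℂ t) = s ×ˢ t := by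
    ext p; simp [Complex.mem_reProdIm]
  rw [h2, Measure.volume_eq_prod, setLIntegral_prod _ (by fun_prop)]
  simp [Complex.measurableEquivRealProd_symm_apply, Complex.mk_eq_add_mul_I]

theorem enorm_I : ‖Complex.I‖ₑ = 1 := by
  rw [← ofReal_norm, Complex.norm_I, ENNReal.ofReal_one]

theorem ofReal_norm_sq_eq (x : ℂ) : ENNReal.ofReal (‖x‖ ^ 2) = ‖x‖ₑ ^ 2 := by
  rw [ENNReal.ofReal_pow (norm_nonneg _), ofReal_norm]

theorem enorm_add_sq_le (x y : ℂ) : ‖x + y‖ₑ ^ 2 ≤ 2 * ‖x‖ₑ ^ 2 + 2 * ‖y‖ₑ ^ 2 := by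
  rw [← ofReal_norm_sq_eq, ← ofReal_norm_sq_eq, ← ofReal_norm_sq_eq,
    ← ENNReal.ofReal_ofNat 2, ← ENNReal.ofReal_mul (by norm_num),
      ← ENNReal.ofReal_mul (by norm_num),
    ← ENNReal.ofReal_add (by positivity) (by positivity)]
  apply ENNReal.ofReal_le_ofReal
  have h := norm_add_le x y
  have h2 : ‖x + y‖ ^ 2 ≤ (‖x‖ + ‖y‖) ^ 2 := by gcongr
  nlinarith [sq_nonneg (‖x‖ - ‖y‖)]

/-- The energy of `L` in the part of height `h` of one period. -/
noncomputable def stripEnergy (L : ℂ → ℂ) (h : ℝ) : ENNReal :=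
  ∫⁻ ζ in Ioc 0 (2 * π) ×ℂ Ioo 0 h, ‖deriv L ζ‖ₑ ^ 2

theorem volume_reProdIm_lt_top {a b c d : ℝ} : volume (Ioc a b ×ℂ Ioo c d) < ⊤ := by
  have h := lintegral_reProdIm (measurableSet_Ioc (a := a) (b := b))
    (measurableSet_Ioo (a := c) (b := d)) (u := fun _ => 1) measurable_const
  simp only [one_mul, volume_Ioo, lintegral_const, Measure.restrict_apply,
    MeasurableSet.univ, univ_inter, volume_Ioc] at h
  rw [h]
  exact ENNReal.mul_lt_top ENNReal.ofReal_lt_top ENNReal.ofReal_lt_top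

theorem injOn_toDisk_strip {h : ℝ} : InjOn toDisk (Ioc 0 (2 * π) ×ℂ Ioo 0 h) :=
  (toDisk_injOn (a := 0)).mono fun ζ hζ => by
    simpa using (Complex.mem_reProdIm.1 hζ).1

theorem disk_energy_iff_stripEnergy {F L : ℂ → ℂ} (hF : DifferentiableOn ℂ F (ball (0 : ℂ) 1))
    (hi : InjOn F (ball (0 : ℂ) 1))
    (hL : ∀ ζ : ℂ, 0 < ζ.im → deriv L ζ = Complex.I *
        (toDisk ζ * (deriv (deriv F) (toDisk ζ) / deriv F (toDisk ζ)) + 1)) :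
    (∫⁻ z in ball (0 : ℂ) 1, ENNReal.ofReal (‖deriv (deriv F) z / deriv F z‖ ^ 2)) < ⊤ ↔
      stripEnergy L 1 < ⊤ := by
  set q : ℂ → ℂ := fun z => deriv (deriv F) z / deriv F z with hq
  have hqm : Measurable q := (measurable_deriv _).div (measurable_deriv _)
  set S : Set ℂ := Ioc 0 (2 * π) ×ℂ Ioo 0 1 with hS
  have hSm : MeasurableSet S := measurableSet_reProdIm measurableSet_Ioc measurableSet_Ioo
  have hSv : volume S < ⊤ := volume_reProdIm_lt_top
  have hS0 : ∀ ζ ∈ S, 0 < ζ.im := fun ζ hζ => (Complex.mem_reProdIm.1 hζ).2.1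
  have hqd : DifferentiableOn ℂ q (ball (0 : ℂ) 1) :=
    ((hF.deriv isOpen_ball).deriv isOpen_ball).div (hF.deriv isOpen_ball)
      fun z hz => deriv_ne_zero_of_injOn isOpen_ball hF hi hz
  have himg := lintegral_image_holomorphic hSm (fun z _ => hasDerivAt_toDisk z)
    (injOn_toDisk_strip (h := 1)) (fun z => ‖q z‖ₑ ^ 2)
  have h_int : ∀ ζ, ENNReal.ofReal (‖Complex.I * toDisk ζ‖ ^ 2) * ‖q (toDisk ζ)‖ₑ ^ 2 =
      ‖toDisk ζ * q (toDisk ζ)‖ₑ ^ 2 := by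
    intro ζ
    rw [ofReal_norm_sq_eq, ← mul_pow, ← enorm_mul, mul_assoc, enorm_mul, enorm_I, one_mul]
  simp only [h_int] at himg
  simp only [ofReal_norm_sq_eq]
  have htm : Measurable toDisk := by unfold toDisk; fun_prop
  constructor
  · intro h
    have h1 : ∫⁻ z in S, ‖toDisk z * q (toDisk z)‖ₑ ^ 2 < ⊤ := by
      rw [← himg]
      refine lt_of_le_of_lt (lintegral_mono_set ?_) h
      rintro _ ⟨ζ, hζ, rfl⟩
      exact toDisk_mem_ball (hS0 ζ hζ)
    calc stripEnergy L 1 = ∫⁻ ζ in S, ‖toDisk ζ * q (toDisk ζ) + 1‖ₑ ^ 2 := by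
          refine setLIntegral_congr_fun hSm fun ζ hζ => ?_
          simp only [hL ζ (hS0 ζ hζ), enorm_mul, hq, enorm_I, one_mul]
      _ ≤ ∫⁻ ζ in S, (2 * ‖toDisk ζ * q (toDisk ζ)‖ₑ ^ 2 + 2) := by
          refine lintegral_mono fun ζ => ?_
          simpa using enorm_add_sq_le (toDisk ζ * q (toDisk ζ)) 1
      _ < ⊤ := by
          rw [lintegral_add_right _ measurable_const, lintegral_const_mul _ (by fun_prop)]
          refine ENNReal.add_lt_top.2 ⟨ENNReal.mul_lt_top (by simp) h1, ?_⟩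
          simpa using ENNReal.mul_lt_top (by simp) hSv
  · intro h
    have h1 : ∫⁻ z in S, ‖toDisk z * q (toDisk z)‖ₑ ^ 2 < ⊤ := by
      calc ∫⁻ z in S, ‖toDisk z * q (toDisk z)‖ₑ ^ 2
          ≤ ∫⁻ z in S, (2 * ‖deriv L z‖ₑ ^ 2 + 2) := by
            refine setLIntegral_mono (by have := measurable_deriv L; fun_prop) fun ζ hζ => ?_
            have h2 : toDisk ζ * q (toDisk ζ) = deriv L ζ / Complex.I + (-1) := by
              rw [hL ζ (hS0 ζ hζ)]
              rw [mul_div_cancel_left₀ _ Complex.I_ne_zero]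
              simp [hq]
            rw [h2]
            simpa [div_eq_mul_inv, enorm_mul,
              enorm_I] using enorm_add_sq_le (deriv L ζ / Complex.I) (-1)
        _ < ⊤ := by
          rw [lintegral_add_right _ measurable_const,
            lintegral_const_mul _ (by have := measurable_deriv L; fun_prop)]
          refine ENNReal.add_lt_top.2 ⟨ENNReal.mul_lt_top (by simp) h, ?_⟩
          simpa using ENNReal.mul_lt_top (by simp) hSv
    rw [← himg] at h1
    have hcov : ball (0 : ℂ) 1 ⊆ toDisk '' S ∪ closedBall (0 : ℂ) (Real.exp (-1)) := by
      intro z hz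
      rw [mem_ball_zero_iff] at hz
      by_cases hz1 : ‖z‖ ≤ Real.exp (-1)
      · right; simpa using hz1
      · left
        push Not at hz1
        have hz0 : 0 < ‖z‖ := (Real.exp_pos _).trans hz1
        obtain ⟨ζ, h1, h2, h3⟩ := toDisk_surj (norm_pos_iff.1 hz0)
        refine ⟨ζ, Complex.mem_reProdIm.2 ⟨h1, ?_, ?_⟩, h3⟩
        · rw [h2]; have := Real.log_neg hz0 hz; linarith
        · rw [h2]; have := (Real.lt_log_iff_exp_lt hz0).2 hz1; linarith
    refine lt_of_le_of_lt (lintegral_mono_set hcov) ?_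
    refine lt_of_le_of_lt (lintegral_union_le _ _ _) (ENNReal.add_lt_top.2 ⟨h1, ?_⟩)
    have hsub : closedBall (0 : ℂ) (Real.exp (-1)) ⊆ ball (0 : ℂ) 1 :=
      closedBall_subset_ball (by rw [Real.exp_lt_one_iff]; norm_num)
    obtain ⟨C, hC⟩ := (isCompact_closedBall (0 : ℂ) (Real.exp (-1))).exists_bound_of_continuousOn
      (hqd.continuousOn.mono hsub)
    calc ∫⁻ z in closedBall (0 : ℂ) (Real.exp (-1)), ‖q z‖ₑ ^ 2
        ≤ ∫⁻ z in closedBall (0 : ℂ) (Real.exp (-1)), ENNReal.ofReal (C ^ 2) := by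
          refine setLIntegral_mono measurable_const fun z hz => ?_
          rw [← ofReal_norm_sq_eq]
          exact ENNReal.ofReal_le_ofReal (pow_le_pow_left₀ (norm_nonneg _) (hC z hz) 2)
      _ < ⊤ := by
          simp only [lintegral_const, Measure.restrict_apply, MeasurableSet.univ, univ_inter]
          exact ENNReal.mul_lt_top ENNReal.ofReal_lt_top measure_closedBall_lt_top

theorem setLIntegral_Ioc_of_periodic {g : ℝ → ENNReal} (hg : ∀ x, g (x + 2 * π) = g x) (a b : ℝ) :
    ∫⁻ x in Ioc a (a + 2 * π), g x = ∫⁻ x in Ioc b (b + 2 * π), g x := by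
  refine (isAddFundamentalDomain_Ioc two_pi_pos a).setLIntegral_eq
    (isAddFundamentalDomain_Ioc two_pi_pos b) g ?_
  have hp : Function.Periodic g (2 * π) := hg
  rintro ⟨_, n, rfl⟩ x
  have := hp.zsmul n x
  simpa [AddSubgroup.vadd_def, add_comm] using this

theorem enorm_sq_mul_le_lintegral_ball {f : ℂ → ℂ} {c : ℂ} {R : ℝ} (hR : 0 < R)
    (hf : DifferentiableOn ℂ f (ball c R)) :
    ‖f c‖ₑ ^ 2 * ENNReal.ofReal (π * R ^ 2) ≤ ∫⁻ z in ball c R, ‖f z‖ₑ ^ 2 := by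
  have hcirc : ∀ r ∈ Ioo 0 R, ‖f c‖ₑ ^ 2 * ENNReal.ofReal (2 * π) ≤
      ∫⁻ θ in Ioo (-π) π, ‖f (c + r * Complex.exp (θ * Complex.I))‖ₑ ^ 2 := by
    intro r hr
    have hsub : closedBall c r ⊆ ball c R := closedBall_subset_ball hr.2
    have hfd : DifferentiableOn ℂ f (closedBall c r) := hf.mono hsub
    have h1 : Real.circleAverage (fun z => f z ^ 2) c r = f c ^ 2 := by
      apply DiffContOnCl.circleAverage
      rw [abs_of_pos hr.1]
      exact ((hf.pow 2).mono hsub).diffContOnCl_ball subset_rfl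
    have h2 : f c ^ 2 = (2 * π)⁻¹ • ∫ θ in (-π)..π, f (circleMap c r θ) ^ 2 := by
      rw [← h1, Real.circleAverage_def]
      congr 1
      have hp : Function.Periodic (fun θ => f (circleMap c r θ) ^ 2) (2 * π) := fun θ => by
        simp only [periodic_circleMap c r θ]
      have := hp.intervalIntegral_add_eq 0 (-π)
      rw [zero_add] at this
      rw [this]; congr 1; ring
    have h3 : ∀ θ : ℝ, circleMap c r θ = c + r * Complex.exp (θ * Complex.I) := fun θ => rfl
    have h4 : ‖f c ^ 2 * (2 * π)‖ₑ ≤ ∫⁻ θ in Ioo (-π) π, ‖f (circleMap c r θ) ^ 2‖ₑ := by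
      have : f c ^ 2 * (2 * π) = ∫ θ in Ioc (-π) π, f (circleMap c r θ) ^ 2 := by
        rw [← intervalIntegral.integral_of_le (by linarith [pi_pos]), h2]
        rw [Complex.real_smul]
        have := pi_ne_zero
        push_cast
        field_simp
      rw [this, restrict_Ioo_eq_restrict_Ioc]
      exact enorm_integral_le_lintegral_enorm _
    simp only [enorm_pow, enorm_mul, h3] at h4
    convert h4 using 2
    rw [← ofReal_norm, ← ofReal_norm, ← ENNReal.ofReal_mul (by positivity)]
    simp [abs_of_pos pi_pos]
  have hpol := Complex.lintegral_comp_polarCoord_symm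
    (fun z => (ball (0 : ℂ) R).indicator (fun z => ‖f (c + z)‖ₑ ^ 2) z)
  rw [lintegral_indicator measurableSet_ball] at hpol
  have htr : ∫⁻ z in ball (0 : ℂ) R, ‖f (c + z)‖ₑ ^ 2 = ∫⁻ z in ball c R, ‖f z‖ₑ ^ 2 := by
    have hmp := (measurePreserving_add_left (volume : Measure ℂ) c).setLIntegral_comp_preimage_emb
      (MeasurableEquiv.addLeft c).measurableEmbedding (fun z => ‖f z‖ₑ ^ 2) (ball c R)
    rw [← hmp]
    congr 2
    ext z; simp
  rw [← htr, ← hpol]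
  have hsub : Ioo 0 R ×ˢ Ioo (-π) π ⊆ Complex.polarCoord.target := by
    rw [Complex.polarCoord_target]
    exact prod_mono Ioo_subset_Ioi_self subset_rfl
  refine le_trans ?_ (lintegral_mono_set hsub)
  have hcont : ContinuousOn (fun p : ℝ × ℝ => f (c + p.1 * Complex.exp (p.2 * Complex.I)))
      (Ioo 0 R ×ˢ Ioo (-π) π) := by
    refine hf.continuousOn.comp (by fun_prop) ?_
    rintro ⟨r, θ⟩ ⟨hr, -⟩
    simp only [mem_ball, dist_self_add_left]
    rw [norm_mul, Complex.norm_exp_ofReal_mul_I, mul_one, Complex.norm_real, norm_eq_abs,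
      abs_of_pos hr.1]
    exact hr.2
  have hms : MeasurableSet (Ioo 0 R ×ˢ Ioo (-π) π) := measurableSet_Ioo.prod measurableSet_Ioo
  have heq : ∫⁻ p in Ioo 0 R ×ˢ Ioo (-π) π, ENNReal.ofReal p.1 • (ball (0 : ℂ) R).indicator
      (fun z => ‖f (c + z)‖ₑ ^ 2) (Complex.polarCoord.symm p) =
      ∫⁻ p in Ioo 0 R ×ˢ Ioo (-π) π, ENNReal.ofReal p.1 *
        ‖f (c + p.1 * Complex.exp (p.2 * Complex.I))‖ₑ ^ 2 := by
    refine setLIntegral_congr_fun hms ?_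
    rintro ⟨r, θ⟩ ⟨hr, -⟩
    have he : Complex.polarCoord.symm (r, θ) = r * Complex.exp (θ * Complex.I) := by
      rw [Complex.polarCoord_symm_apply, Complex.exp_mul_I]; push_cast; rfl
    simp only [he, smul_eq_mul]
    rw [indicator_of_mem]
    rw [mem_ball_zero_iff, norm_mul, Complex.norm_exp_ofReal_mul_I, mul_one, Complex.norm_real,
      norm_eq_abs, abs_of_pos hr.1]
    exact hr.2
  rw [heq, Measure.volume_eq_prod, setLIntegral_prod]
  · calc ‖f c‖ₑ ^ 2 * ENNReal.ofReal (π * R ^ 2)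
        = ∫⁻ r in Ioo 0 R, ENNReal.ofReal r * (‖f c‖ₑ ^ 2 * ENNReal.ofReal (2 * π)) := by
          rw [lintegral_mul_const _ (by fun_prop)]
          have : ∫⁻ r in Ioo 0 R, ENNReal.ofReal r = ENNReal.ofReal (R ^ 2 / 2) := by
            rw [restrict_Ioo_eq_restrict_Ioc, ← ofReal_integral_eq_lintegral_ofReal,
              ← intervalIntegral.integral_of_le hR.le, integral_id]
            · congr 1; ring
            · exact (intervalIntegrable_iff_integrableOn_Ioc_of_le hR.le).1
                (continuous_id.intervalIntegrable 0 R)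
            · filter_upwards [ae_restrict_mem measurableSet_Ioc] with r hr using hr.1.le
          rw [this, mul_left_comm, ← ENNReal.ofReal_mul (by positivity)]
          congr 2; ring
      _ ≤ _ := by
          refine setLIntegral_mono' measurableSet_Ioo fun r hr => ?_
          refine (mul_le_mul_right (hcirc r hr) _).trans ?_
          rw [← lintegral_const_mul' _ _ ENNReal.ofReal_ne_top]
  · rw [← Measure.volume_eq_prod]
    exact ((by fun_prop : Measurable fun p : ℝ × ℝ => ENNReal.ofReal p.1).aemeasurable).mul
      ((hcont.aestronglyMeasurable hms).enorm.pow_const 2)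

/-- Energy over one period, starting anywhere. -/
theorem lintegral_strip_eq {Ψ L : ℂ → ℂ} (hL : IsLift Ψ L) (a h : ℝ) :
    ∫⁻ ζ in Ioc a (a + 2 * π) ×ℂ Ioo 0 h, ‖deriv L ζ‖ₑ ^ 2 = stripEnergy L h := by
  have hm : Measurable fun ζ => ‖deriv L ζ‖ₑ ^ 2 := by have := measurable_deriv L; fun_prop
  rw [stripEnergy, lintegral_reProdIm measurableSet_Ioc measurableSet_Ioo hm,
    lintegral_reProdIm measurableSet_Ioc measurableSet_Ioo hm]
  have := setLIntegral_Ioc_of_periodic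
    (g := fun x => ∫⁻ y in Ioo 0 h, ‖deriv L (x + y * Complex.I)‖ₑ ^ 2) (fun x => ?_) a 0
  · rw [this, zero_add]
  · refine setLIntegral_congr_fun measurableSet_Ioo fun y hy => ?_
    have := hL.perL (x + y * Complex.I) (by simpa using hy.1)
    rw [← this]; push_cast; congr 3; ring

theorem tendsto_stripEnergy {L : ℂ → ℂ} (h : stripEnergy L 1 < ⊤) :
    Tendsto (stripEnergy L) (𝓝[>] 0) (𝓝 0) := by
  have h1 : Tendsto (fun h : ℝ => ∫⁻ ζ in Ioc 0 (2 * π) ×ℂ Ioo 0 h, ‖deriv L ζ‖ₑ ^ 2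
      ∂(volume.restrict (Ioc 0 (2 * π) ×ℂ Ioo 0 1))) (𝓝[>] 0) (𝓝 0) := by
    refine tendsto_setLIntegral_zero h.ne ?_
    have h2 : Tendsto (fun h : ℝ => ENNReal.ofReal (h * (2 * π))) (𝓝[>] 0) (𝓝 0) := by
      have h3 : Tendsto (fun h : ℝ => h * (2 * π)) (𝓝[>] 0) (𝓝 0) := by
        have : Tendsto (fun h : ℝ => h * (2 * π)) (𝓝 0) (𝓝 (0 * (2 * π))) :=
          (continuous_id.mul continuous_const).tendsto 0
        rw [zero_mul] at this
        exact this.mono_left nhdsWithin_le_nhds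
      simpa using ENNReal.tendsto_ofReal h3
    refine tendsto_of_tendsto_of_tendsto_of_le_of_le' tendsto_const_nhds h2
      (Eventually.of_forall fun _ => zero_le) ?_
    filter_upwards [self_mem_nhdsWithin] with h hh
    have hh : 0 < h := hh
    refine (Measure.restrict_apply_le _ _).trans ?_
    have h := lintegral_reProdIm (measurableSet_Ioc (a := 0) (b := 2 * π))
      (measurableSet_Ioo (a := 0) (b := h)) (u := fun _ => 1) measurable_const
    simp only [one_mul, volume_Ioo, lintegral_const, Measure.restrict_apply,
      MeasurableSet.univ, univ_inter, volume_Ioc, sub_zero] at h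
    rw [h, ENNReal.ofReal_mul hh.le]
  refine h1.congr' ?_
  filter_upwards [Ioo_mem_nhdsGT one_pos] with h hh
  rw [Measure.restrict_restrict (measurableSet_reProdIm measurableSet_Ioc measurableSet_Ioo),
    inter_eq_left.2]
  · rfl
  · intro ζ hζ
    exact ⟨hζ.1, hζ.2.1, hζ.2.2.trans hh.2⟩

/-- The little Bloch property. -/
theorem exists_im_mul_norm_deriv_le {Ψ L : ℂ → ℂ} (hL : IsLift Ψ L) (hE : stripEnergy L 1 < ⊤)
    {ε : ℝ} (hε : 0 < ε) :
    ∃ y₀ ∈ Ioo (0 : ℝ) 1, ∀ ζ : ℂ, 0 < ζ.im → ζ.im ≤ y₀ → ζ.im * ‖deriv L ζ‖ ≤ ε := by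
  have h1 : ∀ᶠ h in 𝓝[>] (0 : ℝ), stripEnergy L h < ENNReal.ofReal (ε ^ 2 * (π / 4)) :=
    (tendsto_stripEnergy hE).eventually_lt_const (by simp; positivity)
  obtain ⟨h, hhE, hh⟩ := (h1.and (Ioo_mem_nhdsGT one_pos)).exists
  refine ⟨h / 2, ⟨by linarith [hh.1], by linarith [hh.2]⟩, fun ζ hζ hζh => ?_⟩
  set y := ζ.im with hy
  have him : ∀ w ∈ ball ζ (y / 2), |w.re - ζ.re| < y / 2 ∧ |w.im - y| < y / 2 := by
    intro w hw
    rw [mem_ball, Complex.dist_eq] at hw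
    exact ⟨(Complex.abs_re_le_norm (w - ζ)).trans_lt hw,
      (Complex.abs_im_le_norm (w - ζ)).trans_lt hw⟩
  have hdiff : DifferentiableOn ℂ (deriv L) (ball ζ (y / 2)) := by
    have hLd : DifferentiableOn ℂ L {ζ : ℂ | 0 < ζ.im} := fun w hw =>
      (hL.diff w hw).differentiableAt.differentiableWithinAt
    refine (hLd.deriv isOpen_upper).mono fun w hw => ?_
    have := (abs_lt.1 (him w hw).2).1
    simp only [mem_ofPred_eq]; linarith
  have h2 := enorm_sq_mul_le_lintegral_ball (by linarith) hdiff
  have h3 : ∫⁻ z in ball ζ (y / 2), ‖deriv L z‖ₑ ^ 2 ≤ stripEnergy L h := by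
    rw [← lintegral_strip_eq hL (ζ.re - π)]
    refine lintegral_mono_set fun w hw => Complex.mem_reProdIm.2 ?_
    have h4 := abs_lt.1 (him w hw).1
    have h5 := abs_lt.1 (him w hw).2
    have := pi_gt_three
    exact ⟨⟨by linarith [hh.2], by linarith [hh.2]⟩, by linarith, by linarith⟩
  have h4 := (h2.trans h3).trans_lt hhE
  rw [← ofReal_norm_sq_eq, ← ENNReal.ofReal_mul (by positivity), ENNReal.ofReal_lt_ofReal_iff
    (by positivity)] at h4
  have h5 : (y * ‖deriv L ζ‖) ^ 2 ≤ ε ^ 2 := by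
    have hp := pi_pos
    have : ‖deriv L ζ‖ ^ 2 * (π * (y / 2) ^ 2) = (y * ‖deriv L ζ‖) ^ 2 * (π / 4) := by ring
    rw [this] at h4
    exact (lt_of_mul_lt_mul_right h4 (by positivity)).le
  exact le_of_sq_le_sq h5 hε.le

theorem sq_lintegral_mul_le {α : Type*} [MeasurableSpace α] {μ : Measure α} {f g : α → ENNReal}
    (hf : AEMeasurable f μ) (hg : AEMeasurable g μ) :
    (∫⁻ x, f x * g x ∂μ) ^ 2 ≤ (∫⁻ x, f x ^ 2 ∂μ) * ∫⁻ x, g x ^ 2 ∂μ := by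
  have h := ENNReal.lintegral_mul_le_Lp_mul_Lq μ Real.HolderConjugate.two_two hf hg
  simp only [Pi.mul_apply] at h
  calc (∫⁻ x, f x * g x ∂μ) ^ 2
      ≤ ((∫⁻ x, f x ^ (2 : ℝ) ∂μ) ^ (1 / (2 : ℝ)) *
        (∫⁻ x, g x ^ (2 : ℝ) ∂μ) ^ (1 / (2 : ℝ))) ^ 2 := by
        gcongr
    _ = _ := by
        rw [mul_pow, ← ENNReal.rpow_natCast, ← ENNReal.rpow_natCast, ← ENNReal.rpow_mul,
          ← ENNReal.rpow_mul]
        norm_num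

theorem IsLift.exp_per {Ψ L : ℂ → ℂ} (hL : IsLift Ψ L) {ζ : ℂ} (hζ : 0 < ζ.im) :
    Complex.exp (L (ζ + 2 * π)) = Complex.exp (L ζ) := by
  have h1 : HasDerivAt (fun w => Ψ (w + 2 * π)) (Complex.exp (L (ζ + 2 * π))) ζ := by
    have := (hL.hasDerivAt (ζ + 2 * π) (by simpa using hζ)).comp_add_const ζ (2 * π : ℂ)
    exact this
  refine h1.unique ((hL.hasDerivAt ζ hζ).congr_of_eventuallyEq ?_)
  filter_upwards [isOpen_upper.mem_nhds hζ] with w hw using hL.per w hw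

theorem hasDerivAt_vertical {f : ℂ → ℂ} {f' : ℂ} {x y : ℝ}
    (h : HasDerivAt f f' (x + y * Complex.I)) :
    HasDerivAt (fun t : ℝ => f (x + t * Complex.I)) (f' * Complex.I) y := by
  have h1 : HasDerivAt (fun t : ℝ => (x + t * Complex.I : ℂ)) Complex.I y := by
    simpa using ((hasDerivAt_id y).ofReal_comp.mul_const Complex.I).const_add (x : ℂ)
  exact h.comp y h1

theorem hasDerivAt_horizontal {f : ℂ → ℂ} {f' : ℂ} {x y : ℝ}
    (h : HasDerivAt f f' (x + y * Complex.I)) :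
    HasDerivAt (fun t : ℝ => f (t + y * Complex.I)) f' x := by
  have h1 : HasDerivAt (fun t : ℝ => (t + y * Complex.I : ℂ)) 1 x := by
    simpa using ((hasDerivAt_id x).ofReal_comp).add_const (y * Complex.I : ℂ)
  have h2 := h.comp x h1
  rw [mul_one] at h2
  exact h2

theorem im_add_mul_I (x y : ℝ) : ((x : ℂ) + y * Complex.I).im = y := by simp

/-- Growth of the derivative along vertical lines. -/
theorem norm_exp_le_of_vertical {Ψ L : ℂ → ℂ} (hL : IsLift Ψ L) {ε y₀ : ℝ}
    (hB : ∀ ζ : ℂ, 0 < ζ.im → ζ.im ≤ y₀ → ζ.im * ‖deriv L ζ‖ ≤ ε) {x y u : ℝ} (hy : 0 < y)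
    (hyu : y ≤ u) (hu : u ≤ y₀) :
    ‖Complex.exp (L (x + y * Complex.I))‖ ≤
      (u / y) ^ ε * ‖Complex.exp (L (x + u * Complex.I))‖ := by
  have hu0 : 0 < u := hy.trans_le hyu
  set g : ℝ → ℝ := fun t => (L (x + t * Complex.I)).re + ε * Real.log t with hg
  have hder : ∀ t ∈ Icc y u, HasDerivAt g ((deriv L (x + t * Complex.I) * Complex.I).re + ε * t⁻¹)
      t := by
    intro t ht
    have ht0 : 0 < t := hy.trans_le ht.1
    exact (Complex.reCLM.hasFDerivAt.comp_hasDerivAt t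
      (hasDerivAt_vertical (hL.diff _ (by simpa using ht0)))).add
      ((Real.hasDerivAt_log ht0.ne').const_mul ε)
  have hmono : MonotoneOn g (Icc y u) := by
    refine monotoneOn_of_deriv_nonneg (convex_Icc y u)
      (fun t ht => (hder t ht).continuousAt.continuousWithinAt)
      (fun t ht => (hder t (interior_subset ht)).differentiableAt.differentiableWithinAt) ?_
    intro t ht
    have ht := interior_subset ht
    have ht0 : 0 < t := hy.trans_le ht.1
    rw [(hder t ht).deriv]
    have h1 := hB (x + t * Complex.I) (by simpa using ht0) (by simpa using ht.2.trans hu)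
    rw [im_add_mul_I] at h1
    have h2 := (abs_le.1 (Complex.abs_re_le_norm (deriv L (x + t * Complex.I) * Complex.I))).1
    rw [norm_mul, Complex.norm_I, mul_one] at h2
    have h3 : ‖deriv L (x + t * Complex.I)‖ ≤ ε * t⁻¹ := by
      rw [← div_eq_mul_inv, le_div_iff₀ ht0]; linarith
    linarith
  have h1 := hmono (left_mem_Icc.2 hyu) (right_mem_Icc.2 hyu) hyu
  simp only [hg] at h1
  rw [Complex.norm_exp, Complex.norm_exp, Real.rpow_def_of_pos (by positivity), ← Real.exp_add,
    Real.exp_le_exp, Real.log_div hu0.ne' hy.ne']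
  linarith

theorem norm_sub_le_of_horizontal {Ψ L : ℂ → ℂ} (hL : IsLift Ψ L) {ε y₀ : ℝ}
    (hB : ∀ ζ : ℂ, 0 < ζ.im → ζ.im ≤ y₀ → ζ.im * ‖deriv L ζ‖ ≤ ε) {x x' u : ℝ} (hu : 0 < u)
    (hu' : u ≤ y₀) :
    ‖L (x' + u * Complex.I) - L (x + u * Complex.I)‖ ≤ ε / u * |x' - x| := by
  have := convex_univ.norm_image_sub_le_of_norm_hasDerivWithin_le
    (f := fun t : ℝ => L (t + u * Complex.I)) (f' := fun t : ℝ => deriv L (t + u * Complex.I))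
    (C := ε / u) (fun t _ => (hasDerivAt_horizontal
      (hL.diff _ (by simpa using hu))).hasDerivWithinAt)
    (fun t _ => ?_) (mem_univ x) (mem_univ x')
  · simpa using this
  · have h1 := hB (t + u * Complex.I) (by simpa using hu) (by simpa using hu')
    rw [im_add_mul_I] at h1
    rw [le_div_iff₀ hu]; linarith

theorem IsLift.deriv_eq {Ψ L : ℂ → ℂ} (hL : IsLift Ψ L) {ζ : ℂ} (hζ : 0 < ζ.im) :
    deriv Ψ ζ = Complex.exp (L ζ) := (hL.hasDerivAt ζ hζ).deriv

theorem IsLift.differentiableOn_deriv {Ψ L : ℂ → ℂ} (hL : IsLift Ψ L) :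
    DifferentiableOn ℂ (deriv L) {ζ | 0 < ζ.im} :=
  DifferentiableOn.deriv (fun ζ hζ => (hL.diff ζ hζ).differentiableAt.differentiableWithinAt)
    isOpen_upper

theorem IsLift.hasDerivAt_deriv {Ψ L : ℂ → ℂ} (hL : IsLift Ψ L) {ζ : ℂ} (hζ : 0 < ζ.im) :
    HasDerivAt (deriv Ψ) (deriv L ζ * deriv Ψ ζ) ζ := by
  have h1 := (hL.diff ζ hζ).cexp
  rw [hL.deriv_eq hζ, mul_comm]
  refine h1.congr_of_eventuallyEq ?_
  filter_upwards [isOpen_upper.mem_nhds hζ] with w hw using hL.deriv_eq hw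

theorem IsLift.deriv_ne_zero {Ψ L : ℂ → ℂ} (hL : IsLift Ψ L) {ζ : ℂ} (hζ : 0 < ζ.im) :
    deriv Ψ ζ ≠ 0 := by
  rw [hL.deriv_eq hζ]; exact Complex.exp_ne_zero _

theorem IsLift.deriv_per {Ψ L : ℂ → ℂ} (hL : IsLift Ψ L) {ζ : ℂ} (hζ : 0 < ζ.im) :
    deriv Ψ (ζ + 2 * π) = deriv Ψ ζ := by
  rw [hL.deriv_eq hζ, hL.deriv_eq (by simpa using hζ), hL.exp_per hζ]

/-- The weighted energy of `L'` on a vertical segment. -/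
noncomputable def radialEnergy (L : ℂ → ℂ) (x u : ℝ) : ENNReal :=
  ∫⁻ t in Ioo 0 u, ENNReal.ofReal (t ^ (1 / 2 : ℝ)) * ‖deriv L (x + t * Complex.I)‖ₑ ^ 2

theorem measurable_deriv_vertical (f : ℂ → ℂ) :
    Measurable fun p : ℝ × ℝ => deriv f (p.1 + p.2 * Complex.I) :=
  (measurable_deriv f).comp (by fun_prop)

theorem continuousOn_vertical {f : ℂ → ℂ} (hf : ContinuousOn f {ζ | 0 < ζ.im}) (x : ℝ) :
    ContinuousOn (fun t : ℝ => f (x + t * Complex.I)) (Ioi 0) :=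
  hf.comp (by fun_prop) (fun t ht => by simpa using ht)

theorem continuousOn_horizontal {f : ℂ → ℂ} (hf : ContinuousOn f {ζ | 0 < ζ.im}) {y : ℝ}
    (hy : 0 < y) : Continuous (fun t : ℝ => f (t + y * Complex.I)) :=
  hf.comp_continuous (by fun_prop) (fun t => by simpa using hy)

theorem IsLift.continuousOn_deriv_map {Ψ L : ℂ → ℂ} (hL : IsLift Ψ L) :
    ContinuousOn (deriv Ψ) {ζ | 0 < ζ.im} :=
  fun _ hζ => (hL.hasDerivAt_deriv hζ).continuousAt.continuousWithinAt

theorem lintegral_weight_le {y u : ℝ} (hy : 0 < y) (hyu : y ≤ u) :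
    ∫⁻ t in Ioc y u, ENNReal.ofReal ((u / t) ^ (1 / 8 : ℝ) * t ^ (-(1 / 4) : ℝ)) ^ 2 ≤
      4 * ENNReal.ofReal (u ^ (1 / 2 : ℝ)) := by
  have hu : 0 < u := hy.trans_le hyu
  have h1 : ∀ t ∈ Ioc y u, ENNReal.ofReal ((u / t) ^ (1 / 8 : ℝ) * t ^ (-(1 / 4) : ℝ)) ^ 2 =
      ENNReal.ofReal (u ^ (1 / 4 : ℝ) * t ^ (-(3 / 4) : ℝ)) := by
    intro t ht
    have ht0 : 0 < t := hy.trans ht.1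
    rw [← ENNReal.ofReal_pow (by positivity)]
    congr 1
    rw [Real.div_rpow hu.le ht0.le, ← Real.rpow_natCast _ 2, Real.mul_rpow (by positivity)
      (by positivity), Real.div_rpow (by positivity) (by positivity), ← Real.rpow_mul hu.le,
      ← Real.rpow_mul ht0.le, ← Real.rpow_mul ht0.le, div_eq_mul_inv, ← Real.rpow_neg ht0.le,
      mul_assoc, ← Real.rpow_add ht0]
    norm_num
  rw [setLIntegral_congr_fun measurableSet_Ioc h1]
  have h2 : IntervalIntegrable (fun t : ℝ => u ^ (1 / 4 : ℝ) * t ^ (-(3 / 4) : ℝ)) volume y u :=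
    (intervalIntegral.intervalIntegrable_rpow' (by norm_num)).const_mul _
  rw [← ofReal_integral_eq_lintegral_ofReal
    ((intervalIntegrable_iff_integrableOn_Ioc_of_le hyu).1 h2)
    ((ae_restrict_iff' measurableSet_Ioc).2 (ae_of_all _ fun t ht => by
      have : 0 < t := hy.trans ht.1
      positivity)), ← intervalIntegral.integral_of_le hyu, intervalIntegral.integral_const_mul,
    integral_rpow (Or.inl (by norm_num))]
  rw [show (4 : ENNReal) = ENNReal.ofReal 4 by simp, ← ENNReal.ofReal_mul (by norm_num)]
  apply ENNReal.ofReal_le_ofReal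
  have h3 : u ^ (1 / 2 : ℝ) = u ^ (1 / 4 : ℝ) * u ^ (1 / 4 : ℝ) := by
    rw [← Real.rpow_add hu]; norm_num
  rw [h3, show (-(3 / 4) + 1 : ℝ) = 1 / 4 by norm_num]
  have h4 : 0 ≤ y ^ (1 / 4 : ℝ) := by positivity
  have h5 : 0 ≤ u ^ (1 / 4 : ℝ) := by positivity
  have h6 : 0 ≤ u ^ (1 / 4 : ℝ) * y ^ (1 / 4 : ℝ) := by positivity
  field_simp
  nlinarith

/-- The oscillation of `Ψ'` on vertical segments. -/
theorem enorm_deriv_sub_sq_le {Ψ L : ℂ → ℂ} (hL : IsLift Ψ L) {y₀ : ℝ}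
    (hB : ∀ ζ : ℂ, 0 < ζ.im → ζ.im ≤ y₀ → ζ.im * ‖deriv L ζ‖ ≤ 1 / 8) {x y u : ℝ} (hy : 0 < y)
    (hyu : y ≤ u) (hu : u ≤ y₀) :
    ‖deriv Ψ (x + y * Complex.I) - deriv Ψ (x + u * Complex.I)‖ₑ ^ 2 ≤
      4 * ENNReal.ofReal (u ^ (1 / 2 : ℝ)) * radialEnergy L x u *
        ‖deriv Ψ (x + u * Complex.I)‖ₑ ^ 2 := by
  have hu0 : 0 < u := hy.trans_le hyu
  have hsub : uIcc y u ⊆ Ioi 0 := by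
    rw [uIcc_of_le hyu]; exact fun t ht => hy.trans_le ht.1
  have hcont : ContinuousOn (fun t : ℝ => deriv L (x + t * Complex.I) *
      deriv Ψ (x + t * Complex.I) * Complex.I) (Ioi 0) :=
    ((continuousOn_vertical hL.differentiableOn_deriv.continuousOn x).mul
      (continuousOn_vertical hL.continuousOn_deriv_map x)).mul continuousOn_const
  have hftc := intervalIntegral.integral_eq_sub_of_hasDerivAt
    (f := fun t : ℝ => deriv Ψ (x + t * Complex.I)) (a := y) (b := u)
    (f' := fun t : ℝ => deriv L (x + t * Complex.I) * deriv Ψ (x + t * Complex.I) * Complex.I)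
    (fun t ht => hasDerivAt_vertical (hL.hasDerivAt_deriv (by simpa using hsub ht)))
    (hcont.mono hsub).intervalIntegrable
  rw [← neg_sub, enorm_neg, ← hftc, intervalIntegral.integral_of_le hyu]
  set c := ‖deriv Ψ (x + u * Complex.I)‖ₑ with hc
  have h1 : ‖∫ t in Ioc y u, deriv L (x + t * Complex.I) * deriv Ψ (x + t * Complex.I) *
      Complex.I‖ₑ ≤ c * ∫⁻ t in Ioc y u,
        ENNReal.ofReal ((u / t) ^ (1 / 8 : ℝ) * t ^ (-(1 / 4) : ℝ)) *
        (ENNReal.ofReal (t ^ (1 / 4 : ℝ)) * ‖deriv L (x + t * Complex.I)‖ₑ) := by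
    refine (enorm_integral_le_lintegral_enorm _).trans ?_
    rw [← lintegral_const_mul' _ _ (by simp [hc])]
    refine setLIntegral_mono' measurableSet_Ioc fun t ht => ?_
    have ht0 : 0 < t := hy.trans ht.1
    have h2 := norm_exp_le_of_vertical hL hB (x := x) ht0 ht.2 hu
    rw [← hL.deriv_eq (by simpa using ht0), ← hL.deriv_eq (by simpa using hu0)] at h2
    have h3 : ‖deriv Ψ (x + t * Complex.I)‖ₑ ≤ ENNReal.ofReal ((u / t) ^ (1 / 8 : ℝ)) * c := by
      rw [← ofReal_norm, hc, ← ofReal_norm, ← ENNReal.ofReal_mul (by positivity)]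
      exact ENNReal.ofReal_le_ofReal h2
    have h4 : ENNReal.ofReal ((u / t) ^ (1 / 8 : ℝ) * t ^ (-(1 / 4) : ℝ)) *
        ENNReal.ofReal (t ^ (1 / 4 : ℝ)) = ENNReal.ofReal ((u / t) ^ (1 / 8 : ℝ)) := by
      rw [← ENNReal.ofReal_mul (by positivity), mul_assoc, ← Real.rpow_add ht0]
      norm_num
    rw [enorm_mul, enorm_mul, enorm_I, mul_one, ← mul_assoc (ENNReal.ofReal _), h4]
    calc _ ≤ ‖deriv L (x + t * Complex.I)‖ₑ * (ENNReal.ofReal ((u / t) ^ (1 / 8 : ℝ)) * c) := by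
          gcongr
      _ = _ := by ring
  have hm : Measurable fun t : ℝ => deriv L (x + t * Complex.I) :=
    (measurable_deriv L).comp (by fun_prop)
  have h5 := sq_lintegral_mul_le (μ := volume.restrict (Ioc y u))
    (f := fun t => ENNReal.ofReal ((u / t) ^ (1 / 8 : ℝ) * t ^ (-(1 / 4) : ℝ)))
    (g := fun t => ENNReal.ofReal (t ^ (1 / 4 : ℝ)) * ‖deriv L (x + t * Complex.I)‖ₑ)
    (by fun_prop) (by fun_prop)
  have h6 : ∫⁻ t in Ioc y u, (ENNReal.ofReal (t ^ (1 / 4 : ℝ)) *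
      ‖deriv L (x + t * Complex.I)‖ₑ) ^ 2 ≤ radialEnergy L x u := by
    rw [radialEnergy, setLIntegral_congr Ioo_ae_eq_Ioc]
    refine (setLIntegral_mono_ae' measurableSet_Ioc (ae_of_all _ fun t ht => ?_)).trans
      (lintegral_mono_set (Ioc_subset_Ioc_left hy.le))
    have ht0 : 0 < t := hy.trans ht.1
    rw [mul_pow, ← ENNReal.ofReal_pow (by positivity), ← Real.rpow_natCast _ 2,
      ← Real.rpow_mul ht0.le]
    norm_num
  calc _ ≤ (c * ∫⁻ t in Ioc y u,
        ENNReal.ofReal ((u / t) ^ (1 / 8 : ℝ) * t ^ (-(1 / 4) : ℝ)) *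
        (ENNReal.ofReal (t ^ (1 / 4 : ℝ)) * ‖deriv L (x + t * Complex.I)‖ₑ)) ^ 2 := by gcongr
    _ ≤ c ^ 2 * ((4 * ENNReal.ofReal (u ^ (1 / 2 : ℝ))) * radialEnergy L x u) := by
        rw [mul_pow]
        gcongr
        exact h5.trans (mul_le_mul' (lintegral_weight_le hy hyu) h6)
    _ = _ := by ring

/-- The energy of `L'` on a vertical unit segment. -/
noncomputable def verticalEnergy (L : ℂ → ℂ) (x : ℝ) : ENNReal :=
  ∫⁻ t in Ioo (0 : ℝ) 1, ‖deriv L (x + t * Complex.I)‖ₑ ^ 2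

theorem measurable_enorm_deriv_sq (L : ℂ → ℂ) :
    Measurable fun p : ℝ × ℝ => ‖deriv L (p.1 + p.2 * Complex.I)‖ₑ ^ 2 := by
  have := measurable_deriv_vertical L
  fun_prop

theorem measurable_radialEnergy (L : ℂ → ℂ) (u : ℝ) : Measurable fun x => radialEnergy L x u := by
  have := measurable_deriv_vertical L
  unfold radialEnergy
  exact Measurable.lintegral_prod_right'
    (f := fun p : ℝ × ℝ => ENNReal.ofReal (p.2 ^ (1 / 2 : ℝ)) *
      ‖deriv L (p.1 + p.2 * Complex.I)‖ₑ ^ 2) (by fun_prop)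

theorem measurable_verticalEnergy (L : ℂ → ℂ) : Measurable (verticalEnergy L) :=
  Measurable.lintegral_prod_right' (measurable_enorm_deriv_sq L)

theorem radialEnergy_le {L : ℂ → ℂ} {x u : ℝ} :
    radialEnergy L x u ≤ ENNReal.ofReal (u ^ (1 / 2 : ℝ)) *
      ∫⁻ t in Ioo 0 u, ‖deriv L (x + t * Complex.I)‖ₑ ^ 2 := by
  rw [← lintegral_const_mul' _ _ (by simp)]
  refine setLIntegral_mono' measurableSet_Ioo fun t ht => ?_
  gcongr
  · exact ht.1.le
  · exact ht.2.le

theorem radialEnergy_le_verticalEnergy {L : ℂ → ℂ} {x u : ℝ} (hu : u ≤ 1) :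
    radialEnergy L x u ≤ ENNReal.ofReal (u ^ (1 / 2 : ℝ)) * verticalEnergy L x := by
  refine radialEnergy_le.trans ?_
  gcongr
  exact lintegral_mono_set (Ioo_subset_Ioo_right hu)

theorem lintegral_lintegral_strip {Ψ L : ℂ → ℂ} (hL : IsLift Ψ L) (a h : ℝ) :
    ∫⁻ x in Ioc a (a + 2 * π), ∫⁻ t in Ioo 0 h, ‖deriv L (x + t * Complex.I)‖ₑ ^ 2 =
      stripEnergy L h := by
  have := measurable_deriv L
  rw [← lintegral_strip_eq hL a h, lintegral_reProdIm measurableSet_Ioc measurableSet_Ioo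
    (u := fun ζ => ‖deriv L ζ‖ₑ ^ 2) (by fun_prop)]

theorem lintegral_radialEnergy_le {Ψ L : ℂ → ℂ} (hL : IsLift Ψ L) (a u : ℝ) :
    ∫⁻ x in Ioc a (a + 2 * π), radialEnergy L x u ≤
      ENNReal.ofReal (u ^ (1 / 2 : ℝ)) * stripEnergy L u := by
  rw [← lintegral_lintegral_strip hL a u, ← lintegral_const_mul' _ _ (by simp)]
  exact lintegral_mono fun x => radialEnergy_le

theorem ae_of_forall_ae_restrict_Ioc {p : ℝ → Prop}
    (h : ∀ a : ℝ, ∀ᵐ x ∂(volume.restrict (Ioc a (a + 2 * π))), p x) : ∀ᵐ x, p x := by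
  have h1 := iUnion_Ioc_add_zsmul Real.two_pi_pos 0
  rw [← Measure.restrict_univ (μ := (volume : Measure ℝ)), ← h1, ae_restrict_iUnion_iff]
  intro n
  have h2 := h (0 + n • (2 * π))
  rwa [add_assoc, ← add_one_zsmul] at h2

theorem ae_verticalEnergy_lt_top {Ψ L : ℂ → ℂ} (hL : IsLift Ψ L) (hE : stripEnergy L 1 < ⊤) :
    ∀ᵐ x, verticalEnergy L x < ⊤ := by
  refine ae_of_forall_ae_restrict_Ioc fun a => ?_
  refine ae_lt_top (measurable_verticalEnergy L) ?_
  exact ((lintegral_lintegral_strip hL a 1).trans_lt hE).ne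

theorem exists_tendsto_of_norm_sub_le {f : ℝ → ℂ} {K c y₀ : ℝ} (hc : 0 < c) (hy₀ : 0 < y₀)
    (h : ∀ y u, 0 < y → y ≤ u → u ≤ y₀ → ‖f y - f u‖ ≤ K * u ^ c) :
    ∃ l, Tendsto f (𝓝[>] 0) (𝓝 l) := by
  apply cauchy_map_iff_exists_tendsto.1
  rw [Metric.cauchy_iff]
  refine ⟨inferInstance, fun ε hε => ?_⟩
  have h1 : Tendsto (fun u : ℝ => K * u ^ c) (𝓝[>] 0) (𝓝 0) := by
    have : Tendsto (fun u : ℝ => K * u ^ c) (𝓝 0) (𝓝 (K * 0 ^ c)) :=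
      ((Real.continuous_rpow_const hc.le).const_mul K).tendsto 0
    rw [Real.zero_rpow hc.ne', mul_zero] at this
    exact this.mono_left nhdsWithin_le_nhds
  obtain ⟨δ, hδ, hδ'⟩ := mem_nhdsGT_iff_exists_Ioo_subset.1
    ((h1.eventually_lt_const hε).and (Ioo_mem_nhdsGT hy₀))
  refine ⟨f '' Ioo 0 δ, image_mem_map (Ioo_mem_nhdsGT hδ), ?_⟩
  rintro _ ⟨y, hy, rfl⟩ _ ⟨u, hu, rfl⟩
  rcases le_total y u with hyu | hyu
  · rw [dist_eq_norm]
    exact (h y u hy.1 hyu (hδ' hu).2.2.le).trans_lt (hδ' hu).1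
  · rw [dist_comm, dist_eq_norm]
    exact (h u y hu.1 hyu (hδ' hy).2.2.le).trans_lt (hδ' hy).1

/-- The vertical boundary values of `Ψ'`. -/
noncomputable def bdryDeriv (Ψ : ℂ → ℂ) (x : ℝ) : ℂ :=
  limUnder atTop (fun n : ℕ => deriv Ψ (x + ((1 / (n + 1) : ℝ) : ℂ) * Complex.I))

theorem measurable_bdryDeriv (Ψ : ℂ → ℂ) : Measurable (bdryDeriv Ψ) :=
  (StronglyMeasurable.limUnder fun _ =>
    ((measurable_deriv Ψ).comp (by fun_prop)).stronglyMeasurable).measurable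

theorem bdryDeriv_per {Ψ L : ℂ → ℂ} (hL : IsLift Ψ L) (x : ℝ) :
    bdryDeriv Ψ (x + 2 * π) = bdryDeriv Ψ x := by
  unfold bdryDeriv
  congr 1
  ext n
  rw [← hL.deriv_per (ζ := x + ((1 / (n + 1) : ℝ) : ℂ) * Complex.I)]
  · push_cast; ring_nf
  · rw [im_add_mul_I]; positivity

theorem tendsto_one_div_nhdsGT :
    Tendsto (fun n : ℕ => (1 / (n + 1) : ℝ)) atTop (𝓝[>] 0) :=
  tendsto_nhdsWithin_iff.2 ⟨tendsto_one_div_add_atTop_nhds_zero_nat,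
    Eventually.of_forall fun n => by simp only [mem_Ioi]; positivity⟩

theorem bdryDeriv_eq_of_tendsto {Ψ : ℂ → ℂ} {x : ℝ} {l : ℂ}
    (h : Tendsto (fun y : ℝ => deriv Ψ (x + y * Complex.I)) (𝓝[>] 0) (𝓝 l)) :
    bdryDeriv Ψ x = l :=
  (h.comp tendsto_one_div_nhdsGT).limUnder_eq

theorem norm_deriv_le_rpow {Ψ L : ℂ → ℂ} (hL : IsLift Ψ L) {y₀ : ℝ} 
    (hB : ∀ ζ : ℂ, 0 < ζ.im → ζ.im ≤ y₀ → ζ.im * ‖deriv L ζ‖ ≤ 1 / 8) {x u : ℝ}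
    (hu : 0 < u) (huy : u ≤ y₀) :
    ‖deriv Ψ (x + u * Complex.I)‖ ≤
      (y₀ / u) ^ (1 / 8 : ℝ) * ‖deriv Ψ (x + y₀ * Complex.I)‖ := by
  have := norm_exp_le_of_vertical hL hB (x := x) hu huy le_rfl
  rwa [← hL.deriv_eq (by simpa using hu), ← hL.deriv_eq (by simpa using hu.trans_le huy)] at this

theorem tendsto_bdryDeriv {Ψ L : ℂ → ℂ} (hL : IsLift Ψ L) {y₀ : ℝ} (hy₀ : y₀ ∈ Ioo (0 : ℝ) 1)
    (hB : ∀ ζ : ℂ, 0 < ζ.im → ζ.im ≤ y₀ → ζ.im * ‖deriv L ζ‖ ≤ 1 / 8) {x : ℝ}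
    (hx : verticalEnergy L x < ⊤) :
    Tendsto (fun y : ℝ => deriv Ψ (x + y * Complex.I)) (𝓝[>] 0) (𝓝 (bdryDeriv Ψ x)) := by
  suffices ∃ l, Tendsto (fun y : ℝ => deriv Ψ (x + y * Complex.I)) (𝓝[>] 0) (𝓝 l) by
    obtain ⟨l, hl⟩ := this
    rwa [bdryDeriv_eq_of_tendsto hl]
  set E := (verticalEnergy L x).toReal with hEdef
  have hEE : verticalEnergy L x = ENNReal.ofReal E := (ENNReal.ofReal_toReal hx.ne).symm
  have hE0 : 0 ≤ E := ENNReal.toReal_nonneg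
  set D := ‖deriv Ψ (x + y₀ * Complex.I)‖ with hD
  refine exists_tendsto_of_norm_sub_le
    (K := 2 * Real.sqrt E * y₀ ^ (1 / 8 : ℝ) * D) (c := 3 / 8) (by norm_num) hy₀.1 ?_
  intro y u hy hyu hu
  have hu0 : 0 < u := hy.trans_le hyu
  have h1 := (enorm_deriv_sub_sq_le hL hB (x := x) hy hyu hu).trans
    (mul_le_mul_left (mul_le_mul_right (radialEnergy_le_verticalEnergy
      (L := L) (x := x) (hu.trans hy₀.2.le)) _) _)
  have h2 := norm_deriv_le_rpow hL hB (x := x) hu0 hu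
  rw [hEE, ← ofReal_norm_sq_eq, ← ofReal_norm_sq_eq, show (4 : ENNReal) = ENNReal.ofReal 4 by simp,
    ← ENNReal.ofReal_mul (by norm_num), ← ENNReal.ofReal_mul (by positivity),
    ← ENNReal.ofReal_mul (by positivity), ← ENNReal.ofReal_mul (by positivity),
    ENNReal.ofReal_le_ofReal_iff (by positivity)] at h1
  have h3 : 0 ≤ y₀ := hy₀.1.le
  refine abs_le_of_sq_le_sq' ?_ (by positivity) |>.2
  calc _ ≤ _ := h1
    _ ≤ 4 * u ^ (1 / 2 : ℝ) * (u ^ (1 / 2 : ℝ) * E) * ((y₀ / u) ^ (1 / 8 : ℝ) * D) ^ 2 := by gcongr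
    _ = _ := by
      rw [Real.div_rpow h3 hu0.le]
      have h4 : u ^ (1 / 2 : ℝ) = u ^ (1 / 8 : ℝ) * u ^ (3 / 8 : ℝ) := by
        rw [← Real.rpow_add hu0]; norm_num
      have h5 : Real.sqrt E ^ 2 = E := Real.sq_sqrt hE0
      rw [h4]
      simp only [mul_pow, h5]
      have : u ^ (1 / 8 : ℝ) ≠ 0 := by positivity
      field_simp
      ring

theorem enorm_bdryDeriv_sub_sq_le {Ψ L : ℂ → ℂ} (hL : IsLift Ψ L) {y₀ : ℝ}
    (hy₀ : y₀ ∈ Ioo (0 : ℝ) 1)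
    (hB : ∀ ζ : ℂ, 0 < ζ.im → ζ.im ≤ y₀ → ζ.im * ‖deriv L ζ‖ ≤ 1 / 8) {x : ℝ}
    (hx : verticalEnergy L x < ⊤) {u : ℝ} (hu : 0 < u) (huy : u ≤ y₀) :
    ‖bdryDeriv Ψ x - deriv Ψ (x + u * Complex.I)‖ₑ ^ 2 ≤
      4 * ENNReal.ofReal (u ^ (1 / 2 : ℝ)) * radialEnergy L x u *
        ‖deriv Ψ (x + u * Complex.I)‖ₑ ^ 2 := by
  have h1 := tendsto_bdryDeriv hL hy₀ hB hx
  have h2 := ENNReal.Tendsto.pow (n := 2) ((h1.sub_const (deriv Ψ (x + u * Complex.I))).enorm)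
  refine le_of_tendsto h2 ?_
  filter_upwards [Ioo_mem_nhdsGT hu] with y hy
  exact enorm_deriv_sub_sq_le hL hB hy.1 hy.2.le huy

theorem bdryDeriv_ne_zero {Ψ L : ℂ → ℂ} (hL : IsLift Ψ L) {y₀ : ℝ}
    (hy₀ : y₀ ∈ Ioo (0 : ℝ) 1)
    (hB : ∀ ζ : ℂ, 0 < ζ.im → ζ.im ≤ y₀ → ζ.im * ‖deriv L ζ‖ ≤ 1 / 8) {x : ℝ}
    (hx : verticalEnergy L x < ⊤) : bdryDeriv Ψ x ≠ 0 := by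
  intro h0
  set E := (verticalEnergy L x).toReal with hEdef
  have hEE : verticalEnergy L x = ENNReal.ofReal E := (ENNReal.ofReal_toReal hx.ne).symm
  have hE0 : 0 ≤ E := ENNReal.toReal_nonneg
  set u := min y₀ (1 / (8 * (E + 1))) with hu
  have hy0 := hy₀.1
  have hu0 : 0 < u := by positivity
  have h1 := (enorm_bdryDeriv_sub_sq_le hL hy₀ hB hx hu0 (min_le_left _ _)).trans
    (mul_le_mul_left (mul_le_mul_right (radialEnergy_le_verticalEnergy
      (L := L) (x := x) ((min_le_left _ _).trans hy₀.2.le)) _) _)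
  rw [← hu] at h1
  rw [h0, zero_sub, enorm_neg, hEE, ← ofReal_norm_sq_eq, show (4 : ENNReal) =
    ENNReal.ofReal 4 by simp,
    ← ENNReal.ofReal_mul (by norm_num), ← ENNReal.ofReal_mul (by positivity),
    ← ENNReal.ofReal_mul (by positivity), ← ENNReal.ofReal_mul (by positivity),
    ENNReal.ofReal_le_ofReal_iff (by positivity)] at h1
  have h2 : 0 < ‖deriv Ψ (x + u * Complex.I)‖ ^ 2 :=
    pow_pos (norm_pos_iff.2 (hL.deriv_ne_zero (by simpa using hu0))) 2
  have h3 : u ^ (1 / 2 : ℝ) * u ^ (1 / 2 : ℝ) = u := by rw [← Real.rpow_add hu0]; norm_num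
  have h4 : 4 * u ^ (1 / 2 : ℝ) * (u ^ (1 / 2 : ℝ) * E) = 4 * u * E := by
    linear_combination 4 * E * h3
  rw [h4] at h1
  have h5 : u ≤ 1 / (8 * (E + 1)) := min_le_right _ _
  rw [le_div_iff₀ (by positivity)] at h5
  nlinarith

/-- A lift whose logarithmic derivative has finite energy and satisfies a small Bloch bound below
height `y₀`. -/
structure FiniteLift (Ψ L : ℂ → ℂ) (y₀ : ℝ) : Prop where
  lift : IsLift Ψ L
  height : y₀ ∈ Ioo (0 : ℝ) 1
  bloch : ∀ ζ : ℂ, 0 < ζ.im → ζ.im ≤ y₀ → ζ.im * ‖deriv L ζ‖ ≤ 1 / 8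
  energy : stripEnergy L 1 < ⊤

theorem exists_norm_le_of_periodic {f : ℝ → ℂ} (hf : Continuous f)
    (hp : ∀ x, f (x + 2 * π) = f x) : ∃ C, 0 < C ∧ ∀ x, ‖f x‖ ≤ C := by
  obtain ⟨C, hC⟩ :=
    (Function.Periodic.isBounded_of_continuous hp Real.two_pi_pos.ne' hf).exists_norm_le
  exact ⟨max C 1, by positivity, fun x => (hC _ (mem_range_self x)).trans (le_max_left _ _)⟩

namespace FiniteLift

variable {Ψ L : ℂ → ℂ} {y₀ : ℝ}

theorem exists_norm_deriv_le (h : FiniteLift Ψ L y₀) :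
    ∃ M : ℝ, 0 < M ∧ ∀ x u : ℝ, 0 < u → u ≤ y₀ →
      ‖deriv Ψ (x + u * Complex.I)‖ ≤ M * u ^ (-(1 / 8) : ℝ) := by
  have hy := h.height.1
  obtain ⟨C, hC0, hC⟩ := exists_norm_le_of_periodic
    (continuousOn_horizontal h.lift.continuousOn_deriv_map hy) (fun x => by
      rw [← h.lift.deriv_per (ζ := x + y₀ * Complex.I) (by simpa using hy)]
      push_cast; ring_nf)
  refine ⟨y₀ ^ (1 / 8 : ℝ) * C, by positivity, fun x u hu huy => ?_⟩
  refine (norm_deriv_le_rpow h.lift h.bloch hu huy).trans ?_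
  rw [Real.div_rpow hy.le hu.le, Real.rpow_neg hu.le, div_eq_mul_inv]
  calc _ ≤ y₀ ^ (1 / 8 : ℝ) * (u ^ (1 / 8 : ℝ))⁻¹ * C := by gcongr; exact hC x
    _ = _ := by ring

theorem exists_norm_sub_le (h : FiniteLift Ψ L y₀) :
    ∃ K : ℝ, 0 < K ∧ ∀ x y u : ℝ, 0 < y → y ≤ u → u ≤ y₀ →
      ‖Ψ (x + y * Complex.I) - Ψ (x + u * Complex.I)‖ ≤ K * u ^ (7 / 8 : ℝ) := by
  obtain ⟨M, hM, hM'⟩ := h.exists_norm_deriv_le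
  refine ⟨M * (8 / 7), by positivity, fun x y u hy hyu hu => ?_⟩
  have hu0 : 0 < u := hy.trans_le hyu
  have hsub : uIcc y u ⊆ Ioi 0 := by
    rw [uIcc_of_le hyu]; exact fun t ht => hy.trans_le ht.1
  have hftc := intervalIntegral.integral_eq_sub_of_hasDerivAt
    (f := fun t : ℝ => Ψ (x + t * Complex.I)) (a := y) (b := u)
    (f' := fun t : ℝ => deriv Ψ (x + t * Complex.I) * Complex.I)
    (fun t ht => hasDerivAt_vertical (by
      have ht0 : 0 < (x + t * Complex.I).im := by simpa using hsub ht
      rw [h.lift.deriv_eq ht0]; exact h.lift.hasDerivAt _ ht0))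
    (((continuousOn_vertical h.lift.continuousOn_deriv_map x).mul
      continuousOn_const).mono hsub).intervalIntegrable
  rw [norm_sub_rev, ← hftc]
  refine (intervalIntegral.norm_integral_le_of_norm_le hyu
    (g := fun t => M * t ^ (-(1 / 8) : ℝ)) (ae_of_all _ fun t ht => ?_)
    ((intervalIntegral.intervalIntegrable_rpow' (by norm_num)).const_mul _)).trans ?_
  · rw [norm_mul, Complex.norm_I, mul_one]
    exact hM' x t (hy.trans ht.1) (ht.2.trans hu)
  · rw [intervalIntegral.integral_const_mul, integral_rpow (Or.inl (by norm_num)), mul_assoc]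
    gcongr
    have : 0 ≤ y ^ (7 / 8 : ℝ) := by positivity
    rw [show (-(1 / 8) + 1 : ℝ) = 7 / 8 by norm_num]
    linarith

end FiniteLift

/-- The vertical boundary values of `Ψ`. -/
noncomputable def bdryVal (Ψ : ℂ → ℂ) (x : ℝ) : ℂ :=
  limUnder atTop (fun n : ℕ => Ψ (x + ((1 / (n + 1) : ℝ) : ℂ) * Complex.I))

namespace FiniteLift

variable {Ψ L : ℂ → ℂ} {y₀ : ℝ}

theorem bdryVal_per (h : FiniteLift Ψ L y₀) (x : ℝ) : bdryVal Ψ (x + 2 * π) = bdryVal Ψ x := by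
  unfold bdryVal
  congr 1
  ext n
  rw [← h.lift.per (x + ((1 / (n + 1) : ℝ) : ℂ) * Complex.I)]
  · push_cast; ring_nf
  · rw [im_add_mul_I]; positivity

theorem tendsto_bdryVal (h : FiniteLift Ψ L y₀) (x : ℝ) :
    Tendsto (fun y : ℝ => Ψ (x + y * Complex.I)) (𝓝[>] 0) (𝓝 (bdryVal Ψ x)) := by
  obtain ⟨K, hK, hK'⟩ := h.exists_norm_sub_le
  obtain ⟨l, hl⟩ := exists_tendsto_of_norm_sub_le (by norm_num) h.height.1 (hK' x)
  have h1 : bdryVal Ψ x = l := (hl.comp tendsto_one_div_nhdsGT).limUnder_eq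
  rwa [h1]

theorem exists_norm_bdryVal_sub_le (h : FiniteLift Ψ L y₀) :
    ∃ K : ℝ, 0 < K ∧ ∀ x u : ℝ, 0 < u → u ≤ y₀ →
      ‖bdryVal Ψ x - Ψ (x + u * Complex.I)‖ ≤ K * u ^ (7 / 8 : ℝ) := by
  obtain ⟨K, hK, hK'⟩ := h.exists_norm_sub_le
  refine ⟨K, hK, fun x u hu huy => ?_⟩
  refine le_of_tendsto ((h.tendsto_bdryVal x).sub_const _).norm ?_
  filter_upwards [Ioo_mem_nhdsGT hu] with y hy
  exact hK' x y u hy.1 hy.2.le huy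

theorem eventually_norm_bdryVal_sub_lt (h : FiniteLift Ψ L y₀) {ε : ℝ} (hε : 0 < ε) :
    ∀ᶠ u : ℝ in 𝓝[>] 0, ∀ x, ‖bdryVal Ψ x - Ψ (x + u * Complex.I)‖ < ε := by
  obtain ⟨K, hK, hK'⟩ := h.exists_norm_bdryVal_sub_le
  have h1 : Tendsto (fun u : ℝ => K * u ^ (7 / 8 : ℝ)) (𝓝[>] 0) (𝓝 0) := by
    have : Tendsto (fun u : ℝ => K * u ^ (7 / 8 : ℝ)) (𝓝 0) (𝓝 (K * 0 ^ (7 / 8 : ℝ))) :=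
      ((Real.continuous_rpow_const (by norm_num)).const_mul K).tendsto 0
    rw [Real.zero_rpow (by norm_num), mul_zero] at this
    exact this.mono_left nhdsWithin_le_nhds
  filter_upwards [h1.eventually_lt_const hε, Ioo_mem_nhdsGT h.height.1] with u hu hu' x
  exact (hK' x u hu'.1 hu'.2.le).trans_lt hu

theorem continuous_horizontal (h : FiniteLift Ψ L y₀) {u : ℝ} (hu : 0 < u) :
    Continuous fun x : ℝ => Ψ (x + u * Complex.I) :=
  continuousOn_horizontal
    (fun _ hζ => (h.lift.hasDerivAt _ hζ).continuousAt.continuousWithinAt) hu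

theorem continuous_bdryVal (h : FiniteLift Ψ L y₀) : Continuous (bdryVal Ψ) := by
  have h1 : TendstoUniformly (fun (u : ℝ) (x : ℝ) => Ψ (x + u * Complex.I)) (bdryVal Ψ)
      (𝓝[>] 0) := by
    rw [Metric.tendstoUniformly_iff]
    intro ε hε
    filter_upwards [h.eventually_norm_bdryVal_sub_lt hε] with u hu x
    rw [dist_eq_norm]; exact hu x
  refine h1.continuous (Eventually.frequently ?_)
  filter_upwards [self_mem_nhdsWithin] with u hu using h.continuous_horizontal hu

theorem ae_lt_top (h : FiniteLift Ψ L y₀) : ∀ᵐ x, verticalEnergy L x < ⊤ :=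
  ae_verticalEnergy_lt_top h.lift h.energy

theorem ae_enorm_bdryDeriv_sub_sq_le (h : FiniteLift Ψ L y₀) :
    ∀ᵐ x, ∀ u : ℝ, 0 < u → u ≤ y₀ → ‖bdryDeriv Ψ x - deriv Ψ (x + u * Complex.I)‖ₑ ^ 2 ≤
      4 * ENNReal.ofReal (u ^ (1 / 2 : ℝ)) * radialEnergy L x u *
        ‖deriv Ψ (x + u * Complex.I)‖ₑ ^ 2 := by
  filter_upwards [h.ae_lt_top] with x hx u hu huy
  exact enorm_bdryDeriv_sub_sq_le h.lift h.height h.bloch hx hu huy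

theorem ae_bdryDeriv_ne_zero (h : FiniteLift Ψ L y₀) : ∀ᵐ x, bdryDeriv Ψ x ≠ 0 := by
  filter_upwards [h.ae_lt_top] with x hx
  exact bdryDeriv_ne_zero h.lift h.height h.bloch hx

theorem exists_lintegral_bdryDeriv_sub_le (h : FiniteLift Ψ L y₀) :
    ∃ M : ℝ, 0 < M ∧ ∀ a u : ℝ, 0 < u → u ≤ y₀ →
      ∫⁻ x in Ioc a (a + 2 * π), ‖bdryDeriv Ψ x - deriv Ψ (x + u * Complex.I)‖ₑ ^ 2 ≤
        ENNReal.ofReal (M * u ^ (3 / 4 : ℝ)) * stripEnergy L 1 := by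
  obtain ⟨M, hM, hM'⟩ := h.exists_norm_deriv_le
  refine ⟨4 * M ^ 2, by positivity, fun a u hu huy => ?_⟩
  calc _ ≤ ∫⁻ x in Ioc a (a + 2 * π), ENNReal.ofReal (4 * u ^ (1 / 2 : ℝ) *
        (M * u ^ (-(1 / 8) : ℝ)) ^ 2) * radialEnergy L x u := by
        refine lintegral_mono_ae (ae_restrict_of_ae ?_)
        filter_upwards [h.ae_enorm_bdryDeriv_sub_sq_le] with x hx
        refine (hx u hu huy).trans ?_
        rw [ENNReal.ofReal_mul (by positivity), ENNReal.ofReal_mul (by norm_num),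
          ← ofReal_norm_sq_eq]
        have : ENNReal.ofReal (‖deriv Ψ (x + u * Complex.I)‖ ^ 2) ≤
          ENNReal.ofReal ((M * u ^ (-(1 / 8) : ℝ)) ^ 2) := by
            gcongr; exact hM' x u hu huy
        rw [mul_assoc, mul_assoc, mul_comm (radialEnergy L x u), ← mul_assoc, ← mul_assoc]
        gcongr
        simp
    _ ≤ ENNReal.ofReal (4 * u ^ (1 / 2 : ℝ) * (M * u ^ (-(1 / 8) : ℝ)) ^ 2) *
        (ENNReal.ofReal (u ^ (1 / 2 : ℝ)) * stripEnergy L 1) := by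
        rw [lintegral_const_mul' _ _ (by simp)]
        gcongr
        refine (lintegral_radialEnergy_le h.lift a u).trans ?_
        gcongr
        exact lintegral_mono_set fun ζ hζ => ⟨hζ.1, hζ.2.1,
          hζ.2.2.trans_le (huy.trans h.height.2.le)⟩
    _ = _ := by
        rw [← mul_assoc, ← ENNReal.ofReal_mul (by positivity)]
        congr 2
        rw [mul_pow, ← Real.rpow_natCast (u ^ _) 2, ← Real.rpow_mul hu.le]
        have : u ^ (3 / 4 : ℝ) = u ^ (1 / 2 : ℝ) * u ^ (-(1 / 8) * (2 : ℕ) : ℝ) *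
          u ^ (1 / 2 : ℝ) := by
          rw [← Real.rpow_add hu, ← Real.rpow_add hu]; norm_num
        rw [this]; ring

theorem lintegral_bdryDeriv_sq_lt_top (h : FiniteLift Ψ L y₀) (a : ℝ) :
    ∫⁻ x in Ioc a (a + 2 * π), ‖bdryDeriv Ψ x‖ₑ ^ 2 < ⊤ := by
  obtain ⟨M, hM, hM'⟩ := h.exists_lintegral_bdryDeriv_sub_le
  obtain ⟨C, hC, hC'⟩ := h.exists_norm_deriv_le
  have hy := h.height.1
  have h1 := hM' a y₀ hy le_rfl
  have hm1 := measurable_bdryDeriv Ψ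
  have hm2 : Measurable fun x : ℝ => deriv Ψ (x + y₀ * Complex.I) :=
    (measurable_deriv Ψ).comp (by fun_prop)
  calc _ ≤ ∫⁻ x in Ioc a (a + 2 * π), (2 * ‖bdryDeriv Ψ x - deriv Ψ (x + y₀ * Complex.I)‖ₑ ^ 2 +
        2 * ENNReal.ofReal ((C * y₀ ^ (-(1 / 8) : ℝ)) ^ 2)) := by
        refine lintegral_mono fun x => ?_
        have := enorm_add_sq_le (bdryDeriv Ψ x - deriv Ψ (x + y₀ * Complex.I))
          (deriv Ψ (x + y₀ * Complex.I))
        rw [sub_add_cancel] at this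
        refine this.trans ?_
        gcongr
        rw [← ofReal_norm_sq_eq]
        gcongr
        exact hC' x y₀ hy le_rfl
    _ < ⊤ := by
        rw [lintegral_add_right _ measurable_const, lintegral_const_mul' _ _ (by simp)]
        refine ENNReal.add_lt_top.2 ⟨ENNReal.mul_lt_top (by simp) (h1.trans_lt
          (ENNReal.mul_lt_top (by simp) h.energy)), ?_⟩
        rw [lintegral_const]
        exact ENNReal.mul_lt_top (ENNReal.mul_lt_top (by simp) ENNReal.ofReal_lt_top)
          (by rw [Measure.restrict_apply_univ]; exact measure_Ioc_lt_top)

theorem integrableOn_bdryDeriv (h : FiniteLift Ψ L y₀) (a : ℝ) :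
    IntegrableOn (bdryDeriv Ψ) (Ioc a (a + 2 * π)) := by
  have h1 : MemLp (bdryDeriv Ψ) 2 (volume.restrict (Ioc a (a + 2 * π))) := by
    refine ⟨(measurable_bdryDeriv Ψ).aestronglyMeasurable, ?_⟩
    rw [eLpNorm_lt_top_iff_lintegral_rpow_enorm_lt_top (by norm_num) (by norm_num)]
    simpa using h.lintegral_bdryDeriv_sq_lt_top a
  exact h1.integrable (by norm_num)

theorem intervalIntegrable_bdryDeriv (h : FiniteLift Ψ L y₀) (a b : ℝ) :
    IntervalIntegrable (bdryDeriv Ψ) volume a b := by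
  refine Function.Periodic.intervalIntegrable (T := 2 * π) (t := 0) (bdryDeriv_per h.lift)
    Real.two_pi_pos.ne' ?_ a b
  rw [intervalIntegrable_iff_integrableOn_Ioc_of_le (by linarith [Real.two_pi_pos])]
  exact h.integrableOn_bdryDeriv 0

theorem integral_deriv_horizontal (h : FiniteLift Ψ L y₀) {u : ℝ} (hu : 0 < u) (a b : ℝ) :
    ∫ x in a..b, deriv Ψ (x + u * Complex.I) = Ψ (b + u * Complex.I) - Ψ (a + u * Complex.I) := by
  refine intervalIntegral.integral_eq_sub_of_hasDerivAt
    (f := fun x : ℝ => Ψ (x + u * Complex.I)) (fun x _ => hasDerivAt_horizontal ?_)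
    (continuousOn_horizontal h.lift.continuousOn_deriv_map hu).continuousOn.intervalIntegrable
  have hx : 0 < (x + u * Complex.I).im := by simpa using hu
  rw [h.lift.deriv_eq hx]
  exact h.lift.hasDerivAt _ hx

theorem bdryVal_sub_of_le (h : FiniteLift Ψ L y₀) {a b : ℝ} (hab : a ≤ b) (hb : b ≤ a + 2 * π) :
    bdryVal Ψ b - bdryVal Ψ a = ∫ x in a..b, bdryDeriv Ψ x := by
  have h1 : Tendsto (fun u : ℝ => ∫ x in a..b, deriv Ψ (x + u * Complex.I)) (𝓝[>] 0)
      (𝓝 (bdryVal Ψ b - bdryVal Ψ a)) := by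
    refine ((h.tendsto_bdryVal b).sub (h.tendsto_bdryVal a)).congr' ?_
    filter_upwards [self_mem_nhdsWithin] with u hu
    exact (h.integral_deriv_horizontal hu a b).symm
  refine tendsto_nhds_unique h1 ?_
  rw [tendsto_iff_edist_tendsto_0]
  obtain ⟨M, hM, hM'⟩ := h.exists_lintegral_bdryDeriv_sub_le
  have h2 : Tendsto (fun u : ℝ => ENNReal.ofReal (2 * π) *
      (ENNReal.ofReal (M * u ^ (3 / 4 : ℝ)) * stripEnergy L 1)) (𝓝[>] 0) (𝓝 0) := by
    have h3 : Tendsto (fun u : ℝ => M * u ^ (3 / 4 : ℝ)) (𝓝[>] 0) (𝓝 0) := by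
      have : Tendsto (fun u : ℝ => M * u ^ (3 / 4 : ℝ)) (𝓝 0) (𝓝 (M * 0 ^ (3 / 4 : ℝ))) :=
        ((Real.continuous_rpow_const (by norm_num)).const_mul M).tendsto 0
      rw [Real.zero_rpow (by norm_num), mul_zero] at this
      exact this.mono_left nhdsWithin_le_nhds
    have h4 := ENNReal.Tendsto.const_mul (a := ENNReal.ofReal (2 * π))
      (ENNReal.Tendsto.mul_const (b := stripEnergy L 1) (ENNReal.tendsto_ofReal h3)
        (Or.inr h.energy.ne)) (Or.inr ENNReal.ofReal_ne_top)
    simpa using h4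
  have h5 : Tendsto (fun u : ℝ => (edist (∫ x in a..b, deriv Ψ (x + u * Complex.I))
      (∫ x in a..b, bdryDeriv Ψ x)) ^ 2) (𝓝[>] 0) (𝓝 0) := by
    refine tendsto_of_tendsto_of_tendsto_of_le_of_le' tendsto_const_nhds h2
      (Eventually.of_forall fun _ => zero_le) ?_
    filter_upwards [Ioo_mem_nhdsGT h.height.1] with u hu
    have hm2 : Measurable fun x : ℝ => deriv Ψ (x + u * Complex.I) :=
      (measurable_deriv Ψ).comp (by fun_prop)
    have hm1 := measurable_bdryDeriv Ψ
    rw [edist_comm, edist_eq_enorm_sub, ← intervalIntegral.integral_sub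
      (h.intervalIntegrable_bdryDeriv a b)
      (continuousOn_horizontal h.lift.continuousOn_deriv_map hu.1).continuousOn.intervalIntegrable,
      intervalIntegral.integral_of_le hab]
    calc _ ≤ (∫⁻ x in Ioc a (a + 2 * π), 1 *
          ‖bdryDeriv Ψ x - deriv Ψ (x + u * Complex.I)‖ₑ) ^ 2 := by
          simp only [one_mul]
          gcongr
          exact (enorm_integral_le_lintegral_enorm _).trans
            (lintegral_mono_set (Ioc_subset_Ioc_right hb))
      _ ≤ _ := sq_lintegral_mul_le (by fun_prop) (by fun_prop)
      _ ≤ _ := by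
          refine mul_le_mul' ?_ (hM' a u hu.1 hu.2.le)
          simp
  have h6 := (ENNReal.continuous_rpow_const (y := 1 / 2)).tendsto 0 |>.comp h5
  rw [ENNReal.zero_rpow_of_pos (by norm_num)] at h6
  refine h6.congr fun u => ?_
  simp only [Function.comp, one_div]
  exact ENNReal.pow_rpow_inv_natCast (n := 2) (by norm_num) _

theorem bdryVal_sub (h : FiniteLift Ψ L y₀) {a b : ℝ} (hab : a ≤ b) :
    bdryVal Ψ b - bdryVal Ψ a = ∫ x in a..b, bdryDeriv Ψ x := by
  have key : ∀ n : ℕ, ∀ b, a ≤ b → b ≤ a + n * (2 * π) →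
      bdryVal Ψ b - bdryVal Ψ a = ∫ x in a..b, bdryDeriv Ψ x := by
    intro n
    induction n with
    | zero =>
      intro b hab hb
      have : b = a := by simp at hb; linarith
      simp [this]
    | succ n ih =>
      intro b hab hb
      rcases le_total b (a + 2 * π) with h1 | h1
      · exact h.bdryVal_sub_of_le hab h1
      · push_cast at hb
        rw [← intervalIntegral.integral_add_adjacent_intervals
          (h.intervalIntegrable_bdryDeriv a (b - 2 * π)) (h.intervalIntegrable_bdryDeriv _ b),
          ← ih (b - 2 * π) (by linarith) (by linarith),
          ← h.bdryVal_sub_of_le (by linarith [Real.two_pi_pos]) (by linarith)]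
        ring
  obtain ⟨n, hn⟩ := exists_nat_ge ((b - a) / (2 * π))
  refine key n b hab ?_
  rw [div_le_iff₀ Real.two_pi_pos] at hn
  linarith

end FiniteLift

theorem norm_deriv_sub_le_of_horizontal {Ψ L : ℂ → ℂ} (hL : IsLift Ψ L) {ε y₀ : ℝ}
    (hB : ∀ ζ : ℂ, 0 < ζ.im → ζ.im ≤ y₀ → ζ.im * ‖deriv L ζ‖ ≤ ε) (hε : ε ≤ 1) {a x u : ℝ}
    (hu : 0 < u) (hu' : u ≤ y₀) (hx : |x - a| ≤ u) :
    ‖deriv Ψ (x + u * Complex.I) - deriv Ψ (a + u * Complex.I)‖ ≤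
      2 * ε * ‖deriv Ψ (a + u * Complex.I)‖ := by
  have hε0 : 0 ≤ ε := le_trans (mul_nonneg (by simpa using hu.le) (norm_nonneg _))
    (hB (u * Complex.I) (by simpa) (by simpa))
  have h1 := norm_sub_le_of_horizontal hL hB (x := a) (x' := x) hu hu'
  set d := L (x + u * Complex.I) - L (a + u * Complex.I) with hd
  have h2 : ‖d‖ ≤ ε := by
    refine h1.trans ?_
    calc ε / u * |x - a| ≤ ε / u * u := by gcongr
      _ = ε := by field_simp
  have h3 := Complex.norm_exp_sub_one_le (x := d) (h2.trans hε)
  have h4 : deriv Ψ (x + u * Complex.I) - deriv Ψ (a + u * Complex.I) =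
      (Complex.exp d - 1) * deriv Ψ (a + u * Complex.I) := by
    rw [hL.deriv_eq (by simpa using hu), hL.deriv_eq (by simpa using hu), sub_mul,
      ← Complex.exp_add,
      hd, sub_add_cancel, one_mul]
  rw [h4, norm_mul]
  gcongr
  linarith

namespace FiniteLift

variable {Ψ L : ℂ → ℂ} {y₀ : ℝ}

/-- Mean oscillation of the boundary values of `Ψ'`. -/
theorem exists_average_le (h : FiniteLift Ψ L y₀) {η : ℝ} (hη : 0 < η) :
    ∃ h₀ : ℝ, 0 < h₀ ∧ h₀ ≤ y₀ ∧ ∀ a u : ℝ, 0 < u → u ≤ h₀ →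
      ∫⁻ x in Ioc a (a + u), ‖bdryDeriv Ψ x - deriv Ψ (a + u * Complex.I)‖ₑ ≤
        ENNReal.ofReal (η * u * ‖deriv Ψ (a + u * Complex.I)‖) := by
  obtain ⟨y₁, hy₁, hB⟩ := exists_im_mul_norm_deriv_le h.lift h.energy
    (ε := min (η / 4) (1 / 2)) (by positivity)
  have h1 : ∀ᶠ t in 𝓝[>] (0 : ℝ), stripEnergy L t < ENNReal.ofReal ((η / 8) ^ 2) :=
    (tendsto_stripEnergy h.energy).eventually_lt_const (by simp; positivity)
  obtain ⟨δ, hδ0, hδ⟩ := mem_nhdsGT_iff_exists_Ioo_subset.1 h1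
  have hδ0 : 0 < δ := hδ0
  have hy₀ := h.height.1
  have hy₁0 := hy₁.1
  refine ⟨min (δ / 2) (min y₀ y₁), by positivity, (min_le_right _ _).trans (min_le_left _ _),
    fun a u hu huh => ?_⟩
  have hu1 : u ≤ δ / 2 := huh.trans (min_le_left _ _)
  have hu2 : u ≤ y₀ := huh.trans ((min_le_right _ _).trans (min_le_left _ _))
  have hu3 : u ≤ y₁ := huh.trans ((min_le_right _ _).trans (min_le_right _ _))
  have huE : stripEnergy L u ≤ ENNReal.ofReal ((η / 8) ^ 2) :=
    (hδ ⟨hu, by linarith⟩ : stripEnergy L u < _).le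
  set D := ‖deriv Ψ (a + u * Complex.I)‖ with hD
  have hosc : ∀ x ∈ Ioc a (a + u), ‖deriv Ψ (x + u * Complex.I) - deriv Ψ (a + u * Complex.I)‖ ≤
      2 * min (η / 4) (1 / 2) * D := fun x hx =>
    norm_deriv_sub_le_of_horizontal h.lift hB (by
      refine (min_le_right _ _).trans (by norm_num)) hu hu3
      (abs_le.2 ⟨by linarith [hx.1], by linarith [hx.2]⟩)
  have hD0 : 0 ≤ D := norm_nonneg _
  have hm1 := measurable_bdryDeriv Ψ
  have hm2 : Measurable fun x : ℝ => deriv Ψ (x + u * Complex.I) :=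
    (measurable_deriv Ψ).comp (by fun_prop)
  have hfirst : ∫⁻ x in Ioc a (a + u), ‖bdryDeriv Ψ x - deriv Ψ (x + u * Complex.I)‖ₑ ≤
      ENNReal.ofReal (η / 2 * u * D) := by
    rw [← (ENNReal.pow_right_strictMono two_ne_zero).le_iff_le]
    calc (∫⁻ x in Ioc a (a + u), ‖bdryDeriv Ψ x - deriv Ψ (x + u * Complex.I)‖ₑ) ^ 2
        = (∫⁻ x in Ioc a (a + u), 1 * ‖bdryDeriv Ψ x - deriv Ψ (x + u * Complex.I)‖ₑ) ^ 2 := by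
          simp
      _ ≤ _ := sq_lintegral_mul_le (by fun_prop) (by fun_prop)
      _ ≤ ENNReal.ofReal u * ∫⁻ x in Ioc a (a + u),
          ENNReal.ofReal (4 * u ^ (1 / 2 : ℝ) * (2 * D) ^ 2) * radialEnergy L x u := by
          refine mul_le_mul' (by simp) ?_
          refine setLIntegral_mono_ae' measurableSet_Ioc ?_
          filter_upwards [h.ae_enorm_bdryDeriv_sub_sq_le] with x hx hxm
          refine (hx u hu hu2).trans ?_
          have h5 : ‖deriv Ψ (x + u * Complex.I)‖ ≤ 2 * D := by
            have h6 := hosc x hxm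
            have h7 : min (η / 4) (1 / 2) ≤ 1 / 2 := min_le_right _ _
            have h8 := norm_sub_norm_le (deriv Ψ (x + u * Complex.I)) (deriv Ψ (a + u * Complex.I))
            have h9 : 2 * min (η / 4) (1 / 2) * D ≤ 2 * (1 / 2) * D := by gcongr
            linarith
          rw [ENNReal.ofReal_mul (by positivity), ENNReal.ofReal_mul (by norm_num),
            ← ofReal_norm_sq_eq, mul_assoc, mul_assoc, mul_comm (radialEnergy L x u), ← mul_assoc,
            ← mul_assoc]
          gcongr
          simp
      _ ≤ ENNReal.ofReal u * (ENNReal.ofReal (4 * u ^ (1 / 2 : ℝ) * (2 * D) ^ 2) *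
          (ENNReal.ofReal (u ^ (1 / 2 : ℝ)) * ENNReal.ofReal ((η / 8) ^ 2))) := by
          rw [lintegral_const_mul' _ _ (by simp)]
          gcongr
          refine (lintegral_mono_set (Ioc_subset_Ioc_right ?_)).trans
            ((lintegral_radialEnergy_le h.lift a u).trans (by gcongr))
          linarith [h.height.2, Real.pi_gt_three]
      _ = ENNReal.ofReal (η / 2 * u * D) ^ 2 := by
          rw [← ENNReal.ofReal_mul (by positivity), ← ENNReal.ofReal_mul (by positivity),
            ← ENNReal.ofReal_mul (by positivity), ← ENNReal.ofReal_pow (by positivity)]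
          congr 1
          have : u ^ (1 / 2 : ℝ) * u ^ (1 / 2 : ℝ) = u := by rw [← Real.rpow_add hu]; norm_num
          linear_combination u * 16 * D ^ 2 * (η / 8) ^ 2 * this
  calc _ ≤ ∫⁻ x in Ioc a (a + u), (‖bdryDeriv Ψ x - deriv Ψ (x + u * Complex.I)‖ₑ +
        ENNReal.ofReal (η / 2 * D)) := by
        refine setLIntegral_mono' measurableSet_Ioc fun x hx => ?_
        rw [← sub_add_sub_cancel _ (deriv Ψ (x + u * Complex.I))]
        refine (enorm_add_le _ _).trans ?_
        gcongr
        rw [← ofReal_norm]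
        gcongr
        refine (hosc x hx).trans ?_
        have h7 : min (η / 4) (1 / 2) ≤ η / 4 := min_le_left _ _
        have h9 : 2 * min (η / 4) (1 / 2) * D ≤ 2 * (η / 4) * D := by gcongr
        linarith
    _ ≤ ENNReal.ofReal (η / 2 * u * D) + ENNReal.ofReal (η / 2 * D) * ENNReal.ofReal u := by
        rw [lintegral_add_right _ measurable_const, lintegral_const]
        gcongr
        simp
    _ = _ := by
        rw [← ENNReal.ofReal_mul (by positivity), ← ENNReal.ofReal_add (by positivity)
          (by positivity)]
        congr 1; ring

/-- Comparison of boundary increments with interior derivatives. -/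
theorem exists_comparison (h : FiniteLift Ψ L y₀) :
    ∃ h₀ : ℝ, 0 < h₀ ∧ h₀ ≤ y₀ ∧ ∀ a u : ℝ, 0 < u → u ≤ h₀ →
      u * ‖deriv Ψ (a + u * Complex.I)‖ ≤ 2 * ‖bdryVal Ψ (a + u) - bdryVal Ψ a‖ ∧
      ∫ x in a..(a + u), ‖bdryDeriv Ψ x‖ ≤ 2 * (u * ‖deriv Ψ (a + u * Complex.I)‖) := by
  obtain ⟨h₀, hh0, hhy, H⟩ := h.exists_average_le (η := 1 / 2) (by norm_num)
  refine ⟨h₀, hh0, hhy, fun a u hu huh => ?_⟩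
  have h1 := H a u hu huh
  set D := deriv Ψ (a + u * Complex.I) with hD
  have hau : a ≤ a + u := by linarith
  have h_int := h.intervalIntegrable_bdryDeriv a (a + u)
  have h2 : ∫ x in a..(a + u), ‖bdryDeriv Ψ x - D‖ ≤ 1 / 2 * u * ‖D‖ := by
    rw [intervalIntegral.integral_of_le hau, integral_norm_eq_lintegral_enorm
      ((measurable_bdryDeriv Ψ).sub_const D).aestronglyMeasurable]
    exact ENNReal.toReal_le_of_le_ofReal (by positivity) h1
  have hc : ∫ x in a..(a + u), D = u * D := by simp
  have hint2 : IntervalIntegrable (fun x => bdryDeriv Ψ x - D) volume a (a + u) :=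
    h_int.sub intervalIntegrable_const
  constructor
  · have h3 : ‖(bdryVal Ψ (a + u) - bdryVal Ψ a) - u * D‖ ≤ 1 / 2 * u * ‖D‖ := by
      rw [h.bdryVal_sub hau, ← hc, ← intervalIntegral.integral_sub h_int intervalIntegrable_const]
      exact (intervalIntegral.norm_integral_le_integral_norm hau).trans h2
    have h4 := norm_sub_norm_le (u * D) (bdryVal Ψ (a + u) - bdryVal Ψ a)
    rw [norm_sub_rev (u * D : ℂ) _, norm_mul, Complex.norm_real,
      Real.norm_of_nonneg hu.le] at h4
    linarith
  · have h5 : ∫ x in a..(a + u), ‖bdryDeriv Ψ x‖ ≤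
        ∫ x in a..(a + u), (‖bdryDeriv Ψ x - D‖ + ‖D‖) := by
      refine intervalIntegral.integral_mono_on hau h_int.norm
        (hint2.norm.add intervalIntegrable_const) fun x _ => ?_
      calc ‖bdryDeriv Ψ x‖ = ‖(bdryDeriv Ψ x - D) + D‖ := by rw [sub_add_cancel]
        _ ≤ _ := norm_add_le _ _
    rw [intervalIntegral.integral_add hint2.norm intervalIntegrable_const] at h5
    simp only [intervalIntegral.integral_const, add_sub_cancel_left, smul_eq_mul] at h5
    nlinarith [mul_nonneg hu.le (norm_nonneg D)]

theorem bdryVal_locally_injective (h : FiniteLift Ψ L y₀) :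
    ∃ h₀ : ℝ, 0 < h₀ ∧ ∀ a u : ℝ, 0 < u → u ≤ h₀ → bdryVal Ψ (a + u) ≠ bdryVal Ψ a := by
  obtain ⟨h₀, hh0, hhy, H⟩ := h.exists_comparison
  refine ⟨h₀, hh0, fun a u hu huh heq => ?_⟩
  have h1 := (H a u hu huh).1
  rw [heq, sub_self, norm_zero, mul_zero] at h1
  have h2 : 0 < ‖deriv Ψ (a + u * Complex.I)‖ :=
    norm_pos_iff.2 (h.lift.deriv_ne_zero (by simpa using hu))
  have := mul_pos hu h2
  linarith

end FiniteLift

theorem eq_of_exp_eq_one {X : Type*} [TopologicalSpace X] [PreconnectedSpace X] {c : X → ℂ}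
    (hc : Continuous c) (h : ∀ x, Complex.exp (c x) = 1) (x y : X) : c x = c y := by
  have h1 : (range fun n : ℤ => (n : ℂ) * (2 * π * Complex.I)).Countable := countable_range _
  have h2 : range c ⊆ range fun n : ℤ => (n : ℂ) * (2 * π * Complex.I) := by
    rintro _ ⟨z, rfl⟩
    obtain ⟨n, hn⟩ := Complex.exp_eq_one_iff.1 (h z)
    exact ⟨n, hn.symm⟩
  exact h1.isTotallyDisconnected _ h2 (isPreconnected_range hc) (mem_range_self x)
    (mem_range_self y)

theorem strictMono_or_strictAnti_of_ne {f : ℝ → ℝ} (hf : Continuous f) {h : ℝ} (hh : 0 < h)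
    (hne : ∀ a u, 0 < u → u ≤ h → f (a + u) ≠ f a) : StrictMono f ∨ StrictAnti f := by
  have key : ∀ g : ℝ → ℝ, (∀ a u, 0 < u → u ≤ h → g a < g (a + u)) → StrictMono g := by
    intro g hg a b hab
    have h1 : ∀ n : ℕ, ∀ b, a < b → b ≤ a + n * h → g a < g b := by
      intro n
      induction n with
      | zero => intro b h1 h2; simp at h2; linarith
      | succ n ih =>
        intro b h1 h2
        push_cast at h2
        rcases le_or_gt b (a + h) with h3 | h3
        · have := hg a (b - a) (by linarith) (by linarith)
          rwa [add_sub_cancel] at this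
        · have h4 := ih (b - h) (by linarith) (by linarith)
          have h5 := hg (b - h) h hh le_rfl
          rw [sub_add_cancel] at h5
          exact h4.trans h5
    obtain ⟨n, hn⟩ := exists_nat_ge ((b - a) / h)
    rw [div_le_iff₀ hh] at hn
    exact h1 n b hab (by linarith)
  have hpre : IsPreconnected ((univ : Set ℝ) ×ˢ Ioc 0 h) :=
    isPreconnected_univ.prod isPreconnected_Ioc
  have hcont : Continuous fun p : ℝ × ℝ => f (p.1 + p.2) - f p.1 := by fun_prop
  have him := hpre.image _ hcont.continuousOn
  have h0 : (0 : ℝ) ∉ (fun p : ℝ × ℝ => f (p.1 + p.2) - f p.1) '' ((univ : Set ℝ) ×ˢ Ioc 0 h) := by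
    rintro ⟨p, hp, hp0⟩
    exact hne p.1 p.2 hp.2.1 hp.2.2 (sub_eq_zero.1 hp0)
  by_cases hpos : ∃ p ∈ (univ : Set ℝ) ×ˢ Ioc 0 h, 0 < f (p.1 + p.2) - f p.1
  · left
    obtain ⟨p, hp, hp0⟩ := hpos
    refine key f fun a u hu huh => ?_
    by_contra hcon
    exact h0 (him.Icc_subset (mem_image_of_mem _ (show (a, u) ∈ _ from ⟨mem_univ _, hu, huh⟩))
      (mem_image_of_mem _ hp) ⟨by simp only; linarith, hp0.le⟩)
  · right
    push Not at hpos
    have h1 : StrictMono fun x => -f x := by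
      refine key _ fun a u hu huh => ?_
      have h2 := hpos (a, u) ⟨mem_univ _, hu, huh⟩
      have h3 := hne a u hu huh
      have h4 : f (a + u) < f a := lt_of_le_of_ne (by simpa using h2) h3
      linarith
    intro a b hab
    have := h1 hab
    simp only at this
    linarith

section Curve

variable {γ : ℝ → ℂ}

instance : Fact (0 < 2 * π) := ⟨Real.two_pi_pos⟩

theorem lift_injective (hγp : Function.Periodic γ (2 * π)) (hγi : InjOn γ (Ico 0 (2 * π))) :
    Function.Injective (Function.Periodic.lift hγp) := by
  intro x y hxy
  obtain ⟨a, ha, rfl⟩ := AddCircle.eq_coe_Ico x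
  obtain ⟨b, hb, rfl⟩ := AddCircle.eq_coe_Ico y
  rw [Function.Periodic.lift_coe, Function.Periodic.lift_coe] at hxy
  rw [hγi ha hb hxy]

theorem exists_int_of_eq (hγp : Function.Periodic γ (2 * π)) (hγi : InjOn γ (Ico 0 (2 * π)))
    {s t : ℝ} (h : γ s = γ t) : ∃ n : ℤ, s = t + n * (2 * π) := by
  have h1 : (s : AddCircle (2 * π)) = t := lift_injective hγp hγi (by
    rwa [Function.Periodic.lift_coe, Function.Periodic.lift_coe])
  rw [← sub_eq_zero, ← AddCircle.coe_sub, AddCircle.coe_eq_zero_iff] at h1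
  obtain ⟨n, hn⟩ := h1
  exact ⟨n, by rw [zsmul_eq_mul] at hn; linarith⟩

theorem exists_lift_of_range_subset (hγc : Continuous γ) (hγp : Function.Periodic γ (2 * π))
    (hγi : InjOn γ (Ico 0 (2 * π))) {β : ℝ → ℂ} (hβ : Continuous β)
    (hr : ∀ x, β x ∈ range γ) : ∃ f : ℝ → ℝ, Continuous f ∧ ∀ x, γ (f x) = β x := by
  have hc : Continuous (Function.Periodic.lift hγp) := continuous_coinduced_dom.2 hγc
  have hemb : IsClosedEmbedding (Function.Periodic.lift hγp) :=
    hc.isClosedEmbedding (lift_injective hγp hγi)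
  have hr' : ∀ x, ∃ z : AddCircle (2 * π), Function.Periodic.lift hγp z = β x := by
    intro x
    obtain ⟨t, ht⟩ := hr x
    exact ⟨t, by rwa [Function.Periodic.lift_coe]⟩
  choose b hb using hr'
  have hbc : Continuous b := by
    rw [hemb.isInducing.continuous_iff]
    convert hβ using 1
    ext x; exact hb x
  obtain ⟨e, he⟩ := QuotientAddGroup.mk_surjective (b 0)
  obtain ⟨f, ⟨-, hf⟩, -⟩ := (AddCircle.isCoveringMap_coe (2 * π)).existsUnique_continuousMap_lifts
    (⟨b, hbc⟩ : C(ℝ, AddCircle (2 * π))) 0 e he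
  refine ⟨f, f.continuous, fun x => ?_⟩
  rw [← hb x]
  have := congrFun hf x
  simp only [Function.comp, ContinuousMap.coe_mk] at this
  rw [← this, Function.Periodic.lift_coe]

theorem exists_log_sub (hγc : Continuous γ) {ω : ℂ} (hω : ω ∉ range γ) :
    ∃ l : ℝ → ℂ, Continuous l ∧ ∀ t, Complex.exp (l t) = γ t - ω := by
  have h1 : (0 : ℂ) ∉ (fun t => γ t - ω) '' univ := by
    rintro ⟨t, -, ht⟩
    exact hω ⟨t, sub_eq_zero.1 ht⟩
  obtain ⟨l, hl, hl'⟩ := Complex.exists_continuousOn_eqOn_exp_comp (U := (univ : Set ℝ))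
    (by
      have := (convex_univ : Convex ℝ (univ : Set ℝ)).contractibleSpace ⟨0, mem_univ _⟩
      exact (inferInstance : SimplyConnectedSpace (univ : Set ℝ))) isOpen_univ
    (hγc.sub continuous_const).continuousOn h1
  exact ⟨l, continuousOn_univ.1 hl, fun t => hl' (mem_univ t)⟩

theorem map_add_int_mul {E : Type*} [AddCommGroup E] {f : ℝ → E} {c : E}
    (h : ∀ t, f (t + 2 * π) = f t + c) (n : ℤ) (t : ℝ) : f (t + n * (2 * π)) = f t + n • c := by
  induction n using Int.induction_on with
  | zero => simp
  | succ n ih =>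
    have := h (t + n * (2 * π))
    push_cast at *
    rw [add_mul, one_mul, ← add_assoc, this, ih, add_smul, one_smul, add_assoc]
  | pred n ih =>
    have := h (t + (-n - 1) * (2 * π))
    push_cast at *
    rw [show t + (-n - 1) * (2 * π) + 2 * π = t + -n * (2 * π) by ring, ih] at this
    rw [sub_smul, one_smul, eq_sub_of_add_eq this.symm, add_sub_assoc]

end Curve

structure JordanMap (γ : ℝ → ℂ) (Ω Ωstar : Set ℂ) (F : ℂ → ℂ) : Prop where
  cont : Continuous γ
  per : Function.Periodic γ (2 * π)
  inj : InjOn γ (Ico 0 (2 * π))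
  isOpen_int : IsOpen Ω
  conn_int : IsConnected Ω
  isOpen_ext : IsOpen Ωstar
  conn_ext : IsConnected Ωstar
  disj : Disjoint Ω Ωstar
  union : Ω ∪ Ωstar = (range γ)ᶜ
  bdd : Bornology.IsBounded Ω
  unbdd : ¬ Bornology.IsBounded Ωstar
  diff : DifferentiableOn ℂ F (ball (0 : ℂ) 1)
  bij : BijOn F (ball (0 : ℂ) 1) Ω

namespace JordanMap

variable {γ : ℝ → ℂ} {Ω Ωstar : Set ℂ} {F L : ℂ → ℂ} {y₀ : ℝ}

theorem range_eq_image (J : JordanMap γ Ω Ωstar F) : range γ = γ '' Icc 0 (2 * π) := by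
  refine subset_antisymm ?_ (image_subset_range _ _)
  rintro _ ⟨t, rfl⟩
  obtain ⟨s, hs, hst⟩ := J.per.exists_mem_Ico₀ two_pi_pos t
  exact ⟨s, Ico_subset_Icc_self hs, hst.symm⟩

theorem isCompact_range (J : JordanMap γ Ω Ωstar F) : IsCompact (range γ) := by
  rw [J.range_eq_image]
  exact isCompact_Icc.image J.cont

theorem closure_subset (J : JordanMap γ Ω Ωstar F) : closure Ω ⊆ Ω ∪ range γ := by
  intro p hp
  by_contra hcon
  have h1 : p ∈ Ω ∪ Ωstar := by
    rw [J.union]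
    exact fun h => hcon (Or.inr h)
  rcases h1 with h1 | h1
  · exact hcon (Or.inl h1)
  · obtain ⟨q, hq1, hq2⟩ := mem_closure_iff.1 hp _ J.isOpen_ext h1
    exact disjoint_left.1 J.disj hq2 hq1

theorem notMem_range (J : JordanMap γ Ω Ωstar F) {p : ℂ} (hp : p ∈ Ω) : p ∉ range γ := by
  have : p ∈ Ω ∪ Ωstar := Or.inl hp
  rwa [J.union] at this

theorem exists_inverse (J : JordanMap γ Ω Ωstar F) :
    ∃ G : ℂ → ℂ, LeftInvOn G F (ball 0 1) ∧ DifferentiableOn ℂ G Ω := by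
  refine ⟨Function.invFunOn F (ball 0 1), J.bij.injOn.leftInvOn_invFunOn, ?_⟩
  have := differentiableOn_leftInverse isOpen_ball J.diff J.bij.injOn
    J.bij.injOn.leftInvOn_invFunOn
  rwa [J.bij.image_eq] at this

theorem exists_radius (J : JordanMap γ Ω Ωstar F) {ε : ℝ} (hε : 0 < ε) :
    ∃ r < 1, ∀ z : ℂ, ‖z‖ < 1 → r < ‖z‖ → infDist (F z) (range γ) < ε := by
  obtain ⟨G, hG, hGd⟩ := J.exists_inverse
  set K : Set ℂ := closure Ω ∩ {p | ε ≤ infDist p (range γ)} with hK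
  have hKc : IsCompact K :=
    (Metric.isCompact_of_isClosed_isBounded isClosed_closure J.bdd.closure).inter_right
      (isClosed_le continuous_const (continuous_infDist_pt _))
  have hKΩ : K ⊆ Ω := by
    rintro p ⟨hp1, hp2⟩
    rcases J.closure_subset hp1 with h | h
    · exact h
    · exact absurd (show ε ≤ infDist p (range γ) from hp2) (by
        rw [infDist_zero_of_mem h]; exact not_le.2 hε)
  rcases K.eq_empty_or_nonempty with h0 | hne
  · refine ⟨0, one_pos, fun z hz _ => ?_⟩
    by_contra hcon
    have : F z ∈ K := ⟨subset_closure (J.bij.mapsTo (by simpa using hz)), not_lt.1 hcon⟩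
    rw [h0] at this
    exact this
  · obtain ⟨p, hp, hmax⟩ := hKc.exists_isMaxOn hne
      (hGd.continuousOn.mono hKΩ).norm
    refine ⟨‖G p‖, ?_, fun z hz hzr => ?_⟩
    · obtain ⟨q, hq, rfl⟩ := J.bij.surjOn (hKΩ hp)
      rw [hG hq]
      simpa using hq
    · by_contra hcon
      have hz' : z ∈ ball (0 : ℂ) 1 := by simpa using hz
      have : F z ∈ K := ⟨subset_closure (J.bij.mapsTo hz'), not_lt.1 hcon⟩
      have h2 := hmax this
      simp only [mem_ofPred_eq, hG hz'] at h2
      linarith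

theorem exists_height (J : JordanMap γ Ω Ωstar F) {ε : ℝ} (hε : 0 < ε) :
    ∃ h > 0, ∀ ζ : ℂ, 0 < ζ.im → ζ.im < h → infDist (F (toDisk ζ)) (range γ) < ε := by
  obtain ⟨r, hr, hr'⟩ := J.exists_radius hε
  have h1 : Tendsto (fun y : ℝ => Real.exp (-y)) (𝓝 0) (𝓝 1) := by
    have : Continuous fun y : ℝ => Real.exp (-y) := by fun_prop
    simpa using this.tendsto 0
  obtain ⟨h, hh, hh'⟩ := Metric.eventually_nhds_iff.1 (h1.eventually_const_lt hr)
  refine ⟨h, hh, fun ζ h1 h2 => hr' _ (by simpa using toDisk_mem_ball h1) ?_⟩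
  rw [norm_toDisk]
  exact hh' (by rw [dist_zero_right, Real.norm_of_nonneg h1.le]; exact h2)

theorem bdryVal_mem (J : JordanMap γ Ω Ωstar F)
    (h : FiniteLift (fun ζ => F (toDisk ζ)) L y₀) (x : ℝ) :
    bdryVal (fun ζ => F (toDisk ζ)) x ∈ range γ := by
  rw [J.isCompact_range.isClosed.mem_iff_infDist_zero (range_nonempty γ)]
  have h1 := ((continuous_infDist_pt (range γ)).tendsto _).comp (h.tendsto_bdryVal x)
  refine tendsto_nhds_unique h1 ?_
  rw [Metric.tendsto_nhds]
  intro ε hε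
  obtain ⟨t, ht, ht'⟩ := J.exists_height hε
  filter_upwards [Ioo_mem_nhdsGT ht] with y hy
  simp only [Function.comp_apply]
  rw [dist_zero_right, Real.norm_of_nonneg infDist_nonneg]
  exact ht' _ (by simpa using hy.1) (by simpa using hy.2)

theorem exists_log_quotient (J : JordanMap γ Ω Ωstar F) :
    ∃ k : ℂ → ℂ, ContinuousOn k (ball 0 1) ∧
      ∀ z ∈ ball (0 : ℂ) 1, z * Complex.exp (k z) = F z - F 0 := by
  have h0 : (0 : ℂ) ∈ ball (0 : ℂ) 1 := by simp
  have hd : DifferentiableOn ℂ (dslope F 0) (ball 0 1) :=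
    (Complex.differentiableOn_dslope (isOpen_ball.mem_nhds h0)).2 J.diff
  have hne : ∀ z ∈ ball (0 : ℂ) 1, dslope F 0 z ≠ 0 := by
    intro z hz h
    by_cases hz0 : z = 0
    · rw [hz0, dslope_same] at h
      exact deriv_ne_zero_of_injOn isOpen_ball J.diff J.bij.injOn h0 h
    · rw [dslope_of_ne _ hz0, slope_def_field, div_eq_zero_iff] at h
      rcases h with h | h
      · exact hz0 (J.bij.injOn hz h0 (sub_eq_zero.1 h))
      · exact hz0 (by simpa using h)
  have hsc : IsSimplyConnected (ball (0 : ℂ) 1) := by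
    have := (convex_ball (0 : ℂ) 1).contractibleSpace ⟨0, h0⟩
    exact (inferInstance : SimplyConnectedSpace (ball (0 : ℂ) 1))
  obtain ⟨k, hk, hk'⟩ := Complex.exists_continuousOn_eqOn_exp_comp hsc isOpen_ball
    hd.continuousOn (by rintro ⟨z, hz, h⟩; exact hne z hz h)
  refine ⟨k, hk, fun z hz => ?_⟩
  have h2 : Complex.exp (k z) = dslope F 0 z := hk' hz
  have h3 := sub_smul_dslope F 0 z
  rw [h2, ← h3, sub_zero, smul_eq_mul]

/-- The lift of the boundary map through `γ` shifts by `±2π` over a period. -/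
theorem exists_degree (J : JordanMap γ Ω Ωstar F)
    (h : FiniteLift (fun ζ => F (toDisk ζ)) L y₀) {f : ℝ → ℝ} (hf : Continuous f)
    (hfγ : ∀ x, γ (f x) = bdryVal (fun ζ => F (toDisk ζ)) x) :
    ∃ n : ℤ, n * n = 1 ∧ ∀ x, f (x + 2 * π) = f x + n * (2 * π) := by
  set Ψ : ℂ → ℂ := fun ζ => F (toDisk ζ) with hΨ
  have h0 : (0 : ℂ) ∈ ball (0 : ℂ) 1 := by simp
  have hω : F 0 ∉ range γ := J.notMem_range (J.bij.mapsTo h0)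
  obtain ⟨l, hl, hl'⟩ := exists_log_sub J.cont hω
  obtain ⟨k, hk, hk'⟩ := J.exists_log_quotient
  have hn : ∃ n : ℤ, ∀ x, f (x + 2 * π) = f x + n * (2 * π) := by
    have h1 : ∀ x, ∃ n : ℤ, f (x + 2 * π) = f x + n * (2 * π) := fun x =>
      exists_int_of_eq J.per J.inj (by rw [hfγ, hfγ, h.bdryVal_per])
    have h2 : Continuous fun x : ℝ => ((f (x + 2 * π) - f x : ℝ) : ℂ) * Complex.I := by fun_prop
    have h3 := eq_of_exp_eq_one h2 (fun x => by
      obtain ⟨n, hn⟩ := h1 x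
      rw [Complex.exp_eq_one_iff]
      exact ⟨n, by rw [hn]; push_cast; ring⟩)
    obtain ⟨n, hn⟩ := h1 0
    refine ⟨n, fun x => ?_⟩
    have h4 := mul_right_cancel₀ Complex.I_ne_zero (h3 x 0)
    have h5 : f (x + 2 * π) - f x = f (0 + 2 * π) - f 0 := by exact_mod_cast h4
    linarith
  obtain ⟨n, hn⟩ := hn
  obtain ⟨c, hc⟩ : ∃ c : ℂ, ∀ t, l (t + 2 * π) = l t + c := by
    have h2 : Continuous fun x : ℝ => l (x + 2 * π) - l x := by fun_prop
    have h3 := eq_of_exp_eq_one h2 (fun x => by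
      rw [Complex.exp_sub, hl', hl', J.per, div_self]
      exact sub_ne_zero.2 fun e => hω ⟨x, e⟩)
    exact ⟨l (0 + 2 * π) - l 0, fun t => by rw [← h3 t 0]; ring⟩
  obtain ⟨m, hm⟩ : ∃ m : ℤ, c = m * (2 * π * Complex.I) := by
    rw [← Complex.exp_eq_one_iff]
    have h1 := hl' (0 + 2 * π)
    rw [hc, Complex.exp_add, J.per, hl'] at h1
    exact mul_left_cancel₀ (sub_ne_zero.2 fun e => hω ⟨0, e⟩) (h1.trans (mul_one _).symm)
  -- a low level at which `Ψ` stays close to its boundary values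
  have hδ : 0 < infDist (F 0) (range γ) :=
    (J.isCompact_range.isClosed.notMem_iff_infDist_pos (range_nonempty γ)).1 hω
  obtain ⟨y, hy, hy0⟩ := ((h.eventually_norm_bdryVal_sub_lt hδ).and self_mem_nhdsWithin).exists
  have hy0' : (0 : ℝ) < y := hy0
  have him : ∀ x : ℝ, 0 < ((x : ℂ) + y * Complex.I).im := fun x => by simpa using hy0'
  have hβne : ∀ x, infDist (F 0) (range γ) ≤ ‖bdryVal Ψ x - F 0‖ := fun x => by
    rw [← dist_eq_norm, dist_comm]
    exact infDist_le_dist_of_mem (J.bdryVal_mem h x)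
  set q : ℝ → ℂ := fun x => (Ψ (x + y * Complex.I) - F 0) / (bdryVal Ψ x - F 0) with hq
  have hβ0 : ∀ x, bdryVal Ψ x - F 0 ≠ 0 := fun x => norm_pos_iff.1 (hδ.trans_le (hβne x))
  have hΨc : Continuous fun x : ℝ => Ψ (x + y * Complex.I) := h.continuous_horizontal hy0'
  have hqc : Continuous q :=
    (hΨc.sub continuous_const).div (h.continuous_bdryVal.sub continuous_const) hβ0
  have hq1 : ∀ x, ‖q x - 1‖ < 1 := by
    intro x
    have : q x - 1 = -(bdryVal Ψ x - Ψ (x + y * Complex.I)) / (bdryVal Ψ x - F 0) := by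
      rw [hq]; field_simp [hβ0 x]; ring
    rw [this, norm_div, norm_neg, div_lt_one (hδ.trans_le (hβne x))]
    exact (hy x).trans_le (hβne x)
  have hqs : ∀ x, q x ∈ Complex.slitPlane := fun x => by
    refine Or.inl ?_
    have h1 := (Complex.abs_re_le_norm (q x - 1)).trans_lt (hq1 x)
    rw [abs_lt, Complex.sub_re, Complex.one_re] at h1
    linarith [h1.1]
  have hq0 : ∀ x, q x ≠ 0 := fun x => Complex.slitPlane_ne_zero (hqs x)
  set b : ℝ → ℂ := fun x => Complex.I * (x + y * Complex.I) + k (toDisk (x + y * Complex.I))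
    - l (f x) - Complex.log (q x) with hb
  have hbc : Continuous b := by
    have h1 : Continuous fun x : ℝ => k (toDisk (x + y * Complex.I)) := by
      refine hk.comp_continuous ?_ fun x => toDisk_mem_ball (him x)
      unfold toDisk
      fun_prop
    have h2 : Continuous fun x => Complex.log (q x) := hqc.clog hqs
    have h3 : Continuous fun x => l (f x) := hl.comp hf
    have h4 : Continuous fun x : ℝ => Complex.I * (x + y * Complex.I) := by fun_prop
    exact ((h4.add h1).sub h3).sub h2
  have hb1 : ∀ x, Complex.exp (b x) = 1 := by
    intro x
    have h1 := hk' _ (toDisk_mem_ball (him x))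
    rw [hb]
    simp only
    rw [Complex.exp_sub, Complex.exp_sub, Complex.exp_add, hl', Complex.exp_log (hq0 x), hfγ]
    have h2 : Complex.exp (Complex.I * (x + y * Complex.I)) = toDisk (x + y * Complex.I) := rfl
    rw [h2, h1, div_eq_one_iff_eq (hq0 x)]
  have hbe := eq_of_exp_eq_one hbc hb1 (0 + 2 * π) 0
  have hshift : ((0 + 2 * π : ℝ) : ℂ) + y * Complex.I = ((0 : ℝ) : ℂ) + y * Complex.I + 2 * π := by
    push_cast; ring
  have hqp : q (0 + 2 * π) = q 0 := by
    rw [hq]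
    simp only
    rw [hshift, h.lift.per _ (him 0), h.bdryVal_per]
  have hlf : l (f (0 + 2 * π)) = l (f 0) + n * c := by
    rw [hn, map_add_int_mul hc, zsmul_eq_mul]
  rw [hb] at hbe
  simp only at hbe
  rw [hqp, hlf, hshift, toDisk_add_two_pi, hm] at hbe
  have h5 : (2 * π * Complex.I) * (1 - n * m) = 0 := by linear_combination hbe
  have h6 : (1 : ℂ) - n * m = 0 :=
    (mul_eq_zero.1 h5).resolve_left (by simp [Real.pi_ne_zero])
  have h7 : n * m = 1 := by
    have : ((n * m : ℤ) : ℂ) = ((1 : ℤ) : ℂ) := by push_cast; linear_combination -h6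
    exact_mod_cast this
  refine ⟨n, ?_, hn⟩
  rcases Int.eq_one_or_neg_one_of_mul_eq_one h7 with h | h <;> rw [h] <;> norm_num

theorem bdryVal_injOn_and_range (J : JordanMap γ Ω Ωstar F)
    (h : FiniteLift (fun ζ => F (toDisk ζ)) L y₀) :
    InjOn (bdryVal fun ζ => F (toDisk ζ)) (Ico 0 (2 * π)) ∧
      range (bdryVal fun ζ => F (toDisk ζ)) = range γ := by
  obtain ⟨f, hf, hfγ⟩ := exists_lift_of_range_subset J.cont J.per J.inj h.continuous_bdryVal
    (J.bdryVal_mem h)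
  obtain ⟨n, hn1, hn⟩ := J.exists_degree h hf hfγ
  obtain ⟨h₀, hh0, hloc⟩ := h.bdryVal_locally_injective
  have hinj : Function.Injective f := by
    rcases strictMono_or_strictAnti_of_ne hf hh0 (fun a u hu huh he =>
      hloc a u hu huh (by rw [← hfγ, ← hfγ, he])) with hm | hm
    · exact hm.injective
    · exact hm.injective
  have hn1' : (n : ℝ) * n = 1 := by exact_mod_cast hn1
  have hshift : ∀ (m : ℤ) x, f (x + (m * n : ℤ) * (2 * π)) = f x + m * (2 * π) := by
    intro m x
    rw [map_add_int_mul hn, zsmul_eq_mul]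
    push_cast
    linear_combination (m : ℝ) * (2 * π) * hn1'
  constructor
  · intro a ha b hb hab
    obtain ⟨m, hm⟩ := exists_int_of_eq J.per J.inj (by rw [hfγ, hfγ]; exact hab : γ (f a) = γ (f b))
    rw [← hshift] at hm
    have h1 := hinj hm
    have h2 : -1 < ((m * n : ℤ) : ℝ) := by
      have := ha.1; have := hb.2
      by_contra hcon
      nlinarith [Real.pi_pos]
    have h3 : ((m * n : ℤ) : ℝ) < 1 := by
      have := ha.2; have := hb.1
      by_contra hcon
      nlinarith [Real.pi_pos]
    have h4 : m * n = 0 := by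
      have h2' : -1 < m * n := by exact_mod_cast h2
      have h3' : m * n < 1 := by exact_mod_cast h3
      omega
    rw [h4] at h1
    simpa using h1
  · refine subset_antisymm (range_subset_iff.2 (J.bdryVal_mem h)) ?_
    rintro _ ⟨t, rfl⟩
    have h1 : t ∈ range f := by
      refine mem_range_of_exists_le_of_exists_ge hf ?_ ?_
      · refine ⟨0 + ((⌊(t - f 0) / (2 * π)⌋ * n : ℤ)) * (2 * π), ?_⟩
        rw [hshift]
        have := Int.floor_le ((t - f 0) / (2 * π))
        rw [le_div_iff₀ two_pi_pos] at this
        linarith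
      · refine ⟨0 + ((⌈(t - f 0) / (2 * π)⌉ * n : ℤ)) * (2 * π), ?_⟩
        rw [hshift]
        have := Int.le_ceil ((t - f 0) / (2 * π))
        rw [div_le_iff₀ two_pi_pos] at this
        linarith
    obtain ⟨x, rfl⟩ := h1
    exact ⟨x, (hfγ x).symm⟩

end JordanMap

/-- A closed curve `β` with density `g = β'`, comparable to its chords on a small scale. -/
structure ArcData (β g : ℝ → ℂ) (h₀ : ℝ) : Prop where
  meas : Measurable g
  per : ∀ x, β (x + 2 * π) = β x
  gper : ∀ x, g (x + 2 * π) = g x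
  integrable : ∀ a b, IntervalIntegrable g volume a b
  sub : ∀ a b, a ≤ b → β b - β a = ∫ x in a..b, g x
  ne_zero : ∀ᵐ x, g x ≠ 0
  inj : InjOn β (Ico 0 (2 * π))
  pos : 0 < h₀
  comparison : ∀ a u, 0 < u → u ≤ h₀ → ∫ x in a..(a + u), ‖g x‖ ≤ 4 * ‖β (a + u) - β a‖

noncomputable def arcLength (g : ℝ → ℂ) (x : ℝ) : ℝ := ∫ t in (0 : ℝ)..x, ‖g t‖

namespace ArcData

variable {β g : ℝ → ℂ} {h₀ : ℝ}

theorem intervalIntegrable_norm (h : ArcData β g h₀) (a b : ℝ) :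
    IntervalIntegrable (fun t => ‖g t‖) volume a b := (h.integrable a b).norm

theorem arcLength_sub (h : ArcData β g h₀) (a b : ℝ) :
    arcLength g b - arcLength g a = ∫ t in a..b, ‖g t‖ :=
  intervalIntegral.integral_interval_sub_left (h.intervalIntegrable_norm _ _)
    (h.intervalIntegrable_norm _ _)

theorem arcLength_strictMono (h : ArcData β g h₀) : StrictMono (arcLength g) := by
  intro a b hab
  rw [← sub_pos, h.arcLength_sub]
  rw [intervalIntegral.integral_pos_iff_support_of_nonneg_ae
    (Eventually.of_forall fun t => norm_nonneg _) (h.intervalIntegrable_norm a b)]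
  refine ⟨hab, ?_⟩
  have h1 : (volume : Measure ℝ) (Function.support (fun t => ‖g t‖) ∩ Ioc a b) =
      volume (Ioc a b) := by
    refine measure_congr ?_
    filter_upwards [h.ne_zero] with x hx
    refine propext (and_iff_right ?_)
    exact norm_ne_zero_iff.2 hx
  rw [h1, Real.volume_Ioc]
  simpa using hab

theorem arcLength_add_two_pi (h : ArcData β g h₀) (x : ℝ) :
    arcLength g (x + 2 * π) = arcLength g x + arcLength g (2 * π) := by
  have h1 : Function.Periodic (fun t => ‖g t‖) (2 * π) := fun t => by simp only [h.gper t]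
  have h2 := h1.intervalIntegral_add_eq x 0
  rw [zero_add] at h2
  have h3 := h.arcLength_sub x (x + 2 * π)
  rw [h2] at h3
  unfold arcLength at *
  linarith

theorem arcLength_pos (h : ArcData β g h₀) : 0 < arcLength g (2 * π) := by
  have := h.arcLength_strictMono two_pi_pos
  simpa [arcLength] using this

theorem continuous_arcLength (h : ArcData β g h₀) : Continuous (arcLength g) :=
  intervalIntegral.continuous_primitive (fun a b => h.intervalIntegrable_norm a b) 0

theorem norm_sub_le (h : ArcData β g h₀) (a b : ℝ) :
    ‖β b - β a‖ ≤ |arcLength g b - arcLength g a| := by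
  wlog hab : a ≤ b generalizing a b
  · rw [norm_sub_rev, abs_sub_comm]; exact this b a (le_of_not_ge hab)
  rw [h.sub a b hab, h.arcLength_sub]
  exact (intervalIntegral.norm_integral_le_integral_norm hab).trans (le_abs_self _)

theorem arcLength_surjective (h : ArcData β g h₀) : Function.Surjective (arcLength g) := by
  have hshift : ∀ m : ℤ, arcLength g (0 + m * (2 * π)) = m * arcLength g (2 * π) := by
    intro m
    rw [map_add_int_mul h.arcLength_add_two_pi, zsmul_eq_mul]
    simp [arcLength]
  intro t
  refine mem_range_of_exists_le_of_exists_ge h.continuous_arcLength ?_ ?_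
  · refine ⟨0 + (⌊t / arcLength g (2 * π)⌋ : ℤ) * (2 * π), ?_⟩
    rw [hshift, ← le_div_iff₀ h.arcLength_pos]
    exact Int.floor_le _
  · refine ⟨0 + (⌈t / arcLength g (2 * π)⌉ : ℤ) * (2 * π), ?_⟩
    rw [hshift, ← div_le_iff₀ h.arcLength_pos]
    exact Int.le_ceil _

theorem exists_orderIso (h : ArcData β g h₀) :
    ∃ T : ℝ ≃o ℝ, ∀ x, arcLength g (2 * π) / (2 * π) * T x = arcLength g x := by
  have hl := h.arcLength_pos
  have hc : 0 < 2 * π / arcLength g (2 * π) := div_pos two_pi_pos hl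
  have h1 : StrictMono fun x => 2 * π / arcLength g (2 * π) * arcLength g x :=
    h.arcLength_strictMono.const_mul hc
  have h2 : Function.Surjective fun x => 2 * π / arcLength g (2 * π) * arcLength g x := by
    intro t
    obtain ⟨x, hx⟩ := h.arcLength_surjective (arcLength g (2 * π) / (2 * π) * t)
    refine ⟨x, ?_⟩
    simp only [hx]
    field_simp
  refine ⟨h1.orderIsoOfSurjective _ h2, fun x => ?_⟩
  rw [StrictMono.coe_orderIsoOfSurjective]
  field_simp

section Param

variable {T : ℝ ≃o ℝ} {v : ℝ}

theorem map_withDensity (h : ArcData β g h₀) (hv : 0 < v) (hT : ∀ x, v * T x = arcLength g x) :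
    Measure.map T (volume.withDensity fun x => ENNReal.ofReal (v⁻¹) * ‖g x‖ₑ) = volume := by
  symm
  refine Measure.ext_of_Ioc _ _ fun {a b} hab => ?_
  have hTm : Measurable T := T.toHomeomorph.continuous.measurable
  rw [Measure.map_apply hTm measurableSet_Ioc, OrderIso.preimage_Ioc,
    withDensity_apply _ measurableSet_Ioc, lintegral_const_mul _ h.meas.enorm, Real.volume_Ioc]
  have hab' : T.symm a ≤ T.symm b := T.symm.monotone hab.le
  have h1 : ∫⁻ x in Ioc (T.symm a) (T.symm b), ‖g x‖ₑ =
      ENNReal.ofReal (∫ x in (T.symm a)..(T.symm b), ‖g x‖) := by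
    rw [intervalIntegral.integral_of_le hab', ofReal_integral_norm_eq_lintegral_enorm
      (h.integrable _ _).1]
  rw [h1, ← h.arcLength_sub, ← hT, ← hT, T.apply_symm_apply, T.apply_symm_apply,
    ← ENNReal.ofReal_mul (inv_nonneg.2 hv.le)]
  congr 1
  field_simp

theorem lintegral_comp (h : ArcData β g h₀) (hv : 0 < v) (hT : ∀ x, v * T x = arcLength g x)
    (s : Set ℝ) (hs : MeasurableSet s) {u : ℝ → ENNReal} (hu : Measurable u) :
    ∫⁻ x in s, u x = ∫⁻ x in T ⁻¹' s, ENNReal.ofReal (v⁻¹) * ‖g x‖ₑ * u (T x) := by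
  have hTm : Measurable T := T.toHomeomorph.continuous.measurable
  have hgm : Measurable fun x => ENNReal.ofReal (v⁻¹) * ‖g x‖ₑ := h.meas.enorm.const_mul _
  conv_lhs => rw [← h.map_withDensity hv hT]
  rw [setLIntegral_map hs hu hTm, restrict_withDensity (hTm hs)]
  exact lintegral_withDensity_eq_lintegral_mul _ hgm (hu.comp hTm)

theorem ae_comp_symm (h : ArcData β g h₀) (hv : 0 < v) (hT : ∀ x, v * T x = arcLength g x)
    {p : ℝ → Prop} (hp : ∀ᵐ x, p x) : ∀ᵐ x, p (T.symm x) := by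
  have hTe : MeasurableEmbedding T := T.toHomeomorph.measurableEmbedding
  rw [← h.map_withDensity hv hT, hTe.ae_map_iff]
  have h1 := (withDensity_absolutelyContinuous (volume : Measure ℝ)
    fun x => ENNReal.ofReal (v⁻¹) * ‖g x‖ₑ).ae_le hp
  filter_upwards [h1] with x hx
  rwa [T.symm_apply_apply]

theorem ae_hasDerivAt (h : ArcData β g h₀) (hv : 0 < v) (hT : ∀ x, v * T x = arcLength g x) :
    ∀ᵐ x, HasDerivAt (fun y => β (T.symm y)) ((v / ‖g x‖ : ℝ) * g x) (T x) := by
  have hli : LocallyIntegrable g volume := fun x =>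
    ⟨Ioc (x - 1) (x + 1), Ioc_mem_nhds (by linarith) (by linarith), (h.integrable _ _).1⟩
  have hli' : LocallyIntegrable (fun x => ‖g x‖) volume := fun x =>
    ⟨Ioc (x - 1) (x + 1), Ioc_mem_nhds (by linarith) (by linarith), (h.integrable _ _).1.norm⟩
  filter_upwards [_root_.LocallyIntegrable.ae_hasDerivAt_integral hli,
    _root_.LocallyIntegrable.ae_hasDerivAt_integral hli', h.ne_zero]
    with x hx1 hx2 hx3
  have hβ : HasDerivAt β (g x) x := by
    have h1 := (hx1 (x - 1)).add_const (β (x - 1))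
    refine h1.congr_of_eventuallyEq ?_
    filter_upwards [Ioi_mem_nhds (sub_one_lt x)] with y hy
    rw [← h.sub _ _ (le_of_lt hy)]; ring
  have hTd : HasDerivAt T (v⁻¹ * ‖g x‖) x := by
    have h1 := (hx2 0).const_mul v⁻¹
    refine h1.congr_of_eventuallyEq (Eventually.of_forall fun y => ?_)
    have := hT y
    simp only [arcLength] at this
    simp only [← this]
    field_simp
  have hne : v⁻¹ * ‖g x‖ ≠ 0 := mul_ne_zero (inv_ne_zero hv.ne') (norm_ne_zero_iff.2 hx3)
  have hTs : HasDerivAt T.symm (v⁻¹ * ‖g x‖)⁻¹ (T x) := by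
    refine HasDerivAt.of_local_left_inverse T.symm.toHomeomorph.continuous.continuousAt ?_ hne
      (Eventually.of_forall fun y => T.apply_symm_apply y)
    rwa [T.symm_apply_apply]
  have h2 : HasDerivAt β (g x) (T.symm (T x)) := by rwa [T.symm_apply_apply]
  have h3 := h2.scomp (T x) hTs
  refine h3.congr_deriv ?_
  rw [Complex.real_smul, mul_inv, inv_inv, div_eq_mul_inv]

theorem lipschitzWith (h : ArcData β g h₀) (hv : 0 < v) (hT : ∀ x, v * T x = arcLength g x) :
    LipschitzWith v.toNNReal fun x => β (T.symm x) := by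
  refine LipschitzWith.of_dist_le_mul fun x y => ?_
  rw [dist_eq_norm, Real.coe_toNNReal _ hv.le, Real.dist_eq]
  refine (h.norm_sub_le _ _).trans_eq ?_
  rw [← hT, ← hT, T.apply_symm_apply, T.apply_symm_apply, ← mul_sub, abs_mul, abs_of_pos hv]

end Param

end ArcData

theorem norm_exp_sub_exp (x y : ℝ) :
    ‖Complex.exp (x * Complex.I) - Complex.exp (y * Complex.I)‖ = 2 * |Real.sin ((x - y) / 2)| := by
  have h1 : Complex.exp (x * Complex.I) - Complex.exp (y * Complex.I) =
      Complex.exp (((x + y) / 2 : ℝ) * Complex.I) *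
        (2 * Complex.I * Complex.sin (((x - y) / 2 : ℝ) : ℂ)) := by
    rw [Complex.sin]
    have h2 : Complex.exp (x * Complex.I) = Complex.exp (((x + y) / 2 : ℝ) * Complex.I) *
        Complex.exp ((((x - y) / 2 : ℝ) : ℂ) * Complex.I) := by
      rw [← Complex.exp_add]; congr 1; push_cast; ring
    have h3 : Complex.exp (y * Complex.I) = Complex.exp (((x + y) / 2 : ℝ) * Complex.I) *
        Complex.exp (-(((x - y) / 2 : ℝ) : ℂ) * Complex.I) := by
      rw [← Complex.exp_add]; congr 1; push_cast; ring
    rw [h2, h3]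
    linear_combination (Complex.exp (((x + y) / 2 : ℝ) * Complex.I) *
      (Complex.exp ((((x - y) / 2 : ℝ) : ℂ) * Complex.I) -
        Complex.exp (-(((x - y) / 2 : ℝ) : ℂ) * Complex.I))) * Complex.I_mul_I
  rw [h1, norm_mul, Complex.norm_exp_ofReal_mul_I, one_mul, norm_mul, norm_mul, Complex.norm_I,
    ← Complex.ofReal_sin, Complex.norm_real, Real.norm_eq_abs]
  simp

theorem min_le_norm_exp_sub_exp {x y : ℝ} (h : |x - y| ≤ 2 * π) :
    min |x - y| (2 * π - |x - y|) ≤ π / 2 *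
      ‖Complex.exp (x * Complex.I) - Complex.exp (y * Complex.I)‖ := by
  have h0 : |Real.sin ((x - y) / 2)| = Real.sin (|x - y| / 2) := by
    have h2 : 0 ≤ Real.sin (|x - y| / 2) :=
      Real.sin_nonneg_of_nonneg_of_le_pi (by positivity) (by linarith)
    rcases abs_cases (x - y) with ⟨h1, -⟩ | ⟨h1, -⟩
    · rw [h1] at h2 ⊢; exact abs_of_nonneg h2
    · rw [h1, neg_div, Real.sin_neg] at h2 ⊢
      exact abs_of_nonpos (by linarith)
  rw [norm_exp_sub_exp, h0]
  rcases le_total |x - y| π with h1 | h1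
  · have := Real.mul_le_sin (x := |x - y| / 2) (by positivity) (by linarith)
    refine (min_le_left _ _).trans ?_
    have h3 := mul_le_mul_of_nonneg_left this Real.pi_pos.le
    field_simp at h3
    linarith
  · have := Real.mul_le_sin (x := π - |x - y| / 2) (by linarith) (by linarith)
    rw [Real.sin_pi_sub] at this
    refine (min_le_right _ _).trans ?_
    have h3 := mul_le_mul_of_nonneg_left this Real.pi_pos.le
    field_simp at h3
    linarith

theorem norm_mul_norm_mul_sub_sq_le (a b : ℂ) (ha : a ≠ 0) (hb : b ≠ 0) {v : ℝ} (hv : 0 < v) :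
    v⁻¹ * ‖a‖ * (v⁻¹ * ‖b‖) * ‖((v / ‖a‖ : ℝ) : ℂ) * a - ((v / ‖b‖ : ℝ) : ℂ) * b‖ ^ 2 ≤
      ‖a - b‖ ^ 2 := by
  have ha' : 0 < ‖a‖ := norm_pos_iff.2 ha
  have hb' : 0 < ‖b‖ := norm_pos_iff.2 hb
  rw [← Complex.real_smul, ← Complex.real_smul, norm_sub_sq_real, norm_sub_sq_real, norm_smul,
    norm_smul, inner_smul_left, inner_smul_right, Real.norm_of_nonneg (by positivity),
    Real.norm_of_nonneg (by positivity), div_mul_cancel₀ _ ha'.ne', div_mul_cancel₀ _ hb'.ne']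
  have : v⁻¹ * ‖a‖ * (v⁻¹ * ‖b‖) * (v ^ 2 - 2 * ((starRingEnd ℝ) (v / ‖a‖) *
      (v / ‖b‖ * inner ℝ a b)) + v ^ 2) = 2 * ‖a‖ * ‖b‖ - 2 * inner ℝ a b := by
    simp only [conj_trivial]
    field_simp
    ring
  rw [this]
  nlinarith [sq_nonneg (‖a‖ - ‖b‖)]

theorem norm_sub_le_min {w : ℝ → ℂ} {v : ℝ} (hv : 0 < v) (hw : LipschitzWith v.toNNReal w)
    (hp : ∀ x, w (x + 2 * π) = w x) {x y : ℝ} (hxy : |x - y| ≤ 2 * π) :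
    ‖w x - w y‖ ≤ v * min |x - y| (2 * π - |x - y|) := by
  have hl : ∀ x y, ‖w x - w y‖ ≤ v * |x - y| := fun x y => by
    have := hw.dist_le_mul x y
    rwa [dist_eq_norm, Real.coe_toNNReal _ hv.le, Real.dist_eq] at this
  rw [mul_min_of_nonneg _ _ hv.le]
  refine le_min (hl x y) ?_
  wlog hyx : y ≤ x generalizing x y
  · rw [abs_sub_comm, norm_sub_rev] at *
    exact this hxy (le_of_not_ge hyx)
  rw [abs_of_nonneg (sub_nonneg.2 hyx)] at *
  have := hl x (y + 2 * π)
  rwa [hp, abs_of_nonpos (by linarith), show -(x - (y + 2 * π)) = 2 * π - (x - y) by ring] at this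

theorem abs_sub_le_two_pi {x y : ℝ} (hx : x ∈ Icc 0 (2 * π)) (hy : y ∈ Icc 0 (2 * π)) :
    |x - y| ≤ 2 * π := abs_le.2 ⟨by linarith [hx.1, hy.2], by linarith [hx.2, hy.1]⟩

/-- The Douglas-type energy of the density `g` relative to the curve `β`. -/
noncomputable def chordEnergy (β g : ℝ → ℂ) : ENNReal :=
  ∫⁻ a in Ioc 0 (2 * π), ∫⁻ b in Ioc 0 (2 * π),
    ENNReal.ofReal (‖g a - g b‖ ^ 2 / ‖β a - β b‖ ^ 2)

namespace ArcData

variable {β g : ℝ → ℂ} {h₀ : ℝ} {T : ℝ ≃o ℝ} {v : ℝ}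

theorem injOn_Ioc (h : ArcData β g h₀) : InjOn β (Ioc 0 (2 * π)) := by
  intro a ha b hb hab
  have key : ∀ a ∈ Ioc 0 (2 * π), β a = β (2 * π) → a = 2 * π := by
    intro a ha hab
    by_contra hcon
    have h1 := h.inj (x₁ := a) (x₂ := 0) ⟨ha.1.le, lt_of_le_of_ne ha.2 hcon⟩ ⟨le_rfl, two_pi_pos⟩
      (by rw [hab]; have := h.per 0; rwa [zero_add] at this)
    exact ha.1.ne' h1
  by_cases h1 : a = 2 * π
  · rw [h1]; exact (key b hb (by rw [← hab, h1])).symm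
  by_cases h2 : b = 2 * π
  · rw [h2]; exact key a ha (by rw [hab, h2])
  exact h.inj ⟨ha.1.le, lt_of_le_of_ne ha.2 h1⟩ ⟨hb.1.le, lt_of_le_of_ne hb.2 h2⟩ hab

theorem continuous (h : ArcData β g h₀) : Continuous β := by
  rw [continuous_iff_continuousAt]
  intro x
  rw [ContinuousAt, tendsto_iff_norm_sub_tendsto_zero]
  have h1 : Tendsto (fun y => |arcLength g y - arcLength g x|) (𝓝 x) (𝓝 0) := by
    have : Continuous fun y => |arcLength g y - arcLength g x| :=
      (h.continuous_arcLength.sub continuous_const).abs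
    simpa using this.tendsto x
  exact squeeze_zero (fun _ => norm_nonneg _) (fun y => h.norm_sub_le x y) h1

theorem orderIso_zero
    (hT : ∀ x, arcLength g (2 * π) / (2 * π) * T x = arcLength g x) (h : ArcData β g h₀) :
    T 0 = 0 := by
  have h1 := hT 0
  simp only [arcLength, intervalIntegral.integral_same, mul_eq_zero] at h1
  exact h1.resolve_left (div_pos h.arcLength_pos two_pi_pos).ne'

theorem orderIso_add_two_pi
    (hT : ∀ x, arcLength g (2 * π) / (2 * π) * T x = arcLength g x) (h : ArcData β g h₀) (x : ℝ) :
    T (x + 2 * π) = T x + 2 * π := by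
  have hv := div_pos h.arcLength_pos two_pi_pos
  have h1 := hT (x + 2 * π)
  rw [h.arcLength_add_two_pi, ← hT x] at h1
  have h2 : arcLength g (2 * π) = arcLength g (2 * π) / (2 * π) * (2 * π) := by field_simp
  have h3 : arcLength g (2 * π) / (2 * π) * T (x + 2 * π) =
    arcLength g (2 * π) / (2 * π) * (T x + 2 * π) := by rw [mul_add, ← h2, h1]
  exact mul_left_cancel₀ hv.ne' h3

theorem orderIso_two_pi
    (hT : ∀ x, arcLength g (2 * π) / (2 * π) * T x = arcLength g x) (h : ArcData β g h₀) :
    T (2 * π) = 2 * π := by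
  have := h.orderIso_add_two_pi hT 0
  rwa [zero_add, h.orderIso_zero hT, zero_add] at this

theorem symm_zero
    (hT : ∀ x, arcLength g (2 * π) / (2 * π) * T x = arcLength g x) (h : ArcData β g h₀) :
    T.symm 0 = 0 := by
  rw [← h.orderIso_zero hT, T.symm_apply_apply, h.orderIso_zero hT]

theorem symm_two_pi
    (hT : ∀ x, arcLength g (2 * π) / (2 * π) * T x = arcLength g x) (h : ArcData β g h₀) :
    T.symm (2 * π) = 2 * π := by
  conv_lhs => rw [← h.orderIso_two_pi hT, T.symm_apply_apply]

theorem symm_add_two_pi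
    (hT : ∀ x, arcLength g (2 * π) / (2 * π) * T x = arcLength g x) (h : ArcData β g h₀) (x : ℝ) :
    T.symm (x + 2 * π) = T.symm x + 2 * π := by
  rw [OrderIso.symm_apply_eq, h.orderIso_add_two_pi hT, T.apply_symm_apply]

theorem curve_per
    (hT : ∀ x, arcLength g (2 * π) / (2 * π) * T x = arcLength g x) (h : ArcData β g h₀) (x : ℝ) :
    β (T.symm (x + 2 * π)) = β (T.symm x) := by
  rw [h.symm_add_two_pi hT, h.per]

theorem curve_injOn
    (hT : ∀ x, arcLength g (2 * π) / (2 * π) * T x = arcLength g x) (h : ArcData β g h₀) :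
    InjOn (fun x => β (T.symm x)) (Ico 0 (2 * π)) := by
  have h1 : ∀ x ∈ Ico 0 (2 * π), T.symm x ∈ Ico 0 (2 * π) := by
    intro x hx
    refine ⟨?_, ?_⟩
    · rw [← h.symm_zero hT]; exact T.symm.monotone hx.1
    · rw [← h.symm_two_pi hT]; exact T.symm.strictMono hx.2
  exact fun x hx y hy hxy => T.symm.injective (h.inj (h1 x hx) (h1 y hy) hxy)

theorem curve_chordArc
    (hT : ∀ x, arcLength g (2 * π) / (2 * π) * T x = arcLength g x) (h : ArcData β g h₀) :
    ∃ C : ℝ, 0 < C ∧ ∀ θ ∈ Icc (0 : ℝ) (2 * π), ∀ σ ∈ Icc (0 : ℝ) (2 * π),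
      (arcLength g (2 * π) / (2 * π)) * min |θ - σ| (2 * π - |θ - σ|) ≤
        C * ‖β (T.symm θ) - β (T.symm σ)‖ := by
  set ℓ := arcLength g (2 * π) with hℓ
  have hl : 0 < ℓ := h.arcLength_pos
  have hv : 0 < ℓ / (2 * π) := div_pos hl two_pi_pos
  have hb : Continuous β := h.continuous
  obtain ⟨m, hm, hm'⟩ : ∃ m : ℝ, 0 < m ∧ ∀ a ∈ Icc 0 (2 * π), ∀ b ∈ Icc 0 (2 * π),
      h₀ ≤ b - a → b - a ≤ 2 * π - h₀ → m ≤ ‖β b - β a‖ := by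
    set S : Set (ℝ × ℝ) := (Icc 0 (2 * π) ×ˢ Icc 0 (2 * π)) ∩
      {p | h₀ ≤ p.2 - p.1 ∧ p.2 - p.1 ≤ 2 * π - h₀}
    have hS : IsCompact S := by
      refine (isCompact_Icc.prod isCompact_Icc).inter_right ?_
      exact (isClosed_le continuous_const (continuous_snd.sub continuous_fst)).inter
        (isClosed_le (continuous_snd.sub continuous_fst) continuous_const)
    rcases S.eq_empty_or_nonempty with h0 | hne
    · refine ⟨1, one_pos, fun a ha b hb h1 h2 => ?_⟩
      have : (a, b) ∈ S := ⟨⟨ha, hb⟩, h1, h2⟩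
      rw [h0] at this
      exact this.elim
    · obtain ⟨p, hp, hmin⟩ := hS.exists_isMinOn (f := fun p : ℝ × ℝ => ‖β p.2 - β p.1‖) hne
        (by fun_prop)
      refine ⟨‖β p.2 - β p.1‖, ?_, fun a ha b hb h1 h2 =>
        hmin (show (a, b) ∈ S from ⟨⟨ha, hb⟩, h1, h2⟩)⟩
      rw [norm_pos_iff, sub_ne_zero]
      intro he
      obtain ⟨⟨⟨h1, h2⟩, h3, h4⟩, h5, h6⟩ := hp
      have := h.pos
      have h7 := h.injOn_Ioc (x₁ := p.2) (x₂ := p.1 + if p.1 = 0 then 2 * π else 0)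
        ⟨by linarith, h4⟩ (by
          split_ifs with h0
          · rw [h0, zero_add]; exact ⟨two_pi_pos, le_rfl⟩
          · rw [add_zero]; exact ⟨lt_of_le_of_ne h1 (Ne.symm h0), h2⟩) (by
          split_ifs with h0
          · rw [h.per, he]
          · rw [add_zero, he])
      split_ifs at h7 <;> linarith
  refine ⟨max 4 (ℓ / m), lt_max_of_lt_left (by norm_num), ?_⟩
  have key : ∀ θ ∈ Icc (0 : ℝ) (2 * π), ∀ σ ∈ Icc (0 : ℝ) (2 * π), θ < σ →
      (ℓ / (2 * π)) * min (σ - θ) (2 * π - (σ - θ)) ≤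
        max 4 (ℓ / m) * ‖β (T.symm σ) - β (T.symm θ)‖ := by
    intro θ hθ σ hσ hlt
    have hab : T.symm θ < T.symm σ := T.symm.strictMono hlt
    have ha0 : 0 ≤ T.symm θ := by rw [← h.symm_zero hT]; exact T.symm.monotone hθ.1
    have hb0 : T.symm σ ≤ 2 * π := by
      conv_rhs => rw [← h.symm_two_pi hT]
      exact T.symm.monotone hσ.2
    have hsθ : arcLength g (T.symm θ) = ℓ / (2 * π) * θ := by rw [← hT, T.apply_symm_apply]
    have hsσ : arcLength g (T.symm σ) = ℓ / (2 * π) * σ := by rw [← hT, T.apply_symm_apply]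
    rcases le_or_gt (T.symm σ - T.symm θ) h₀ with h1 | h1
    · have h2 := h.comparison (T.symm θ) (T.symm σ - T.symm θ) (sub_pos.2 hab) h1
      rw [add_sub_cancel, ← h.arcLength_sub, hsθ, hsσ, ← mul_sub] at h2
      calc _ ≤ ℓ / (2 * π) * (σ - θ) := by gcongr; exact min_le_left _ _
        _ ≤ _ := h2
        _ ≤ _ := by gcongr; exact le_max_left _ _
    rcases le_or_gt (T.symm σ - T.symm θ) (2 * π - h₀) with h3 | h3
    · have h2 := hm' _ ⟨ha0, hab.le.trans hb0⟩ _ ⟨ha0.trans hab.le, hb0⟩ h1.le h3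
      calc _ ≤ ℓ / (2 * π) * (2 * π) := by
            gcongr; exact (min_le_left _ _).trans (by linarith [hθ.1, hσ.2])
        _ = ℓ / m * m := by field_simp
        _ ≤ _ := by gcongr; exact le_max_right _ _
    · have hu : T.symm θ + 2 * π - T.symm σ < h₀ := by linarith
      rcases eq_or_lt_of_le (show 0 ≤ T.symm θ + 2 * π - T.symm σ by linarith) with h0 | h0
      · have h4 : T.symm σ = T.symm (θ + 2 * π) := by rw [h.symm_add_two_pi hT]; linarith
        have h5 := T.symm.injective h4
        calc _ ≤ ℓ / (2 * π) * 0 := by gcongr; exact (min_le_right _ _).trans (by linarith)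
          _ ≤ _ := by rw [mul_zero]; positivity
      · have h2 := h.comparison (T.symm σ) (T.symm θ + 2 * π - T.symm σ) h0 hu.le
        rw [add_sub_cancel, ← h.arcLength_sub, h.arcLength_add_two_pi, hsθ, hsσ, h.per] at h2
        calc _ ≤ ℓ / (2 * π) * (2 * π - (σ - θ)) := by gcongr; exact min_le_right _ _
          _ = ℓ / (2 * π) * θ + ℓ - ℓ / (2 * π) * σ := by field_simp; ring
          _ ≤ _ := h2
          _ ≤ _ := by rw [norm_sub_rev]; gcongr; exact le_max_left _ _
  intro θ hθ σ hσ
  rcases lt_trichotomy θ σ with h1 | h1 | h1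
  · have := key θ hθ σ hσ h1
    rwa [abs_sub_comm, norm_sub_rev, abs_of_pos (sub_pos.2 h1)]
  · subst h1
    simp only [sub_self, abs_zero, sub_zero, norm_zero, mul_zero]
    rw [min_eq_left two_pi_pos.le, mul_zero]
  · have := key σ hσ θ hθ h1
    rwa [abs_of_pos (sub_pos.2 h1)]

theorem preimage_Ioc
    (hT : ∀ x, arcLength g (2 * π) / (2 * π) * T x = arcLength g x) (h : ArcData β g h₀) :
    T ⁻¹' Ioc 0 (2 * π) = Ioc 0 (2 * π) := by
  rw [OrderIso.preimage_Ioc, h.symm_zero hT, h.symm_two_pi hT]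

theorem ofReal_integrand_le
    (hT : ∀ x, arcLength g (2 * π) / (2 * π) * T x = arcLength g x) (h : ArcData β g h₀)
    {a b : ℝ} (ha : a ∈ Ioc 0 (2 * π)) (hb : b ∈ Ioc 0 (2 * π)) (hga : g a ≠ 0)
    (hgb : g b ≠ 0) :
    ENNReal.ofReal (arcLength g (2 * π) / (2 * π))⁻¹ * ‖g a‖ₑ *
      (ENNReal.ofReal (arcLength g (2 * π) / (2 * π))⁻¹ * ‖g b‖ₑ * ENNReal.ofReal
        (‖((arcLength g (2 * π) / (2 * π) / ‖g a‖ : ℝ) : ℂ) * g a -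
          ((arcLength g (2 * π) / (2 * π) / ‖g b‖ : ℝ) : ℂ) * g b‖ ^ 2 /
        ‖Complex.exp (T a * Complex.I) - Complex.exp (T b * Complex.I)‖ ^ (1 + 2 * (1 / 2) : ℝ))) ≤
    ENNReal.ofReal ((arcLength g (2 * π) / (2 * π) * (π / 2)) ^ 2) *
      ENNReal.ofReal (‖g a - g b‖ ^ 2 / ‖β a - β b‖ ^ 2) := by
  set v := arcLength g (2 * π) / (2 * π) with hv
  have hv0 : 0 < v := div_pos h.arcLength_pos two_pi_pos
  rw [← ofReal_norm, ← ofReal_norm, ← ENNReal.ofReal_mul (by positivity),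
    ← ENNReal.ofReal_mul (by positivity), ← ENNReal.ofReal_mul (by positivity),
    ← ENNReal.ofReal_mul (by positivity), ← ENNReal.ofReal_mul (by positivity)]
  refine ENNReal.ofReal_le_ofReal ?_
  rcases eq_or_ne a b with rfl | hab
  · simp
  have hTa : T a ∈ Icc 0 (2 * π) := by
    have : a ∈ T ⁻¹' Ioc 0 (2 * π) := by rw [h.preimage_Ioc hT]; exact ha
    exact Ioc_subset_Icc_self this
  have hTb : T b ∈ Icc 0 (2 * π) := by
    have : b ∈ T ⁻¹' Ioc 0 (2 * π) := by rw [h.preimage_Ioc hT]; exact hb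
    exact Ioc_subset_Icc_self this
  have h1 := norm_mul_norm_mul_sub_sq_le (g a) (g b) hga hgb hv0
  have h2 := norm_sub_le_min hv0 (h.lipschitzWith hv0 hT) (h.curve_per hT)
    (abs_sub_le_two_pi hTa hTb)
  have h3 := min_le_norm_exp_sub_exp (abs_sub_le_two_pi hTa hTb)
  simp only [T.symm_apply_apply] at h2
  have hβ : 0 < ‖β a - β b‖ := norm_pos_iff.2 (sub_ne_zero.2 fun e => hab (h.injOn_Ioc ha hb e))
  set E := ‖Complex.exp (T a * Complex.I) - Complex.exp (T b * Complex.I)‖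
  have h4 : ‖β a - β b‖ ≤ v * (π / 2) * E := by
    calc _ ≤ _ := h2
      _ ≤ v * (π / 2 * E) := by gcongr
      _ = _ := by ring
  have hE : 0 < E := by
    by_contra hcon
    have : v * (π / 2) * E ≤ 0 := mul_nonpos_of_nonneg_of_nonpos (by positivity) (not_lt.1 hcon)
    linarith
  have h5 : (1 + 2 * (1 / 2) : ℝ) = (2 : ℕ) := by norm_num
  rw [h5, Real.rpow_natCast, ← mul_assoc, ← mul_div_assoc, ← mul_div_assoc,
    div_le_div_iff₀ (by positivity)
    (by positivity)]
  have h6 : ‖β a - β b‖ ^ 2 ≤ (v * (π / 2)) ^ 2 * E ^ 2 := by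
    rw [← mul_pow]; gcongr
  calc _ ≤ ‖g a - g b‖ ^ 2 * ((v * (π / 2)) ^ 2 * E ^ 2) := by gcongr
    _ = _ := by ring

theorem curve_sobolevSeminorm_le
    (hT : ∀ x, arcLength g (2 * π) / (2 * π) * T x = arcLength g x) (h : ArcData β g h₀) :
    sobolevSeminorm (1 / 2) (deriv fun x => β (T.symm x)) ≤
      ENNReal.ofReal ((arcLength g (2 * π) / (2 * π) * (π / 2)) ^ 2) * chordEnergy β g := by
  set v := arcLength g (2 * π) / (2 * π) with hv
  have hv0 : 0 < v := div_pos h.arcLength_pos two_pi_pos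
  have hm : Measurable (deriv fun x => β (T.symm x)) := measurable_deriv _
  have hmu : Measurable fun p : ℝ × ℝ => ENNReal.ofReal
      (‖deriv (fun x => β (T.symm x)) p.1 - deriv (fun x => β (T.symm x)) p.2‖ ^ 2 /
        ‖Complex.exp (p.1 * Complex.I) -
          Complex.exp (p.2 * Complex.I)‖ ^ (1 + 2 * (1 / 2) : ℝ)) := by
    have h1 := hm.comp (measurable_fst : Measurable fun p : ℝ × ℝ => p.1)
    have h2 := hm.comp (measurable_snd : Measurable fun p : ℝ × ℝ => p.2)
    have h3 : Measurable fun p : ℝ × ℝ =>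
      ‖Complex.exp (p.1 * Complex.I) - Complex.exp (p.2 * Complex.I)‖ :=
      (by fun_prop : Continuous fun p : ℝ × ℝ =>
      ‖Complex.exp (p.1 * Complex.I) - Complex.exp (p.2 * Complex.I)‖).measurable
    exact (((h1.sub h2).norm.pow_const 2).div (h3.pow_const _)).ennreal_ofReal
  unfold sobolevSeminorm chordEnergy
  rw [h.lintegral_comp hv0 hT _ measurableSet_Ioc hmu.lintegral_prod_right', h.preimage_Ioc hT,
    ← lintegral_const_mul' _ _ ENNReal.ofReal_ne_top]
  have hae := h.ae_hasDerivAt hv0 hT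
  refine lintegral_mono_ae ?_
  filter_upwards [ae_restrict_of_ae hae, ae_restrict_of_ae h.ne_zero,
    ae_restrict_mem measurableSet_Ioc] with a ha1 ha2 ha3
  have hmu' := hmu.comp (measurable_prodMk_left (x := T a))
  have h1 := h.lintegral_comp hv0 hT _ (measurableSet_Ioc (a := 0) (b := 2 * π)) hmu'
  simp only [Function.comp_def] at h1
  rw [h1, h.preimage_Ioc hT,
    ← lintegral_const_mul' _ _ ENNReal.ofReal_ne_top,
    ← lintegral_const_mul' _ _ (ENNReal.mul_ne_top ENNReal.ofReal_ne_top enorm_ne_top)]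
  refine lintegral_mono_ae ?_
  filter_upwards [ae_restrict_of_ae hae, ae_restrict_of_ae h.ne_zero,
    ae_restrict_mem measurableSet_Ioc] with b hb1 hb2 hb3
  rw [ha1.deriv, hb1.deriv]
  exact h.ofReal_integrand_le hT ha3 hb3 ha2 hb2

end ArcData

theorem lintegral_Ioc_add (f : ℝ → ENNReal) (a b c : ℝ) :
    ∫⁻ x in Ioc a b, f (x + c) = ∫⁻ x in Ioc (a + c) (b + c), f x := by
  have h := (measurePreserving_add_right volume c).setLIntegral_comp_preimage_emb
    (MeasurableEquiv.addRight c).measurableEmbedding f (Ioc (a + c) (b + c))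
  simpa using h

theorem lintegral_Ico_neg (f : ℝ → ENNReal) (a b : ℝ) :
    ∫⁻ x in Ioc a b, f (-x) = ∫⁻ x in Ico (-b) (-a), f x := by
  have h := (Measure.measurePreserving_neg (volume : Measure ℝ)).setLIntegral_comp_preimage_emb
    (MeasurableEquiv.neg ℝ).measurableEmbedding f (Ico (-b) (-a))
  simpa using h

theorem lintegral_periodic_kernel {K : ℝ → ℝ → ENNReal} (hK : Measurable fun p : ℝ × ℝ => K p.1 p.2)
    (hp : ∀ a b, K a (b + 2 * π) = K a b) (hs : ∀ a b, K a b = K b a) :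
    ∫⁻ a in Ioc 0 (2 * π), ∫⁻ b in Ioc 0 (2 * π), K a b =
      2 * ∫⁻ u in Ioc 0 π, ∫⁻ a in Ioc 0 (2 * π), K a (a + u) := by
  have hp' : ∀ a b, K (a + 2 * π) b = K a b := fun a b => by rw [hs, hp, hs]
  set G : ℝ → ENNReal := fun u => ∫⁻ a in Ioc 0 (2 * π), K a (a + u) with hG
  have h1 : ∀ a, ∫⁻ b in Ioc 0 (2 * π), K a b = ∫⁻ u in Ioc (-π) π, K a (a + u) := by
    intro a
    have h2 := setLIntegral_Ioc_of_periodic (g := K a) (hp a) 0 (-π + a)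
    have h3 := lintegral_Ioc_add (K a) (-π) π a
    rw [zero_add, show -π + a + 2 * π = π + a by ring] at h2
    rw [h2, ← h3]
    simp only [add_comm]
  have hneg : ∀ u, G (-u) = G u := by
    intro u
    have h2 : ∀ a, K a (a + -u) = (fun x => K x (x + u)) (a + -u) := by
      intro a; simp only; rw [hs]; congr 1; ring
    simp only [hG]
    rw [lintegral_congr h2, lintegral_Ioc_add (fun x => K x (x + u))]
    have h3 := setLIntegral_Ioc_of_periodic (g := fun x => K x (x + u)) (fun x => by
      rw [hp', add_right_comm, hp]) 0 (0 + -u)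
    rw [zero_add] at h3
    rw [h3]; congr 3; ring
  calc _ = ∫⁻ a in Ioc 0 (2 * π), ∫⁻ u in Ioc (-π) π, K a (a + u) :=
        lintegral_congr fun a => h1 a
    _ = ∫⁻ u in Ioc (-π) π, G u := by
        rw [lintegral_lintegral_swap]
        have h2 : Measurable fun p : ℝ × ℝ => (p.1, p.1 + p.2) := by fun_prop
        exact (hK.comp h2).aemeasurable
    _ = ∫⁻ u in Ioc (-π) 0 ∪ Ioc 0 π, G u := by
        rw [Ioc_union_Ioc_eq_Ioc (by linarith [pi_pos]) pi_pos.le]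
    _ = 2 * ∫⁻ u in Ioc 0 π, G u := by
        rw [lintegral_union measurableSet_Ioc
          (by rw [Set.disjoint_left]; intro x hx hx'; exact absurd hx.2 (not_le.2 hx'.1)), two_mul]
        congr 1
        have h4 := lintegral_Ico_neg G 0 π
        rw [neg_zero] at h4
        rw [setLIntegral_congr Ioo_ae_eq_Ioc.symm, setLIntegral_congr Ioo_ae_eq_Ico, ← h4]
        exact lintegral_congr hneg

theorem exists_norm_sub_ge_of_injOn {β : ℝ → ℂ} (hc : Continuous β)
    (hp : ∀ x, β (x + 2 * π) = β x) (hi : InjOn β (Ico 0 (2 * π))) {h : ℝ} (hh : 0 < h) :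
    ∃ m : ℝ, 0 < m ∧ ∀ a, ∀ u ∈ Icc h (2 * π - h), m ≤ ‖β (a + u) - β a‖ := by
  rcases (Icc h (2 * π - h)).eq_empty_or_nonempty with he | hne
  · exact ⟨1, one_pos, fun a u hu => by rw [he] at hu; exact hu.elim⟩
  obtain ⟨p, hpm, hpmin⟩ := ((isCompact_Icc (a := (0 : ℝ)) (b := 2 * π)).prod
    (isCompact_Icc (a := h) (b := 2 * π - h))).exists_isMinOn
    ((nonempty_Icc.2 two_pi_pos.le).prod hne)
    (f := fun p : ℝ × ℝ => ‖β (p.1 + p.2) - β p.1‖) (by fun_prop)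
  refine ⟨‖β (p.1 + p.2) - β p.1‖, ?_, fun a u hu => ?_⟩
  · rw [norm_pos_iff, sub_ne_zero]
    intro heq
    obtain ⟨n, hn⟩ := exists_int_of_eq hp hi heq
    have h1 : p.2 = n * (2 * π) := by linarith
    have h2 := hpm.2.1
    have h3 := hpm.2.2
    rw [h1] at h2 h3
    have h4 : (0 : ℝ) < n := by
      by_contra hcon
      have := mul_nonpos_of_nonpos_of_nonneg (not_lt.1 hcon) two_pi_pos.le
      linarith
    have h5 : (1 : ℝ) ≤ n := by exact_mod_cast (by exact_mod_cast h4 : (0 : ℤ) < n)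
    have := mul_le_mul_of_nonneg_right h5 two_pi_pos.le
    linarith
  · have hper : Function.Periodic (fun a => ‖β (a + u) - β a‖) (2 * π) := fun a => by
      change ‖β (a + 2 * π + u) - β (a + 2 * π)‖ = _
      rw [add_right_comm, hp, hp]
    obtain ⟨a', ha', hE⟩ := hper.exists_mem_Ico₀ two_pi_pos a
    rw [show ‖β (a + u) - β a‖ = ‖β (a' + u) - β a'‖ from hE]
    exact hpmin (a := (a', u)) ⟨⟨ha'.1, ha'.2.le⟩, hu⟩

/-- The energy of `L'` along the horizontal period at height `t`. -/
noncomputable def horizontalEnergy (L : ℂ → ℂ) (t : ℝ) : ENNReal :=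
  ∫⁻ x in Ioc 0 (2 * π), ‖deriv L (x + t * Complex.I)‖ₑ ^ 2

theorem measurable_horizontalEnergy (L : ℂ → ℂ) : Measurable (horizontalEnergy L) :=
  Measurable.lintegral_prod_left' (measurable_enorm_deriv_sq L)

theorem lintegral_horizontalEnergy {Ψ L : ℂ → ℂ} (hL : IsLift Ψ L) (h : ℝ) :
    ∫⁻ t in Ioo 0 h, horizontalEnergy L t = stripEnergy L h := by
  unfold horizontalEnergy
  rw [← lintegral_lintegral_strip hL 0 h, zero_add, lintegral_lintegral_swap]
  exact ((measurable_enorm_deriv_sq L).comp measurable_swap).aemeasurable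

theorem lintegral_radialEnergy {Ψ L : ℂ → ℂ} (hL : IsLift Ψ L) (a u : ℝ) :
    ∫⁻ x in Ioc a (a + 2 * π), radialEnergy L x u =
      ∫⁻ t in Ioo 0 u, ENNReal.ofReal (t ^ (1 / 2 : ℝ)) * horizontalEnergy L t := by
  have hm := measurable_enorm_deriv_sq L
  unfold radialEnergy
  rw [lintegral_lintegral_swap (by fun_prop)]
  refine setLIntegral_congr_fun measurableSet_Ioo fun t ht => ?_
  have h2 : Measurable fun x : ℝ => ‖deriv L (x + t * Complex.I)‖ₑ ^ 2 := by
    have := (measurable_deriv L).comp (g := deriv L) (f := fun x : ℝ => (x + t * Complex.I : ℂ))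
      (by fun_prop)
    exact this.enorm.pow_const 2
  rw [lintegral_const_mul _ h2]
  congr 1
  have h3 := setLIntegral_Ioc_of_periodic (g := fun x : ℝ => ‖deriv L (x + t * Complex.I)‖ₑ ^ 2)
    (fun x => by
      rw [← hL.perL (x + t * Complex.I) (by simpa using ht.1)]
      push_cast; ring_nf) a 0
  rw [zero_add] at h3
  exact h3

theorem IsLift.continuousOn_deriv {Ψ L : ℂ → ℂ} (hL : IsLift Ψ L) :
    ContinuousOn (deriv L) {ζ | 0 < ζ.im} :=
  (DifferentiableOn.deriv (fun ζ hζ => (hL.diff ζ hζ).differentiableAt.differentiableWithinAt)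
    isOpen_upper).continuousOn

namespace FiniteLift

variable {Ψ L : ℂ → ℂ} {y₀ : ℝ}

theorem enorm_horizontal_sub_sq_le (h : FiniteLift Ψ L y₀) (a : ℝ) {u : ℝ} (hu : 0 < u)
    (huy : u ≤ y₀) : ‖deriv Ψ ((a + u : ℝ) + u * Complex.I) - deriv Ψ (a + u * Complex.I)‖ₑ ^ 2 ≤
      4 * ‖deriv Ψ (a + u * Complex.I)‖ₑ ^ 2 * ENNReal.ofReal u *
        ∫⁻ x in Ioc a (a + u), ‖deriv L (x + u * Complex.I)‖ₑ ^ 2 := by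
  have hau : a ≤ a + u := by linarith
  have hd : ∀ x : ℝ, HasDerivAt (fun x : ℝ => deriv Ψ (x + u * Complex.I))
      (deriv L (x + u * Complex.I) * deriv Ψ (x + u * Complex.I)) x := fun x =>
    hasDerivAt_horizontal (h.lift.hasDerivAt_deriv (by simpa using hu))
  have hc : Continuous fun x : ℝ => deriv L (x + u * Complex.I) * deriv Ψ (x + u * Complex.I) :=
    (continuousOn_horizontal h.lift.continuousOn_deriv hu).mul
      (continuousOn_horizontal h.lift.continuousOn_deriv_map hu)
  have h1 := intervalIntegral.integral_eq_sub_of_hasDerivAt (fun x _ => hd x)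
    (hc.intervalIntegrable a (a + u))
  rw [← h1, intervalIntegral.integral_of_le hau]
  have hD : ∀ x ∈ Ioc a (a + u), ‖deriv Ψ (x + u * Complex.I)‖ₑ ≤
      2 * ‖deriv Ψ (a + u * Complex.I)‖ₑ := by
    intro x hx
    have h2 := norm_deriv_sub_le_of_horizontal h.lift h.bloch (by norm_num) hu huy
      (abs_le.2 ⟨by linarith [hx.1], by linarith [hx.2]⟩ : |x - a| ≤ u)
    have h3 := norm_sub_norm_le (deriv Ψ (x + u * Complex.I)) (deriv Ψ (a + u * Complex.I))
    have h4 := norm_nonneg (deriv Ψ (a + u * Complex.I))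
    rw [← ofReal_norm, ← ofReal_norm, ← ENNReal.ofReal_ofNat 2, ← ENNReal.ofReal_mul (by norm_num)]
    exact ENNReal.ofReal_le_ofReal (by linarith)
  have hm : Measurable fun x : ℝ => deriv L (x + u * Complex.I) :=
    (measurable_deriv L).comp (by fun_prop)
  calc _ ≤ (∫⁻ x in Ioc a (a + u), ‖deriv L (x + u * Complex.I)‖ₑ *
        (2 * ‖deriv Ψ (a + u * Complex.I)‖ₑ)) ^ 2 := by
        gcongr
        refine (enorm_integral_le_lintegral_enorm _).trans ?_
        refine setLIntegral_mono' measurableSet_Ioc fun x hx => ?_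
        rw [enorm_mul]
        gcongr
        exact hD x hx
    _ ≤ _ := sq_lintegral_mul_le (by fun_prop) (by fun_prop)
    _ = _ := by
        rw [setLIntegral_const, Real.volume_Ioc, add_sub_cancel_left]
        ring

theorem ae_chord_le (h : FiniteLift Ψ L y₀) {u : ℝ} (hu : 0 < u) (huy : u ≤ y₀)
    (hcomp : ∀ a : ℝ, u * ‖deriv Ψ (a + u * Complex.I)‖ ≤ 2 * ‖bdryVal Ψ (a + u) - bdryVal Ψ a‖) :
    ∀ᵐ a, ENNReal.ofReal (‖bdryDeriv Ψ a - bdryDeriv Ψ (a + u)‖ ^ 2 /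
        ‖bdryVal Ψ a - bdryVal Ψ (a + u)‖ ^ 2) ≤
      ENNReal.ofReal (4 * u ^ (-2 : ℝ)) *
        (8 * ENNReal.ofReal (u ^ (1 / 2 : ℝ)) * radialEnergy L a u +
          16 * ENNReal.ofReal u * (∫⁻ x in Ioc a (a + u), ‖deriv L (x + u * Complex.I)‖ₑ ^ 2) +
          64 * ENNReal.ofReal (u ^ (1 / 2 : ℝ)) * radialEnergy L (a + u) u) := by
  have h0 := h.ae_enorm_bdryDeriv_sub_sq_le
  filter_upwards [h0, (measurePreserving_add_right volume u).quasiMeasurePreserving.ae h0]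
    with a ha hau
  have ha := ha u hu huy
  have hau := hau u hu huy
  set D := ‖deriv Ψ (a + u * Complex.I)‖ with hDdef
  have hD0 : 0 < D := norm_pos_iff.2 (h.lift.deriv_ne_zero (by simpa using hu))
  have hDe : ‖deriv Ψ (a + u * Complex.I)‖ₑ = ENNReal.ofReal D := by rw [ofReal_norm]
  have hD2 : ‖deriv Ψ ((a + u : ℝ) + u * Complex.I)‖ₑ ≤ 2 * ENNReal.ofReal D := by
    have h2 := norm_deriv_sub_le_of_horizontal h.lift h.bloch (by norm_num) hu huy
      (by rw [add_sub_cancel_left, abs_of_pos hu] : |(a + u) - a| ≤ u)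
    have h3 := norm_sub_norm_le (deriv Ψ ((a + u : ℝ) + u * Complex.I))
      (deriv Ψ (a + u * Complex.I))
    rw [← ofReal_norm, ← ENNReal.ofReal_ofNat 2, ← ENNReal.ofReal_mul (by norm_num)]
    exact ENNReal.ofReal_le_ofReal (by linarith)
  have hhor := h.enorm_horizontal_sub_sq_le a hu huy
  rw [hDe] at ha hhor
  set P := bdryDeriv Ψ a
  set Q := bdryDeriv Ψ (a + u)
  set p := deriv Ψ (a + u * Complex.I)
  set q := deriv Ψ ((a + u : ℝ) + u * Complex.I)
  have hnum : ‖P - Q‖ₑ ^ 2 ≤ ENNReal.ofReal D ^ 2 *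
        (8 * ENNReal.ofReal (u ^ (1 / 2 : ℝ)) * radialEnergy L a u +
          16 * ENNReal.ofReal u * (∫⁻ x in Ioc a (a + u), ‖deriv L (x + u * Complex.I)‖ₑ ^ 2) +
          64 * ENNReal.ofReal (u ^ (1 / 2 : ℝ)) * radialEnergy L (a + u) u) := by
    have e1 : P - Q = (P - p) + ((p - q) + (q - Q)) := by ring
    have e2 : ‖p - q‖ₑ = ‖q - p‖ₑ := enorm_sub_rev _ _
    have e3 : ‖q - Q‖ₑ = ‖Q - q‖ₑ := enorm_sub_rev _ _
    calc ‖P - Q‖ₑ ^ 2 ≤ 2 * ‖P - p‖ₑ ^ 2 + 2 * (2 * ‖q - p‖ₑ ^ 2 + 2 * ‖Q - q‖ₑ ^ 2) := by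
          rw [e1, ← e2, ← e3]
          exact (enorm_add_sq_le _ _).trans (by gcongr; exact enorm_add_sq_le _ _)
      _ ≤ 2 * (4 * ENNReal.ofReal (u ^ (1 / 2 : ℝ)) * radialEnergy L a u * ENNReal.ofReal D ^ 2) +
          2 * (2 * (4 * ENNReal.ofReal D ^ 2 * ENNReal.ofReal u *
            ∫⁻ x in Ioc a (a + u), ‖deriv L (x + u * Complex.I)‖ₑ ^ 2) +
          2 * (4 * ENNReal.ofReal (u ^ (1 / 2 : ℝ)) * radialEnergy L (a + u) u *
            (2 * ENNReal.ofReal D) ^ 2)) := by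
          gcongr
          refine hau.trans ?_
          gcongr
      _ = _ := by ring
  have hden : ENNReal.ofReal (‖P - Q‖ ^ 2 / ‖bdryVal Ψ a - bdryVal Ψ (a + u)‖ ^ 2) ≤
      ENNReal.ofReal (4 * u ^ (-2 : ℝ)) * (‖P - Q‖ₑ ^ 2 * (ENNReal.ofReal D ^ 2)⁻¹) := by
    rw [← ofReal_norm_sq_eq, ← ENNReal.ofReal_pow hD0.le,
      ← ENNReal.ofReal_inv_of_pos (by positivity),
      ← ENNReal.ofReal_mul (by positivity), ← ENNReal.ofReal_mul (by positivity)]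
    apply ENNReal.ofReal_le_ofReal
    have h5 := hcomp a
    rw [norm_sub_rev (bdryVal Ψ a)]
    have h6 : 0 < u * D := by positivity
    have h7 : (u * D) ^ 2 ≤ (2 * ‖bdryVal Ψ (a + u) - bdryVal Ψ a‖) ^ 2 :=
      pow_le_pow_left₀ h6.le h5 2
    calc _ ≤ ‖P - Q‖ ^ 2 / ((u * D) ^ 2 / 4) := by
          gcongr
          linarith
      _ = _ := by
          rw [show (-2 : ℝ) = -(2 : ℕ) by norm_num, Real.rpow_neg hu.le, Real.rpow_natCast]
          field_simp
  refine hden.trans ?_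
  gcongr
  rw [← div_eq_mul_inv]
  refine ENNReal.div_le_of_le_mul ?_
  rwa [mul_comm] at hnum

end FiniteLift

theorem lintegral_rpow_neg_three_halves {t : ℝ} (ht : 0 < t) :
    ∫⁻ u in Ioi t, ENNReal.ofReal (u ^ (-(3 / 2) : ℝ)) =
      ENNReal.ofReal (2 * t ^ (-(1 / 2) : ℝ)) := by
  rw [← ofReal_integral_eq_lintegral_ofReal (integrableOn_Ioi_rpow_of_lt (by norm_num) ht)]
  · rw [integral_Ioi_rpow_of_lt (by norm_num) ht]
    congr 1
    rw [show (-(3 / 2) : ℝ) + 1 = -(1 / 2) by norm_num]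
    ring
  · exact (ae_restrict_mem measurableSet_Ioi).mono fun u hu => by
      have : 0 < u := ht.trans hu
      positivity

theorem lintegral_hardy_le {e : ℝ → ENNReal} (he : Measurable e) (h : ℝ) :
    ∫⁻ u in Ioc 0 h, ENNReal.ofReal (u ^ (-(3 / 2) : ℝ)) *
      ∫⁻ t in Ioo 0 u, ENNReal.ofReal (t ^ (1 / 2 : ℝ)) * e t ≤ 2 * ∫⁻ t in Ioo 0 h, e t := by
  have h1 : ∀ u ∈ Ioc 0 h, ENNReal.ofReal (u ^ (-(3 / 2) : ℝ)) *
      ∫⁻ t in Ioo 0 u, ENNReal.ofReal (t ^ (1 / 2 : ℝ)) * e t =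
      ∫⁻ t in Ioo 0 h, (Ioi t).indicator (fun u => ENNReal.ofReal (u ^ (-(3 / 2) : ℝ))) u *
        (ENNReal.ofReal (t ^ (1 / 2 : ℝ)) * e t) := by
    intro u hu
    rw [← lintegral_const_mul _ (by fun_prop), ← lintegral_indicator measurableSet_Ioo,
      ← lintegral_indicator measurableSet_Ioo]
    refine lintegral_congr fun t => ?_
    by_cases htu : t ∈ Ioo 0 u
    · rw [indicator_of_mem htu,
        indicator_of_mem (show t ∈ Ioo 0 h from ⟨htu.1, htu.2.trans_le hu.2⟩),
        indicator_of_mem (show u ∈ Ioi t from htu.2)]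
    · rw [indicator_of_notMem htu]
      by_cases hth : t ∈ Ioo 0 h
      · rw [indicator_of_mem hth, indicator_of_notMem, zero_mul]
        exact fun hc => htu ⟨hth.1, hc⟩
      · rw [indicator_of_notMem hth]
  rw [setLIntegral_congr_fun measurableSet_Ioc h1, lintegral_lintegral_swap,
    ← lintegral_const_mul _ he]
  · refine setLIntegral_mono' measurableSet_Ioo fun t ht => ?_
    rw [lintegral_mul_const _ ((by fun_prop : Measurable fun u : ℝ =>
      ENNReal.ofReal (u ^ (-(3 / 2) : ℝ))).indicator measurableSet_Ioi)]
    calc _ ≤ ENNReal.ofReal (2 * t ^ (-(1 / 2) : ℝ)) *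
        (ENNReal.ofReal (t ^ (1 / 2 : ℝ)) * e t) := by
          gcongr
          rw [← lintegral_rpow_neg_three_halves ht.1, ← lintegral_indicator measurableSet_Ioi]
          exact setLIntegral_le_lintegral _ _
      _ = 2 * e t := by
          have := ht.1
          rw [← mul_assoc, ← ENNReal.ofReal_mul (by positivity), mul_assoc (2 : ℝ),
            ← Real.rpow_add this]
          norm_num
  · have hs : MeasurableSet {p : ℝ × ℝ | p.2 < p.1} :=
      measurableSet_lt measurable_snd measurable_fst
    have hm : Measurable ({p : ℝ × ℝ | p.2 < p.1}.indicator fun p : ℝ × ℝ =>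
        ENNReal.ofReal (p.1 ^ (-(3 / 2) : ℝ))) := Measurable.indicator (by fun_prop) hs
    exact (hm.mul (by fun_prop : Measurable fun p : ℝ × ℝ =>
      ENNReal.ofReal (p.2 ^ (1 / 2 : ℝ)) * e p.2)).aemeasurable

namespace FiniteLift

variable {Ψ L : ℂ → ℂ} {y₀ : ℝ}

theorem lintegral_horizontal_window (h : FiniteLift Ψ L y₀) {u : ℝ} (hu : 0 < u) :
    ∫⁻ a in Ioc 0 (2 * π), ∫⁻ x in Ioc a (a + u), ‖deriv L (x + u * Complex.I)‖ₑ ^ 2 =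
      ENNReal.ofReal u * horizontalEnergy L u := by
  set G : ℝ → ENNReal := fun x => ‖deriv L (x + u * Complex.I)‖ₑ ^ 2 with hG
  have hGm : Measurable G :=
    ((measurable_deriv L).comp (g := deriv L) (f := fun x : ℝ => (x + u * Complex.I : ℂ))
      (by fun_prop)).enorm.pow_const 2
  have hGp : ∀ x, G (x + 2 * π) = G x := fun x => by
    simp only [hG]
    rw [← h.lift.perL (x + u * Complex.I) (by simpa using hu)]
    push_cast; ring_nf
  have h1 : ∀ a, ∫⁻ x in Ioc a (a + u), G x = ∫⁻ s in Ioc 0 u, G (a + s) := fun a => by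
    have := lintegral_Ioc_add G 0 u a
    rw [zero_add, add_comm u a] at this
    rw [← this]
    simp only [add_comm]
  simp_rw [h1]
  rw [lintegral_lintegral_swap]
  · have h2 : ∀ s, ∫⁻ a in Ioc 0 (2 * π), G (a + s) = horizontalEnergy L u := fun s => by
      rw [lintegral_Ioc_add, add_comm (2 * π), zero_add, setLIntegral_Ioc_of_periodic hGp s 0,
        zero_add]
      rfl
    simp_rw [h2]
    rw [setLIntegral_const, Real.volume_Ioc, sub_zero, mul_comm]
  · exact (hGm.comp (by fun_prop : Measurable fun p : ℝ × ℝ => p.1 + p.2)).aemeasurable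

theorem lintegral_chord_le (h : FiniteLift Ψ L y₀) {u : ℝ} (hu : 0 < u) (huy : u ≤ y₀)
    (hcomp : ∀ a : ℝ, u * ‖deriv Ψ (a + u * Complex.I)‖ ≤ 2 * ‖bdryVal Ψ (a + u) - bdryVal Ψ a‖) :
    ∫⁻ a in Ioc 0 (2 * π), ENNReal.ofReal (‖bdryDeriv Ψ a - bdryDeriv Ψ (a + u)‖ ^ 2 /
        ‖bdryVal Ψ a - bdryVal Ψ (a + u)‖ ^ 2) ≤
      288 * (ENNReal.ofReal (u ^ (-(3 / 2) : ℝ)) *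
        ∫⁻ t in Ioo 0 u, ENNReal.ofReal (t ^ (1 / 2 : ℝ)) * horizontalEnergy L t) +
      64 * horizontalEnergy L u := by
  have hR : ∀ c, ∫⁻ a in Ioc 0 (2 * π), radialEnergy L (a + c) u =
      ∫⁻ t in Ioo 0 u, ENNReal.ofReal (t ^ (1 / 2 : ℝ)) * horizontalEnergy L t := fun c => by
    rw [lintegral_Ioc_add (fun x => radialEnergy L x u), add_comm (2 * π), zero_add,
      lintegral_radialEnergy h.lift]
  have hR0 := hR 0
  simp only [add_zero] at hR0
  have hm := measurable_radialEnergy L u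
  have hm2 : Measurable fun a : ℝ => ∫⁻ x in Ioc a (a + u), ‖deriv L (x + u * Complex.I)‖ₑ ^ 2 := by
    have h1 : ∀ a : ℝ, ∫⁻ x in Ioc a (a + u), ‖deriv L (x + u * Complex.I)‖ₑ ^ 2 =
        ∫⁻ s in Ioc 0 u, ‖deriv L ((s + a : ℝ) + u * Complex.I)‖ₑ ^ 2 := fun a => by
      have := lintegral_Ioc_add (fun x : ℝ => ‖deriv L (x + u * Complex.I)‖ₑ ^ 2) 0 u a
      rw [zero_add, add_comm u a] at this
      rw [← this]
    simp_rw [h1]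
    exact Measurable.lintegral_prod_left' (f := fun p : ℝ × ℝ =>
      ‖deriv L ((p.1 + p.2 : ℝ) + u * Complex.I)‖ₑ ^ 2)
      (((measurable_deriv L).comp (by fun_prop)).enorm.pow_const 2)
  refine (lintegral_mono_ae (ae_restrict_of_ae (h.ae_chord_le hu huy hcomp))).trans (le_of_eq ?_)
  rw [lintegral_const_mul' _ _ ENNReal.ofReal_ne_top, lintegral_add_left (by fun_prop),
    lintegral_add_left (by fun_prop), lintegral_const_mul _ (by fun_prop),
    lintegral_const_mul _ (by fun_prop), lintegral_const_mul _ (by fun_prop), hR u, hR0,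
    h.lintegral_horizontal_window hu]
  set X := ∫⁻ t in Ioo 0 u, ENNReal.ofReal (t ^ (1 / 2 : ℝ)) * horizontalEnergy L t
  set Y := horizontalEnergy L u
  have e1 : ENNReal.ofReal (4 * u ^ (-2 : ℝ)) * ENNReal.ofReal (u ^ (1 / 2 : ℝ)) =
      4 * ENNReal.ofReal (u ^ (-(3 / 2) : ℝ)) := by
    rw [← ENNReal.ofReal_mul (by positivity), mul_assoc, ← Real.rpow_add hu,
      ENNReal.ofReal_mul (by norm_num)]
    norm_num
  have e2 : ENNReal.ofReal (4 * u ^ (-2 : ℝ)) * ENNReal.ofReal u * ENNReal.ofReal u = 4 := by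
    rw [← ENNReal.ofReal_mul (by positivity), ← ENNReal.ofReal_mul (by positivity),
      show (-2 : ℝ) = -(2 : ℕ) by norm_num, Real.rpow_neg hu.le, Real.rpow_natCast]
    rw [show 4 * (u ^ 2)⁻¹ * u * u = 4 by field_simp]
    norm_num
  calc _ = 72 * (ENNReal.ofReal (4 * u ^ (-2 : ℝ)) * ENNReal.ofReal (u ^ (1 / 2 : ℝ))) * X +
      16 * (ENNReal.ofReal (4 * u ^ (-2 : ℝ)) * ENNReal.ofReal u * ENNReal.ofReal u) * Y := by ring
    _ = _ := by rw [e1, e2]; ring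

theorem chordEnergy_lt_top (h : FiniteLift Ψ L y₀) (hi : InjOn (bdryVal Ψ) (Ico 0 (2 * π))) :
    chordEnergy (bdryVal Ψ) (bdryDeriv Ψ) < ⊤ := by
  obtain ⟨h₀, hh0, hhy, H⟩ := h.exists_comparison
  have hhπ : h₀ < π := by linarith [h.height.2, pi_gt_three]
  obtain ⟨m, hm, hm'⟩ := exists_norm_sub_ge_of_injOn h.continuous_bdryVal h.bdryVal_per hi hh0
  have hg := measurable_bdryDeriv Ψ
  have hb := h.continuous_bdryVal.measurable
  unfold chordEnergy
  rw [lintegral_periodic_kernel (K := fun a b => ENNReal.ofReal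
    (‖bdryDeriv Ψ a - bdryDeriv Ψ b‖ ^ 2 / ‖bdryVal Ψ a - bdryVal Ψ b‖ ^ 2)) (by fun_prop)
    (fun a b => by rw [h.bdryVal_per, bdryDeriv_per h.lift])
    (fun a b => by rw [norm_sub_rev, norm_sub_rev (bdryVal Ψ a)]),
    ← Ioc_union_Ioc_eq_Ioc hh0.le hhπ.le, lintegral_union measurableSet_Ioc
      (by rw [Set.disjoint_left]; intro x hx hx'; exact absurd hx.2 (not_le.2 hx'.1))]
  refine ENNReal.mul_lt_top (by simp) (ENNReal.add_lt_top.2 ⟨?_, ?_⟩)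
  · have he := measurable_horizontalEnergy L
    have h1 : stripEnergy L h₀ < ⊤ := by
      refine lt_of_le_of_lt ?_ h.energy
      rw [← lintegral_horizontalEnergy h.lift, ← lintegral_horizontalEnergy h.lift]
      exact lintegral_mono_set (Ioo_subset_Ioo_right (by linarith [h.height.2]))
    calc _ ≤ ∫⁻ u in Ioc 0 h₀, (288 * (ENNReal.ofReal (u ^ (-(3 / 2) : ℝ)) *
          ∫⁻ t in Ioo 0 u, ENNReal.ofReal (t ^ (1 / 2 : ℝ)) * horizontalEnergy L t) +
          64 * horizontalEnergy L u) := setLIntegral_mono' measurableSet_Ioc fun u hu =>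
            h.lintegral_chord_le hu.1 (hu.2.trans hhy) fun a => (H a u hu.1 hu.2).1
      _ = 288 * (∫⁻ u in Ioc 0 h₀, ENNReal.ofReal (u ^ (-(3 / 2) : ℝ)) *
          ∫⁻ t in Ioo 0 u, ENNReal.ofReal (t ^ (1 / 2 : ℝ)) * horizontalEnergy L t) +
          64 * stripEnergy L h₀ := by
          rw [lintegral_add_right _ (by fun_prop), lintegral_const_mul' _ _ (by simp),
            lintegral_const_mul' _ _ (by simp), ← lintegral_horizontalEnergy h.lift,
            ← setLIntegral_congr (f := horizontalEnergy L) Ioo_ae_eq_Ioc]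
      _ ≤ 288 * (2 * stripEnergy L h₀) + 64 * stripEnergy L h₀ := by
          gcongr
          rw [← lintegral_horizontalEnergy h.lift]
          exact lintegral_hardy_le he h₀
      _ < ⊤ := by
          have := h1.ne
          exact ENNReal.add_lt_top.2
            ⟨ENNReal.mul_lt_top (by simp) (ENNReal.mul_lt_top (by simp) h1),
            ENNReal.mul_lt_top (by simp) h1⟩
  · set S := ∫⁻ x in Ioc 0 (2 * π), ‖bdryDeriv Ψ x‖ₑ ^ 2 with hS
    have hSt : S < ⊤ := by
      have := h.lintegral_bdryDeriv_sq_lt_top 0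
      rwa [zero_add] at this
    have hin : ∀ u ∈ Ioc h₀ π, ∫⁻ a in Ioc 0 (2 * π), ENNReal.ofReal
        (‖bdryDeriv Ψ a - bdryDeriv Ψ (a + u)‖ ^ 2 / ‖bdryVal Ψ a - bdryVal Ψ (a + u)‖ ^ 2) ≤
        ENNReal.ofReal (m ^ 2)⁻¹ * (2 * S + 2 * S) := by
      intro u hu
      have hper := setLIntegral_Ioc_of_periodic (g := fun x => ‖bdryDeriv Ψ x‖ₑ ^ 2)
        (fun x => by rw [bdryDeriv_per h.lift]) u 0
      have hsh := lintegral_Ioc_add (fun x => ‖bdryDeriv Ψ x‖ₑ ^ 2) 0 (2 * π) u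
      rw [zero_add, add_comm (2 * π), hper, zero_add] at hsh
      calc _ ≤ ∫⁻ a in Ioc 0 (2 * π), ENNReal.ofReal (m ^ 2)⁻¹ *
            (2 * ‖bdryDeriv Ψ a‖ₑ ^ 2 + 2 * ‖bdryDeriv Ψ (a + u)‖ₑ ^ 2) := by
            refine lintegral_mono fun a => ?_
            have h1 := hm' a u ⟨hu.1.le, by linarith [hu.2]⟩
            rw [norm_sub_rev] at h1
            calc _ ≤ ENNReal.ofReal ((m ^ 2)⁻¹ * ‖bdryDeriv Ψ a - bdryDeriv Ψ (a + u)‖ ^ 2) := by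
                  apply ENNReal.ofReal_le_ofReal
                  rw [inv_mul_eq_div]
                  gcongr
              _ ≤ _ := by
                  rw [ENNReal.ofReal_mul (by positivity), ofReal_norm_sq_eq]
                  gcongr
                  have := enorm_add_sq_le (bdryDeriv Ψ a) (-bdryDeriv Ψ (a + u))
                  rwa [← sub_eq_add_neg, enorm_neg] at this
        _ = _ := by
            rw [lintegral_const_mul' _ _ ENNReal.ofReal_ne_top, lintegral_add_left (by fun_prop),
              lintegral_const_mul' _ _ (by simp), lintegral_const_mul' _ _ (by simp), hsh]
    refine (setLIntegral_mono' measurableSet_Ioc hin).trans_lt ?_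
    rw [setLIntegral_const]
    have : 2 * S + 2 * S < ⊤ := ENNReal.add_lt_top.2
      ⟨ENNReal.mul_lt_top (by simp) hSt, ENNReal.mul_lt_top (by simp) hSt⟩
    exact ENNReal.mul_lt_top (ENNReal.mul_lt_top ENNReal.ofReal_lt_top this) (by simp)

end FiniteLift

/-- `w` is a constant-speed chord-arc parametrization, of length `ℓ`, of the range of `γ`. -/
structure ChordArcCurve (γ : ℝ → ℂ) (ℓ : ℝ) (w : ℝ → ℂ) : Prop where
  length_pos : 0 < ℓ
  lip : LipschitzWith (Real.toNNReal (ℓ / (2 * π))) w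
  per : ∀ θ, w (θ + 2 * π) = w θ
  inj : InjOn w (Ico 0 (2 * π))
  range_eq : range w = range γ
  ae_speed : ∀ᵐ θ : ℝ, ∃ v : ℂ, HasDerivAt w v θ ∧ ‖v‖ = ℓ / (2 * π)
  chordArc : ∃ C : ℝ, 0 < C ∧ ∀ θ ∈ Icc (0 : ℝ) (2 * π), ∀ σ ∈ Icc (0 : ℝ) (2 * π),
    (ℓ / (2 * π)) * min |θ - σ| (2 * π - |θ - σ|) ≤ C * ‖w θ - w σ‖

theorem FiniteLift.exists_arcData {Ψ L : ℂ → ℂ} {y₀ : ℝ} (h : FiniteLift Ψ L y₀)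
    (hi : InjOn (bdryVal Ψ) (Ico 0 (2 * π))) : ∃ h₀, ArcData (bdryVal Ψ) (bdryDeriv Ψ) h₀ := by
  obtain ⟨h₀, hh0, hhy, H⟩ := h.exists_comparison
  refine ⟨h₀, measurable_bdryDeriv Ψ, h.bdryVal_per, bdryDeriv_per h.lift,
    h.intervalIntegrable_bdryDeriv, fun a b hab => h.bdryVal_sub hab, h.ae_bdryDeriv_ne_zero, hi,
    hh0, fun a u hu huh => ?_⟩
  obtain ⟨h1, h2⟩ := H a u hu huh
  linarith

theorem JordanMap.exists_chordArcCurve {γ : ℝ → ℂ} {Ω Ωstar : Set ℂ} {F : ℂ → ℂ}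
    (J : JordanMap γ Ω Ωstar F)
    (hE : (∫⁻ z in ball (0 : ℂ) 1, ENNReal.ofReal (‖deriv (deriv F) z / deriv F z‖ ^ 2)) < ⊤) :
    ∃ ℓ w, ChordArcCurve γ ℓ w ∧ sobolevSeminorm (1 / 2) (fun θ => deriv w θ) < ⊤ := by
  obtain ⟨L, hL, -, hL2⟩ := exists_isLift J.diff J.bij.injOn
  have hS := (disk_energy_iff_stripEnergy J.diff J.bij.injOn hL2).1 hE
  obtain ⟨y₀, hy₀, hB⟩ := exists_im_mul_norm_deriv_le hL hS (ε := 1 / 8) (by norm_num)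
  have h : FiniteLift (fun ζ => F (toDisk ζ)) L y₀ := ⟨hL, hy₀, hB, hS⟩
  obtain ⟨hinj, hrange⟩ := J.bdryVal_injOn_and_range h
  obtain ⟨h₀, hA⟩ := h.exists_arcData hinj
  set β := bdryVal fun ζ => F (toDisk ζ) with hβ
  set g := bdryDeriv fun ζ => F (toDisk ζ) with hg
  obtain ⟨T, hT⟩ := hA.exists_orderIso
  have hv := div_pos hA.arcLength_pos two_pi_pos
  refine ⟨arcLength g (2 * π), fun x => β (T.symm x), ⟨hA.arcLength_pos, hA.lipschitzWith hv hT,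
    hA.curve_per hT, hA.curve_injOn hT, ?_, ?_, hA.curve_chordArc hT⟩, ?_⟩
  · rw [← hrange]
    exact T.symm.surjective.range_comp β
  · filter_upwards [hA.ae_comp_symm hv hT (hA.ae_hasDerivAt hv hT),
      hA.ae_comp_symm hv hT hA.ne_zero]
      with x hx hx0
    rw [T.apply_symm_apply] at hx
    refine ⟨_, hx, ?_⟩
    rw [norm_mul, Complex.norm_real, Real.norm_of_nonneg (by positivity)]
    exact div_mul_cancel₀ _ (norm_ne_zero_iff.2 hx0)
  · refine (hA.curve_sobolevSeminorm_le hT).trans_lt ?_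
    exact ENNReal.mul_lt_top ENNReal.ofReal_lt_top (h.chordEnergy_lt_top hinj)

theorem integral_deriv_of_lipschitzWith {u : ℝ → ℂ} {K : NNReal} (hu : LipschitzWith K u)
    (a b : ℝ) : ∫ s in a..b, deriv u s = u b - u a := by
  have hb : ∀ s, ‖deriv u s‖ ≤ K := fun s => norm_deriv_le_of_lipschitz hu
  have hloc : LocallyIntegrable (deriv u) volume := by
    have h1 : LocallyIntegrable (fun _ : ℝ => (K : ℝ)) volume := locallyIntegrable_const _
    refine h1.mono (measurable_deriv u).aestronglyMeasurable (ae_of_all _ fun s => ?_)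
    exact (hb s).trans (le_abs_self _)
  have h_int : ∀ a b, IntervalIntegrable (deriv u) volume a b := fun a b =>
    intervalIntegrable_iff.mpr
      ((hloc.integrableOn_isCompact isCompact_uIcc).mono_set uIoc_subset_uIcc)
  have hlip : LipschitzWith K fun x => ∫ t in a..x, deriv u t := by
    refine LipschitzWith.of_dist_le_mul fun x y => ?_
    rw [dist_eq_norm, intervalIntegral.integral_interval_sub_left (h_int _ _) (h_int _ _),
      dist_eq_norm,
      Real.norm_eq_abs]
    exact intervalIntegral.norm_integral_le_of_norm_le_const fun s _ => hb s
  set g : ℝ → ℂ := fun x => u x - ∫ t in a..x, deriv u t with hg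
  have g_ac : AbsolutelyContinuousOnInterval g a b :=
    ((hu.sub hlip).lipschitzOnWith (s := uIcc a b)).absolutelyContinuousOnInterval
  have g_der : ∀ᵐ x, x ∈ uIcc a b → HasDerivAt g 0 x := by
    filter_upwards [hu.ae_differentiableAt_real,
      _root_.LocallyIntegrable.ae_hasDerivAt_integral hloc] with x hx₁ hx₂ _
    have := hx₁.hasDerivAt.sub (hx₂ a)
    rwa [sub_self] at this
  obtain ⟨C, hC⟩ := g_ac.const_of_ae_hasDerivAt_zero g_der
  have h1 := hC a (by simp)
  have h2 := hC b (by simp)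
  simp only [hg, intervalIntegral.integral_same, sub_zero] at h1 h2
  rw [← h1] at h2
  rw [sub_eq_iff_eq_add] at h2
  rw [h2]; abel

/-- A constant speed `2π`-periodic chord-arc map. -/
structure ChordArcMap (w : ℝ → ℂ) (v c : ℝ) : Prop where
  v_pos : 0 < v
  c_pos : 0 < c
  lipschitz : LipschitzWith (Real.toNNReal v) w
  per : ∀ x, w (x + 2 * π) = w x
  ae_norm : ∀ᵐ θ, ‖deriv w θ‖ = v
  chord : ∀ x y, |x - y| ≤ π → c * |x - y| ≤ ‖w x - w y‖

theorem abs_le_abs_add_int_mul {a : ℝ} (ha : |a| ≤ π) (n : ℤ) : |a| ≤ |a + n * (2 * π)| := by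
  have hp := pi_pos
  obtain ⟨h1, h2⟩ := abs_le.1 ha
  rcases lt_trichotomy n 0 with h | h | h
  · have : (n : ℝ) ≤ -1 := by exact_mod_cast (by omega : n ≤ -1)
    have h3 : a + n * (2 * π) ≤ -π := by nlinarith
    rw [abs_of_nonpos (a := a + n * (2 * π)) (by linarith)]; linarith
  · simp [h]
  · have : (1 : ℝ) ≤ n := by exact_mod_cast (by omega : 1 ≤ n)
    have h3 : π ≤ a + n * (2 * π) := by nlinarith
    exact ha.trans (h3.trans (le_abs_self _))

theorem exists_eq_add_int_mul (x : ℝ) : ∃ n : ℤ, ∃ t ∈ Ico 0 (2 * π), x = t + n * (2 * π) :=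
  ⟨toIcoDiv two_pi_pos 0 x, toIcoMod two_pi_pos 0 x,
    by simpa using toIcoMod_mem_Ico two_pi_pos 0 x, by
    rw [← zsmul_eq_mul, toIcoMod_add_toIcoDiv_zsmul]⟩

theorem ChordArcCurve.exists_chordArcMap {γ w : ℝ → ℂ} {ℓ : ℝ} (h : ChordArcCurve γ ℓ w) :
    ∃ c, ChordArcMap w (ℓ / (2 * π)) c := by
  obtain ⟨C, hC, hc⟩ := h.chordArc
  have hv := div_pos h.length_pos two_pi_pos
  refine ⟨ℓ / (2 * π) / C, hv, div_pos hv hC, h.lip, h.per, ?_, fun x y hxy => ?_⟩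
  · filter_upwards [h.ae_speed] with θ hθ
    obtain ⟨u, hu, hn⟩ := hθ
    rw [hu.deriv, hn]
  · obtain ⟨m, s, hs, rfl⟩ := exists_eq_add_int_mul x
    obtain ⟨n, t, ht, rfl⟩ := exists_eq_add_int_mul y
    have hw : ∀ (k : ℤ) r, w (r + k * (2 * π)) = w r := fun k r => by
      simpa using map_add_int_mul (f := w) (c := 0) (fun t => by rw [h.per, add_zero]) k r
    rw [hw, hw]
    refine le_trans ?_ ((div_le_iff₀' hC).2
      (hc s (Ico_subset_Icc_self hs) t (Ico_subset_Icc_self ht)))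
    rw [div_mul_eq_mul_div]
    gcongr
    have key : ∀ k : ℤ, |s + m * (2 * π) - (t + n * (2 * π))| ≤ |s - t + k * (2 * π)| := by
      intro k
      have := abs_le_abs_add_int_mul hxy (k - m + n)
      push_cast at this
      rwa [show s + m * (2 * π) - (t + n * (2 * π)) + (k - m + n) * (2 * π) = s - t + k * (2 * π) by
        ring] at this
    refine le_min (by simpa using key 0) ?_
    have h1 := abs_sub_lt_of_nonneg_of_lt hs.1 hs.2 ht.1 ht.2
    rcases le_total 0 (s - t) with h0 | h0
    · have := key (-1)
      rw [abs_of_nonneg h0] at *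
      rwa [abs_of_nonpos (a := s - t + (-1 : ℤ) * (2 * π)) (by push_cast; linarith),
        show -(s - t + (-1 : ℤ) * (2 * π)) = 2 * π - (s - t) by push_cast; ring] at this
    · have := key 1
      rw [abs_of_nonpos h0] at *
      rwa [abs_of_nonneg (a := s - t + (1 : ℤ) * (2 * π)) (by push_cast; linarith),
        show s - t + (1 : ℤ) * (2 * π) = 2 * π - -(s - t) by push_cast; ring] at this

/-- Lebesgue measure on a period. -/
noncomputable abbrev circ : Measure ℝ := volume.restrict (Ioc 0 (2 * π))

/-- The weight `|p - w s|⁻⁴`. -/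
noncomputable def kern (w : ℝ → ℂ) (p : ℂ) (s : ℝ) : ℝ := (‖p - w s‖ ^ 4)⁻¹

/-- Total mass of the weight `kern w p`. -/
noncomputable def mass (w : ℝ → ℂ) (p : ℂ) : ℝ := ∫ s, kern w p s ∂circ

/-- The average of the tangent `w'` with respect to the weight `kern w p`. -/
noncomputable def tangent (w : ℝ → ℂ) (p : ℂ) : ℂ :=
  (mass w p : ℂ)⁻¹ * ∫ s, (kern w p s : ℂ) * deriv w s ∂circ

theorem kern_nonneg (w : ℝ → ℂ) (p : ℂ) (s : ℝ) : 0 ≤ kern w p s := by unfold kern; positivity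

namespace ChordArcMap

variable {w : ℝ → ℂ} {v c d : ℝ} {p : ℂ}

theorem norm_sub_le (H : ChordArcMap w v c) (x y : ℝ) : ‖w x - w y‖ ≤ v * |x - y| := by
  have := H.lipschitz.dist_le_mul x y
  rwa [Real.coe_toNNReal _ H.v_pos.le, dist_eq_norm, Real.dist_eq] at this

theorem continuous (H : ChordArcMap w v c) : Continuous w := H.lipschitz.continuous

theorem norm_deriv_le (H : ChordArcMap w v c) (s : ℝ) : ‖deriv w s‖ ≤ v := by
  have := norm_deriv_le_of_lipschitz H.lipschitz (x₀ := s)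
  rwa [Real.coe_toNNReal _ H.v_pos.le] at this

theorem ae_circ_norm (H : ChordArcMap w v c) : ∀ᵐ s ∂circ, ‖deriv w s‖ = v :=
  ae_restrict_of_ae H.ae_norm

theorem kern_le (hd : 0 < d) (hm : ∀ t, d ≤ ‖p - w t‖) (s : ℝ) : kern w p s ≤ (d ^ 4)⁻¹ := by
  unfold kern
  have := hm s
  gcongr

theorem measurable_kern (H : ChordArcMap w v c) (p : ℂ) : Measurable (kern w p) := by
  have := H.continuous.measurable
  unfold kern
  fun_prop

theorem integrable_kern_mul (H : ChordArcMap w v c) (hd : 0 < d) (hm : ∀ t, d ≤ ‖p - w t‖)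
    {f : ℝ → ℝ} (hf : Measurable f) {B : ℝ} (hB : ∀ s, |f s| ≤ B) :
    Integrable (fun s => kern w p s * f s) circ := by
  refine Integrable.of_bound ((H.measurable_kern p).mul hf).aestronglyMeasurable ((d ^ 4)⁻¹ * B)
    (ae_of_all _ fun s => ?_)
  rw [norm_mul, Real.norm_of_nonneg (kern_nonneg _ _ _), Real.norm_eq_abs]
  exact mul_le_mul (kern_le hd hm s) (hB s) (abs_nonneg _) (by positivity)

theorem integrable_kern (H : ChordArcMap w v c) (hd : 0 < d) (hm : ∀ t, d ≤ ‖p - w t‖) :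
    Integrable (kern w p) circ := by
  simpa using H.integrable_kern_mul hd hm (measurable_const (a := (1 : ℝ))) (B := 1) (by simp)

theorem integrable_kern_smul (H : ChordArcMap w v c) (hd : 0 < d) (hm : ∀ t, d ≤ ‖p - w t‖) :
    Integrable (fun s => (kern w p s : ℂ) * deriv w s) circ := by
  refine Integrable.of_bound ?_ ((d ^ 4)⁻¹ * v) (ae_of_all _ fun s => ?_)
  · exact ((Complex.measurable_ofReal.comp (H.measurable_kern p)).mul
      (measurable_deriv w)).aestronglyMeasurable
  rw [norm_mul, Complex.norm_real, Real.norm_of_nonneg (kern_nonneg _ _ _)]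
  exact mul_le_mul (kern_le hd hm s) (H.norm_deriv_le s) (norm_nonneg _) (by positivity)

/-- Lower bound for the mass in terms of the distance to the curve. -/
theorem mass_ge (H : ChordArcMap w v c) (hd : 0 < d) (hm : ∀ t, d ≤ ‖p - w t‖) {s : ℝ}
    (hs : ‖p - w s‖ = d) (hdv : d ≤ 2 * π * v) : (16 * v * d ^ 3)⁻¹ ≤ mass w p := by
  have hper : Function.Periodic (kern w p) (2 * π) := fun t => by simp only [kern, H.per]
  have h1 : mass w p = ∫ t in s..s + 2 * π, kern w p t := by
    rw [mass, ← intervalIntegral.integral_of_le two_pi_pos.le]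
    have := hper.intervalIntegral_add_eq 0 s
    rwa [zero_add] at this
  have hI : ∀ a b, IntervalIntegrable (kern w p) volume a b := fun a b => by
    refine Continuous.intervalIntegrable ?_ a b
    unfold kern
    refine Continuous.inv₀ (by have := H.continuous; fun_prop) fun t => ?_
    have := hd.trans_le (hm t)
    positivity
  have hv := H.v_pos
  have hdv' : d / v ≤ 2 * π := by rwa [div_le_iff₀ hv]
  have hdv0 := div_pos hd hv
  rw [h1, ← intervalIntegral.integral_add_adjacent_intervals (hI s (s + d / v)) (hI _ _)]
  have h2 : 0 ≤ ∫ t in (s + d / v)..(s + 2 * π), kern w p t :=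
    intervalIntegral.integral_nonneg (by linarith) fun t _ => kern_nonneg _ _ _
  have h3 : ∫ t in s..s + d / v, ((2 * d) ^ 4)⁻¹ ≤ ∫ t in s..s + d / v, kern w p t := by
    refine intervalIntegral.integral_mono_on (by linarith) (by simp) (hI _ _) fun t ht => ?_
    unfold kern
    have hlt : 0 < ‖p - w t‖ := hd.trans_le (hm t)
    have : ‖p - w t‖ ≤ 2 * d := by
      have e : p - w t = (p - w s) + (w s - w t) := by ring
      rw [e]
      refine (norm_add_le _ _).trans ?_
      have h4 := H.norm_sub_le s t
      have h5 : v * |s - t| ≤ v * (d / v) := by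
        gcongr
        rw [abs_sub_comm, abs_of_nonneg (by linarith [ht.1])]; linarith [ht.2]
      rw [mul_div_cancel₀ _ hv.ne'] at h5
      linarith
    gcongr
  rw [intervalIntegral.integral_const, smul_eq_mul] at h3
  have : (16 * v * d ^ 3)⁻¹ = (s + d / v - s) * ((2 * d) ^ 4)⁻¹ := by
    field_simp
    ring
  linarith

theorem norm_sub_ge_of_nearest (H : ChordArcMap w v c) (hm : ∀ t, d ≤ ‖p - w t‖) {s r : ℝ}
    (hs : ‖p - w s‖ = d) (hr : |r| ≤ π) : c * |r| / 2 ≤ ‖p - w (s + r)‖ := by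
  have h1 := H.chord (s + r) s (by simpa using hr)
  have h2 := hm (s + r)
  have e : w (s + r) - w s = (p - w s) - (p - w (s + r)) := by ring
  rw [add_sub_cancel_left] at h1
  have h3 := _root_.norm_sub_le (p - w s) (p - w (s + r))
  rw [← e, hs] at h3
  linarith

theorem mass_le (H : ChordArcMap w v c) (hd : 0 < d) (hm : ∀ t, d ≤ ‖p - w t‖) {s : ℝ}
    (hs : ‖p - w s‖ = d) : mass w p ≤ 4 * π / (c * d ^ 3) := by
  have hper : Function.Periodic (kern w p) (2 * π) := fun t => by simp only [kern, H.per]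
  have hc := H.c_pos
  have hk : Continuous (kern w p) := by
    unfold kern
    refine Continuous.inv₀ (by have := H.continuous; fun_prop) fun t => ?_
    have := hd.trans_le (hm t)
    positivity
  have h1 : mass w p = ∫ r in (-π)..π, kern w p (s + r) := by
    rw [mass, ← intervalIntegral.integral_of_le two_pi_pos.le,
      intervalIntegral.integral_comp_add_left]
    have := hper.intervalIntegral_add_eq 0 (s + -π)
    rwa [zero_add, show s + -π + 2 * π = s + π by ring] at this
  have h_int : Integrable (fun r : ℝ => 2 / d ^ 4 * (1 + (c / (2 * d) * r) ^ 2)⁻¹) :=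
    (integrable_inv_one_add_sq.comp_mul_left' (by positivity)).const_mul _
  calc mass w p = ∫ r in (-π)..π, kern w p (s + r) := h1
    _ ≤ ∫ r in (-π)..π, 2 / d ^ 4 * (1 + (c / (2 * d) * r) ^ 2)⁻¹ := by
        refine intervalIntegral.integral_mono_on (by linarith [pi_pos])
          ((hk.comp (continuous_const_add s)).intervalIntegrable _ _) h_int.intervalIntegrable
          fun r hr => ?_
        have h2 := H.norm_sub_ge_of_nearest hm hs (abs_le.2 hr)
        have h3 := hm (s + r)
        unfold kern
        set N := ‖p - w (s + r)‖
        have e : 2 / d ^ 4 * (1 + (c / (2 * d) * r) ^ 2)⁻¹ =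
          (d ^ 2 * ((d ^ 2 + (c * |r| / 2) ^ 2) / 2))⁻¹ := by
          simp only [div_pow, mul_pow, sq_abs]
          field_simp
        rw [e]
        have h4 : d ^ 2 ≤ N ^ 2 := by gcongr
        have h5 : (c * |r| / 2) ^ 2 ≤ N ^ 2 := by gcongr
        refine inv_anti₀ (by positivity) ?_
        calc d ^ 2 * ((d ^ 2 + (c * |r| / 2) ^ 2) / 2) ≤ N ^ 2 * N ^ 2 := by
              gcongr; linarith
          _ = N ^ 4 := by ring
    _ ≤ ∫ r, 2 / d ^ 4 * (1 + (c / (2 * d) * r) ^ 2)⁻¹ := by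
        rw [intervalIntegral.integral_of_le (by linarith [pi_pos])]
        exact setIntegral_le_integral h_int (ae_of_all _ fun r => by positivity)
    _ = 4 * π / (c * d ^ 3) := by
        rw [integral_const_mul, Measure.integral_comp_mul_left (fun x : ℝ => (1 + x ^ 2)⁻¹),
          integral_univ_inv_one_add_sq, abs_of_pos (by positivity), smul_eq_mul]
        field_simp
        ring

end ChordArcMap

namespace ChordArcMap

variable {w : ℝ → ℂ} {v c d : ℝ} {p : ℂ}

/-- The variance of the tangent. -/
theorem integral_kern_sq (H : ChordArcMap w v c) (hd : 0 < d) (hm : ∀ t, d ≤ ‖p - w t‖)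
    (hZ : 0 < mass w p) (a : ℂ) :
    ∫ s, kern w p s * ‖deriv w s - a‖ ^ 2 ∂circ =
      mass w p * (v ^ 2 - ‖tangent w p‖ ^ 2 + ‖tangent w p - a‖ ^ 2) := by
  have hI := H.integrable_kern hd hm
  have hJ := H.integrable_kern_smul hd hm
  have h1 : ∀ᵐ s ∂circ, kern w p s * ‖deriv w s - a‖ ^ 2 =
      (v ^ 2 + ‖a‖ ^ 2) * kern w p s -
        2 * ((kern w p s : ℂ) * deriv w s * (starRingEnd ℂ) a).re := by
    filter_upwards [H.ae_circ_norm] with s hs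
    rw [← hs, ← Complex.normSq_eq_norm_sq, ← Complex.normSq_eq_norm_sq, ← Complex.normSq_eq_norm_sq,
      Complex.normSq_sub, mul_assoc, Complex.re_ofReal_mul]
    ring
  have hT : ∫ s, (kern w p s : ℂ) * deriv w s ∂circ = mass w p * tangent w p := by
    rw [tangent, ← mul_assoc, mul_inv_cancel₀ (by exact_mod_cast hZ.ne'), one_mul]
  have h2 : ∫ s, ((kern w p s : ℂ) * deriv w s * (starRingEnd ℂ) a).re ∂circ =
      mass w p * (tangent w p * (starRingEnd ℂ) a).re := by
    have := integral_re (hJ.mul_const ((starRingEnd ℂ) a))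
    simp only [RCLike.re_eq_complex_re] at this
    rw [this, integral_mul_const, hT, mul_assoc, Complex.re_ofReal_mul]
  have hJ' : Integrable (fun s => ((kern w p s : ℂ) * deriv w s * (starRingEnd ℂ) a).re) circ :=
    (hJ.mul_const ((starRingEnd ℂ) a)).re
  rw [integral_congr_ae h1, integral_sub (hI.const_mul _) (hJ'.const_mul _), integral_const_mul,
    integral_const_mul, h2]
  simp only [← Complex.normSq_eq_norm_sq]
  rw [Complex.normSq_sub, ← mass]
  ring

theorem norm_tangent_sq_le (H : ChordArcMap w v c) (hd : 0 < d) (hm : ∀ t, d ≤ ‖p - w t‖)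
    (hZ : 0 < mass w p) : ‖tangent w p‖ ^ 2 ≤ v ^ 2 := by
  have h := H.integral_kern_sq hd hm hZ (tangent w p)
  have h0 : 0 ≤ ∫ s, kern w p s * ‖deriv w s - tangent w p‖ ^ 2 ∂circ :=
    integral_nonneg fun s => mul_nonneg (kern_nonneg _ _ _) (by positivity)
  rw [h, sub_self, norm_zero] at h0
  have := nonneg_of_mul_nonneg_right h0 hZ
  linarith

theorem norm_tangent_le (H : ChordArcMap w v c) (hd : 0 < d) (hm : ∀ t, d ≤ ‖p - w t‖)
    (hZ : 0 < mass w p) : ‖tangent w p‖ ≤ v :=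
  le_of_sq_le_sq (H.norm_tangent_sq_le hd hm hZ) H.v_pos.le

theorem mass_mul_le (H : ChordArcMap w v c) (hd : 0 < d) (hm : ∀ t, d ≤ ‖p - w t‖)
    (hZ : 0 < mass w p) (s : ℝ) :
    mass w p * (v ^ 2 - ‖tangent w p‖ ^ 2) ≤
      ∫ t, kern w p t * ‖deriv w t - deriv w s‖ ^ 2 ∂circ := by
  rw [H.integral_kern_sq hd hm hZ]
  gcongr
  have := sq_nonneg ‖tangent w p - deriv w s‖
  linarith

theorem integral_kern_norm_le (H : ChordArcMap w v c) (hd : 0 < d) (hm : ∀ t, d ≤ ‖p - w t‖)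
    (hZ : 0 < mass w p) :
    ∫ s, kern w p s * ‖deriv w s - tangent w p‖ ∂circ ≤
      mass w p * √(v ^ 2 - ‖tangent w p‖ ^ 2) := by
  have hV := H.norm_tangent_le hd hm hZ
  have hA := H.norm_tangent_sq_le hd hm hZ
  have hmeas : Measurable fun s => ‖deriv w s - tangent w p‖ :=
    ((measurable_deriv w).sub_const _).norm
  have hB : ∀ s, ‖deriv w s - tangent w p‖ ≤ 2 * v := fun s =>
    (_root_.norm_sub_le _ _).trans (by linarith [H.norm_deriv_le s])
  have hI1 := H.integrable_kern_mul hd hm hmeas (B := 2 * v) fun s => by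
    rw [abs_of_nonneg (norm_nonneg _)]; exact hB s
  have hI2 := H.integrable_kern_mul hd hm (hmeas.pow_const 2) (B := (2 * v) ^ 2) fun s => by
    rw [abs_of_nonneg (by positivity)]; exact pow_le_pow_left₀ (norm_nonneg _) (hB s) 2
  have hI := H.integrable_kern hd hm
  set A := √(v ^ 2 - ‖tangent w p‖ ^ 2) with hAdef
  set Z := mass w p with hZdef
  set m := Z⁻¹ * ∫ s, kern w p s * ‖deriv w s - tangent w p‖ ∂circ with hm'
  have hE : ∫ s, kern w p s * ‖deriv w s - tangent w p‖ ∂circ = Z * m := by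
    rw [hm', ← mul_assoc, mul_inv_cancel₀ hZ.ne', one_mul]
  have hsq : ∫ s, kern w p s * ‖deriv w s - tangent w p‖ ^ 2 ∂circ = Z * A ^ 2 := by
    rw [H.integral_kern_sq hd hm hZ, Real.sq_sqrt (by linarith), sub_self, norm_zero]
    ring
  have h0 : 0 ≤ ∫ s, (kern w p s * ‖deriv w s - tangent w p‖ ^ 2 -
      2 * m * (kern w p s * ‖deriv w s - tangent w p‖) + m ^ 2 * kern w p s) ∂circ := by
    refine integral_nonneg fun s => ?_
    have := mul_nonneg (kern_nonneg w p s) (sq_nonneg (‖deriv w s - tangent w p‖ - m))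
    simp only [Pi.zero_apply]
    nlinarith
  have hI3 : Integrable (fun s => kern w p s * ‖deriv w s - tangent w p‖ ^ 2 -
      2 * m * (kern w p s * ‖deriv w s - tangent w p‖)) circ := hI2.sub (hI1.const_mul _)
  rw [integral_add hI3 (hI.const_mul _), integral_sub hI2 (hI1.const_mul _),
    integral_const_mul, integral_const_mul, hE, hsq, ← mass, ← hZdef] at h0
  rw [hE]
  gcongr
  refine le_of_sq_le_sq ?_ (Real.sqrt_nonneg _)
  have : 0 ≤ Z * (A ^ 2 - m ^ 2) := by linarith
  have := nonneg_of_mul_nonneg_right this hZ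
  linarith

end ChordArcMap

/-- Chordal distance on the unit circle, in terms of the angles. -/
noncomputable def circDist (z : ℝ × ℝ) : ℝ :=
  ‖Complex.exp (z.1 * Complex.I) - Complex.exp (z.2 * Complex.I)‖

theorem measurable_circDist : Measurable circDist := by
  unfold circDist
  fun_prop

theorem circDist_pos {z : ℝ × ℝ} (h1 : z.1 ∈ Ioc 0 (2 * π)) (h2 : z.2 ∈ Ioc 0 (2 * π))
    (hne : z.1 ≠ z.2) : 0 < circDist z := by
  have h3 : |z.1 - z.2| < 2 * π := abs_lt.2 ⟨by linarith [h1.1, h2.2], by linarith [h1.2, h2.1]⟩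
  have h4 := min_le_norm_exp_sub_exp h3.le
  have h5 : 0 < min |z.1 - z.2| (2 * π - |z.1 - z.2|) :=
    lt_min (abs_pos.2 (sub_ne_zero.2 hne)) (by linarith)
  exact pos_of_mul_pos_right (h5.trans_le h4) (by positivity)

/-- The squared increment of the derivative. -/
noncomputable def jump (w : ℝ → ℂ) (z : ℝ × ℝ) : ℝ := ‖deriv w z.1 - deriv w z.2‖ ^ 2

theorem jump_nonneg (w : ℝ → ℂ) (z : ℝ × ℝ) : 0 ≤ jump w z := by unfold jump; positivity

theorem measurable_jump (w : ℝ → ℂ) : Measurable (jump w) := by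
  have := measurable_deriv w
  unfold jump
  fun_prop

/-- A majorant for the squared gradient of `tangent w` at `p`. -/
noncomputable def tangentDensity (w : ℝ → ℂ) (c : ℝ) (p : ℂ) : ENNReal :=
  ∫⁻ z, ENNReal.ofReal ((max ‖p - w z.1‖ (c / 2 * circDist z) ^ 4)⁻¹ * jump w z) ∂(circ.prod circ)

theorem lintegral_jump_eq (w : ℝ → ℂ) :
    ∫⁻ z, ENNReal.ofReal ((circDist z ^ 2)⁻¹ * jump w z) ∂(circ.prod circ) =
      sobolevSeminorm (1 / 2) fun θ => deriv w θ := by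
  rw [lintegral_prod _ (by
    have := measurable_circDist
    have := measurable_jump w
    fun_prop)]
  rw [sobolevSeminorm]
  refine lintegral_congr fun s => lintegral_congr fun t => ?_
  rw [circDist, jump, div_eq_inv_mul]
  norm_num

namespace ChordArcMap

variable {w : ℝ → ℂ} {v c d : ℝ} {p : ℂ}

theorem circDist_le_norm_sub (H : ChordArcMap w v c) (z : ℝ × ℝ) :
    c * circDist z ≤ ‖w z.1 - w z.2‖ := by
  obtain ⟨n, t, ht, hx⟩ := exists_eq_add_int_mul (z.1 - z.2 + π)
  have hw : ∀ (k : ℤ) r, w (r + k * (2 * π)) = w r := fun k r => by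
    simpa using map_add_int_mul (f := w) (c := 0) (fun t => by rw [H.per, add_zero]) k r
  have h1 : z.1 = (z.2 + (t - π)) + n * (2 * π) := by linarith
  have h2 : Complex.exp (z.1 * Complex.I) = Complex.exp (((z.2 + (t - π) : ℝ)) * Complex.I) := by
    rw [h1, Complex.exp_eq_exp_iff_exists_int]
    exact ⟨n, by push_cast; ring⟩
  have h3 : |t - π| ≤ π := abs_le.2 ⟨by linarith [ht.1], by linarith [ht.2]⟩
  rw [circDist, h2, norm_exp_sub_exp, h1, hw]
  refine le_trans ?_ (H.chord _ _ (by rwa [add_sub_cancel_left]))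
  have := H.c_pos.le
  gcongr
  rw [add_sub_cancel_left]
  have := Real.abs_sin_le_abs (x := (t - π) / 2)
  rw [abs_div, abs_two] at this
  linarith

theorem kern_mul_kern_le (H : ChordArcMap w v c) (hd : 0 < d) (hm : ∀ t, d ≤ ‖p - w t‖)
    (z : ℝ × ℝ) : kern w p z.1 * kern w p z.2 ≤
      (d ^ 4)⁻¹ * (max ‖p - w z.1‖ (c / 2 * circDist z) ^ 4)⁻¹ := by
  have h1 := H.circDist_le_norm_sub z
  have h2 : ‖w z.1 - w z.2‖ ≤ ‖p - w z.1‖ + ‖p - w z.2‖ := by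
    rw [show w z.1 - w z.2 = (p - w z.2) - (p - w z.1) by ring, add_comm]
    exact _root_.norm_sub_le _ _
  have h3 := hm z.1
  have h4 := hm z.2
  unfold kern
  have h5 : 0 < max ‖p - w z.1‖ (c / 2 * circDist z) := lt_max_of_lt_left (hd.trans_le h3)
  rcases le_total ‖p - w z.1‖ ‖p - w z.2‖ with h | h
  · have : max ‖p - w z.1‖ (c / 2 * circDist z) ≤ ‖p - w z.2‖ := max_le h (by linarith)
    gcongr
  · have : max ‖p - w z.1‖ (c / 2 * circDist z) ≤ ‖p - w z.1‖ := max_le le_rfl (by linarith)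
    rw [mul_comm]
    gcongr

theorem ofReal_defect_le (H : ChordArcMap w v c) (hd : 0 < d) (hm : ∀ t, d ≤ ‖p - w t‖) {s : ℝ}
    (hs : ‖p - w s‖ = d) (hdv : d ≤ 2 * π * v) :
    ENNReal.ofReal (v ^ 2 - ‖tangent w p‖ ^ 2) ≤
      ENNReal.ofReal (256 * v ^ 2 * d ^ 2) * tangentDensity w c p := by
  have hv := H.v_pos
  have hZ1 := H.mass_ge hd hm hs hdv
  have hZ : 0 < mass w p := lt_of_lt_of_le (by positivity) hZ1
  have hA := H.norm_tangent_sq_le hd hm hZ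
  set A := v ^ 2 - ‖tangent w p‖ ^ 2 with hAdef
  have hA0 : 0 ≤ A := by linarith
  set Z := mass w p with hZdef
  have hmk := H.measurable_kern p
  have hmd := measurable_deriv w
  have hmJ := measurable_jump w
  have hmC := measurable_circDist
  have hI := H.integrable_kern hd hm
  have h1 : ENNReal.ofReal (Z * (Z * A)) ≤
      ∫⁻ z, ENNReal.ofReal (kern w p z.1 * kern w p z.2 * jump w z) ∂(circ.prod circ) := by
    rw [lintegral_prod _ (by fun_prop)]
    have e : Z * (Z * A) = ∫ s, kern w p s * (Z * A) ∂circ := by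
      rw [integral_mul_const, ← mass]
    rw [e, ofReal_integral_eq_lintegral_ofReal (hI.mul_const _)
      (ae_of_all _ fun s => mul_nonneg (kern_nonneg _ _ _) (by positivity))]
    refine lintegral_mono fun s => ?_
    simp only [mul_assoc]
    have hk := kern_nonneg w p s
    rw [ENNReal.ofReal_mul hk]
    have hmeas : Measurable fun t => ENNReal.ofReal (kern w p t * jump w (s, t)) := by fun_prop
    calc ENNReal.ofReal (kern w p s) * ENNReal.ofReal (Z * A)
        ≤ ENNReal.ofReal (kern w p s) *
          ∫⁻ t, ENNReal.ofReal (kern w p t * jump w (s, t)) ∂circ := by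
          gcongr
          refine (ENNReal.ofReal_le_ofReal (H.mass_mul_le hd hm hZ s)).trans ?_
          rw [ofReal_integral_eq_lintegral_ofReal]
          · refine le_of_eq (lintegral_congr fun t => ?_)
            rw [jump, norm_sub_rev]
          · refine H.integrable_kern_mul hd hm (by fun_prop) (B := (2 * v) ^ 2) fun t => ?_
            rw [abs_of_nonneg (by positivity)]
            refine pow_le_pow_left₀ (norm_nonneg _) ((_root_.norm_sub_le _ _).trans ?_) 2
            linarith [H.norm_deriv_le s, H.norm_deriv_le t]
          · exact ae_of_all _ fun t => mul_nonneg (kern_nonneg _ _ _) (by positivity)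
      _ = ∫⁻ t, ENNReal.ofReal (kern w p s * (kern w p t * jump w (s, t))) ∂circ := by
          rw [← lintegral_const_mul _ hmeas]
          refine lintegral_congr fun t => ?_
          rw [ENNReal.ofReal_mul hk]
  have h2 : ∫⁻ z, ENNReal.ofReal (kern w p z.1 * kern w p z.2 * jump w z) ∂(circ.prod circ) ≤
      ENNReal.ofReal (d ^ 4)⁻¹ * tangentDensity w c p := by
    have hmw := H.continuous.measurable
    rw [tangentDensity, ← lintegral_const_mul _ (by fun_prop)]
    refine lintegral_mono fun z => ?_
    rw [← ENNReal.ofReal_mul (by positivity), ← mul_assoc]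
    refine ENNReal.ofReal_le_ofReal ?_
    exact mul_le_mul_of_nonneg_right (H.kern_mul_kern_le hd hm z) (jump_nonneg _ _)
  have h3 : A ≤ 256 * v ^ 2 * d ^ 6 * (Z * (Z * A)) := by
    have h4 : 1 ≤ 16 * v * d ^ 3 * Z := by
      have := (inv_le_iff_one_le_mul₀' (by positivity)).1 hZ1
      linarith
    have h5 : 1 ≤ (16 * v * d ^ 3 * Z) ^ 2 := one_le_pow₀ h4
    nlinarith
  calc ENNReal.ofReal A ≤ ENNReal.ofReal (256 * v ^ 2 * d ^ 6 * (Z * (Z * A))) :=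
        ENNReal.ofReal_le_ofReal h3
    _ = ENNReal.ofReal (256 * v ^ 2 * d ^ 6) * ENNReal.ofReal (Z * (Z * A)) :=
        ENNReal.ofReal_mul (by positivity)
    _ ≤ ENNReal.ofReal (256 * v ^ 2 * d ^ 6) *
        (ENNReal.ofReal (d ^ 4)⁻¹ * tangentDensity w c p) := by
        gcongr
        exact h1.trans h2
    _ = ENNReal.ofReal (256 * v ^ 2 * d ^ 2) * tangentDensity w c p := by
        rw [← mul_assoc, ← ENNReal.ofReal_mul (by positivity)]
        congr 2
        field_simp

end ChordArcMap

theorem exists_lintegral_max_le : ∃ K : ℝ, 0 < K ∧ ∀ (q : ℂ) (R : ℝ), 0 < R →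
    ∫⁻ p : ℂ, ENNReal.ofReal ((max ‖p - q‖ R ^ 4)⁻¹) ≤ ENNReal.ofReal (K * (R ^ 2)⁻¹) := by
  have hfin : ∫⁻ z : ℂ, ENNReal.ofReal ((1 + ‖z‖) ^ (-(4 : ℝ))) < ⊤ :=
    finite_integral_one_add_norm (by rw [Complex.finrank_real_complex]; norm_num)
  set I := ∫⁻ z : ℂ, ENNReal.ofReal ((1 + ‖z‖) ^ (-(4 : ℝ))) with hI
  refine ⟨16 * I.toReal + 1, by positivity, fun q R hR => ?_⟩
  rw [lintegral_sub_right_eq_self (fun p : ℂ => ENNReal.ofReal ((max ‖p‖ R ^ 4)⁻¹)) q]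
  have h1 : ∀ p : ℂ, ENNReal.ofReal ((max ‖p‖ R ^ 4)⁻¹) ≤
      ENNReal.ofReal (16 * (R ^ 4)⁻¹) * ENNReal.ofReal ((1 + ‖R⁻¹ • p‖) ^ (-(4 : ℝ))) := by
    intro p
    rw [← ENNReal.ofReal_mul (by positivity)]
    refine ENNReal.ofReal_le_ofReal ?_
    have h2 : (1 + ‖R⁻¹ • p‖) ^ (-(4 : ℝ)) = ((1 + ‖R⁻¹ • p‖) ^ 4)⁻¹ := by
      rw [Real.rpow_neg (by positivity)]
      norm_num
    rw [h2, norm_smul, norm_inv, Real.norm_of_nonneg hR.le]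
    have e : 16 * (R ^ 4)⁻¹ * ((1 + R⁻¹ * ‖p‖) ^ 4)⁻¹ = (((R + ‖p‖) / 2) ^ 4)⁻¹ := by
      have : R * (1 + R⁻¹ * ‖p‖) = R + ‖p‖ := by field_simp
      rw [← this, div_pow, mul_pow]
      field_simp
      norm_num
    rw [e]
    have h3 := le_max_left ‖p‖ R
    have h4 := le_max_right ‖p‖ R
    have : (R + ‖p‖) / 2 ≤ max ‖p‖ R := by linarith
    gcongr
  refine (lintegral_mono h1).trans ?_
  rw [lintegral_const_mul' _ _ ENNReal.ofReal_ne_top]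
  have h5 : ∫⁻ p : ℂ, ENNReal.ofReal ((1 + ‖R⁻¹ • p‖) ^ (-(4 : ℝ))) =
    ENNReal.ofReal (R ^ 2) * I := by
    have h6 := Measure.map_addHaar_smul (volume : Measure ℂ) (r := R⁻¹) (by positivity)
    rw [hI, ← smul_eq_mul, ← lintegral_smul_measure]
    rw [Complex.finrank_real_complex, abs_of_pos (by positivity), inv_pow, inv_inv] at h6
    rw [← h6, lintegral_map (by fun_prop) (by fun_prop)]
  rw [h5, ← mul_assoc, ← ENNReal.ofReal_mul (by positivity)]
  have h7 : I = ENNReal.ofReal I.toReal := (ENNReal.ofReal_toReal hfin.ne).symm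
  calc ENNReal.ofReal (16 * (R ^ 4)⁻¹ * R ^ 2) * I
      = ENNReal.ofReal (16 * (R ^ 4)⁻¹ * R ^ 2) * ENNReal.ofReal I.toReal := by rw [← h7]
    _ ≤ _ := ?_
  rw [← ENNReal.ofReal_mul (by positivity)]
  refine ENNReal.ofReal_le_ofReal ?_
  have : 16 * (R ^ 4)⁻¹ * R ^ 2 * I.toReal = 16 * I.toReal * (R ^ 2)⁻¹ := by
    field_simp
  rw [this]
  have : 0 < (R ^ 2)⁻¹ := by positivity
  nlinarith

namespace ChordArcMap

variable {w : ℝ → ℂ} {v c d : ℝ} {p : ℂ}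

theorem ae_circ_prod : ∀ᵐ z : ℝ × ℝ ∂(circ.prod circ),
    z.1 ∈ Ioc 0 (2 * π) ∧ z.2 ∈ Ioc 0 (2 * π) := by
  rw [circ, Measure.prod_restrict]
  exact ae_restrict_mem (measurableSet_Ioc.prod measurableSet_Ioc)

theorem lintegral_tangentDensity_lt_top (H : ChordArcMap w v c)
    (hS : sobolevSeminorm (1 / 2) (fun θ => deriv w θ) < ⊤) :
    ∫⁻ p, tangentDensity w c p < ⊤ := by
  obtain ⟨K, hK, hb⟩ := exists_lintegral_max_le
  have hmd := measurable_deriv w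
  have hmJ := measurable_jump w
  have hmC := measurable_circDist
  have hmw := H.continuous.measurable
  have hc := H.c_pos
  have : ∀ p, tangentDensity w c p = ∫⁻ z, ENNReal.ofReal
    ((max ‖p - w z.1‖ (c / 2 * circDist z) ^ 4)⁻¹ * jump w z) ∂(circ.prod circ) := fun p => rfl
  simp_rw [this]
  rw [lintegral_lintegral_swap (by fun_prop)]
  calc ∫⁻ z, (∫⁻ p : ℂ, ENNReal.ofReal
        ((max ‖p - w z.1‖ (c / 2 * circDist z) ^ 4)⁻¹ * jump w z)) ∂(circ.prod circ)
      ≤ ∫⁻ z, ENNReal.ofReal (4 * K / c ^ 2) * ENNReal.ofReal ((circDist z ^ 2)⁻¹ * jump w z)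
          ∂(circ.prod circ) := by
        refine lintegral_mono_ae ?_
        filter_upwards [ae_circ_prod] with z hz
        rcases eq_or_ne z.1 z.2 with h | h
        · simp [jump, h]
        have hD := circDist_pos hz.1 hz.2 h
        have hJ := jump_nonneg w z
        calc ∫⁻ p : ℂ, ENNReal.ofReal ((max ‖p - w z.1‖ (c / 2 * circDist z) ^ 4)⁻¹ * jump w z)
            = (∫⁻ p : ℂ, ENNReal.ofReal ((max ‖p - w z.1‖ (c / 2 * circDist z) ^ 4)⁻¹)) *
              ENNReal.ofReal (jump w z) := by
              rw [← lintegral_mul_const' _ _ ENNReal.ofReal_ne_top]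
              exact lintegral_congr fun p => ENNReal.ofReal_mul (by positivity)
          _ ≤ ENNReal.ofReal (K * ((c / 2 * circDist z) ^ 2)⁻¹) * ENNReal.ofReal (jump w z) := by
              gcongr
              exact hb _ _ (by positivity)
          _ = _ := by
              rw [← ENNReal.ofReal_mul (by positivity), ← ENNReal.ofReal_mul (by positivity)]
              congr 1
              field_simp
              ring
    _ < ⊤ := by
        rw [lintegral_const_mul' _ _ ENNReal.ofReal_ne_top, lintegral_jump_eq]
        exact ENNReal.mul_lt_top ENNReal.ofReal_lt_top hS

theorem tendsto_defect (H : ChordArcMap w v c)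
    (hS : sobolevSeminorm (1 / 2) (fun θ => deriv w θ) < ⊤) :
    Tendsto (fun d : ℝ => ∫⁻ z, ENNReal.ofReal (d ^ 2 * ((max d (c / 2 * circDist z) ^ 4)⁻¹ *
      jump w z)) ∂(circ.prod circ)) (𝓝[>] 0) (𝓝 0) := by
  have hmJ := measurable_jump w
  have hmC := measurable_circDist
  have hc := H.c_pos
  rw [← lintegral_zero (μ := circ.prod circ)]
  refine tendsto_lintegral_filter_of_dominated_convergence
    (fun z => ENNReal.ofReal (4 / c ^ 2) * ENNReal.ofReal ((circDist z ^ 2)⁻¹ * jump w z))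
    (Eventually.of_forall fun d => by fun_prop) ?_ ?_ ?_
  · filter_upwards [self_mem_nhdsWithin] with d hd
    have hd : 0 < d := hd
    filter_upwards [ae_circ_prod] with z hz
    rcases eq_or_ne z.1 z.2 with h | h
    · simp [jump, h]
    have hD := circDist_pos hz.1 hz.2 h
    have hJ := jump_nonneg w z
    rw [← ENNReal.ofReal_mul (by positivity), ← mul_assoc, ← mul_assoc]
    refine ENNReal.ofReal_le_ofReal (mul_le_mul_of_nonneg_right ?_ hJ)
    have h1 : 0 < max d (c / 2 * circDist z) := lt_max_of_lt_left hd
    have h2 : d ^ 2 ≤ max d (c / 2 * circDist z) ^ 2 := by gcongr; exact le_max_left _ _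
    have h3 : (c / 2 * circDist z) ^ 2 ≤ max d (c / 2 * circDist z) ^ 2 := by
      gcongr; exact le_max_right _ _
    calc d ^ 2 * (max d (c / 2 * circDist z) ^ 4)⁻¹
        ≤ max d (c / 2 * circDist z) ^ 2 * (max d (c / 2 * circDist z) ^ 4)⁻¹ := by gcongr
      _ = (max d (c / 2 * circDist z) ^ 2)⁻¹ := by field_simp
      _ ≤ ((c / 2 * circDist z) ^ 2)⁻¹ := by gcongr
      _ = 4 / c ^ 2 * (circDist z ^ 2)⁻¹ := by field_simp; norm_num
  · rw [lintegral_const_mul' _ _ ENNReal.ofReal_ne_top, lintegral_jump_eq]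
    exact (ENNReal.mul_lt_top ENNReal.ofReal_lt_top hS).ne
  · filter_upwards [ae_circ_prod] with z hz
    rcases eq_or_ne z.1 z.2 with h | h
    · simp [jump, h]
    have hD := circDist_pos hz.1 hz.2 h
    rw [← ENNReal.ofReal_zero]
    refine ENNReal.tendsto_ofReal ?_
    have h4 : Tendsto (fun d : ℝ => d ^ 2 * ((max d (c / 2 * circDist z) ^ 4)⁻¹ * jump w z)) (𝓝 0)
        (𝓝 (0 ^ 2 * ((max 0 (c / 2 * circDist z) ^ 4)⁻¹ * jump w z))) := by
      have h5 : ContinuousAt (fun d : ℝ => (max d (c / 2 * circDist z) ^ 4)⁻¹) 0 := by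
        refine ContinuousAt.inv₀ (by fun_prop) ?_
        rw [max_eq_right (by positivity)]
        positivity
      exact ((continuous_pow 2).tendsto 0).mul (h5.tendsto.mul_const _)
    simp only [ne_eq, OfNat.ofNat_ne_zero, not_false_eq_true, zero_pow, zero_mul] at h4
    exact h4.mono_left nhdsWithin_le_nhds

/-- The averaged tangent has almost full length near the curve. -/
theorem exists_defect_le (H : ChordArcMap w v c)
    (hS : sobolevSeminorm (1 / 2) (fun θ => deriv w θ) < ⊤) {ε : ℝ} (hε : 0 < ε) :
    ∃ d₀ > 0, ∀ (p : ℂ) (d s : ℝ), 0 < d → d < d₀ → (∀ t, d ≤ ‖p - w t‖) → ‖p - w s‖ = d →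
      v ^ 2 - ‖tangent w p‖ ^ 2 ≤ ε := by
  have hv := H.v_pos
  have hmJ := measurable_jump w
  have hmC := measurable_circDist
  have h1 := (H.tendsto_defect hS).eventually
    (eventually_lt_nhds (b := ENNReal.ofReal (ε / (256 * v ^ 2)))
      (ENNReal.ofReal_pos.2 (by positivity)))
  obtain ⟨d₁, hd₁, hd⟩ := mem_nhdsGT_iff_exists_Ioo_subset.1 h1
  have hd₁ : 0 < d₁ := hd₁
  refine ⟨min d₁ (2 * π * v), by positivity, fun p d s h0 hdd hm hs => ?_⟩
  have h2 := H.ofReal_defect_le h0 hm hs (hdd.le.trans (min_le_right _ _))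
  have h3 := hd ⟨h0, hdd.trans_le (min_le_left _ _)⟩
  have h4 : ENNReal.ofReal (256 * v ^ 2 * d ^ 2) * tangentDensity w c p ≤
      ENNReal.ofReal (256 * v ^ 2) * ∫⁻ z, ENNReal.ofReal (d ^ 2 *
        ((max d (c / 2 * circDist z) ^ 4)⁻¹ * jump w z)) ∂(circ.prod circ) := by
    rw [ENNReal.ofReal_mul (by positivity), mul_assoc]
    gcongr
    rw [tangentDensity, ← lintegral_const_mul' _ _ ENNReal.ofReal_ne_top]
    refine lintegral_mono fun z => ?_
    rw [← ENNReal.ofReal_mul (by positivity)]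
    refine ENNReal.ofReal_le_ofReal ?_
    have hJ := jump_nonneg w z
    have := hm z.1
    have h1 : 0 < max d (c / 2 * circDist z) := lt_max_of_lt_left h0
    gcongr
  have h5 : ENNReal.ofReal (v ^ 2 - ‖tangent w p‖ ^ 2) ≤ ENNReal.ofReal ε := by
    refine h2.trans (h4.trans ((mul_le_mul_right h3.le _).trans ?_))
    rw [← ENNReal.ofReal_mul (by positivity)]
    refine ENNReal.ofReal_le_ofReal (le_of_eq ?_)
    field_simp
  exact (ENNReal.ofReal_le_ofReal_iff hε.le).1 h5

end ChordArcMap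

theorem hasFDerivAt_inv_norm_pow_four {q x : ℂ} (h : x ≠ q) :
    HasFDerivAt (fun y : ℂ => (‖y - q‖ ^ 4)⁻¹)
      (-(4 * (‖x - q‖ ^ 6)⁻¹) • innerSL ℝ (x - q)) x := by
  have h0 : 0 < ‖x - q‖ := norm_pos_iff.2 (sub_ne_zero.2 h)
  have h1 : HasFDerivAt (fun y : ℂ => ‖y - q‖ ^ 2) (2 • innerSL ℝ (x - q)) x := by
    have := (hasStrictFDerivAt_norm_sq (x - q)).hasFDerivAt.comp x
      ((hasFDerivAt_id x).sub_const q)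
    simpa [Function.comp_def] using this
  have h2 : HasDerivAt (fun u : ℝ => (u ^ 2)⁻¹) (-(2 * (‖x - q‖ ^ 6)⁻¹)) (‖x - q‖ ^ 2) := by
    have := (hasDerivAt_pow 2 (‖x - q‖ ^ 2)).inv (by positivity)
    refine this.congr_deriv ?_
    field_simp
    push_cast
    ring
  have h3 := h2.comp_hasFDerivAt x h1
  have e1 : (fun y : ℂ => (‖y - q‖ ^ 4)⁻¹) = (fun u : ℝ => (u ^ 2)⁻¹) ∘ fun y => ‖y - q‖ ^ 2 := by
    funext y; simp only [Function.comp]; ring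
  rw [e1]
  refine h3.congr_fderiv ?_
  rw [two_smul, ← two_smul ℝ, smul_smul]
  congr 1
  ring

theorem norm_neg_smul_innerSL_le {q x : ℂ} {d : ℝ} (hd : 0 < d) (h : d ≤ ‖x - q‖) :
    ‖-(4 * (‖x - q‖ ^ 6)⁻¹) • innerSL ℝ (x - q)‖ ≤ 4 / d * (‖x - q‖ ^ 4)⁻¹ := by
  have h0 : 0 < ‖x - q‖ := hd.trans_le h
  rw [norm_smul, innerSL_apply_norm, norm_neg, Real.norm_of_nonneg (by positivity)]
  calc 4 * (‖x - q‖ ^ 6)⁻¹ * ‖x - q‖ = 4 / ‖x - q‖ * (‖x - q‖ ^ 4)⁻¹ := by field_simp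
    _ ≤ _ := by gcongr

theorem half_le_norm_sub {w : ℝ → ℂ} {p q : ℂ} {d : ℝ} (hm : ∀ t, d ≤ ‖p - w t‖)
    (hq : q ∈ ball p (d / 2)) (t : ℝ) : d / 2 ≤ ‖q - w t‖ := by
  have h1 : ‖q - p‖ < d / 2 := by simpa [dist_eq_norm] using hq
  have h2 := hm t
  have h3 : ‖p - w t‖ ≤ ‖q - w t‖ + ‖q - p‖ := by
    calc ‖p - w t‖ = ‖(q - w t) - (q - p)‖ := by congr 1; ring
      _ ≤ _ := norm_sub_le _ _
  linarith

namespace ChordArcMap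

variable {w : ℝ → ℂ} {v c d : ℝ} {p : ℂ}

theorem integral_kern_mul_sub (H : ChordArcMap w v c) (hd : 0 < d) (hm : ∀ t, d ≤ ‖p - w t‖)
    (hZ : (mass w p : ℂ) ≠ 0) (V : ℂ) :
    ∫ s, (kern w p s : ℂ) * (deriv w s - V) ∂circ = mass w p * (tangent w p - V) := by
  have hi : Integrable (fun s => (kern w p s : ℂ) * V) circ :=
    (H.integrable_kern hd hm).ofReal.mul_const V
  simp_rw [mul_sub]
  rw [integral_sub (H.integrable_kern_smul hd hm) hi, integral_mul_const,
    integral_complex_ofReal, tangent, show ∫ s, kern w p s ∂circ = mass w p from rfl]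
  field_simp

theorem hasFDerivAt_integral_kern (H : ChordArcMap w v c) (hd : 0 < d)
    (hm : ∀ t, d ≤ ‖p - w t‖) {g : ℝ → ℂ} (hg : Measurable g) {B : ℝ} (hB : ∀ s, ‖g s‖ ≤ B) :
    ∃ D : ℂ →L[ℝ] ℂ, HasFDerivAt (fun q => ∫ s, (kern w q s : ℂ) * g s ∂circ) D p ∧
      ‖D‖ ≤ 4 / d * ∫ s, kern w p s * ‖g s‖ ∂circ := by
  set F' : ℂ → ℝ → ℂ →L[ℝ] ℂ := fun x s =>
    ((-(4 * (‖x - w s‖ ^ 6)⁻¹)) • innerSL ℝ (x - w s)).smulRight (g s) with hF'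
  have hB0 : 0 ≤ B := (norm_nonneg _).trans (hB 0)
  have hw := H.continuous
  have hball : ∀ x ∈ ball p (d / 2), ∀ s, d / 2 ≤ ‖x - w s‖ := fun x hx => half_le_norm_sub hm hx
  have hbd : ∀ x, ∀ δ > 0, (∀ s, δ ≤ ‖x - w s‖) → ∀ s, ‖F' x s‖ ≤ 4 / δ * (kern w x s * ‖g s‖) := by
    intro x δ hδ h s
    rw [hF', ContinuousLinearMap.norm_smulRight_apply, ← mul_assoc]
    exact mul_le_mul_of_nonneg_right (norm_neg_smul_innerSL_le hδ (h s)) (norm_nonneg _)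
  have hF'm : AEStronglyMeasurable (F' p) circ := by
    have h1 : Continuous fun s => (-(4 * (‖p - w s‖ ^ 6)⁻¹)) • innerSL ℝ (p - w s) := by
      have h2 : Continuous fun s => innerSL ℝ (p - w s) :=
        (innerSL ℝ (E := ℂ)).continuous.comp (continuous_const.sub hw)
      have h3 : Continuous fun s => -(4 * (‖p - w s‖ ^ 6)⁻¹) := by
        refine (continuous_const.mul (Continuous.inv₀
          ((continuous_const.sub hw).norm.pow 6) fun s => ?_)).neg
        exact pow_ne_zero _ (hd.trans_le (hm s)).ne'
      exact h3.smul h2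
    exact (ContinuousLinearMap.smulRightL ℝ ℂ ℂ).aestronglyMeasurable_comp₂
      h1.aestronglyMeasurable hg.aestronglyMeasurable
  have key : HasFDerivAt (fun q => ∫ s, (kern w q s : ℂ) * g s ∂circ) (∫ s, F' p s ∂circ) p := by
    refine hasFDerivAt_integral_of_dominated_of_fderiv_le (s := ball p (d / 2))
      (bound := fun _ => 4 / (d / 2) * (((d / 2) ^ 4)⁻¹ * B)) (ball_mem_nhds _ (by positivity))
      (Eventually.of_forall fun q => ?_) ?_ hF'm (ae_of_all _ fun s x hx => ?_)
      (integrable_const _) (ae_of_all _ fun s x hx => ?_)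
    · exact ((Complex.measurable_ofReal.comp (H.measurable_kern q)).mul hg).aestronglyMeasurable
    · refine Integrable.of_bound ((Complex.measurable_ofReal.comp
        (H.measurable_kern p)).mul hg).aestronglyMeasurable ((d ^ 4)⁻¹ * B)
        (ae_of_all _ fun s => ?_)
      rw [norm_mul, Complex.norm_real, Real.norm_of_nonneg (kern_nonneg _ _ _)]
      exact mul_le_mul (kern_le hd hm s) (hB s) (norm_nonneg _) (by positivity)
    · refine (hbd x (d / 2) (by positivity) (hball x hx) s).trans ?_
      gcongr
      · exact kern_le (by positivity) (hball x hx) s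
      · exact hB s
    · have h1 : x ≠ w s := by
        intro h
        have := hball x hx s
        rw [h, sub_self, norm_zero] at this
        linarith
      have h2 := (hasFDerivAt_inv_norm_pow_four h1).smul_const (g s)
      simpa [kern, hF'] using h2
  refine ⟨_, key, (norm_integral_le_integral_norm _).trans ?_⟩
  rw [← integral_const_mul]
  refine integral_mono_of_nonneg (ae_of_all _ fun s => norm_nonneg _) ?_
    (ae_of_all _ (hbd p d hd hm))
  refine Integrable.const_mul ?_ _
  exact H.integrable_kern_mul hd hm hg.norm (B := B) (fun s => by rw [abs_norm]; exact hB s)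

/-- The averaged tangent is differentiable off the curve, with a gradient bound. -/
theorem exists_hasFDerivAt_tangent (H : ChordArcMap w v c) (hd : 0 < d)
    (hm : ∀ t, d ≤ ‖p - w t‖) (hZ : 0 < mass w p) :
    ∃ D : ℂ →L[ℝ] ℂ, HasFDerivAt (tangent w) D p ∧
      ‖D‖ ≤ 4 / d * √(v ^ 2 - ‖tangent w p‖ ^ 2) := by
  set V := tangent w p with hV
  obtain ⟨D₁, h1, hb1⟩ := H.hasFDerivAt_integral_kern hd hm (g := fun s => deriv w s - V)
    ((measurable_deriv w).sub_const V) (B := v + ‖V‖)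
    (fun s => (_root_.norm_sub_le _ _).trans (by gcongr; exact H.norm_deriv_le s))
  obtain ⟨D₂, h2, -⟩ := H.hasFDerivAt_integral_kern hd hm (g := fun s => (1 : ℂ))
    measurable_const (B := 1) (by simp)
  have e2 : (fun q => ∫ s, (kern w q s : ℂ) * 1 ∂circ) = fun q => (mass w q : ℂ) := by
    funext q
    rw [mass, ← integral_complex_ofReal]
    simp
  rw [e2] at h2
  have hZ' : (mass w p : ℂ) ≠ 0 := by exact_mod_cast hZ.ne'
  have hN0 : ∫ s, (kern w p s : ℂ) * (deriv w s - V) ∂circ = 0 := by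
    rw [H.integral_kern_mul_sub hd hm hZ', sub_self, mul_zero]
  have hinv : HasFDerivAt (fun q => ((mass w q : ℂ))⁻¹) (-(((mass w p : ℂ) ^ 2)⁻¹ • D₂)) p := by
    have := (hasDerivAt_inv hZ').comp_hasFDerivAt (𝕜 := ℝ) p h2
    simpa [Function.comp_def, neg_smul] using this
  have h3 := hinv.mul h1
  have h4 : HasFDerivAt (fun q => (mass w q : ℂ)⁻¹ *
      ∫ s, (kern w q s : ℂ) * (deriv w s - V) ∂circ) ((mass w p : ℂ)⁻¹ • D₁) p := by
    refine h3.congr_fderiv ?_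
    rw [hN0]
    simp
  have h5 : tangent w =ᶠ[𝓝 p] fun q => V + (mass w q : ℂ)⁻¹ *
      ∫ s, (kern w q s : ℂ) * (deriv w s - V) ∂circ := by
    have hne : ∀ᶠ q in 𝓝 p, (mass w q : ℂ) ≠ 0 := h2.continuousAt.eventually_ne hZ'
    filter_upwards [hne, ball_mem_nhds p (half_pos hd)] with q hq hqb
    have hm' := half_le_norm_sub hm hqb
    rw [H.integral_kern_mul_sub (half_pos hd) hm' hq]
    field_simp
    ring
  refine ⟨_, (h4.const_add V).congr_of_eventuallyEq h5, ?_⟩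
  have h6 := H.integral_kern_norm_le hd hm hZ
  rw [norm_smul, norm_inv, Complex.norm_real, Real.norm_of_nonneg hZ.le]
  calc (mass w p)⁻¹ * ‖D₁‖ ≤ (mass w p)⁻¹ * (4 / d * (mass w p * √(v ^ 2 - ‖V‖ ^ 2))) := by
        gcongr
        exact hb1.trans (by gcongr)
    _ = _ := by field_simp

end ChordArcMap

theorem intervalIntegrable_of_norm_le {E : Type*} [NormedAddCommGroup E] {g : ℝ → E}
    (hg : AEStronglyMeasurable g) {B : ℝ} (hB : ∀ t, ‖g t‖ ≤ B) (a b : ℝ) :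
    IntervalIntegrable g volume a b := by
  rw [intervalIntegrable_iff]
  exact IntegrableOn.of_bound (by simp [uIoc]) hg.restrict B (ae_of_all _ hB)

namespace ChordArcMap

variable {w : ℝ → ℂ} {v c d : ℝ} {p : ℂ}

theorem deriv_periodic (H : ChordArcMap w v c) : Function.Periodic (deriv w) (2 * π) := by
  intro t
  rw [← deriv_comp_add_const]
  congr 1
  funext x
  exact H.per x

theorem integral_flat_le (H : ChordArcMap w v c) {L s : ℝ} (hL : 0 < L) (hd : 0 < d)
    (hm : ∀ t, d ≤ ‖p - w t‖) (hs : ‖p - w s‖ = d) (hZ : 0 < mass w p) (hLd : L * d ≤ π) :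
    ∫ r in (-(L * d))..(L * d), ‖deriv w (s + r) - tangent w p‖ ≤
      (L * v + 1) ^ 4 * (4 * π / c) * √(v ^ 2 - ‖tangent w p‖ ^ 2) * d := by
  set V := tangent w p with hV
  have hv := H.v_pos
  have hc := H.c_pos
  have hmd := measurable_deriv w
  have hwm := H.continuous.measurable
  have hbd : ∀ t, ‖deriv w t - V‖ ≤ v + ‖V‖ := fun t =>
    (_root_.norm_sub_le _ _).trans (by gcongr; exact H.norm_deriv_le t)
  have hii : ∀ (g : ℝ → ℝ) (B : ℝ), Measurable g → (∀ t, |g t| ≤ B) → ∀ a b,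
      IntervalIntegrable g volume a b := fun g B hg hB a b =>
    intervalIntegrable_of_norm_le hg.aestronglyMeasurable hB a b
  set g : ℝ → ℝ := fun t => kern w p t * ‖deriv w t - V‖ with hg
  have hgm : Measurable g := (H.measurable_kern p).mul (hmd.sub_const V).norm
  have hg0 : ∀ t, 0 ≤ g t := fun t => mul_nonneg (kern_nonneg _ _ _) (norm_nonneg _)
  have hgB : ∀ t, |g t| ≤ (d ^ 4)⁻¹ * (v + ‖V‖) := by
    intro t
    rw [abs_of_nonneg (hg0 t)]
    exact mul_le_mul (kern_le hd hm t) (hbd t) (norm_nonneg _) (by positivity)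
  have hgper : Function.Periodic g (2 * π) := by
    intro t
    simp only [hg, kern, H.per, H.deriv_periodic t]
  have hK : 0 < ((L * v + 1) * d) ^ 4 := by positivity
  have hLd0 : 0 < L * d := by positivity
  calc ∫ r in (-(L * d))..(L * d), ‖deriv w (s + r) - V‖
      ≤ ∫ r in (-(L * d))..(L * d), ((L * v + 1) * d) ^ 4 * g (s + r) := by
        refine intervalIntegral.integral_mono_on (by linarith)
          (hii _ (v + ‖V‖) (by fun_prop) (fun t => by rw [abs_norm]; exact hbd _) _ _)
          (hii _ (((L * v + 1) * d) ^ 4 * ((d ^ 4)⁻¹ * (v + ‖V‖))) (by fun_prop) (fun t => ?_) _ _)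
          fun r hr => ?_
        · rw [abs_mul, abs_of_pos hK]
          gcongr
          exact hgB _
        · have h1 : ‖p - w (s + r)‖ ≤ (L * v + 1) * d := by
            have h2 := H.norm_sub_le s (s + r)
            have h3 : |s - (s + r)| ≤ L * d := by
              rw [abs_le]; constructor <;> linarith [hr.1, hr.2]
            calc ‖p - w (s + r)‖ = ‖(p - w s) + (w s - w (s + r))‖ := by congr 1; ring
              _ ≤ ‖p - w s‖ + ‖w s - w (s + r)‖ := norm_add_le _ _
              _ ≤ d + v * (L * d) := by rw [hs]; gcongr; exact h2.trans (by gcongr)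
              _ = _ := by ring
          have h4 : 0 < ‖p - w (s + r)‖ := hd.trans_le (hm _)
          have h5 : 1 ≤ ((L * v + 1) * d) ^ 4 * kern w p (s + r) := by
            rw [kern, ← div_eq_mul_inv, one_le_div (by positivity)]
            gcongr
          have := mul_le_mul_of_nonneg_right h5 (norm_nonneg (deriv w (s + r) - V))
          simpa only [hg, one_mul, mul_assoc] using this
    _ ≤ ∫ r in (-π)..π, ((L * v + 1) * d) ^ 4 * g (s + r) := by
        refine intervalIntegral.integral_mono_interval (by linarith) (by linarith) hLd
          (ae_of_all _ fun t => mul_nonneg hK.le (hg0 _)) ?_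
        refine hii _ (((L * v + 1) * d) ^ 4 * ((d ^ 4)⁻¹ * (v + ‖V‖))) (by fun_prop) (fun t =>
          ?_) _ _
        rw [abs_mul, abs_of_pos hK]
        gcongr
        exact hgB _
    _ = ((L * v + 1) * d) ^ 4 * ∫ t, g t ∂circ := by
        rw [intervalIntegral.integral_const_mul, intervalIntegral.integral_comp_add_left,
          circ, ← intervalIntegral.integral_of_le two_pi_pos.le]
        congr 1
        have := hgper.intervalIntegral_add_eq (s + -π) 0
        rwa [zero_add, show s + -π + 2 * π = s + π by ring] at this
    _ ≤ ((L * v + 1) * d) ^ 4 * (4 * π / (c * d ^ 3) * √(v ^ 2 - ‖V‖ ^ 2)) := by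
        gcongr
        exact (H.integral_kern_norm_le hd hm hZ).trans (by gcongr; exact H.mass_le hd hm hs)
    _ = _ := by field_simp

/-- Near a nearest point the curve is almost a straight segment in the direction of the averaged
tangent. -/
theorem exists_flat (H : ChordArcMap w v c)
    (hS : sobolevSeminorm (1 / 2) (fun θ => deriv w θ) < ⊤) {L η : ℝ} (hL : 0 < L) (hη : 0 < η) :
    ∃ d₀ > 0, ∀ (p : ℂ) (d s : ℝ), 0 < d → d < d₀ → (∀ t, d ≤ ‖p - w t‖) → ‖p - w s‖ = d →
      0 < mass w p ∧ v / 2 ≤ ‖tangent w p‖ ∧ L * d ≤ π ∧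
      ∫ r in (-(L * d))..(L * d), ‖deriv w (s + r) - tangent w p‖ ≤ η * d := by
  have hv := H.v_pos
  have hc := H.c_pos
  set K := (L * v + 1) ^ 4 * (4 * π / c) with hK
  have hK0 : 0 < K := by positivity
  obtain ⟨d₁, hd₁, h1⟩ := H.exists_defect_le hS (ε := min ((η / K) ^ 2) (3 / 4 * v ^ 2))
    (by positivity)
  refine ⟨min d₁ (min (π / L) (2 * π * v)), by positivity, fun p d s hd hdd hm hs => ?_⟩
  have h2 := h1 p d s hd (hdd.trans_le (min_le_left _ _)) hm hs
  have h3 : d ≤ π / L := hdd.le.trans ((min_le_right _ _).trans (min_le_left _ _))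
  have h4 : d ≤ 2 * π * v := hdd.le.trans ((min_le_right _ _).trans (min_le_right _ _))
  have hZ : 0 < mass w p := lt_of_lt_of_le (by positivity) (H.mass_ge hd hm hs h4)
  have hLd : L * d ≤ π := by rw [le_div_iff₀ hL] at h3; linarith
  refine ⟨hZ, ?_, hLd, ?_⟩
  · have := h2.trans (min_le_right _ _)
    refine le_of_sq_le_sq ?_ (norm_nonneg _)
    nlinarith
  · refine (H.integral_flat_le hL hd hm hs hZ hLd).trans ?_
    have h5 : √(v ^ 2 - ‖tangent w p‖ ^ 2) ≤ η / K := by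
      rw [Real.sqrt_le_left (by positivity)]
      exact h2.trans (min_le_left _ _)
    calc K * √(v ^ 2 - ‖tangent w p‖ ^ 2) * d ≤ K * (η / K) * d := by gcongr
      _ = η * d := by field_simp

theorem norm_sub_sub_le_of_flat (H : ChordArcMap w v c) {R B s r : ℝ} {V : ℂ}
    (hB : ∫ r in (-R)..R, ‖deriv w (s + r) - V‖ ≤ B) (hr : |r| ≤ R) :
    ‖w (s + r) - w s - r * V‖ ≤ B := by
  have hR : 0 ≤ R := (abs_nonneg r).trans hr
  have hmd := measurable_deriv w
  have hbd : ∀ t, ‖deriv w t - V‖ ≤ v + ‖V‖ := fun t =>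
    (_root_.norm_sub_le _ _).trans (by gcongr; exact H.norm_deriv_le t)
  have hi : ∀ a b, IntervalIntegrable (fun t => deriv w (s + t) - V) volume a b :=
    intervalIntegrable_of_norm_le (Measurable.aestronglyMeasurable (by fun_prop)) fun t => hbd _
  have hi2 : ∀ a b, IntervalIntegrable (fun t => deriv w (s + t)) volume a b :=
    intervalIntegrable_of_norm_le (Measurable.aestronglyMeasurable (by fun_prop))
      fun t => H.norm_deriv_le _
  have e : w (s + r) - w s - r * V = ∫ t in (0 : ℝ)..r, (deriv w (s + t) - V) := by
    rw [intervalIntegral.integral_sub (hi2 _ _) (by simp),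
      intervalIntegral.integral_comp_add_left (fun t => deriv w t),
      integral_deriv_of_lipschitzWith H.lipschitz]
    simp
  rw [e]
  have h1 := intervalIntegral.norm_integral_le_abs_integral_norm (f := fun t => deriv w (s + t) - V)
    (a := 0) (b := r) (μ := volume)
  refine h1.trans (le_trans ?_ hB)
  have hr' := abs_le.1 hr
  rcases le_total 0 r with h | h
  · rw [abs_of_nonneg (intervalIntegral.integral_nonneg h fun _ _ => norm_nonneg _)]
    exact intervalIntegral.integral_mono_interval (by linarith) h hr'.2
      (ae_of_all _ fun _ => norm_nonneg _) (hi _ _).norm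
  · rw [intervalIntegral.integral_symm, abs_neg,
      abs_of_nonneg (intervalIntegral.integral_nonneg h fun _ _ => norm_nonneg _)]
    exact intervalIntegral.integral_mono_interval hr'.1 h hR
      (ae_of_all _ fun _ => norm_nonneg _) (hi _ _).norm

end ChordArcMap

/-- The Cauchy integral `∫ dw / (w - p)` along the closed curve `w`. -/
noncomputable def windInt (w : ℝ → ℂ) (p : ℂ) : ℂ := ∫ s in 0..2 * π, deriv w s / (w s - p)

namespace ChordArcMap

variable {w : ℝ → ℂ} {v c d : ℝ} {p : ℂ}

theorem lipschitzWith_inv_sub (H : ChordArcMap w v c) (hd : 0 < d) (hm : ∀ t, d ≤ ‖p - w t‖) :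
    LipschitzWith (Real.toNNReal (v / d ^ 2)) fun s => (w s - p)⁻¹ := by
  have hv := H.v_pos
  refine LipschitzWith.of_dist_le_mul fun x y => ?_
  have hx : d ≤ ‖w x - p‖ := by rw [norm_sub_rev]; exact hm x
  have hy : d ≤ ‖w y - p‖ := by rw [norm_sub_rev]; exact hm y
  have hx0 : w x - p ≠ 0 := norm_pos_iff.1 (hd.trans_le hx)
  have hy0 : w y - p ≠ 0 := norm_pos_iff.1 (hd.trans_le hy)
  have h1 := H.norm_sub_le y x
  rw [Real.coe_toNNReal _ (by positivity), dist_eq_norm, inv_sub_inv hx0 hy0, norm_div, norm_mul,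
    Real.dist_eq]
  calc ‖w y - p - (w x - p)‖ / (‖w x - p‖ * ‖w y - p‖) ≤ (v * |y - x|) / (d * d) := by
        gcongr
        simpa using h1
    _ = v / d ^ 2 * |x - y| := by rw [abs_sub_comm]; ring

theorem integral_deriv_div_sq (H : ChordArcMap w v c) (hd : 0 < d) (hm : ∀ t, d ≤ ‖p - w t‖) :
    ∫ s in 0..2 * π, deriv w s / (w s - p) ^ 2 = 0 := by
  have hne : ∀ s, w s - p ≠ 0 := fun s => by
    rw [← norm_pos_iff, norm_sub_rev]; exact hd.trans_le (hm s)
  have h1 := integral_deriv_of_lipschitzWith (H.lipschitzWith_inv_sub hd hm) 0 (2 * π)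
  have h2 : w (2 * π) = w 0 := by simpa using H.per 0
  rw [h2, sub_self] at h1
  have h3 : ∫ s in 0..2 * π, deriv (fun s => (w s - p)⁻¹) s =
      ∫ s in 0..2 * π, -(deriv w s / (w s - p) ^ 2) := by
    refine intervalIntegral.integral_congr_ae ?_
    filter_upwards [H.lipschitz.ae_differentiableAt] with s hs _
    have := (hs.hasDerivAt.sub_const p).inv (hne s)
    rw [← neg_div]
    exact this.deriv
  rw [h3, intervalIntegral.integral_neg, neg_eq_zero] at h1
  exact h1

theorem hasDerivAt_windInt (H : ChordArcMap w v c) (hd : 0 < d) (hm : ∀ t, d ≤ ‖p - w t‖) :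
    HasDerivAt (windInt w) 0 p := by
  have hmd := measurable_deriv w
  have hwm := H.continuous.measurable
  have hv := H.v_pos
  rw [← H.integral_deriv_div_sq hd hm]
  refine (intervalIntegral.hasDerivAt_integral_of_dominated_loc_of_deriv_le (μ := volume)
    (F := fun q s => deriv w s / (w s - q)) (F' := fun q s => deriv w s / (w s - q) ^ 2)
    (s := ball p (d / 2)) (bound := fun _ => v / (d / 2) ^ 2) (ball_mem_nhds _ (by positivity))
    (Eventually.of_forall fun q => Measurable.aestronglyMeasurable (by fun_prop)) ?_
    (Measurable.aestronglyMeasurable (by fun_prop)) (ae_of_all _ fun s _ q hq => ?_) (by simp)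
    (ae_of_all _ fun s _ q hq => ?_)).2
  · refine intervalIntegrable_of_norm_le (Measurable.aestronglyMeasurable (by fun_prop))
      (B := v / d) (fun s => ?_) _ _
    rw [norm_div, norm_sub_rev]
    have := hm s
    have := H.norm_deriv_le s
    gcongr
  · rw [norm_div, norm_pow, norm_sub_rev]
    have := half_le_norm_sub hm hq s
    have := H.norm_deriv_le s
    gcongr
  · have h0 : w s - q ≠ 0 := by
      rw [← norm_pos_iff, norm_sub_rev]
      exact (half_pos hd).trans_le (half_le_norm_sub hm hq s)
    refine (((hasDerivAt_id q).const_sub (w s)).inv h0).const_mul (deriv w s) |>.congr_deriv ?_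
      |>.congr_of_eventuallyEq (Eventually.of_forall fun _ => rfl)
    simp [div_eq_mul_inv]

theorem exists_dist (H : ChordArcMap w v c) (p : ℂ) : ∃ s, ∀ t, ‖p - w s‖ ≤ ‖p - w t‖ := by
  have hw := H.continuous
  obtain ⟨s, -, hs⟩ := (isCompact_Icc (a := (0 : ℝ)) (b := 2 * π)).exists_isMinOn
    ⟨0, by simp [pi_pos.le]⟩ (f := fun t => ‖p - w t‖) (by fun_prop)
  refine ⟨s, fun t => ?_⟩
  obtain ⟨n, t', ht', rfl⟩ := exists_eq_add_int_mul t
  have h1 : w (t' + n * (2 * π)) = w t' := by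
    simpa using map_add_int_mul (c := (0 : ℂ)) (f := w) (by simpa using H.per) n t'
  rw [h1]
  exact hs (Ico_subset_Icc_self ht')

theorem exists_nearest (H : ChordArcMap w v c) (hp : p ∉ range w) :
    ∃ d s, 0 < d ∧ (∀ t, d ≤ ‖p - w t‖) ∧ ‖p - w s‖ = d := by
  obtain ⟨s, hs⟩ := H.exists_dist p
  exact ⟨‖p - w s‖, s, norm_pos_iff.2 (sub_ne_zero.2 fun h => hp ⟨s, h.symm⟩), hs, rfl⟩

theorem exists_windInt_eq (H : ChordArcMap w v c) {U : Set ℂ} (hU : IsOpen U)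
    (hc : IsPreconnected U) (hd : Disjoint U (range w)) : ∃ κ, ∀ p ∈ U, windInt w p = κ := by
  have h1 : ∀ p ∈ U, HasDerivAt (windInt w) 0 p := fun p hp => by
    obtain ⟨d, s, hd0, hm, -⟩ := H.exists_nearest (disjoint_left.1 hd hp)
    exact H.hasDerivAt_windInt hd0 hm
  exact hU.exists_is_const_of_deriv_eq_zero hc
    (fun p hp => (h1 p hp).differentiableAt.differentiableWithinAt) fun p hp => (h1 p hp).deriv

theorem windInt_eq_zero (H : ChordArcMap w v c) {U : Set ℂ} (hU : IsOpen U)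
    (hc : IsPreconnected U) (hd : Disjoint U (range w)) (hb : ¬ Bornology.IsBounded U) {p : ℂ}
    (hp : p ∈ U) : windInt w p = 0 := by
  obtain ⟨κ, hκ⟩ := H.exists_windInt_eq hU hc hd
  have hv := H.v_pos
  rw [hκ p hp]
  by_contra hne
  have hκ0 : 0 < ‖κ‖ := norm_pos_iff.2 hne
  obtain ⟨C, hC, hwC⟩ := exists_norm_le_of_periodic H.continuous H.per
  refine hb ((isBounded_iff_forall_norm_le).2 ⟨C + 2 * π * v / ‖κ‖, fun q hq => ?_⟩)
  by_contra! hlt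
  have h0 : 0 < 2 * π * v / ‖κ‖ := by positivity
  set D := ‖q‖ - C with hD
  have hD0 : 2 * π * v / ‖κ‖ < D := by linarith
  have h2 : ∀ s, D ≤ ‖w s - q‖ := fun s => by
    have := norm_sub_norm_le q (w s)
    rw [norm_sub_rev] at this
    linarith [hwC s]
  have h3 : ‖windInt w q‖ ≤ v / D * |2 * π - 0| := by
    refine intervalIntegral.norm_integral_le_of_norm_le_const fun s _ => ?_
    rw [norm_div]
    have := H.norm_deriv_le s
    have := h2 s
    gcongr
    linarith
  rw [hκ q hq, sub_zero, abs_of_pos two_pi_pos] at h3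
  rw [div_lt_iff₀ hκ0] at hD0
  rw [div_mul_eq_mul_div, le_div_iff₀ (by linarith)] at h3
  linarith

end ChordArcMap

theorem norm_integral_le_of_inv_sq {g : ℝ → ℂ} {K R b : ℝ} (hR : 0 < R) (hRb : R ≤ b)
    (hK : 0 ≤ K) (hg : ∀ r, R ≤ r → r ≤ b → ‖g r‖ ≤ K * (r ^ 2)⁻¹) :
    ‖∫ r in R..b, g r‖ ≤ K / R := by
  have hne : ∀ r ∈ uIcc R b, r ≠ 0 := fun r hr => by
    rw [uIcc_of_le hRb] at hr; exact (hR.trans_le hr.1).ne'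
  have hi : IntervalIntegrable (fun r : ℝ => K * (r ^ 2)⁻¹) volume R b := by
    refine ContinuousOn.intervalIntegrable ?_
    exact continuousOn_const.mul ((continuousOn_pow 2).inv₀ fun r hr => pow_ne_zero _ (hne r hr))
  refine (intervalIntegral.norm_integral_le_of_norm_le hRb (ae_of_all _ fun r hr =>
    hg r hr.1.le hr.2) hi).trans ?_
  have h1 : ∫ r in R..b, K * (r ^ 2)⁻¹ = -K * b⁻¹ - -K * R⁻¹ := by
    refine intervalIntegral.integral_eq_sub_of_hasDerivAt (f := fun r => -K * r⁻¹)
      (fun r hr => ?_) hi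
    refine ((hasDerivAt_inv (hne r hr)).const_mul (-K)).congr_deriv ?_
    ring
  rw [h1]
  have : 0 ≤ K * b⁻¹ := mul_nonneg hK (inv_nonneg.2 (hR.le.trans hRb))
  rw [div_eq_mul_inv]
  linarith

/-- The argument of an almost straight path increases by a definite amount across a point
close to it. -/
theorem re_integral_pos {q : ℝ → ℂ} {h R B : ℝ} (hqc : Continuous q) (hh : 0 < h)
    (hR : h ≤ R) (hRπ : R ≤ π) (h1 : ∀ r, |r| ≤ R → ‖q r - r‖ ≤ h / 200)
    (h2 : ∫ r in (-R)..R, ‖deriv q r - 1‖ ≤ h / 200)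
    (h3 : ∀ r, R ≤ |r| → |r| ≤ π → B * r ^ 2 ≤ ‖q r ^ 2 + h ^ 2‖)
    (hK : ∀ r, ‖deriv q r‖ ≤ 2) (hB : 200 * h ≤ B * R)
    (h0 : ∀ r, q r ^ 2 + h ^ 2 ≠ 0) :
    0 < (∫ r in (-π)..π, 2 * h * deriv q r / (q r ^ 2 + h ^ 2)).re := by
  have hR0 : 0 < R := hh.trans_le hR
  have hB0 : 0 < B := pos_of_mul_pos_left (by linarith) hR0.le
  have hmd := measurable_deriv q
  set D : ℝ → ℂ := fun r => q r ^ 2 + h ^ 2 with hD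
  have hDc : Continuous D := by fun_prop
  have hinv : Continuous fun r => 2 * (h : ℂ) / D r := continuous_const.div hDc h0
  have hi : ∀ a b, IntervalIntegrable (fun r => 2 * h * deriv q r / D r) volume a b := by
    intro a b
    have h4 : IntervalIntegrable (deriv q) volume a b :=
      intervalIntegrable_of_norm_le hmd.aestronglyMeasurable hK a b
    refine (h4.continuousOn_mul (g := fun r => 2 * (h : ℂ) / D r) hinv.continuousOn).congr
      fun r _ => ?_
    ring
  have hsplit : ∫ r in (-π)..π, 2 * h * deriv q r / D r =
      (∫ r in (-π)..(-R), 2 * h * deriv q r / D r) + (∫ r in (-R)..R, 2 * h * deriv q r / D r) +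
      ∫ r in R..π, 2 * h * deriv q r / D r := by
    rw [intervalIntegral.integral_add_adjacent_intervals (hi _ _) (hi _ _),
      intervalIntegral.integral_add_adjacent_intervals (hi _ _) (hi _ _)]
  have htail : ∀ r, R ≤ |r| → |r| ≤ π → ‖2 * h * deriv q r / D r‖ ≤ 4 * h / B * (r ^ 2)⁻¹ := by
    intro r hr hrπ
    have hr0 : 0 < r ^ 2 := by
      rw [← sq_abs]
      have := hR0.trans_le hr
      positivity
    rw [norm_div, norm_mul, norm_mul, Complex.norm_real, Real.norm_of_nonneg hh.le,
      Complex.norm_two]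
    calc 2 * h * ‖deriv q r‖ / ‖D r‖ ≤ 2 * h * 2 / (B * r ^ 2) := by
          gcongr
          · exact hK r
          · exact h3 r hr hrπ
      _ = _ := by field_simp; norm_num
  have ht0 : 4 * h / B / R ≤ 1 / 50 := by
    rw [div_div, div_le_div_iff₀ (by positivity) (by norm_num)]
    linarith
  have ht1 : ‖∫ r in R..π, 2 * h * deriv q r / D r‖ ≤ 1 / 50 :=
    (norm_integral_le_of_inv_sq hR0 hRπ (by positivity) fun r hr hrπ => htail r
      (by rw [abs_of_pos (hR0.trans_le hr)]; exact hr)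
      (by rw [abs_of_pos (hR0.trans_le hr)]; exact hrπ)).trans ht0
  have ht2 : ‖∫ r in (-π)..(-R), 2 * h * deriv q r / D r‖ ≤ 1 / 50 := by
    rw [← intervalIntegral.integral_comp_neg]
    refine (norm_integral_le_of_inv_sq hR0 hRπ (K := 4 * h / B) (by positivity)
      fun r hr hrπ => ?_).trans ht0
    have := htail (-r) (by rw [abs_neg, abs_of_pos (hR0.trans_le hr)]; exact hr)
      (by rw [abs_neg, abs_of_pos (hR0.trans_le hr)]; exact hrπ)
    simpa using this
  have hlow : ∀ r, |r| ≤ R → h ^ 2 / 4 ≤ ‖D r‖ := by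
    intro r hr
    have e : D r = (q r - Complex.I * h) * (q r + Complex.I * h) := by
      have : Complex.I ^ 2 = -1 := Complex.I_sq
      simp only [hD]
      linear_combination ((h : ℂ) ^ 2) * this
    have h5 : ∀ σ : ℝ, |σ| = 1 → h / 2 ≤ ‖q r + Complex.I * (σ * h)‖ := by
      intro σ hσ
      have h6 : h ≤ ‖(r : ℂ) + Complex.I * (σ * h)‖ := by
        have := Complex.abs_im_le_norm ((r : ℂ) + Complex.I * (σ * h))
        simp only [Complex.add_im, Complex.ofReal_im, Complex.mul_im, Complex.I_re, Complex.I_im,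
          Complex.mul_re, Complex.ofReal_re] at this
        norm_num at this
        rwa [hσ, one_mul, abs_of_pos hh] at this
      have h7 : ‖(r : ℂ) + Complex.I * (σ * h)‖ ≤ ‖q r + Complex.I * (σ * h)‖ + ‖q r - r‖ := by
        calc ‖(r : ℂ) + Complex.I * (σ * h)‖
            = ‖(q r + Complex.I * (σ * h)) - (q r - r)‖ := by congr 1; ring
          _ ≤ _ := norm_sub_le _ _
      have := h1 r hr
      linarith
    rw [e, norm_mul]
    have h8 := h5 1 (by simp)
    have h9 := h5 (-1) (by simp)
    rw [Complex.ofReal_one, one_mul] at h8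
    rw [Complex.ofReal_neg, Complex.ofReal_one, neg_one_mul, mul_neg, ← sub_eq_add_neg] at h9
    calc h ^ 2 / 4 = (h / 2) * (h / 2) := by ring
      _ ≤ _ := by gcongr
  have hre : ∀ r, |r| ≤ R → 3 / 4 * h ^ 2 ≤ (D r).re := by
    intro r hr
    have h4 := (Complex.abs_im_le_norm (q r - r)).trans (h1 r hr)
    simp only [Complex.sub_im, Complex.ofReal_im, sub_zero] at h4
    have h5 : (D r).re = (q r).re ^ 2 - (q r).im ^ 2 + h ^ 2 := by
      simp [hD, pow_two, Complex.add_re, Complex.mul_re]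
    have h6 : (q r).im ^ 2 ≤ (h / 200) ^ 2 := sq_le_sq' (by linarith [abs_le.1 h4]) (abs_le.1 h4).2
    rw [h5]
    nlinarith [sq_nonneg (q r).re]
  set m : ℝ → ℝ := fun r => (2 * (h : ℂ) / D r).re with hm
  have hmc : Continuous m := Complex.continuous_re.comp hinv
  have hmeq : ∀ r, m r = 2 * h * (D r).re / ‖D r‖ ^ 2 := by
    intro r
    simp only [hm]
    rw [Complex.div_re, Complex.normSq_eq_norm_sq]
    simp
  have hm0 : ∀ r, |r| ≤ R → 0 ≤ m r := by
    intro r hr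
    rw [hmeq]
    have := hre r hr
    have : 0 ≤ (D r).re := le_trans (by positivity) this
    positivity
  have hmh : ∀ r, |r| ≤ h → 3 / (50 * h) ≤ m r := by
    intro r hr
    have h4 : ‖D r‖ ≤ 5 * h ^ 2 := by
      have h5 : ‖q r‖ ≤ h + h / 200 := by
        calc ‖q r‖ = ‖(r : ℂ) + (q r - r)‖ := by congr 1; ring
          _ ≤ ‖(r : ℂ)‖ + ‖q r - r‖ := norm_add_le _ _
          _ ≤ _ := add_le_add (by rw [Complex.norm_real]; exact hr) (h1 r (hr.trans hR))
      calc ‖D r‖ ≤ ‖q r ^ 2‖ + ‖(h : ℂ) ^ 2‖ := norm_add_le _ _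
        _ = ‖q r‖ ^ 2 + h ^ 2 := by
            rw [norm_pow, norm_pow, Complex.norm_real, Real.norm_of_nonneg hh.le]
        _ ≤ (h + h / 200) ^ 2 + h ^ 2 := by gcongr
        _ ≤ _ := by nlinarith
    have h5 : 0 < ‖D r‖ := norm_pos_iff.2 (h0 r)
    rw [hmeq]
    calc 3 / (50 * h) ≤ 2 * h * (3 / 4 * h ^ 2) / (5 * h ^ 2) ^ 2 := by
          rw [div_le_div_iff₀ (by positivity) (by positivity)]
          ring_nf
          nlinarith [pow_pos hh 4]
      _ ≤ _ := by
          have := hre r (hr.trans hR)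
          have h6 : 0 ≤ (D r).re := le_trans (by positivity) this
          gcongr
  have hmain1 : 3 / 25 ≤ ∫ r in (-R)..R, m r := by
    calc (3 / 25 : ℝ) = ∫ r in (-h)..h, 3 / (50 * h) := by
          rw [intervalIntegral.integral_const, smul_eq_mul]
          field_simp
          norm_num
      _ ≤ ∫ r in (-h)..h, m r := by
          refine intervalIntegral.integral_mono_on (by linarith) (by simp)
            (hmc.intervalIntegrable _ _) fun r hr => hmh r (abs_le.2 ⟨by linarith [hr.1], hr.2⟩)
      _ ≤ ∫ r in (-R)..R, m r := by
          refine intervalIntegral.integral_mono_interval (by linarith) (by linarith) hR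
            ?_ (hmc.intervalIntegrable _ _)
          refine (ae_restrict_mem measurableSet_Ioc).mono fun r hr => hm0 r ?_
          exact abs_le.2 ⟨by linarith [hr.1], hr.2⟩
  have hmain2 : (∫ r in (-R)..R, 2 * (h : ℂ) / D r).re = ∫ r in (-R)..R, m r := by
    have := Complex.reCLM.intervalIntegral_comp_comm
      (hinv.intervalIntegrable (μ := volume) (-R) R)
    exact this.symm
  have herr : ‖∫ r in (-R)..R, (2 * h * deriv q r / D r - 2 * h / D r)‖ ≤ 8 / 200 := by
    have hid : IntervalIntegrable (fun r => ‖deriv q r - 1‖) volume (-R) R :=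
      ((intervalIntegrable_of_norm_le hmd.aestronglyMeasurable hK _ _).sub (by simp)).norm
    refine (intervalIntegral.norm_integral_le_of_norm_le (by linarith) (ae_of_all _ fun r hr => ?_)
      (hid.const_mul (8 / h))).trans ?_
    · have hr' : |r| ≤ R := abs_le.2 ⟨by linarith [hr.1], hr.2⟩
      have h4 := hlow r hr'
      rw [← sub_div, ← mul_sub_one, norm_div, norm_mul, norm_mul, Complex.norm_real,
        Real.norm_of_nonneg hh.le, Complex.norm_two]
      calc 2 * h * ‖deriv q r - 1‖ / ‖D r‖ ≤ 2 * h * ‖deriv q r - 1‖ / (h ^ 2 / 4) := by gcongr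
        _ = _ := by field_simp; ring
    · rw [intervalIntegral.integral_const_mul]
      calc 8 / h * ∫ r in (-R)..R, ‖deriv q r - 1‖ ≤ 8 / h * (h / 200) := by gcongr
        _ = _ := by field_simp
  rw [intervalIntegral.integral_sub (hi _ _) (hinv.intervalIntegrable _ _)] at herr
  have e1 := (Complex.abs_re_le_norm _).trans herr
  have e2 := (Complex.abs_re_le_norm _).trans ht1
  have e3 := (Complex.abs_re_le_norm _).trans ht2
  rw [Complex.sub_re, hmain2] at e1
  rw [hsplit, Complex.add_re, Complex.add_re]
  have e1 := (abs_le.1 e1).1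
  have e2 := (abs_le.1 e2).1
  have e3 := (abs_le.1 e3).1
  linarith

namespace ChordArcMap

variable {w : ℝ → ℂ} {v c d : ℝ} {p : ℂ}

theorem map_add_int (H : ChordArcMap w v c) (n : ℤ) (t : ℝ) : w (t + n * (2 * π)) = w t := by
  simpa using map_add_int_mul (c := (0 : ℂ)) (f := w) (by simpa using H.per) n t

theorem exists_eq_add_of_mem_range (H : ChordArcMap w v c) {x : ℂ} (hx : x ∈ range w) (s : ℝ) :
    ∃ r, |r| ≤ π ∧ x = w (s + r) := by
  obtain ⟨t, rfl⟩ := hx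
  obtain ⟨n, t', ht', h⟩ := exists_eq_add_int_mul (t - s + π)
  refine ⟨t' - π, abs_le.2 ⟨by linarith [ht'.1], by linarith [ht'.2]⟩, ?_⟩
  rw [← H.map_add_int n (s + (t' - π))]
  congr 1
  linarith

theorem abs_im_le_of_flat (H : ChordArcMap w v c) {L N B s : ℝ} {x : ℂ}
    (hd : 0 < d) (hm : ∀ t, d ≤ ‖p - w t‖) (hs : ‖p - w s‖ = d) (hV : tangent w p ≠ 0)
    (hN : 2 * N / c ≤ L)
    (hB : ∫ r in (-(L * d))..(L * d), ‖deriv w (s + r) - tangent w p‖ ≤ B)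
    (hx : x ∈ range w) (hxp : ‖x - p‖ ≤ N * d) :
    |((x - w s) * (starRingEnd ℂ) (tangent w p / ‖tangent w p‖)).im| ≤ B := by
  have hc := H.c_pos
  set V := tangent w p
  obtain ⟨r, hr, rfl⟩ := H.exists_eq_add_of_mem_range hx s
  have h1 := H.norm_sub_ge_of_nearest hm hs hr
  rw [norm_sub_rev] at h1
  have h2 : |r| ≤ L * d := by
    have h3 : |r| ≤ 2 * N / c * d := by
      rw [div_mul_eq_mul_div, le_div_iff₀ hc]
      linarith
    exact h3.trans (by gcongr)
  have h4 := H.norm_sub_sub_le_of_flat hB h2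
  have hVn : (‖V‖ : ℂ) ≠ 0 := by exact_mod_cast (norm_pos_iff.2 hV).ne'
  have h5 : ((w (s + r) - w s) * (starRingEnd ℂ) (V / ‖V‖)).im =
      ((w (s + r) - w s - r * V) * (starRingEnd ℂ) (V / ‖V‖)).im := by
    have e : (r : ℂ) * V * (starRingEnd ℂ) (V / ‖V‖) = ((r * ‖V‖ : ℝ) : ℂ) := by
      rw [map_div₀, Complex.conj_ofReal, mul_div_assoc', mul_assoc, Complex.mul_conj']
      push_cast
      field_simp
    rw [sub_mul _ ((r : ℂ) * V), Complex.sub_im, e, Complex.ofReal_im, sub_zero]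
  rw [h5]
  refine (Complex.abs_im_le_norm _).trans ?_
  rw [norm_mul, RCLike.norm_conj, norm_div, Complex.norm_real, norm_norm,
    div_self (norm_pos_iff.2 hV).ne', mul_one]
  exact h4

/-- The Cauchy integral jumps across the curve, near a nearest point. -/
theorem im_windInt_sub_pos (H : ChordArcMap w v c) {L s : ℝ}
    (hd : 0 < d) (hm : ∀ t, d ≤ ‖p - w t‖) (hs : ‖p - w s‖ = d)
    (hV : v / 2 ≤ ‖tangent w p‖) (hVv : ‖tangent w p‖ ≤ v)
    (hL : 6 / c + 400 * v / c ^ 2 + 2 / v ≤ L) (hLd : L * d ≤ π)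
    (hB : ∫ r in (-(L * d))..(L * d), ‖deriv w (s + r) - tangent w p‖ ≤ d / 400) :
    0 < (windInt w (w s + Complex.I * (d / v : ℝ) * tangent w p) -
      windInt w (w s - Complex.I * (d / v : ℝ) * tangent w p)).im ∧
    w s + Complex.I * (d / v : ℝ) * tangent w p ∉ range w ∧
    w s - Complex.I * (d / v : ℝ) * tangent w p ∉ range w := by
  have hc := H.c_pos
  have hv := H.v_pos
  have hw := H.continuous
  have hmd := measurable_deriv w
  set V := tangent w p with hVdef
  have hVn : 0 < ‖V‖ := by linarith
  have hV0 : V ≠ 0 := norm_pos_iff.1 hVn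
  have hVn' : (‖V‖ : ℂ) ≠ 0 := by exact_mod_cast hVn.ne'
  set h := d / v with hh
  have hh0 : 0 < h := by positivity
  have hL1 : 6 / c ≤ L := by
    have : 0 ≤ 400 * v / c ^ 2 + 2 / v := by positivity
    linarith
  have hL2 : 400 * v / c ^ 2 ≤ L := by
    have : 0 ≤ 6 / c + 2 / v := by positivity
    linarith
  have hL3 : 2 / v ≤ L := by
    have : 0 ≤ 6 / c + 400 * v / c ^ 2 := by positivity
    linarith
  have hL0 : 0 < L := lt_of_lt_of_le (by positivity) hL1
  have hout : ∀ σ : ℝ, |σ| = 1 → w s + σ * (Complex.I * h * V) ∉ range w := by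
    intro σ hσ hmem
    have h1 : ‖w s + σ * (Complex.I * h * V) - p‖ ≤ 3 * d := by
      calc ‖w s + σ * (Complex.I * h * V) - p‖ = ‖(σ : ℂ) * (Complex.I * h * V) - (p - w s)‖ := by
            congr 1; ring
        _ ≤ ‖(σ : ℂ) * (Complex.I * h * V)‖ + ‖p - w s‖ := _root_.norm_sub_le _ _
        _ = h * ‖V‖ + d := by
            rw [hs, norm_mul, norm_mul, norm_mul, Complex.norm_real, Complex.norm_real,
              Real.norm_eq_abs, hσ, Complex.norm_I, Real.norm_of_nonneg hh0.le]
            ring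
        _ ≤ h * v + d := by gcongr
        _ = 2 * d := by rw [hh]; field_simp; norm_num
        _ ≤ _ := by linarith
    have h2 := H.abs_im_le_of_flat hd hm hs hV0 (N := 3) (by norm_num; exact hL1) hB hmem h1
    have e : (w s + σ * (Complex.I * h * V) - w s) * (starRingEnd ℂ) (V / ‖V‖) =
        Complex.I * ((σ * h * ‖V‖ : ℝ) : ℂ) := by
      rw [add_sub_cancel_left, map_div₀, Complex.conj_ofReal, mul_div_assoc', div_eq_iff hVn']
      have := Complex.mul_conj' V
      push_cast
      linear_combination (σ * Complex.I * h) * this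
    rw [e, Complex.I_mul_im, Complex.ofReal_re, abs_mul, abs_mul, hσ, one_mul, abs_of_pos hh0,
      abs_of_pos hVn] at h2
    have h3 : h * (v / 2) ≤ h * ‖V‖ := by gcongr
    have h4 : h * (v / 2) = d / 2 := by rw [hh]; field_simp
    linarith
  have hp1 : w s + Complex.I * h * V ∉ range w := by simpa using hout 1 (by simp)
  have hp2 : w s - Complex.I * h * V ∉ range w := by
    simpa [sub_eq_add_neg] using hout (-1) (by simp)
  refine ⟨?_, hp1, hp2⟩
  set q : ℝ → ℂ := fun r => (w (s + r) - w s) / V with hq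
  have hdq : ∀ r, deriv q r = deriv w (s + r) / V := by
    intro r
    simp only [hq]
    rw [deriv_div_const, deriv_sub_const, deriv_comp_const_add]
  have hqc : Continuous q := by fun_prop
  have hm1 : ∀ r, w (s + r) - (w s + Complex.I * h * V) = V * (q r - Complex.I * h) := by
    intro r; simp only [hq]; field_simp; ring
  have hm2 : ∀ r, w (s + r) - (w s - Complex.I * h * V) = V * (q r + Complex.I * h) := by
    intro r; simp only [hq]; field_simp; ring
  have hn1 : ∀ r, q r - Complex.I * h ≠ 0 := fun r h0 => hp1 ⟨s + r, by
    have := hm1 r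
    rwa [h0, mul_zero, sub_eq_zero] at this⟩
  have hn2 : ∀ r, q r + Complex.I * h ≠ 0 := fun r h0 => hp2 ⟨s + r, by
    have := hm2 r
    rwa [h0, mul_zero, sub_eq_zero] at this⟩
  have hfac : ∀ r, q r ^ 2 + (h : ℂ) ^ 2 = (q r - Complex.I * h) * (q r + Complex.I * h) := by
    intro r
    linear_combination ((h : ℂ) ^ 2) * Complex.I_sq
  have h0 : ∀ r, q r ^ 2 + (h : ℂ) ^ 2 ≠ 0 := fun r => by
    rw [hfac]; exact mul_ne_zero (hn1 r) (hn2 r)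
  have hwind : ∀ x, windInt w x = ∫ r in (-π)..π, deriv w (s + r) / (w (s + r) - x) := by
    intro x
    have hper : Function.Periodic (fun t => deriv w t / (w t - x)) (2 * π) := fun t => by
      simp only [H.deriv_periodic t, H.per]
    rw [intervalIntegral.integral_comp_add_left (fun t => deriv w t / (w t - x)), windInt]
    have := hper.intervalIntegral_add_eq 0 (s + -π)
    rwa [zero_add, show s + -π + 2 * π = s + π by ring] at this
  have h_int : ∀ x ∉ range w, IntervalIntegrable (fun r => deriv w (s + r) / (w (s + r) - x))
      volume (-π) π := by
    intro x hx
    obtain ⟨δ, t, hδ, hmx, -⟩ := H.exists_nearest hx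
    have hwm := hw.measurable
    refine intervalIntegrable_of_norm_le (Measurable.aestronglyMeasurable (by fun_prop))
      (B := v / δ) (fun r => ?_) _ _
    rw [norm_div, norm_sub_rev]
    have := hmx (s + r)
    have := H.norm_deriv_le (s + r)
    gcongr
  have hdiff : windInt w (w s + Complex.I * h * V) - windInt w (w s - Complex.I * h * V) =
      Complex.I * ∫ r in (-π)..π, 2 * h * deriv q r / (q r ^ 2 + h ^ 2) := by
    rw [hwind, hwind, ← intervalIntegral.integral_sub (h_int _ hp1) (h_int _ hp2),
      ← intervalIntegral.integral_const_mul]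
    refine intervalIntegral.integral_congr fun r _ => ?_
    rw [hm1, hm2, hdq, hfac]
    have := hn1 r
    have := hn2 r
    field_simp
    ring
  rw [hdiff, Complex.I_mul_im]
  have hdV : d / 400 / ‖V‖ ≤ h / 200 := by
    rw [div_le_iff₀ hVn]
    have : h / 200 * (v / 2) ≤ h / 200 * ‖V‖ := by gcongr
    have e : h / 200 * (v / 2) = d / 400 := by rw [hh]; field_simp; norm_num
    linarith
  refine re_integral_pos (R := L * d) (B := c ^ 2 / (2 * v ^ 2)) hqc hh0 ?_ hLd (fun r hr => ?_) ?_
    (fun r hr hrπ => ?_) (fun r => ?_) ?_ h0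
  · rw [hh, div_eq_mul_inv, mul_comm]
    have : v⁻¹ ≤ 2 / v := by rw [div_eq_mul_inv]; linarith [inv_pos.2 hv]
    gcongr
    linarith
  · have h1 := H.norm_sub_sub_le_of_flat hB hr
    have e : q r - r = (w (s + r) - w s - r * V) / V := by simp only [hq]; field_simp
    rw [e, norm_div]
    exact (div_le_div_of_nonneg_right h1 hVn.le).trans hdV
  · have e : ∀ r, ‖deriv q r - 1‖ = ‖deriv w (s + r) - V‖ / ‖V‖ := by
      intro r
      rw [hdq, ← norm_div, sub_div, div_self hV0]
    simp_rw [e]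
    rw [intervalIntegral.integral_div]
    exact (div_le_div_of_nonneg_right hB hVn.le).trans hdV
  · have h1 := H.chord (s + r) s (by simpa using hrπ)
    rw [add_sub_cancel_left] at h1
    have h2 : c * |r| / v ≤ ‖q r‖ := by
      simp only [hq]
      rw [norm_div]
      gcongr
    have h3 : (c * |r| / v) ^ 2 ≤ ‖q r‖ ^ 2 := by gcongr
    have h4 : ‖q r‖ ^ 2 - h ^ 2 ≤ ‖q r ^ 2 + h ^ 2‖ := by
      have := norm_sub_norm_le (q r ^ 2) (-(h : ℂ) ^ 2)
      rw [norm_pow, norm_neg, norm_pow, Complex.norm_real, Real.norm_of_nonneg hh0.le,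
        sub_neg_eq_add] at this
      exact this
    have h5 : h ^ 2 ≤ c ^ 2 / (2 * v ^ 2) * r ^ 2 := by
      have h6 : 6 * d ≤ c * |r| := by
        rw [div_le_iff₀ hc] at hL1
        calc 6 * d ≤ L * c * d := by gcongr
          _ = c * (L * d) := by ring
          _ ≤ _ := by gcongr
      have h7 : (6 * d) ^ 2 ≤ (c * |r|) ^ 2 := by gcongr
      rw [mul_pow c, sq_abs] at h7
      rw [hh, div_pow, div_mul_eq_mul_div, div_le_div_iff₀ (by positivity) (by positivity)]
      have : 0 < v ^ 2 := by positivity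
      nlinarith
    have e : (c * |r| / v) ^ 2 = 2 * (c ^ 2 / (2 * v ^ 2) * r ^ 2) := by
      rw [div_pow, mul_pow, sq_abs]; field_simp
    linarith
  · rw [hdq, norm_div, div_le_iff₀ hVn]
    have := H.norm_deriv_le (s + r)
    linarith
  · rw [hh]
    rw [div_le_iff₀ (by positivity)] at hL2
    calc 200 * (d / v) = 400 * v * d / (2 * v ^ 2) := by field_simp; norm_num
      _ ≤ L * c ^ 2 * d / (2 * v ^ 2) := by gcongr
      _ = _ := by ring

end ChordArcMap

/-- The signed distance of `x` to the line through `a` with unit direction `e`. -/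
noncomputable def signedHeight (a e x : ℂ) : ℝ := ((x - a) * (starRingEnd ℂ) e).im

theorem signedHeight_add (a e x y : ℂ) :
    signedHeight a e (x + y) = signedHeight a e x + (y * (starRingEnd ℂ) e).im := by
  rw [signedHeight, signedHeight, ← Complex.add_im]
  ring_nf

theorem abs_signedHeight_sub_le {a e : ℂ} (he : ‖e‖ = 1) (x y : ℂ) :
    |signedHeight a e x - signedHeight a e y| ≤ ‖x - y‖ := by
  rw [signedHeight, signedHeight, ← Complex.sub_im, ← sub_mul]
  refine (Complex.abs_im_le_norm _).trans ?_
  rw [norm_mul, RCLike.norm_conj, he, mul_one]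
  simp

theorem signedHeight_add_mul {a e : ℂ} (he : ‖e‖ = 1) (x : ℂ) (r : ℝ) :
    signedHeight a e (x + r * (Complex.I * e)) = signedHeight a e x + r := by
  rw [signedHeight_add]
  congr 1
  have h : (r : ℂ) * (Complex.I * e) * (starRingEnd ℂ) e = Complex.I * (r : ℂ) := by
    have := Complex.mul_conj' e
    rw [he] at this
    push_cast at this
    linear_combination (r * Complex.I) * this
  rw [h, Complex.I_mul_im, Complex.ofReal_re]

theorem convex_side (a e p : ℂ) (τ R h : ℝ) :
    Convex ℝ {x : ℂ | ‖x - p‖ < R ∧ h < τ * signedHeight a e x} := by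
  have h1 : Convex ℝ {x : ℂ | ‖x - p‖ < R} := by
    have : {x : ℂ | ‖x - p‖ < R} = ball p R := by
      ext x
      rw [mem_ball, dist_eq_norm, mem_ofPred_eq]
    rw [this]
    exact convex_ball p R
  refine h1.inter ?_
  intro x hx y hy b b' hb hb' hbb
  have hx' : h < τ * signedHeight a e x := hx
  have hy' : h < τ * signedHeight a e y := hy
  change h < τ * signedHeight a e (b • x + b' • y)
  have e1 : signedHeight a e (b • x + b' • y) =
    b * signedHeight a e x + b' * signedHeight a e y := by
    have ha : a = (b : ℂ) * a + b' * a := by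
      rw [← add_mul]
      norm_cast
      rw [hbb]
      simp
    simp only [signedHeight]
    rw [← Complex.im_ofReal_mul, ← Complex.im_ofReal_mul, ← Complex.add_im]
    congr 1
    simp only [Complex.real_smul]
    linear_combination (-(starRingEnd ℂ) e) * ha
  rw [e1]
  have h2 : h = b * h + b' * h := by rw [← add_mul, hbb, one_mul]
  rcases hb.eq_or_lt with rfl | hb0
  · have : b' = 1 := by linarith
    subst this
    linarith
  · have := mul_lt_mul_of_pos_left hx' hb0
    have := mul_le_mul_of_nonneg_left hy'.le hb'
    nlinarith

namespace JordanMap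

variable {γ w : ℝ → ℂ} {Ω Ωstar : Set ℂ} {F : ℂ → ℂ} {v c : ℝ}

theorem exists_sign (J : JordanMap γ Ω Ωstar F) (H : ChordArcMap w v c)
    (hr : range w = range γ) : ∃ σ : ℝ, |σ| = 1 ∧ ∀ p q : ℂ, p ∉ range w → q ∉ range w →
      0 < σ * (windInt w p - windInt w q).im → p ∈ Ω ∧ q ∈ Ωstar := by
  have hd1 : Disjoint Ω (range w) := by
    rw [hr]
    exact disjoint_left.2 fun x hx => J.notMem_range hx
  have hd2 : Disjoint Ωstar (range w) := by
    rw [hr]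
    refine disjoint_left.2 fun x hx => ?_
    have : x ∈ Ω ∪ Ωstar := Or.inr hx
    rwa [J.union] at this
  obtain ⟨κ, hκ⟩ := H.exists_windInt_eq J.isOpen_int J.conn_int.isPreconnected hd1
  have h0 : ∀ p ∈ Ωstar, windInt w p = 0 := fun p hp =>
    H.windInt_eq_zero J.isOpen_ext J.conn_ext.isPreconnected hd2 J.unbdd hp
  have hcov : ∀ x ∉ range w, x ∈ Ω ∨ x ∈ Ωstar := fun x hx => by
    rw [hr] at hx
    have : x ∈ (range γ)ᶜ := hx
    rwa [← J.union] at this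
  refine ⟨if 0 < κ.im then 1 else -1, by split_ifs <;> simp, fun p q hp hq hpq => ?_⟩
  rcases hcov p hp with h1 | h1 <;> rcases hcov q hq with h2 | h2
  · simp [hκ p h1, hκ q h2] at hpq
  · exact ⟨h1, h2⟩
  · rw [h0 p h1, hκ q h2] at hpq
    split_ifs at hpq with h3 <;> simp at hpq <;> linarith
  · simp [h0 p h1, h0 q h2] at hpq

theorem exists_side (J : JordanMap γ Ω Ωstar F) (H : ChordArcMap w v c)
    (hr : range w = range γ) (hS : sobolevSeminorm (1 / 2) (fun θ => deriv w θ) < ⊤) :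
    ∃ σ : ℝ, |σ| = 1 ∧ ∀ N : ℝ, 3 ≤ N → ∀ η : ℝ, 0 < η → η < 1 / 2 → ∃ d₀ > 0, ∀ p ∈ Ω, ∀ d s : ℝ,
      0 < d → d < d₀ → (∀ t, d ≤ ‖p - w t‖) → ‖p - w s‖ = d →
      0 < mass w p ∧ v / 2 ≤ ‖tangent w p‖ ∧
      (∀ x, ‖x - p‖ < N * d →
        η * d < σ * signedHeight (w s) (tangent w p / ‖tangent w p‖) x → x ∈ Ω) ∧
      (∀ x, ‖x - p‖ < N * d →
        σ * signedHeight (w s) (tangent w p / ‖tangent w p‖) x < -(η * d) → x ∈ Ωstar) ∧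
      (1 - η) * d ≤ σ * signedHeight (w s) (tangent w p / ‖tangent w p‖) p ∧
      σ * signedHeight (w s) (tangent w p / ‖tangent w p‖) p ≤ d := by
  obtain ⟨σ, hσ, hσs⟩ := J.exists_sign H hr
  refine ⟨σ, hσ, fun N hN η hη hη2 => ?_⟩
  have hc := H.c_pos
  have hv := H.v_pos
  set L := 2 * N / c + (6 / c + 400 * v / c ^ 2 + 2 / v) with hL
  have hL1 : 2 * N / c ≤ L := by
    have : 0 < 6 / c + 400 * v / c ^ 2 + 2 / v := by positivity
    linarith
  have hL2 : 6 / c + 400 * v / c ^ 2 + 2 / v ≤ L := by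
    have : 0 < 2 * N / c := by positivity
    linarith
  have hL3 : 2 / v ≤ L := by
    have : 0 < 6 / c + 400 * v / c ^ 2 := by positivity
    linarith
  have hη0 : 0 < min η (1 / 400) := by positivity
  obtain ⟨d₀, hd₀, hfl⟩ := H.exists_flat hS (lt_of_lt_of_le (by positivity) hL3) hη0
  refine ⟨d₀, hd₀, fun p hp d s hd hdd hm hs => ?_⟩
  obtain ⟨hZ, hV, hLd, hB⟩ := hfl p d s hd hdd hm hs
  have hVv := H.norm_tangent_le hd hm hZ
  set V := tangent w p with hVdef
  have hVn : 0 < ‖V‖ := by linarith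
  have hV0 : V ≠ 0 := norm_pos_iff.1 hVn
  have hVn' : (‖V‖ : ℂ) ≠ 0 := by exact_mod_cast hVn.ne'
  set e := V / ‖V‖ with he
  have hen : ‖e‖ = 1 := by
    rw [he, norm_div, Complex.norm_real, norm_norm, div_self hVn.ne']
  have hVe : V = ‖V‖ * e := by rw [he]; field_simp
  have hB1 : ∫ r in (-(L * d))..(L * d), ‖deriv w (s + r) - V‖ ≤ η * d :=
    hB.trans (by gcongr; exact min_le_left _ _)
  have hB2 : ∫ r in (-(L * d))..(L * d), ‖deriv w (s + r) - V‖ ≤ d / 400 :=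
    hB.trans (by
      have := mul_le_mul_of_nonneg_right (min_le_right η (1 / 400)) hd.le
      linarith)
  obtain ⟨hw1, hw2, hw3⟩ := H.im_windInt_sub_pos hd hm hs hV hVv hL2 hLd hB2
  set y : ℝ → ℂ := fun τ => w s + τ * (Complex.I * (d / v : ℝ) * V) with hy
  have hσ' : σ = 1 ∨ σ = -1 := by
    rcases abs_eq (zero_le_one' ℝ) |>.1 hσ with h | h <;> simp [h]
  have hy12 : y σ ∈ Ω ∧ y (-σ) ∈ Ωstar := by
    rcases hσ' with rfl | rfl
    · refine hσs _ _ ?_ ?_ ?_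
      · simpa [hy] using hw2
      · simpa [hy, ← sub_eq_add_neg] using hw3
      · simpa [hy, ← sub_eq_add_neg] using hw1
    · refine hσs _ _ ?_ ?_ ?_
      · simpa [hy, ← sub_eq_add_neg] using hw3
      · simpa [hy] using hw2
      · have : ∀ a b : ℂ, -1 * (a - b).im = (b - a).im := fun a b => by simp
        rw [this]
        simpa [hy, ← sub_eq_add_neg] using hw1
  set S : ℝ → Set ℂ := fun τ =>
    {x : ℂ | ‖x - p‖ < N * d ∧ η * d < τ * signedHeight (w s) e x} with hSd
  have hSsub : ∀ τ : ℝ, |τ| = 1 → S τ ⊆ Ω ∪ Ωstar := by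
    intro τ hτ x hx
    rw [J.union, ← hr]
    intro hmem
    have h1 := H.abs_im_le_of_flat hd hm hs hV0 hL1 hB1 hmem hx.1.le
    have h2 : τ * signedHeight (w s) e x ≤ |signedHeight (w s) e x| := by
      refine (le_abs_self _).trans ?_
      rw [abs_mul, hτ, one_mul]
    have := hx.2
    have h3 : |signedHeight (w s) e x| ≤ η * d := h1
    linarith
  have hyS : ∀ τ : ℝ, |τ| = 1 → y τ ∈ S τ := by
    intro τ hτ
    have hττ : τ * τ = 1 := by rw [← abs_mul_abs_self, hτ, one_mul]
    have e1 : y τ = w s + ((τ * (d / v * ‖V‖) : ℝ) : ℂ) * (Complex.I * e) := by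
      simp only [hy]
      nth_rewrite 1 [hVe]
      push_cast
      ring
    constructor
    · have : ‖y τ - p‖ ≤ d / v * ‖V‖ + d := by
        calc ‖y τ - p‖ = ‖((τ * (d / v * ‖V‖) : ℝ) : ℂ) * (Complex.I * e) - (p - w s)‖ := by
              rw [e1]; congr 1; ring
          _ ≤ _ := _root_.norm_sub_le _ _
          _ = _ := by
            rw [hs, norm_mul, norm_mul, hen, Complex.norm_I, Complex.norm_real, Real.norm_eq_abs,
              abs_mul, hτ, abs_of_nonneg (by positivity)]
            ring
      have h2 : d / v * ‖V‖ ≤ d / v * v := by gcongr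
      rw [div_mul_cancel₀ _ hv.ne'] at h2
      have : 3 * d ≤ N * d := by gcongr
      linarith
    · rw [e1, signedHeight_add_mul hen, signedHeight, sub_self, zero_mul, Complex.zero_im, zero_add,
        ← mul_assoc, hττ, one_mul]
      have h2 : d / v * (v / 2) ≤ d / v * ‖V‖ := by gcongr
      have h3 : d / v * (v / 2) = d / 2 := by field_simp
      nlinarith
  have hpre : ∀ τ, IsPreconnected (S τ) :=
    fun τ => (convex_side (w s) e p τ (N * d) (η * d)).isPreconnected
  have hS1 : S σ ⊆ Ω := (hpre σ).subset_left_of_subset_union J.isOpen_int J.isOpen_ext J.disj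
    (hSsub σ hσ) ⟨_, hyS σ hσ, hy12.1⟩
  have hσn : |-σ| = 1 := by rwa [abs_neg]
  have hS2 : S (-σ) ⊆ Ωstar :=
    (hpre (-σ)).subset_right_of_subset_union J.isOpen_int J.isOpen_ext J.disj
    (hSsub _ hσn) ⟨_, hyS _ hσn, hy12.2⟩
  have hht : |signedHeight (w s) e p| ≤ d := by
    rw [← hs]
    have := abs_signedHeight_sub_le (a := w s) hen p (w s)
    rwa [show signedHeight (w s) e (w s) = 0 by simp [signedHeight], sub_zero] at this
  have hlow : (1 - η) * d ≤ |signedHeight (w s) e p| := by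
    set z := (p - w s) * (starRingEnd ℂ) e with hz
    have hzn : ‖z‖ = d := by rw [hz, norm_mul, RCLike.norm_conj, hen, mul_one, hs]
    have hze : p - w s = z * e := by
      have h1 : e * (starRingEnd ℂ) e = 1 := by rw [Complex.mul_conj', hen]; simp
      rw [hz]
      linear_combination (-(p - w s)) * h1
    have hra : |z.re / ‖V‖| ≤ L * d := by
      rw [abs_div, abs_of_pos hVn, div_le_iff₀ hVn]
      have h1 : |z.re| ≤ d := hzn ▸ Complex.abs_re_le_norm z
      have h2 : 2 / v * d * (v / 2) ≤ L * d * ‖V‖ := by gcongr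
      have h3 : 2 / v * d * (v / 2) = d := by field_simp
      linarith
    have h4 := H.norm_sub_sub_le_of_flat hB1 hra
    have h5 := hm (s + z.re / ‖V‖)
    have h6 : p - w (s + z.re / ‖V‖) = Complex.I * z.im * e -
        (w (s + z.re / ‖V‖) - w s - (z.re / ‖V‖ : ℝ) * V) := by
      have h7 : ((z.re / ‖V‖ : ℝ) : ℂ) * V = z.re * e := by
        rw [he]
        push_cast
        ring
      rw [h7]
      have h8 := Complex.re_add_im z
      linear_combination hze - e * h8
    have h9 : ‖p - w (s + z.re / ‖V‖)‖ ≤ |z.im| + η * d := by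
      rw [h6]
      refine (_root_.norm_sub_le _ _).trans ?_
      gcongr
      rw [norm_mul, norm_mul, hen, Complex.norm_I, Complex.norm_real, Real.norm_eq_abs]
      simp
    have : |signedHeight (w s) e p| = |z.im| := rfl
    linarith
  have hpN : ‖p - p‖ < N * d := by
    rw [sub_self, norm_zero]
    positivity
  have habs : |σ * signedHeight (w s) e p| = |signedHeight (w s) e p| := by
    rw [abs_mul, hσ, one_mul]
  refine ⟨hZ, hV, fun x hx hx' => hS1 ⟨hx, hx'⟩, fun x hx hx' => hS2 ⟨hx, by linarith⟩, ?_, ?_⟩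
  · rcases abs_cases (σ * signedHeight (w s) e p) with ⟨h1, -⟩ | ⟨h1, -⟩
    · linarith
    · exfalso
      refine disjoint_left.1 J.disj hp (hS2 ⟨hpN, ?_⟩)
      nlinarith
  · linarith [le_abs_self (σ * signedHeight (w s) e p)]

/-- Near the curve, `Ω` is squeezed between two tangent-like discs. -/
theorem exists_discs (J : JordanMap γ Ω Ωstar F) (H : ChordArcMap w v c)
    (hr : range w = range γ) (hS : sobolevSeminorm (1 / 2) (fun θ => deriv w θ) < ⊤) :
    ∃ σ : ℝ, |σ| = 1 ∧ ∀ M : ℝ, 1 ≤ M → ∀ ε : ℝ, 0 < ε → ε < 1 → ∃ d₀ > 0, ∀ p ∈ Ω, ∀ d s : ℝ,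
      0 < d → d < d₀ → (∀ t, d ≤ ‖p - w t‖) → ‖p - w s‖ = d →
      0 < mass w p ∧ v / 2 ≤ ‖tangent w p‖ ∧
      ball (p + ((M - (1 - ε)) * d : ℝ) * (σ * Complex.I * (tangent w p / ‖tangent w p‖))) (M * d) ⊆
        Ω ∧
      Disjoint Ω
        (ball (p - ((M + (1 + ε)) * d : ℝ) * (σ * Complex.I * (tangent w p / ‖tangent w p‖))) (M *
          d)) := by
  obtain ⟨σ, hσ, hside⟩ := J.exists_side H hr hS
  refine ⟨σ, hσ, fun M hM ε hε hε1 => ?_⟩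
  obtain ⟨d₀, hd₀, h⟩ := hside (2 * M + 2) (by linarith) (ε / 2) (by linarith) (by linarith)
  refine ⟨d₀, hd₀, fun p hp d s hd hdd hm hs => ?_⟩
  obtain ⟨hZ, hV, h1, h2, h3, h4⟩ := h p hp d s hd hdd hm hs
  refine ⟨hZ, hV, ?_⟩
  have hv := H.v_pos
  have hVn : 0 < ‖tangent w p‖ := by linarith
  set e := tangent w p / ‖tangent w p‖ with he
  have hen : ‖e‖ = 1 := by
    rw [he, norm_div, Complex.norm_real, norm_norm, div_self hVn.ne']
  have hσσ : σ * σ = 1 := by rw [← abs_mul_abs_self, hσ, one_mul]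
  have hcen : ∀ r : ℝ, p + (r : ℂ) * (σ * Complex.I * e) =
    p + ((r * σ : ℝ) : ℂ) * (Complex.I * e) := by
    intro r; push_cast; ring
  have hht : ∀ r : ℝ, σ * signedHeight (w s) e (p + (r : ℂ) * (σ * Complex.I * e)) =
      σ * signedHeight (w s) e p + r := by
    intro r
    rw [hcen, signedHeight_add_mul hen]
    linear_combination r * hσσ
  have hnr : ∀ r : ℝ, ‖(r : ℂ) * (σ * Complex.I * e)‖ = |r| := by
    intro r
    rw [norm_mul, norm_mul, norm_mul, hen, Complex.norm_I, Complex.norm_real, Complex.norm_real,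
      Real.norm_eq_abs, Real.norm_eq_abs, hσ]
    ring
  have key : ∀ r R : ℝ, ∀ x ∈ ball (p + (r : ℂ) * (σ * Complex.I * e)) R,
      ‖x - p‖ < R + |r| ∧
      |σ * signedHeight (w s) e x - (σ * signedHeight (w s) e p + r)| < R := by
    intro r R x hx
    rw [mem_ball, dist_eq_norm] at hx
    constructor
    · rw [← hnr r]
      have := norm_add_le (x - (p + (r : ℂ) * (σ * Complex.I * e))) ((r : ℂ) * (σ * Complex.I * e))
      rw [show x - (p + (r : ℂ) * (σ * Complex.I * e)) + (r : ℂ) * (σ * Complex.I * e) = x - p by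
        ring] at this
      linarith
    · rw [← hht, ← mul_sub, abs_mul, hσ, one_mul]
      exact (abs_signedHeight_sub_le hen _ _).trans_lt hx
  constructor
  · intro x hx
    obtain ⟨k1, k2⟩ := key _ _ x hx
    rw [abs_of_nonneg (by nlinarith)] at k1
    rw [abs_lt] at k2
    exact h1 x (by nlinarith) (by nlinarith)
  · refine disjoint_left.2 fun x hxΩ hx => ?_
    rw [sub_eq_add_neg, ← neg_mul, ← Complex.ofReal_neg] at hx
    obtain ⟨k1, k2⟩ := key _ _ x hx
    rw [abs_neg, abs_of_nonneg (by positivity)] at k1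
    rw [abs_lt] at k2
    exact disjoint_left.1 J.disj hxΩ (h2 x (by nlinarith) (by nlinarith))

end JordanMap

theorem norm_one_sub_conj_mul_sq (a u : ℂ) :
    ‖1 - (starRingEnd ℂ) a * u‖ ^ 2 = ‖u - a‖ ^ 2 + (1 - ‖a‖ ^ 2) * (1 - ‖u‖ ^ 2) := by
  rw [Complex.sq_norm, Complex.sq_norm, Complex.sq_norm, Complex.sq_norm]
  simp only [Complex.normSq_apply, Complex.sub_re, Complex.sub_im, Complex.mul_re, Complex.mul_im,
    Complex.conj_re, Complex.conj_im, Complex.one_re, Complex.one_im]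
  ring

theorem one_sub_conj_mul_ne_zero {a u : ℂ} (ha : ‖a‖ < 1) (hu : ‖u‖ ≤ 1) :
    1 - (starRingEnd ℂ) a * u ≠ 0 := by
  intro h
  have h1 : (starRingEnd ℂ) a * u = 1 := by linear_combination -h
  have h2 : ‖a‖ * ‖u‖ = 1 := by
    rw [← RCLike.norm_conj a, ← norm_mul, h1, norm_one]
  nlinarith [norm_nonneg a, norm_nonneg u]

theorem norm_sub_le_norm_one_sub_conj_mul {a u : ℂ} (ha : ‖a‖ ≤ 1) (hu : ‖u‖ ≤ 1) :
    ‖u - a‖ ≤ ‖1 - (starRingEnd ℂ) a * u‖ := by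
  refine le_of_sq_le_sq ?_ (norm_nonneg _)
  rw [norm_one_sub_conj_mul_sq]
  have h1 : 0 ≤ 1 - ‖a‖ ^ 2 := by nlinarith [norm_nonneg a]
  have h2 : 0 ≤ 1 - ‖u‖ ^ 2 := by nlinarith [norm_nonneg u]
  nlinarith [mul_nonneg h1 h2]

/-- The **Schwarz–Pick inequality** at the centre of the disc. -/
theorem norm_deriv_zero_le_one_sub_sq {φ : ℂ → ℂ} (hφ : DifferentiableOn ℂ φ (ball 0 1))
    (hm : MapsTo φ (ball 0 1) (closedBall 0 1)) : ‖deriv φ 0‖ ≤ 1 - ‖φ 0‖ ^ 2 := by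
  have h0 : (0 : ℂ) ∈ ball (0 : ℂ) 1 := by simp
  have hn : ∀ z ∈ ball (0 : ℂ) 1, ‖φ z‖ ≤ 1 := fun z hz => by simpa using hm hz
  have key : ∀ r ∈ Ioo (0 : ℝ) 1, r * ‖deriv φ 0‖ ≤ 1 - (r * ‖φ 0‖) ^ 2 := by
    intro r hr
    set a : ℂ := r * φ 0 with ha
    have hrn : ∀ z ∈ ball (0 : ℂ) 1, ‖r * φ z‖ < 1 := fun z hz => by
      rw [norm_mul, Complex.norm_real, Real.norm_of_nonneg hr.1.le]
      nlinarith [hn z hz, hr.1, hr.2, norm_nonneg (φ z)]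
    have ha1 : ‖a‖ < 1 := hrn 0 h0
    have hne : ∀ z ∈ ball (0 : ℂ) 1, 1 - (starRingEnd ℂ) a * (r * φ z) ≠ 0 :=
      fun z hz => one_sub_conj_mul_ne_zero ha1 (hrn z hz).le
    set h : ℂ → ℂ := fun z => (r * φ z - a) / (1 - (starRingEnd ℂ) a * (r * φ z)) with hh
    have hd : DifferentiableOn ℂ h (ball 0 1) := by
      refine DifferentiableOn.div ?_ ?_ hne
      · exact (hφ.const_mul _).sub_const _
      · exact ((hφ.const_mul _).const_mul _).const_sub _
    have hh0 : h 0 = 0 := by simp [hh, ha]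
    have hmh : MapsTo h (ball 0 1) (closedBall (h 0) 1) := by
      intro z hz
      rw [hh0, mem_closedBall_zero_iff, hh, norm_div]
      exact div_le_one_of_le₀ (norm_sub_le_norm_one_sub_conj_mul ha1.le (hrn z hz).le)
        (norm_nonneg _)
    have h1 := Complex.norm_deriv_le_one_of_mapsTo_ball hd hmh one_pos
    have hφ0 : HasDerivAt φ (deriv φ 0) 0 :=
      (hφ.differentiableAt (isOpen_ball.mem_nhds h0)).hasDerivAt
    have hD : (1 : ℂ) - (starRingEnd ℂ) a * a = ((1 - ‖a‖ ^ 2 : ℝ) : ℂ) := by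
      have := Complex.conj_mul' a
      push_cast
      linear_combination -this
    have hpos : 0 < 1 - ‖a‖ ^ 2 := by nlinarith [norm_nonneg a]
    have hDne : ((1 - ‖a‖ ^ 2 : ℝ) : ℂ) ≠ 0 := by exact_mod_cast hpos.ne'
    have h2 : HasDerivAt h (r * deriv φ 0 / ((1 - ‖a‖ ^ 2 : ℝ) : ℂ)) 0 := by
      have := ((hφ0.const_mul (r : ℂ)).sub_const a).div
        (((hφ0.const_mul (r : ℂ)).const_mul ((starRingEnd ℂ) a)).const_sub 1) (hne 0 h0)
      refine this.congr_deriv ?_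
      rw [← ha, hD, sub_self, zero_mul, sub_zero]
      field_simp
    rw [h2.deriv, norm_div, norm_mul, Complex.norm_real, Complex.norm_real,
      Real.norm_of_nonneg hr.1.le, Real.norm_of_nonneg hpos.le, div_le_one hpos] at h1
    rwa [ha, norm_mul, Complex.norm_real, Real.norm_of_nonneg hr.1.le] at h1
  have t1 : Tendsto (fun r : ℝ => r * ‖deriv φ 0‖) (𝓝[<] 1) (𝓝 (1 * ‖deriv φ 0‖)) :=
    ((continuous_id.mul continuous_const).tendsto' _ _ rfl).mono_left nhdsWithin_le_nhds
  have t2 : Tendsto (fun r : ℝ => 1 - (r * ‖φ 0‖) ^ 2) (𝓝[<] 1) (𝓝 (1 - (1 * ‖φ 0‖) ^ 2)) :=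
    (Continuous.tendsto (by fun_prop) 1).mono_left nhdsWithin_le_nhds
  have := le_of_tendsto_of_tendsto t1 t2 (by
    filter_upwards [Ioo_mem_nhdsLT (zero_lt_one' ℝ)] with r hr using key r hr)
  simpa using this

/-- The **Schwarz–Pick inequality** for maps from a disc. -/
theorem norm_deriv_mul_le_of_mapsTo_ball {φ : ℂ → ℂ} {c p : ℂ} {ρ : ℝ}
    (hφ : DifferentiableOn ℂ φ (ball c ρ)) (hm : MapsTo φ (ball c ρ) (closedBall 0 1))
    (hp : p ∈ ball c ρ) : ‖deriv φ p‖ * (ρ ^ 2 - ‖p - c‖ ^ 2) ≤ ρ * (1 - ‖φ p‖ ^ 2) := by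
  have hρ : 0 < ρ := pos_of_mem_ball hp
  have hρ' : (ρ : ℂ) ≠ 0 := by exact_mod_cast hρ.ne'
  have hpn : ‖p - c‖ < ρ := by simpa [dist_eq_norm] using hp
  set b : ℂ := (p - c) / ρ with hb
  have hbn : ‖b‖ = ‖p - c‖ / ρ := by
    rw [hb, norm_div, Complex.norm_real, Real.norm_of_nonneg hρ.le]
  have hb1 : ‖-b‖ < 1 := by rwa [norm_neg, hbn, div_lt_one hρ]
  set m : ℂ → ℂ := fun ξ => c + ρ * ((ξ - -b) / (1 - (starRingEnd ℂ) (-b) * ξ)) with hmd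
  have hne : ∀ ξ ∈ ball (0 : ℂ) 1, 1 - (starRingEnd ℂ) (-b) * ξ ≠ 0 := fun ξ hξ =>
    one_sub_conj_mul_ne_zero hb1 (by simpa using (mem_ball_zero_iff.1 hξ).le)
  have h0 : (0 : ℂ) ∈ ball (0 : ℂ) 1 := by simp
  have hm0 : m 0 = p := by
    simp only [hmd, hb]
    field_simp
    simp
  have hmd' : DifferentiableOn ℂ m (ball 0 1) := by
    refine (DifferentiableOn.const_mul ?_ _).const_add _
    refine DifferentiableOn.div (by fun_prop) (by fun_prop) hne
  have hmm : MapsTo m (ball 0 1) (ball c ρ) := by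
    intro ξ hξ
    have hξ1 : ‖ξ‖ < 1 := by simpa using hξ
    rw [mem_ball, dist_eq_norm, hmd, add_sub_cancel_left, norm_mul, Complex.norm_real,
      Real.norm_of_nonneg hρ.le, norm_div]
    have h1 : 0 < ‖1 - (starRingEnd ℂ) (-b) * ξ‖ := norm_pos_iff.2 (hne ξ hξ)
    have h2 : ‖ξ - -b‖ < ‖1 - (starRingEnd ℂ) (-b) * ξ‖ := by
      refine lt_of_pow_lt_pow_left₀ 2 h1.le ?_
      rw [norm_one_sub_conj_mul_sq]
      have h3 : 0 < 1 - ‖-b‖ ^ 2 := by nlinarith [norm_nonneg (-b)]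
      have h4 : 0 < 1 - ‖ξ‖ ^ 2 := by nlinarith [norm_nonneg ξ]
      nlinarith [mul_pos h3 h4]
    have h3 : ‖ξ - -b‖ / ‖1 - (starRingEnd ℂ) (-b) * ξ‖ < 1 := (div_lt_one h1).2 h2
    nlinarith
  have h1 := norm_deriv_zero_le_one_sub_sq (hφ.comp hmd' hmm) (fun ξ hξ => hm (hmm hξ))
  have h2 : HasDerivAt m (ρ * ((1 - ‖b‖ ^ 2 : ℝ) : ℂ)) 0 := by
    have := ((((hasDerivAt_id (0 : ℂ)).sub_const (-b)).div
      (((hasDerivAt_id (0 : ℂ)).const_mul ((starRingEnd ℂ) (-b))).const_sub 1)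
        (hne 0 h0)).const_mul (ρ : ℂ)).const_add c
    refine this.congr_deriv ?_
    have := Complex.conj_mul' b
    simp only [id, map_neg]
    push_cast
    simp only [mul_zero, sub_zero, one_pow, div_one, mul_one, zero_sub, neg_neg]
    linear_combination (-(ρ : ℂ)) * this
  have h3 : HasDerivAt φ (deriv φ p) (m 0) := by
    rw [hm0]
    exact (hφ.differentiableAt (isOpen_ball.mem_nhds hp)).hasDerivAt
  have hpos : 0 < 1 - ‖b‖ ^ 2 := by
    rw [norm_neg] at hb1
    nlinarith [norm_nonneg b]
  rw [(h3.comp 0 h2).deriv, Function.comp_apply, hm0, norm_mul, norm_mul, Complex.norm_real,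
    Complex.norm_real, Real.norm_of_nonneg hρ.le, Real.norm_of_nonneg hpos.le, hbn] at h1
  calc ‖deriv φ p‖ * (ρ ^ 2 - ‖p - c‖ ^ 2)
      = ρ * (‖deriv φ p‖ * (ρ * (1 - (‖p - c‖ / ρ) ^ 2))) := by field_simp
    _ ≤ _ := by gcongr

/-- Second order **Schwarz lemma**. -/
theorem norm_deriv_deriv_zero_le {g : ℂ → ℂ} (hg : DifferentiableOn ℂ g (ball 0 1))
    (hm : MapsTo g (ball 0 1) (closedBall 0 1)) (h0 : g 0 = 0) :
    ‖deriv (deriv g) 0‖ ≤ 2 * (1 - ‖deriv g 0‖ ^ 2) := by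
  have hmem : ball (0 : ℂ) 1 ∈ 𝓝 (0 : ℂ) := ball_mem_nhds 0 one_pos
  set k := dslope g 0 with hk
  have hkd : DifferentiableOn ℂ k (ball 0 1) := (Complex.differentiableOn_dslope hmem).2 hg
  have hkm : MapsTo k (ball 0 1) (closedBall 0 1) := by
    intro z hz
    have := Complex.norm_dslope_le_div_of_mapsTo_ball hg (R₂ := 1) (by rwa [h0]) hz
    simpa using this
  have h1 := norm_deriv_zero_le_one_sub_sq hkd hkm
  have hk0 : k 0 = deriv g 0 := dslope_same g 0
  have hgk : ∀ z, g z = z * k z := fun z => by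
    have := sub_smul_dslope g 0 z
    rw [h0, sub_zero, sub_zero, smul_eq_mul] at this
    exact this.symm
  have hkz : ∀ z ∈ ball (0 : ℂ) 1, HasDerivAt k (deriv k z) z := fun z hz =>
    (hkd.differentiableAt (isOpen_ball.mem_nhds hz)).hasDerivAt
  have hd1 : deriv g =ᶠ[𝓝 0] fun z => k z + z * deriv k z := by
    filter_upwards [hmem] with z hz
    have : HasDerivAt g (1 * k z + id z * deriv k z) z := by
      rw [show g = fun z => id z * k z from funext hgk]
      exact (hasDerivAt_id z).mul (hkz z hz)
    rw [this.deriv, one_mul, id]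
  have hk2 : DifferentiableAt ℂ (deriv k) 0 :=
    (hkd.deriv isOpen_ball).differentiableAt hmem
  have hd2 : deriv (deriv g) 0 = 2 * deriv k 0 := by
    rw [hd1.deriv_eq]
    have := (hkz 0 (by simp)).add ((hasDerivAt_id (0 : ℂ)).mul hk2.hasDerivAt)
    refine (this.congr_deriv ?_).deriv
    simp
    ring
  rw [hd2, norm_mul, ← hk0]
  simpa using h1

/-- A map of the disc omitting a disc, compared with the Möbius map onto the complement. -/
theorem norm_deriv_deriv_div_sub_le {f : ℂ → ℂ} {q n : ℂ} {ρ t : ℝ} (hρ : 0 < ρ) (ht : 0 < t)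
    (hn : ‖n‖ = 1) (hf : DifferentiableOn ℂ f (ball 0 1))
    (hq : ∀ ξ ∈ ball (0 : ℂ) 1, ρ ≤ ‖f ξ - q‖) (hf0 : f 0 = q + (ρ + t : ℝ) * n)
    (h1 : deriv f 0 ≠ 0) :
    ρ * ‖deriv f 0‖ ≤ t * (2 * ρ + t) ∧
    ‖deriv (deriv f) 0 / (2 * deriv f 0) -
      (1 + t / ρ : ℝ) * (ρ * (deriv f 0 / n) / (t * (2 * ρ + t) : ℝ))‖ ≤
      (1 - (ρ * ‖deriv f 0‖ / (t * (2 * ρ + t))) ^ 2) / (ρ * ‖deriv f 0‖ / (t * (2 * ρ + t))) := by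
  have hmem : ball (0 : ℂ) 1 ∈ 𝓝 (0 : ℂ) := ball_mem_nhds 0 one_pos
  have hn0 : n ≠ 0 := norm_pos_iff.1 (by rw [hn]; exact one_pos)
  set T := t * (2 * ρ + t) with hT
  have hT0 : 0 < T := by positivity
  have hTc : (T : ℂ) ≠ 0 := by exact_mod_cast hT0.ne'
  have hρc : (ρ : ℂ) ≠ 0 := by exact_mod_cast hρ.ne'
  set u : ℂ → ℂ := fun ξ => (f ξ - f 0) / n with hu
  have hu0 : u 0 = 0 := by simp [hu]
  have hud : ∀ ξ ∈ ball (0 : ℂ) 1, HasDerivAt u (deriv f ξ / n) ξ := fun ξ hξ =>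
    (((hf.differentiableAt (isOpen_ball.mem_nhds hξ)).hasDerivAt).sub_const _).div_const _
  set D : ℂ → ℂ := fun ξ => (ρ + t : ℝ) * u ξ + T with hD
  have hDd : ∀ ξ ∈ ball (0 : ℂ) 1, HasDerivAt D ((ρ + t : ℝ) * (deriv f ξ / n)) ξ := fun ξ hξ =>
    ((hud ξ hξ).const_mul _).add_const _
  have hle : ∀ ξ ∈ ball (0 : ℂ) 1, ‖ρ * u ξ‖ ≤ ‖D ξ‖ := by
    intro ξ hξ
    have e1 : ‖f ξ - q‖ = ‖u ξ + (ρ + t : ℝ)‖ := by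
      have : f ξ - q = n * (u ξ + (ρ + t : ℝ)) := by
        simp only [hu, hf0]
        field_simp
        ring
      rw [this, norm_mul, hn, one_mul]
    have h2 := hq ξ hξ
    rw [e1] at h2
    have h3 : ρ ^ 2 ≤ ‖u ξ + (ρ + t : ℝ)‖ ^ 2 := by gcongr
    refine le_of_sq_le_sq ?_ (norm_nonneg _)
    have e2 : ‖D ξ‖ ^ 2 - ‖ρ * u ξ‖ ^ 2 = T * (‖u ξ + (ρ + t : ℝ)‖ ^ 2 - ρ ^ 2) := by
      simp only [hD, hT, Complex.sq_norm, Complex.normSq_apply, Complex.add_re, Complex.add_im,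
        Complex.mul_re, Complex.mul_im, Complex.ofReal_re, Complex.ofReal_im]
      ring
    have := mul_nonneg hT0.le (sub_nonneg.2 h3)
    linarith
  have hD0 : ∀ ξ ∈ ball (0 : ℂ) 1, D ξ ≠ 0 := by
    intro ξ hξ h0
    have h2 := hle ξ hξ
    rw [h0, norm_zero, norm_le_zero_iff, mul_eq_zero, or_iff_right hρc] at h2
    rw [hD] at h0
    simp only [h2, mul_zero, zero_add] at h0
    exact hTc h0
  have hDT : D 0 = T := by simp [hD, hu0]
  set g : ℂ → ℂ := fun ξ => ρ * u ξ / D ξ with hg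
  have hg0 : g 0 = 0 := by simp [hg, hu0]
  have hgd : ∀ ξ ∈ ball (0 : ℂ) 1,
      HasDerivAt g (deriv f ξ / n * (ρ - (ρ + t : ℝ) * g ξ) / D ξ) ξ := by
    intro ξ hξ
    refine (((hud ξ hξ).const_mul (ρ : ℂ)).div (hDd ξ hξ) (hD0 ξ hξ)).congr_deriv ?_
    have := hD0 ξ hξ
    simp only [hg]
    field_simp
  have hgm : MapsTo g (ball 0 1) (closedBall 0 1) := fun ξ hξ => by
    rw [mem_closedBall_zero_iff, hg, norm_div]
    exact div_le_one_of_le₀ (hle ξ hξ) (norm_nonneg _)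
  have hgdiff : DifferentiableOn ℂ g (ball 0 1) := fun ξ hξ =>
    (hgd ξ hξ).differentiableAt.differentiableWithinAt
  have k1 := Complex.norm_deriv_le_one_of_mapsTo_ball hgdiff (by rwa [hg0]) one_pos
  have k2 := norm_deriv_deriv_zero_le hgdiff hgm hg0
  have h00 : (0 : ℂ) ∈ ball (0 : ℂ) 1 := by simp
  have e1 : deriv g 0 = ρ * (deriv f 0 / n) / T := by
    rw [(hgd 0 h00).deriv, hg0, hDT]
    ring
  have hf2 : HasDerivAt (deriv f) (deriv (deriv f) 0) 0 :=
    ((hf.deriv isOpen_ball).differentiableAt hmem).hasDerivAt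
  have e2 : deriv (deriv g) 0 = ρ * (deriv (deriv f) 0 / n) / T -
      2 * (ρ + t : ℝ) * (deriv f 0 / n) * deriv g 0 / T := by
    have : deriv g =ᶠ[𝓝 0] fun ξ => deriv f ξ / n * (ρ - (ρ + t : ℝ) * g ξ) / D ξ := by
      filter_upwards [hmem] with ξ hξ using (hgd ξ hξ).deriv
    rw [this.deriv_eq]
    have h3 := (((hf2.div_const n).mul (((hgd 0 h00).const_mul
      ((ρ + t : ℝ) : ℂ)).const_sub (ρ : ℂ))).div (hDd 0 h00) (hD0 0 h00))
    refine (h3.congr_deriv ?_).deriv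
    rw [e1]
    simp only [Pi.mul_apply, hg0, hDT]
    field_simp
    ring
  have hfn : 0 < ‖deriv f 0‖ := norm_pos_iff.2 h1
  have n1 : ‖deriv g 0‖ = ρ * ‖deriv f 0‖ / T := by
    rw [e1, norm_div, norm_mul, norm_div, hn, Complex.norm_real, Complex.norm_real,
      Real.norm_of_nonneg hρ.le, Real.norm_of_nonneg hT0.le, div_one]
  have hgpos : 0 < ‖deriv g 0‖ := by rw [n1]; positivity
  rw [← n1]
  constructor
  · rw [n1, div_le_one hT0] at k1
    exact k1
  · have e3 : deriv (deriv f) 0 / (2 * deriv f 0) -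
        (1 + t / ρ : ℝ) * (ρ * (deriv f 0 / n) / T) = deriv (deriv g) 0 / (2 * deriv g 0) := by
      rw [e2, e1]
      push_cast
      field_simp
    rw [e3, norm_div, norm_mul, Complex.norm_ofNat, div_le_div_iff₀ (by positivity) hgpos]
    nlinarith

/-- The half-plane chart at `ζ` of the disc. -/
noncomputable def diskChart (ζ ξ : ℂ) : ℂ := ζ + ζ.im * Complex.I * (2 * ξ / (1 - ξ))

theorem one_sub_ne_zero_of_norm_lt {ξ : ℂ} (hξ : ξ ∈ ball (0 : ℂ) 1) : 1 - ξ ≠ 0 := by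
  intro h
  rw [mem_ball_zero_iff, ← sub_eq_zero.1 h, norm_one] at hξ
  exact lt_irrefl _ hξ

theorem im_diskChart_pos {ζ ξ : ℂ} (hζ : 0 < ζ.im) (hξ : ξ ∈ ball (0 : ℂ) 1) :
    0 < (diskChart ζ ξ).im := by
  have h1 := one_sub_ne_zero_of_norm_lt hξ
  have h2 : 0 < Complex.normSq (1 - ξ) := Complex.normSq_pos.2 h1
  have h3 : Complex.normSq ξ < 1 := by
    rw [← Complex.sq_norm]
    have := mem_ball_zero_iff.1 hξ
    nlinarith [norm_nonneg ξ]
  have e : (diskChart ζ ξ).im = ζ.im * (1 + (2 * ξ / (1 - ξ)).re) := by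
    rw [diskChart, Complex.add_im, mul_assoc, Complex.im_ofReal_mul, Complex.I_mul_im]
    ring
  rw [e]
  refine mul_pos hζ ?_
  have e2 : 1 + (2 * ξ / (1 - ξ)).re = (1 - Complex.normSq ξ) / Complex.normSq (1 - ξ) := by
    rw [Complex.div_re, ← add_div, eq_div_iff h2.ne', add_mul, div_mul_cancel₀ _ h2.ne']
    simp [Complex.normSq_apply]
    ring
  rw [e2]
  exact div_pos (by linarith) h2

theorem hasDerivAt_diskChart {ζ ξ : ℂ} (hξ : ξ ∈ ball (0 : ℂ) 1) :
    HasDerivAt (diskChart ζ) (2 * ζ.im * Complex.I / (1 - ξ) ^ 2) ξ := by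
  have h1 := one_sub_ne_zero_of_norm_lt hξ
  have := ((((hasDerivAt_id ξ).const_mul (2 : ℂ)).div ((hasDerivAt_id ξ).const_sub 1) h1).const_mul
    (ζ.im * Complex.I)).const_add ζ
  refine this.congr_deriv ?_
  simp only [id]
  field_simp
  ring

theorem IsLift.norm_one_add_sub_le {Ψ L : ℂ → ℂ} (hL : IsLift Ψ L) {ζ q n : ℂ} {ρ t : ℝ}
    (hζ : 0 < ζ.im) (hρ : 0 < ρ) (ht : 0 < t) (hn : ‖n‖ = 1)
    (hq : ∀ z : ℂ, 0 < z.im → ρ ≤ ‖Ψ z - q‖) (hf0 : Ψ ζ = q + (ρ + t : ℝ) * n) :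
    ρ * (2 * ζ.im * ‖Complex.exp (L ζ)‖) ≤ t * (2 * ρ + t) ∧
    ‖1 + Complex.I * ζ.im * deriv L ζ -
      (1 + t / ρ : ℝ) * (ρ * (2 * ζ.im * Complex.I * Complex.exp (L ζ) / n) /
        (t * (2 * ρ + t) : ℝ))‖ ≤
      (1 - (ρ * (2 * ζ.im * ‖Complex.exp (L ζ)‖) / (t * (2 * ρ + t))) ^ 2) /
        (ρ * (2 * ζ.im * ‖Complex.exp (L ζ)‖) / (t * (2 * ρ + t))) := by
  set f : ℂ → ℂ := fun ξ => Ψ (diskChart ζ ξ) with hf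
  have h00 : (0 : ℂ) ∈ ball (0 : ℂ) 1 := by simp
  have hc0 : diskChart ζ 0 = ζ := by simp [diskChart]
  have hfd : ∀ ξ ∈ ball (0 : ℂ) 1, HasDerivAt f (Complex.exp (L (diskChart ζ ξ)) *
      (2 * ζ.im * Complex.I / (1 - ξ) ^ 2)) ξ := fun ξ hξ =>
    (hL.hasDerivAt _ (im_diskChart_pos hζ hξ)).comp ξ (hasDerivAt_diskChart hξ)
  have e1 : deriv f 0 = 2 * ζ.im * Complex.I * Complex.exp (L ζ) := by
    rw [(hfd 0 h00).deriv, hc0]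
    ring
  have hy : (ζ.im : ℂ) ≠ 0 := by exact_mod_cast hζ.ne'
  have hne : deriv f 0 ≠ 0 := by
    rw [e1]
    simp [hy, Complex.exp_ne_zero]
  have e2 : deriv (deriv f) 0 / (2 * deriv f 0) = 1 + Complex.I * ζ.im * deriv L ζ := by
    have h1 : deriv f =ᶠ[𝓝 0] fun ξ => Complex.exp (L (diskChart ζ ξ)) *
        (2 * ζ.im * Complex.I / (1 - ξ) ^ 2) := by
      filter_upwards [ball_mem_nhds 0 one_pos] with ξ hξ using (hfd ξ hξ).deriv
    have h2 : HasDerivAt L (deriv L ζ) (diskChart ζ 0) := by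
      rw [hc0]
      exact hL.diff ζ hζ
    have h3 := (h2.comp 0 (hasDerivAt_diskChart h00)).cexp.mul
      ((hasDerivAt_const (0 : ℂ) (2 * ζ.im * Complex.I)).div
        (((hasDerivAt_id (0 : ℂ)).const_sub 1).pow 2) (by simp))
    have h4 : deriv (deriv f) 0 = Complex.exp (L ζ) * (deriv L ζ * (2 * ζ.im * Complex.I) *
        (2 * ζ.im * Complex.I) + 4 * ζ.im * Complex.I) := by
      rw [h1.deriv_eq]
      refine (h3.congr_deriv ?_).deriv
      simp [hc0]
      ring
    rw [h4, e1]
    have := Complex.exp_ne_zero (L ζ)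
    field_simp
    ring
  have key := norm_deriv_deriv_div_sub_le hρ ht hn
    (fun ξ hξ => (hfd ξ hξ).differentiableAt.differentiableWithinAt)
    (fun ξ hξ => hq _ (im_diskChart_pos hζ hξ)) (by simp only [hf, hc0, hf0]) hne
  have e3 : ‖deriv f 0‖ = 2 * ζ.im * ‖Complex.exp (L ζ)‖ := by
    rw [e1]
    simp [abs_of_pos hζ]
  rw [e2, e3, e1] at key
  exact key

namespace JordanMap

variable {γ w : ℝ → ℂ} {Ω Ωstar : Set ℂ} {F L : ℂ → ℂ} {v c : ℝ}

theorem mapsTo (J : JordanMap γ Ω Ωstar F) {ζ : ℂ} (hζ : 0 < ζ.im) : F (toDisk ζ) ∈ Ω :=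
  J.bij.mapsTo (toDisk_mem_ball hζ)

theorem norm_exp_ge_of_ball_subset (J : JordanMap γ Ω Ωstar F)
    (hL : IsLift (fun ζ => F (toDisk ζ)) L) {ζ q : ℂ} {ρ : ℝ} (hζ : 0 < ζ.im)
    (hq : ball q ρ ⊆ Ω) (hp : F (toDisk ζ) ∈ ball q ρ) :
    Real.exp (-ζ.im) * (ρ ^ 2 - ‖F (toDisk ζ) - q‖ ^ 2) ≤
      ρ * (2 * ζ.im * ‖Complex.exp (L ζ)‖) := by
  obtain ⟨G, hG, hGd⟩ := J.exists_inverse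
  have hGm : MapsTo G Ω (ball 0 1) := by
    intro x hx
    obtain ⟨z, hz, rfl⟩ := J.bij.surjOn hx
    rwa [hG hz]
  have h1 := norm_deriv_mul_le_of_mapsTo_ball (hGd.mono hq)
    (fun x hx => ball_subset_closedBall (hGm (hq hx))) hp
  have h2 : deriv G (F (toDisk ζ)) * Complex.exp (L ζ) = Complex.I * toDisk ζ := by
    have h3 : HasDerivAt G (deriv G (F (toDisk ζ))) (F (toDisk ζ)) :=
      (hGd.differentiableAt (J.isOpen_int.mem_nhds (hq hp))).hasDerivAt
    have h4 := h3.comp ζ (hL.hasDerivAt ζ hζ)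
    refine h4.unique ((hasDerivAt_toDisk ζ).congr_of_eventuallyEq ?_)
    filter_upwards [isOpen_upper.mem_nhds hζ] with z hz
    exact hG (toDisk_mem_ball hz)
  have h3 : ‖deriv G (F (toDisk ζ))‖ * ‖Complex.exp (L ζ)‖ = Real.exp (-ζ.im) := by
    rw [← norm_mul, h2, norm_mul, Complex.norm_I, one_mul, norm_toDisk]
  rw [hG (toDisk_mem_ball hζ), norm_toDisk] at h1
  have h4 : 1 - Real.exp (-ζ.im) ^ 2 ≤ 2 * ζ.im := by
    rw [← Real.exp_nat_mul]
    push_cast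
    linarith [Real.add_one_le_exp (2 * -ζ.im)]
  have hρ : 0 < ρ := pos_of_mem_ball hp
  calc Real.exp (-ζ.im) * (ρ ^ 2 - ‖F (toDisk ζ) - q‖ ^ 2)
      = ‖Complex.exp (L ζ)‖ * (‖deriv G (F (toDisk ζ))‖ * (ρ ^ 2 - ‖F (toDisk ζ) - q‖ ^ 2)) := by
        rw [← h3]; ring
    _ ≤ ‖Complex.exp (L ζ)‖ * (ρ * (2 * ζ.im)) := by
        refine mul_le_mul_of_nonneg_left (h1.trans ?_) (norm_nonneg _)
        gcongr
    _ = _ := by ring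

end JordanMap

/-- The unimodular quotient of the derivative of the conformal map and the averaged tangent. -/
noncomputable def turning (w : ℝ → ℂ) (Ψ L : ℂ → ℂ) (ζ : ℂ) : ℂ :=
  Complex.exp (L ζ) / ‖Complex.exp (L ζ)‖ *
    (starRingEnd ℂ) (tangent w (Ψ ζ) / ‖tangent w (Ψ ζ)‖)

theorem rigidity_arith {M ε y g t ρ : ℝ} (hM : 8 ≤ M) (hε : ε = 1 / M) (hy : 0 < y)
    (hy1 : y ≤ 1 / M) (hg1 : g ≤ 1) (htρ : t / ρ = (1 + ε) / M)
    (hg : Real.exp (-y) * ((1 - ε) * (2 * M - (1 - ε))) ≤ g * ((1 + ε) * (2 * M + (1 + ε)))) :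
    0 < g ∧ (1 - g ^ 2) / g + |(1 + t / ρ) * g - 1| ≤ 22 / M := by
  have hM0 : 0 < M := by linarith
  have hε0 : 0 < ε := by rw [hε]; positivity
  have hε8 : ε ≤ 1 / 8 := by rw [hε]; gcongr
  have hMε : M * ε = 1 := by rw [hε]; field_simp
  have hyε : y ≤ ε := by rw [hε]; exact hy1
  have he : 1 - ε ≤ Real.exp (-y) := by linarith [Real.add_one_le_exp (-y)]
  have h1 : (1 - 4 * ε) * ((1 + ε) * (2 * M + (1 + ε))) ≤
    (1 - ε) * ((1 - ε) * (2 * M - (1 - ε))) := by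
    nlinarith [mul_pos hε0 hε0, mul_nonneg hε0.le (sub_nonneg.2 hε8),
      mul_nonneg (mul_pos hε0 hε0).le (sub_nonneg.2 hε8)]
  have h2 : (1 - ε) * ((1 - ε) * (2 * M - (1 - ε))) ≤
      Real.exp (-y) * ((1 - ε) * (2 * M - (1 - ε))) := by
    have : 0 ≤ (1 - ε) * (2 * M - (1 - ε)) := mul_nonneg (by linarith) (by linarith)
    gcongr
  have hpos : 0 < (1 + ε) * (2 * M + (1 + ε)) := by positivity
  have h3 : 1 - 4 * ε ≤ g := le_of_mul_le_mul_right (h1.trans (h2.trans hg)) hpos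
  have hg2 : 1 / 2 ≤ g := by linarith
  refine ⟨by linarith, ?_⟩
  have h4 : (1 - g ^ 2) / g ≤ 16 * ε := by
    rw [div_le_iff₀ (by linarith)]
    nlinarith
  have h5 : |(1 + t / ρ) * g - 1| ≤ 6 * ε := by
    have h6 : t / ρ = (1 + ε) * ε := by rw [htρ, hε]; ring
    rw [h6, abs_le]
    constructor <;> nlinarith [mul_pos hε0 hε0]
  have : 22 / M = 22 * ε := by rw [hε]; ring
  linarith

namespace JordanMap

variable {γ w : ℝ → ℂ} {Ω Ωstar : Set ℂ} {F L : ℂ → ℂ} {v c : ℝ}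

theorem exists_rigidity (J : JordanMap γ Ω Ωstar F) (H : ChordArcMap w v c)
    (hr : range w = range γ) (hS : sobolevSeminorm (1 / 2) (fun θ => deriv w θ) < ⊤)
    (hL : IsLift (fun ζ => F (toDisk ζ)) L) :
    ∃ σ : ℝ, |σ| = 1 ∧ ∀ κ > 0, ∃ y₀ > 0, ∀ ζ : ℂ, 0 < ζ.im → ζ.im < y₀ → ∃ d s : ℝ,
      0 < d ∧ d < κ ∧ (∀ t, d ≤ ‖F (toDisk ζ) - w t‖) ∧ ‖F (toDisk ζ) - w s‖ = d ∧
      0 < mass w (F (toDisk ζ)) ∧ v / 2 ≤ ‖tangent w (F (toDisk ζ))‖ ∧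
      ζ.im * ‖Complex.exp (L ζ)‖ ≤ 2 * d ∧
      ‖1 + Complex.I * ζ.im * deriv L ζ - σ * turning w (fun ζ => F (toDisk ζ)) L ζ‖ ≤ κ := by
  obtain ⟨σ, hσ, hdisc⟩ := J.exists_discs H hr hS
  refine ⟨σ, hσ, fun κ hκ => ?_⟩
  set M := max 8 (22 / κ) with hMdef
  have hM8 : 8 ≤ M := le_max_left _ _
  have hM0 : 0 < M := by linarith
  have hMκ : 22 / M ≤ κ := by
    rw [div_le_iff₀ hM0, ← div_le_iff₀' hκ]
    exact le_max_right _ _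
  set ε := 1 / M with hε
  have hε0 : 0 < ε := by positivity
  have hε1 : ε ≤ 1 / 8 := by rw [hε]; gcongr
  have hMε : M * ε = 1 := by rw [hε]; field_simp
  obtain ⟨d₀, hd₀, hdisc⟩ := hdisc M (by linarith) ε hε0 (by linarith)
  obtain ⟨h, hh, hht⟩ := J.exists_height (lt_min hd₀ hκ)
  refine ⟨min h ε, lt_min hh hε0, fun ζ hζ hζy => ?_⟩
  have hp := J.mapsTo hζ
  set p := F (toDisk ζ) with hpdef
  have hpr : p ∉ range w := by rw [hr]; exact J.notMem_range hp
  obtain ⟨d, s, hd, hm, hs⟩ := H.exists_nearest hpr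
  have hdd : d < min d₀ κ := by
    have h1 : d ≤ infDist p (range γ) := by
      rw [le_infDist (range_nonempty γ), ← hr]
      rintro _ ⟨t, rfl⟩
      rw [dist_eq_norm]
      exact hm t
    exact h1.trans_lt (hht ζ hζ (hζy.trans_le (min_le_left _ _)))
  obtain ⟨hZ, hV, hb1, hb2⟩ := hdisc p hp d s hd (hdd.trans_le (min_le_left _ _)) hm hs
  have hVn : 0 < ‖tangent w p‖ := by linarith [H.v_pos]
  set e := tangent w p / ‖tangent w p‖ with he
  have hen : ‖e‖ = 1 := by
    rw [he, norm_div, Complex.norm_real, norm_norm, div_self hVn.ne']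
  set n : ℂ := σ * Complex.I * e with hn
  have hnn : ‖n‖ = 1 := by
    rw [hn, norm_mul, norm_mul, hen, Complex.norm_I, Complex.norm_real, Real.norm_eq_abs, hσ]
    norm_num
  set E := Complex.exp (L ζ) with hE
  have hE0 : 0 < ‖E‖ := norm_pos_iff.2 (Complex.exp_ne_zero _)
  have hρ : 0 < M * d := by positivity
  have ht : 0 < (1 + ε) * d := by positivity
  obtain ⟨k1, k2⟩ := hL.norm_one_add_sub_le (q := p - ((M + (1 + ε)) * d : ℝ) * n) hζ hρ ht hnn
    (fun z hz => by
      by_contra hcon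
      push Not at hcon
      exact disjoint_left.1 hb2 (J.mapsTo hz) (by rwa [mem_ball, dist_eq_norm]))
    (by push_cast; ring)
  have hpc : ‖p - (p + ((M - (1 - ε)) * d : ℝ) * n)‖ = (M - (1 - ε)) * d := by
    rw [sub_add_cancel_left, norm_neg, norm_mul, hnn, mul_one, Complex.norm_real,
      Real.norm_of_nonneg (mul_nonneg (by linarith) hd.le)]
  have k3 := J.norm_exp_ge_of_ball_subset hL hζ hb1 (by
    rw [mem_ball, dist_eq_norm, hpc]
    gcongr
    linarith)
  rw [hpc] at k3
  have hT0 : 0 < (1 + ε) * d * (2 * (M * d) + (1 + ε) * d) := by positivity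
  set T := (1 + ε) * d * (2 * (M * d) + (1 + ε) * d) with hT
  set g := M * d * (2 * ζ.im * ‖E‖) / T with hg
  have hg1 : g ≤ 1 := (div_le_one hT0).2 k1
  have hgT : g * T = M * d * (2 * ζ.im * ‖E‖) := div_mul_cancel₀ _ hT0.ne'
  have hlow : Real.exp (-ζ.im) * ((1 - ε) * (2 * M - (1 - ε))) ≤
      g * ((1 + ε) * (2 * M + (1 + ε))) := by
    refine le_of_mul_le_mul_right ?_ (pow_pos hd 2)
    calc _ = Real.exp (-ζ.im) * ((M * d) ^ 2 - ((M - (1 - ε)) * d) ^ 2) := by ring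
      _ ≤ _ := k3
      _ = g * T := hgT.symm
      _ = _ := by rw [hT]; ring
  obtain ⟨hg0, har⟩ := rigidity_arith (t := (1 + ε) * d) (ρ := M * d) hM8 hε hζ
    (hζy.le.trans (min_le_right _ _)) hg1 (by field_simp) hlow
  refine ⟨d, s, hd, hdd.trans_le (min_le_right _ _), hm, hs, hZ, hV, ?_, ?_⟩
  · have h1 : M * d * (2 * ζ.im * ‖E‖) ≤ M * d * (4 * d) := by
      refine k1.trans ?_
      have : (1 + ε) * (2 * M + (1 + ε)) ≤ 4 * M := by nlinarith
      calc T = (1 + ε) * (2 * M + (1 + ε)) * d ^ 2 := by rw [hT]; ring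
        _ ≤ 4 * M * d ^ 2 := by gcongr
        _ = _ := by ring
    have := le_of_mul_le_mul_left h1 hρ
    linarith
  · have hσ2 : (σ : ℂ) * σ = 1 := by
      have : σ * σ = 1 := by rw [← abs_mul_abs_self, hσ, one_mul]
      exact_mod_cast this
    set β : ℂ := σ * turning w (fun ζ => F (toDisk ζ)) L ζ with hβ
    have hβ' : β = σ * (E / ‖E‖ * (starRingEnd ℂ) e) := rfl
    have hβn : ‖β‖ = 1 := by
      rw [hβ', norm_mul, norm_mul, norm_div, Complex.norm_real, Complex.norm_real, norm_norm,
        div_self hE0.ne', RCLike.norm_conj, hen, Real.norm_eq_abs, hσ]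
      norm_num
    have hn0 : n ≠ 0 := norm_pos_iff.1 (by rw [hnn]; exact one_pos)
    have hEc : (‖E‖ : ℂ) ≠ 0 := by exact_mod_cast hE0.ne'
    have hEn : Complex.I * E / n = ‖E‖ * β := by
      rw [div_eq_iff hn0, hβ', hn]
      have h1 : e * (starRingEnd ℂ) e = 1 := by rw [Complex.mul_conj', hen]; simp
      field_simp
      linear_combination (-(σ * σ * E)) * h1 - E * hσ2
    have hGβ : ((M * d : ℝ) : ℂ) * (2 * ζ.im * Complex.I * E / n) / (T : ℝ) = (g : ℝ) * β := by
      rw [show 2 * (ζ.im : ℂ) * Complex.I * E / n = 2 * ζ.im * (Complex.I * E / n) by ring, hEn, hg]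
      push_cast
      ring
    rw [hGβ] at k2
    have h3 : ‖((1 + (1 + ε) * d / (M * d) : ℝ) : ℂ) * ((g : ℝ) * β) - β‖ =
        |(1 + (1 + ε) * d / (M * d)) * g - 1| := by
      rw [show ((1 + (1 + ε) * d / (M * d) : ℝ) : ℂ) * ((g : ℝ) * β) - β =
        (((1 + (1 + ε) * d / (M * d)) * g - 1 : ℝ) : ℂ) * β by push_cast; ring, norm_mul, hβn,
        mul_one, Complex.norm_real, Real.norm_eq_abs]
    refine (norm_sub_le_norm_sub_add_norm_sub _ _ _).trans ((add_le_add k2 h3.le).trans ?_)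
    exact har.trans hMκ

end JordanMap

/-- The averaged tangent, rotated by the argument of the derivative of the conformal map. -/
noncomputable def phase (w : ℝ → ℂ) (a : ℂ) (Ψ L : ℂ → ℂ) (ζ : ℂ) : ℂ :=
  a * tangent w (Ψ ζ) * Complex.exp (-(Complex.I * (L ζ).im))

theorem conj_phase_eq {w : ℝ → ℂ} {σ v : ℝ} {Ψ L : ℂ → ℂ} {ζ : ℂ} (hV : tangent w (Ψ ζ) ≠ 0) :
    (starRingEnd ℂ) (phase w (σ / v : ℝ) Ψ L ζ) =
      (‖tangent w (Ψ ζ)‖ / v : ℝ) * (σ * turning w Ψ L ζ) := by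
  have hVn : (‖tangent w (Ψ ζ)‖ : ℂ) ≠ 0 := by exact_mod_cast (norm_pos_iff.2 hV).ne'
  have h1 : Complex.exp (L ζ) / ‖Complex.exp (L ζ)‖ = Complex.exp (Complex.I * (L ζ).im) := by
    rw [Complex.norm_exp, Complex.ofReal_exp, ← Complex.exp_sub]
    congr 1
    have := Complex.re_add_im (L ζ)
    linear_combination -this
  rw [phase, turning, h1]
  simp only [map_mul, map_div₀, Complex.conj_ofReal, ← Complex.exp_conj, map_neg, Complex.conj_I]
  push_cast
  field_simp

theorem norm_phase {w : ℝ → ℂ} {a : ℂ} {Ψ L : ℂ → ℂ} {ζ : ℂ} :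
    ‖phase w a Ψ L ζ‖ = ‖a‖ * ‖tangent w (Ψ ζ)‖ := by
  rw [phase, norm_mul, norm_mul, Complex.norm_exp]
  simp

/-- The real differential of `Im L`. -/
noncomputable def imDeriv (L : ℂ → ℂ) (ζ : ℂ) : ℂ →L[ℝ] ℝ :=
  Complex.imCLM.comp ((ContinuousLinearMap.toSpanSingleton ℂ (deriv L ζ)).restrictScalars ℝ)

theorem imDeriv_apply (L : ℂ → ℂ) (ζ h : ℂ) : imDeriv L ζ h = (h * deriv L ζ).im := by
  simp [imDeriv]

theorem IsLift.hasFDerivAt_im {Ψ L : ℂ → ℂ} {ζ : ℂ} (hL : IsLift Ψ L) (hζ : 0 < ζ.im) :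
    HasFDerivAt (fun z => (L z).im) (imDeriv L ζ) ζ :=
  Complex.imCLM.hasFDerivAt.comp ζ ((hL.diff ζ hζ).hasFDerivAt.restrictScalars ℝ)

theorem IsLift.hasFDerivAt_phase {w : ℝ → ℂ} {a : ℂ} {Ψ L : ℂ → ℂ} {ζ : ℂ} {D : ℂ →L[ℝ] ℂ}
    (hL : IsLift Ψ L) (hζ : 0 < ζ.im) (hD : HasFDerivAt (tangent w) D (Ψ ζ)) :
    ∃ Q : ℂ →L[ℝ] ℂ, HasFDerivAt (phase w a Ψ L)
      (Q - (imDeriv L ζ).smulRight (Complex.I * phase w a Ψ L ζ)) ζ ∧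
      ‖Q‖ ≤ ‖a‖ * ‖D‖ * ‖Complex.exp (L ζ)‖ := by
  set R : ℂ →L[ℝ] ℂ := (ContinuousLinearMap.toSpanSingleton ℂ (Complex.exp (L ζ))).restrictScalars ℝ
    with hR
  set u := Complex.exp (-(Complex.I * (L ζ).im)) with hu
  have hun : ‖u‖ = 1 := by
    rw [hu, Complex.norm_exp]
    simp
  have h1 : HasFDerivAt (fun z => tangent w (Ψ z)) (D.comp R) ζ :=
    hD.comp ζ ((hL.hasDerivAt ζ hζ).hasFDerivAt.restrictScalars ℝ)
  have h2 : HasFDerivAt (fun z => Complex.exp (-(Complex.I * (L z).im)))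
      (u • -(Complex.I • Complex.ofRealCLM.comp (imDeriv L ζ))) ζ :=
    (((Complex.ofRealCLM.hasFDerivAt.comp ζ (hL.hasFDerivAt_im hζ)).const_mul
      Complex.I).neg).cexp
  refine ⟨(a * u) • D.comp R, ?_, ?_⟩
  · refine ((h1.const_mul a).mul h2).congr_fderiv ?_
    ext h
    simp only [phase, ← hu, add_apply, sub_apply, smul_apply, neg_apply, smul_eq_mul,
      ContinuousLinearMap.comp_apply, ContinuousLinearMap.smulRight_apply, Complex.real_smul,
      Complex.ofRealCLM_apply]
    ring
  · rw [norm_smul, norm_mul, hun, mul_one, mul_assoc]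
    gcongr
    refine (D.opNorm_comp_le R).trans ?_
    gcongr
    rw [hR, ContinuousLinearMap.norm_restrictScalars, ContinuousLinearMap.norm_toSpanSingleton]

namespace JordanMap

variable {γ w : ℝ → ℂ} {Ω Ωstar : Set ℂ} {F L : ℂ → ℂ} {v c : ℝ}

theorem exists_phase (J : JordanMap γ Ω Ωstar F) (H : ChordArcMap w v c)
    (hr : range w = range γ) (hS : sobolevSeminorm (1 / 2) (fun θ => deriv w θ) < ⊤)
    (hL : IsLift (fun ζ => F (toDisk ζ)) L) :
    ∃ a : ℂ, ∀ κ > 0, ∃ y₀ > 0, ∀ ζ : ℂ, 0 < ζ.im → ζ.im < y₀ →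
      1 - κ ≤ ‖phase w a (fun ζ => F (toDisk ζ)) L ζ‖ ∧
      ‖phase w a (fun ζ => F (toDisk ζ)) L ζ‖ ≤ 1 ∧
      ζ.im * ‖Complex.exp (L ζ)‖ ≤ κ ∧
      ‖1 + Complex.I * ζ.im * deriv L ζ -
        (starRingEnd ℂ) (phase w a (fun ζ => F (toDisk ζ)) L ζ)‖ ≤ κ ∧
      ∃ Q : ℂ →L[ℝ] ℂ, HasFDerivAt (phase w a (fun ζ => F (toDisk ζ)) L)
        (Q - (imDeriv L ζ).smulRight (Complex.I * phase w a (fun ζ => F (toDisk ζ)) L ζ)) ζ ∧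
        ζ.im * ‖Q‖ ≤ κ ∧
        ENNReal.ofReal (‖Q‖ ^ 2) ≤ 4096 * ENNReal.ofReal (‖Complex.exp (L ζ)‖ ^ 2) *
          tangentDensity w c (F (toDisk ζ)) := by
  obtain ⟨σ, hσ, hrig⟩ := J.exists_rigidity H hr hS hL
  have hv := H.v_pos
  refine ⟨(σ / v : ℝ), fun κ hκ => ?_⟩
  have han : ‖((σ / v : ℝ) : ℂ)‖ = 1 / v := by
    rw [Complex.norm_real, Real.norm_eq_abs, abs_div, hσ, abs_of_pos hv]
  set ε := min ((κ * v / 8) ^ 2) (κ / 2 * v ^ 2) with hε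
  have hε0 : 0 < ε := by positivity
  obtain ⟨d₀, hd₀, hdef⟩ := H.exists_defect_le hS hε0
  obtain ⟨y₀, hy₀, hrig⟩ := hrig (min (κ / 2) (min (2 * π * v) d₀)) (by positivity)
  refine ⟨y₀, hy₀, fun ζ hζ hζy => ?_⟩
  obtain ⟨d, s, hd, hdd, hm, hs, hZ, hV, hlam, hbeta⟩ := hrig ζ hζ hζy
  have hd1 : d < κ / 2 := hdd.trans_le (min_le_left _ _)
  have hd2 : d < 2 * π * v := hdd.trans_le ((min_le_right _ _).trans (min_le_left _ _))
  have hd3 : d < d₀ := hdd.trans_le ((min_le_right _ _).trans (min_le_right _ _))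
  have hA := hdef _ d s hd hd3 hm hs
  have hA1 := hA.trans (min_le_left _ _)
  have hA2 := hA.trans (min_le_right _ _)
  have hVv := H.norm_tangent_le hd hm hZ
  set Ψ : ℂ → ℂ := fun ζ => F (toDisk ζ) with hΨ
  change v / 2 ≤ ‖tangent w (Ψ ζ)‖ at hV
  change v ^ 2 - ‖tangent w (Ψ ζ)‖ ^ 2 ≤ _ at hA1
  change v ^ 2 - ‖tangent w (Ψ ζ)‖ ^ 2 ≤ _ at hA2
  change ‖tangent w (Ψ ζ)‖ ≤ v at hVv
  have hVn : 0 < ‖tangent w (Ψ ζ)‖ := by linarith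
  set V := tangent w (Ψ ζ) with hVd
  set m := phase w (σ / v : ℝ) Ψ L ζ with hmd
  have hmn : ‖m‖ = ‖V‖ / v := by rw [hmd, norm_phase, han]; ring
  have hm1 : ‖m‖ ≤ 1 := by rw [hmn, div_le_one hv]; exact hVv
  have hm2 : 1 - κ / 2 ≤ ‖m‖ := by
    have h1 : 1 - ‖m‖ ^ 2 ≤ κ / 2 := by
      have : 1 - ‖m‖ ^ 2 = (v ^ 2 - ‖V‖ ^ 2) / v ^ 2 := by rw [hmn]; field_simp
      rw [this, div_le_iff₀ (by positivity)]
      exact hA2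
    nlinarith [norm_nonneg m]
  obtain ⟨D, hD, hDn⟩ := H.exists_hasFDerivAt_tangent hd hm hZ
  obtain ⟨Q, hQ, hQn⟩ := hL.hasFDerivAt_phase (a := (σ / v : ℝ)) hζ hD
  change ‖D‖ ≤ 4 / d * √(v ^ 2 - ‖V‖ ^ 2) at hDn
  set A := v ^ 2 - ‖V‖ ^ 2 with hAd
  have hA0 : 0 ≤ A := by nlinarith
  set E := Complex.exp (L ζ) with hE
  have hQ1 : ‖Q‖ ≤ 1 / v * (4 / d * √A) * ‖E‖ := by
    rw [han] at hQn
    exact hQn.trans (by gcongr)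
  refine ⟨by linarith, hm1, by linarith, ?_, Q, hQ, ?_, ?_⟩
  · have h1 : (starRingEnd ℂ) m = (‖V‖ / v : ℝ) * (σ * turning w Ψ L ζ) :=
      conj_phase_eq (norm_pos_iff.1 hVn)
    have h2 : ‖σ * turning w Ψ L ζ‖ = 1 := by
      have := congrArg norm h1
      rw [RCLike.norm_conj, hmn, norm_mul, Complex.norm_real, Real.norm_of_nonneg (by positivity)]
        at this
      have h3 : 0 < ‖V‖ / v := by positivity
      exact mul_left_cancel₀ h3.ne' (by rw [← this, mul_one])
    have h4 : ‖σ * turning w Ψ L ζ - (starRingEnd ℂ) m‖ = 1 - ‖m‖ := by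
      rw [h1, show σ * turning w Ψ L ζ - (‖V‖ / v : ℝ) * (σ * turning w Ψ L ζ) =
        ((1 - ‖V‖ / v : ℝ) : ℂ) * (σ * turning w Ψ L ζ) by push_cast; ring, norm_mul, h2, mul_one,
        Complex.norm_real, Real.norm_of_nonneg (by rw [← hmn]; linarith), hmn]
    refine (norm_sub_le_norm_sub_add_norm_sub _ (σ * turning w Ψ L ζ) _).trans ?_
    have := hbeta.trans (min_le_left _ _)
    linarith
  · have h1 : √A ≤ κ * v / 8 := by
      rw [← Real.sqrt_sq (by positivity : 0 ≤ κ * v / 8)]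
      exact Real.sqrt_le_sqrt hA1
    calc ζ.im * ‖Q‖ ≤ ζ.im * (1 / v * (4 / d * √A) * ‖E‖) := by gcongr
      _ = ζ.im * ‖E‖ * (1 / v * (4 / d * √A)) := by ring
      _ ≤ 2 * d * (1 / v * (4 / d * (κ * v / 8))) := by gcongr
      _ = κ := by field_simp; norm_num
  · have h1 : ‖Q‖ ^ 2 ≤ 16 * ‖E‖ ^ 2 / (v ^ 2 * d ^ 2) * A := by
      calc ‖Q‖ ^ 2 ≤ (1 / v * (4 / d * √A) * ‖E‖) ^ 2 := by gcongr
        _ = 16 * ‖E‖ ^ 2 / (v ^ 2 * d ^ 2) * √A ^ 2 := by ring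
        _ = _ := by rw [Real.sq_sqrt hA0]
    have h2 := H.ofReal_defect_le hd hm hs hd2.le
    change ENNReal.ofReal A ≤ _ at h2
    calc ENNReal.ofReal (‖Q‖ ^ 2) ≤ ENNReal.ofReal (16 * ‖E‖ ^ 2 / (v ^ 2 * d ^ 2)) *
          ENNReal.ofReal A := by
          rw [← ENNReal.ofReal_mul (by positivity)]
          exact ENNReal.ofReal_le_ofReal h1
      _ ≤ ENNReal.ofReal (16 * ‖E‖ ^ 2 / (v ^ 2 * d ^ 2)) *
          (ENNReal.ofReal (256 * v ^ 2 * d ^ 2) * tangentDensity w c (F (toDisk ζ))) := by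
          gcongr
      _ = _ := by
          rw [← mul_assoc, ← ENNReal.ofReal_mul (by positivity), ← ENNReal.ofReal_ofNat 4096,
            ← ENNReal.ofReal_mul (by norm_num)]
          congr 2
          field_simp
          ring

end JordanMap

/-- A differential inequality which forces `r` to be close to `1` wherever `q` is small. -/
theorem sub_le_of_hasDerivAt {r r' q q' : ℝ → ℝ} {ε y y₁ : ℝ} (hy : 0 < y) (hyy : y ≤ y₁)
    (hr : ∀ t ∈ Icc y y₁, HasDerivAt r (r' t) t) (hq : ∀ t ∈ Icc y y₁, HasDerivAt q (q' t) t)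
    (hq0 : ∀ t ∈ Icc y y₁, 0 < q t) (hr1 : ∀ t ∈ Icc y y₁, |r t| ≤ 1) (hε : 0 ≤ ε)
    (hε1 : 3 * ε ≤ 1)
    (h1 : ∀ t ∈ Icc y y₁, t * r' t ≤ r t ^ 2 - 1 + ε)
    (h2 : ∀ t ∈ Icc y y₁, |t * q' t - q t * r t| ≤ ε * q t) :
    1 - 3 * ε - r y ≤ 2 * (q y / q y₁) := by
  set b := 1 - 3 * ε with hb
  have hd : ∀ t ∈ Icc y y₁, HasDerivAt (fun t => (b - r t) / q t)
      ((-r' t * q t - (b - r t) * q' t) / q t ^ 2) t := fun t ht =>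
    ((hr t ht).const_sub b).div (hq t ht) (hq0 t ht).ne'
  have hmono : MonotoneOn (fun t => (b - r t) / q t) (Icc y y₁) := by
    refine monotoneOn_of_deriv_nonneg (convex_Icc _ _)
      (fun t ht => (hd t ht).continuousAt.continuousWithinAt)
      (fun t ht => (hd t (interior_subset ht)).differentiableAt.differentiableWithinAt)
      (fun t ht => ?_)
    have ht' := interior_subset ht
    rw [(hd t ht').deriv]
    refine div_nonneg ?_ (sq_nonneg _)
    have ht0 : 0 < t := hy.trans_le ht'.1
    have e1 := h1 t ht'
    have e2 := h2 t ht'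
    have hq := hq0 t ht'
    have e3 := abs_le.1 (hr1 t ht')
    have e4 : |(b - r t) * (t * q' t - q t * r t)| ≤ 2 * (ε * q t) := by
      rw [abs_mul]
      refine mul_le_mul ?_ e2 (abs_nonneg _) (by norm_num)
      rw [abs_le]
      constructor <;> linarith
    have e5 := (abs_le.1 e4).2
    have e6 : 0 ≤ t * (-r' t * q t - (b - r t) * q' t) := by
      have e7 : t * r' t * q t ≤ (r t ^ 2 - 1 + ε) * q t :=
        mul_le_mul_of_nonneg_right e1 hq.le
      have e8 : 0 ≤ (1 - b * r t - 3 * ε) * q t := by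
        refine mul_nonneg ?_ hq.le
        nlinarith
      nlinarith
    exact nonneg_of_mul_nonneg_right e6 ht0
  have h := hmono (left_mem_Icc.2 hyy) (right_mem_Icc.2 hyy) hyy
  have hy0 := hq0 y (left_mem_Icc.2 hyy)
  have hy1 := hq0 y₁ (right_mem_Icc.2 hyy)
  have e3 := abs_le.1 (hr1 y₁ (right_mem_Icc.2 hyy))
  have h' : (b - r y) / q y ≤ 2 / q y₁ := h.trans
    (div_le_div_of_nonneg_right (by linarith [e3.1]) hy1.le)
  rw [div_le_iff₀ hy0] at h'
  exact h'.trans_eq (by ring)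

theorem norm_sub_one_sq_le {m : ℂ} (hm : ‖m‖ ≤ 1) : ‖m - 1‖ ^ 2 ≤ 2 * (1 - m.re) := by
  have h1 : ‖m‖ ^ 2 ≤ 1 := pow_le_one₀ (norm_nonneg _) hm
  rw [← Complex.normSq_eq_norm_sq, Complex.normSq_apply] at h1 ⊢
  simp only [Complex.sub_re, Complex.sub_im, Complex.one_re, Complex.one_im]
  nlinarith

theorem IsLift.phase_per {w : ℝ → ℂ} {a : ℂ} {Ψ L : ℂ → ℂ} {ζ : ℂ} (hL : IsLift Ψ L)
    (hζ : 0 < ζ.im) : phase w a Ψ L (ζ + 2 * π) = phase w a Ψ L ζ := by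
  have h1 : ∀ z, Complex.exp (-(Complex.I * (L z).im)) =
      (starRingEnd ℂ) (Complex.exp (L z) / ‖Complex.exp (L z)‖) := by
    intro z
    rw [Complex.norm_exp, Complex.ofReal_exp, ← Complex.exp_sub, ← Complex.exp_conj]
    congr 1
    apply Complex.ext <;> simp
  rw [phase, phase, h1, h1, hL.exp_per hζ, hL.per ζ hζ]

namespace JordanMap

variable {γ w : ℝ → ℂ} {Ω Ωstar : Set ℂ} {F L : ℂ → ℂ} {v c : ℝ}

theorem exists_phase_sub_one (J : JordanMap γ Ω Ωstar F) (H : ChordArcMap w v c)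
    (hr : range w = range γ) (hS : sobolevSeminorm (1 / 2) (fun θ => deriv w θ) < ⊤)
    (hL : IsLift (fun ζ => F (toDisk ζ)) L) :
    ∃ a : ℂ, ∀ κ > 0, ∃ y₀ > 0, ∀ ζ : ℂ, 0 < ζ.im → ζ.im < y₀ →
      ‖phase w a (fun ζ => F (toDisk ζ)) L ζ - 1‖ ≤ κ ∧
      ∃ Q : ℂ →L[ℝ] ℂ, HasFDerivAt (phase w a (fun ζ => F (toDisk ζ)) L)
        (Q - (imDeriv L ζ).smulRight (Complex.I * phase w a (fun ζ => F (toDisk ζ)) L ζ)) ζ ∧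
        ENNReal.ofReal (‖Q‖ ^ 2) ≤ 4096 * ENNReal.ofReal (‖Complex.exp (L ζ)‖ ^ 2) *
          tangentDensity w c (F (toDisk ζ)) := by
  obtain ⟨a, ha⟩ := J.exists_phase H hr hS hL
  refine ⟨a, fun κ hκ => ?_⟩
  set Ψ : ℂ → ℂ := fun ζ => F (toDisk ζ) with hΨ
  set m := phase w a Ψ L with hm
  set η := min (κ ^ 2 / 48) (1 / 12) with hη
  have hη0 : 0 < η := by positivity
  have hη1 : η ≤ κ ^ 2 / 48 := min_le_left _ _
  have hη2 : η ≤ 1 / 12 := min_le_right _ _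
  obtain ⟨Y, hY, hfac⟩ := ha η hη0
  set y₁ := Y / 2 with hy₁
  have hy₁0 : 0 < y₁ := by positivity
  obtain ⟨C, hC, hCb⟩ : ∃ C > 0, ∀ x : ℝ, ‖(Complex.exp (L (x + y₁ * Complex.I)))⁻¹‖ ≤ C := by
    refine exists_norm_le_of_periodic ?_ ?_
    · refine Continuous.inv₀ ?_ (fun x => Complex.exp_ne_zero _)
      exact Complex.continuous_exp.comp (continuousOn_horizontal
        (fun z hz => (hL.diff z hz).continuousAt.continuousWithinAt) hy₁0)
    · intro x
      have := hL.exp_per (ζ := x + y₁ * Complex.I) (by simpa using hy₁0)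
      rw [← this]
      congr 3
      push_cast
      ring
  obtain ⟨y₂, hy₂, hfac2⟩ := ha (κ ^ 2 / 8 * (y₁ / C)) (by positivity)
  refine ⟨min y₁ y₂, by positivity, fun ζ hζ hζy => ?_⟩
  have hz1 : ζ.im < y₁ := hζy.trans_le (min_le_left _ _)
  have hz2 : ζ.im < y₂ := hζy.trans_le (min_le_right _ _)
  obtain ⟨-, hm1, -, -, Q, hQ, -, hQ2⟩ := hfac ζ hζ (by linarith)
  obtain ⟨-, -, hlam, -⟩ := hfac2 ζ hζ hz2
  refine ⟨?_, Q, hQ, hQ2⟩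
  set p : ℝ → ℂ := fun t => ζ.re + t * Complex.I with hp
  have hpim : ∀ t, (p t).im = t := fun t => im_add_mul_I _ _
  have hpd : ∀ t, HasDerivAt p Complex.I t := by
    intro t
    exact (((Complex.ofRealCLM.hasDerivAt (x := t)).mul_const Complex.I).const_add
      (ζ.re : ℂ)).congr_deriv (by simp)
  have hpos : ∀ t ∈ Icc ζ.im y₁, 0 < t := fun t ht => hζ.trans_le ht.1
  have hlt : ∀ t ∈ Icc ζ.im y₁, t < Y := fun t ht => by linarith [ht.2]
  have hfac' : ∀ t ∈ Icc ζ.im y₁, _ := fun t ht =>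
    hfac (p t) (by rw [hpim]; exact hpos t ht) (by rw [hpim]; exact hlt t ht)
  simp only [hpim] at hfac'
  choose! _ _ _ _ Qt hQt hQtn _ using hfac'
  rename_i f1 f2 _ f4 _
  have key := sub_le_of_hasDerivAt (r := fun t => (m (p t)).re)
    (r' := fun t => (Qt t Complex.I - (imDeriv L (p t)).smulRight (Complex.I * m (p t))
      Complex.I).re) (q := fun t => t * Real.exp (L (p t)).re)
    (q' := fun t => Real.exp (L (p t)).re + t * (Real.exp (L (p t)).re *
      (deriv L (p t) * Complex.I).re)) (ε := 4 * η) hζ hz1.le ?_ ?_ ?_ ?_ (by positivity)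
      (by linarith) ?_ ?_
  · have hpz : p ζ.im = ζ := Complex.re_add_im ζ
    simp only [hpz, ← Complex.norm_exp] at key
    have h1 : 1 / C ≤ ‖Complex.exp (L (p y₁))‖ := by
      have := hCb ζ.re
      rw [norm_inv] at this
      rw [one_div]
      exact inv_le_of_inv_le₀ (norm_pos_iff.2 (Complex.exp_ne_zero _)) this
    have h0 : 0 < ‖Complex.exp (L (p y₁))‖ := norm_pos_iff.2 (Complex.exp_ne_zero _)
    have h2 : ζ.im * ‖Complex.exp (L ζ)‖ / (y₁ * ‖Complex.exp (L (p y₁))‖) ≤ κ ^ 2 / 8 := by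
      rw [div_le_iff₀ (by positivity)]
      refine hlam.trans ?_
      refine mul_le_mul_of_nonneg_left ?_ (by positivity)
      rw [div_eq_mul_one_div]
      gcongr
    have h3 := norm_sub_one_sq_le hm1
    refine le_of_sq_le_sq (h3.trans ?_) hκ.le
    linarith
  · intro t ht
    have h1 := (hQt t ht).comp_hasDerivAt t (hpd t)
    exact Complex.reCLM.hasFDerivAt.comp_hasDerivAt t h1
  · intro t ht
    have h1 : HasDerivAt (fun t => L (p t)) (deriv L (p t) * Complex.I) t :=
      (hL.diff (p t) (by rw [hpim]; exact hpos t ht)).comp t (hpd t)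
    have h2 : HasDerivAt (fun t => (L (p t)).re) (deriv L (p t) * Complex.I).re t :=
      Complex.reCLM.hasFDerivAt.comp_hasDerivAt t h1
    exact ((hasDerivAt_id t).mul h2.exp).congr_deriv (by rw [one_mul]; rfl)
  · intro t ht
    have := hpos t ht
    positivity
  · exact fun t ht => (Complex.abs_re_le_norm _).trans (f2 t ht)
  · intro t ht
    have ht0 := hpos t ht
    have e1 := hQtn t ht
    have e2 := f4 t ht
    have e3 := f1 t ht
    set M := m (p t) with hM
    have e4 := (Complex.abs_im_le_norm _).trans e2
    simp only [Complex.sub_im, Complex.add_im, Complex.one_im, Complex.conj_im, Complex.mul_im,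
      Complex.mul_re, Complex.I_re, Complex.I_im, Complex.ofReal_re, Complex.ofReal_im] at e4
    have e5 : |(Qt t Complex.I).re| ≤ ‖Qt t‖ :=
      (Complex.abs_re_le_norm _).trans (((Qt t).le_opNorm _).trans_eq (by simp))
    have e6 : t * (Qt t Complex.I).re ≤ η :=
      (mul_le_mul_of_nonneg_left ((le_abs_self _).trans e5) ht0.le).trans e1
    have e7 : |M.im| ≤ 1 := (Complex.abs_im_le_norm _).trans (f2 t ht)
    have e8 : (1 - η) ^ 2 ≤ ‖M‖ ^ 2 := pow_le_pow_left₀ (by linarith) e3 2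
    rw [← Complex.normSq_eq_norm_sq, Complex.normSq_apply] at e8
    simp only [ContinuousLinearMap.smulRight_apply, imDeriv_apply, Complex.sub_re,
      Complex.real_smul, Complex.mul_re, Complex.mul_im, Complex.I_re, Complex.I_im,
      Complex.ofReal_re, Complex.ofReal_im]
    have e9 : (t * (deriv L (p t)).re + M.im) * M.im ≤ η := by
      refine (le_abs_self _).trans ?_
      rw [abs_mul]
      refine (mul_le_of_le_one_right (abs_nonneg _) e7).trans ?_
      convert e4 using 2
      ring
    nlinarith
  · intro t ht
    have ht0 := hpos t ht
    have e2 := f4 t ht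
    have e4 := (Complex.abs_re_le_norm _).trans e2
    simp only [Complex.sub_re, Complex.add_re, Complex.one_re, Complex.conj_re, Complex.mul_im,
      Complex.mul_re, Complex.I_re, Complex.I_im, Complex.ofReal_re, Complex.ofReal_im] at e4
    have hq : 0 < t * Real.exp (L (p t)).re := by positivity
    have e5 : t * (Real.exp (L (p t)).re + t * (Real.exp (L (p t)).re *
        (deriv L (p t) * Complex.I).re)) - t * Real.exp (L (p t)).re * (m (p t)).re =
        (t * Real.exp (L (p t)).re) * (1 + ((0 * t - 1 * 0) * (deriv L (p t)).re -
          (0 * 0 + 1 * t) * (deriv L (p t)).im) - (m (p t)).re) := by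
      simp only [Complex.mul_re, Complex.I_re, Complex.I_im]
      ring
    rw [e5, abs_mul, abs_of_pos hq, mul_comm]
    refine mul_le_mul_of_nonneg_right ?_ hq.le
    linarith

end JordanMap

section

theorem integrableOn_reProdIm {s t : Set ℝ} {u : ℂ → ℂ} (hu : IntegrableOn u (s ×ℂ t)) :
    IntegrableOn (fun p : ℝ × ℝ => u (p.1 + p.2 * Complex.I)) (s ×ˢ t)
      ((volume : Measure ℝ).prod volume) := by
  have h1 : MeasurePreserving Complex.measurableEquivRealProd.symm volume volume :=
    Complex.volume_preserving_equiv_real_prod.symm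
  have h2 : Complex.measurableEquivRealProd.symm ⁻¹' (s ×ℂ t) = s ×ˢ t := by
    ext p; simp [Complex.mem_reProdIm]
  have h3 := (h1.integrableOn_comp_preimage
    Complex.measurableEquivRealProd.symm.measurableEmbedding).2 hu
  rw [h2, Measure.volume_eq_prod] at h3
  refine h3.congr (Eventually.of_forall fun p => ?_)
  simp [Complex.measurableEquivRealProd_symm_apply, Complex.mk_eq_add_mul_I]

theorem integral_reProdIm_eq {s t : Set ℝ} (u : ℂ → ℂ) :
    ∫ z in s ×ℂ t, u z = ∫ p in s ×ˢ t, u (p.1 + p.2 * Complex.I)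
      ∂((volume : Measure ℝ).prod volume) := by
  have h1 : MeasurePreserving Complex.measurableEquivRealProd.symm volume volume :=
    Complex.volume_preserving_equiv_real_prod.symm
  have h2 : Complex.measurableEquivRealProd.symm ⁻¹' (s ×ℂ t) = s ×ˢ t := by
    ext p; simp [Complex.mem_reProdIm]
  rw [← h1.setIntegral_preimage_emb Complex.measurableEquivRealProd.symm.measurableEmbedding, h2,
    Measure.volume_eq_prod]
  simp [Complex.measurableEquivRealProd_symm_apply, Complex.mk_eq_add_mul_I]

theorem integral_reProdIm {s t : Set ℝ} {u : ℂ → ℂ} (hu : IntegrableOn u (s ×ℂ t)) :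
    ∫ z in s ×ℂ t, u z = ∫ x in s, ∫ y in t, u (x + y * Complex.I) := by
  rw [integral_reProdIm_eq, setIntegral_prod _ (integrableOn_reProdIm hu)]

theorem integral_reProdIm_symm {s t : Set ℝ} {u : ℂ → ℂ} (hu : IntegrableOn u (s ×ℂ t)) :
    ∫ z in s ×ℂ t, u z = ∫ y in t, ∫ x in s, u (x + y * Complex.I) := by
  have h := integrableOn_reProdIm hu
  rw [IntegrableOn, ← Measure.prod_restrict] at h
  rw [integral_reProdIm_eq, ← Measure.prod_restrict, integral_prod_symm _ h]

variable {f : ℂ → ℂ}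

theorem continuousOn_translate (hf : DifferentiableOn ℂ f {z | 0 < z.im}) {t : ℝ} (ht : 0 ≤ t) :
    ContinuousOn (fun z => f (z + t * Complex.I)) {z | 0 < z.im} := by
  refine hf.continuousOn.comp (by fun_prop) (fun z hz => ?_)
  have : 0 < z.im := hz
  simpa using by linarith

theorem differentiableAt_of_upper (hf : DifferentiableOn ℂ f {z | 0 < z.im}) {z : ℂ}
    (hz : 0 < z.im) : DifferentiableAt ℂ f z :=
  hf.differentiableAt (isOpen_upper.mem_nhds hz)

theorem differentiableAt_reflect (hf : DifferentiableOn ℂ f {z | 0 < z.im}) {z : ℂ} {b : ℝ}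
    (hz : z.im < b) : DifferentiableAt ℂ
      (fun z => (starRingEnd ℂ) (f ((starRingEnd ℂ) z + Complex.I * b))) z := by
  have h : DifferentiableAt ℂ (fun u => f (u + Complex.I * b)) ((starRingEnd ℂ) z) := by
    have h1 : DifferentiableAt ℂ f ((starRingEnd ℂ) z + Complex.I * b) :=
      differentiableAt_of_upper hf (by simpa using hz)
    exact DifferentiableAt.comp (f := fun u => u + Complex.I * b) _ h1 (by fun_prop)
  have h2 := h.conj_conj
  rw [Complex.conj_conj] at h2
  exact h2

/-- Shifting the contour in the mean value of `f · conj f`. -/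
theorem integral_mul_conj_translate (hf : DifferentiableOn ℂ f {z | 0 < z.im})
    (hp : ∀ z : ℂ, 0 < z.im → f (z + 2 * π) = f z) {y t : ℝ} (hy : 0 < y) (ht : 0 ≤ t) :
    ∫ x in (0 : ℝ)..2 * π, f (x + y * Complex.I + t * Complex.I) *
        (starRingEnd ℂ) (f (x + y * Complex.I)) =
      ∫ x in (0 : ℝ)..2 * π, f (x + y * Complex.I + (t / 2 : ℝ) * Complex.I) *
        (starRingEnd ℂ) (f (x + y * Complex.I + (t / 2 : ℝ) * Complex.I)) := by
  set b : ℝ := 2 * y + t with hb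
  set G : ℂ → ℂ := fun z => f z * (starRingEnd ℂ) (f ((starRingEnd ℂ) z + Complex.I * b)) with hG
  have hd : DifferentiableOn ℂ G
      (uIcc (⟨0, y + t / 2⟩ : ℂ).re (⟨2 * π, y + t⟩ : ℂ).re ×ℂ
        uIcc (⟨0, y + t / 2⟩ : ℂ).im (⟨2 * π, y + t⟩ : ℂ).im) := by
    intro z hz
    have h1 := (Complex.mem_reProdIm.1 hz).2
    simp only at h1
    rw [uIcc_of_le (by linarith)] at h1
    refine DifferentiableAt.differentiableWithinAt ?_
    refine DifferentiableAt.mul (differentiableAt_of_upper hf (by linarith [h1.1]))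
      (differentiableAt_reflect hf ?_)
    linarith [h1.2]
  have h := Complex.integral_boundary_rect_eq_zero_of_differentiableOn G _ _ hd
  simp only at h
  have hside : ∀ s : ℝ, s ∈ uIcc (y + t / 2) (y + t) → G (((2 * π : ℝ) : ℂ) + s * Complex.I) =
      G (((0 : ℝ) : ℂ) + s * Complex.I) := by
    intro s hs
    rw [uIcc_of_le (by linarith)] at hs
    simp only [hG]
    congr 1
    · rw [← hp (((0 : ℝ) : ℂ) + s * Complex.I) (by simpa using by linarith [hs.1])]
      congr 1
      push_cast
      ring
    · rw [← hp ((starRingEnd ℂ) (((0 : ℝ) : ℂ) + s * Complex.I) + Complex.I * b)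
        (by simpa using by linarith [hs.2])]
      congr 2
      simp only [map_add, map_mul, Complex.conj_ofReal, Complex.conj_I]
      push_cast
      ring
  rw [intervalIntegral.integral_congr hside] at h
  have e1 : ∀ x : ℝ, f (x + y * Complex.I + t * Complex.I) *
      (starRingEnd ℂ) (f (x + y * Complex.I)) = G (x + (y + t : ℝ) * Complex.I) := by
    intro x
    simp only [hG, hb]
    congr 2
    · push_cast; ring
    · congr 1
      simp only [map_add, map_mul, Complex.conj_ofReal, Complex.conj_I]
      push_cast
      ring
  have e2 : ∀ x : ℝ, f (x + y * Complex.I + (t / 2 : ℝ) * Complex.I) *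
      (starRingEnd ℂ) (f (x + y * Complex.I + (t / 2 : ℝ) * Complex.I)) =
        G (x + (y + t / 2 : ℝ) * Complex.I) := by
    intro x
    simp only [hG, hb]
    congr 2
    · push_cast; ring
    · congr 1
      simp only [map_add, map_mul, Complex.conj_ofReal, Complex.conj_I]
      push_cast
      ring
  simp only [e1, e2]
  linear_combination -h

end

section

/-- The energy of `f` in one period of a horizontal strip. -/
noncomputable def boxEnergy (f : ℂ → ℂ) (a b : ℝ) : ENNReal :=
  ∫⁻ z in Ioc 0 (2 * π) ×ℂ Ioc a b, ‖f z‖ₑ ^ 2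

variable {f : ℂ → ℂ}

theorem exists_norm_le_of_continuousOn_upper (hf : ContinuousOn f {z | 0 < z.im}) {a b : ℝ}
    (ha : 0 < a) : ∃ C > 0, ∀ x ∈ Icc 0 (2 * π), ∀ y ∈ Icc a b, ‖f (x + y * Complex.I)‖ ≤ C := by
  have hc : IsCompact (Icc 0 (2 * π) ×ℂ Icc a b) := isCompact_Icc.reProdIm isCompact_Icc
  obtain ⟨C, hC⟩ := hc.exists_bound_of_continuousOn
    (hf.mono fun z hz => ha.trans_le (Complex.mem_reProdIm.1 hz).2.1)
  refine ⟨max C 1, by positivity, fun x hx y hy => (hC _ ?_).trans (le_max_left _ _)⟩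
  exact Complex.mem_reProdIm.2 ⟨by simpa using hx, by simpa using hy⟩

theorem Ioc_reProdIm_subset {a b c d : ℝ} : Ioc a b ×ℂ Ioc c d ⊆ Icc a b ×ℂ Icc c d :=
  fun _ hz => ⟨Ioc_subset_Icc_self hz.1, Ioc_subset_Icc_self hz.2⟩

theorem volume_Ioc_reProdIm_lt_top {a b c d : ℝ} : volume (Ioc a b ×ℂ Ioc c d) < ⊤ :=
  (measure_mono Ioc_reProdIm_subset).trans_lt
    (isCompact_Icc.reProdIm isCompact_Icc).measure_lt_top

theorem boxEnergy_lt_top (hf : ContinuousOn f {z | 0 < z.im}) {a b : ℝ} (ha : 0 < a) :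
    boxEnergy f a b < ⊤ := by
  obtain ⟨C, -, hC⟩ := exists_norm_le_of_continuousOn_upper (b := b) hf ha
  refine setLIntegral_lt_top_of_le_nnreal volume_Ioc_reProdIm_lt_top.ne
    ⟨(C.toNNReal) ^ 2, fun z hz => ?_⟩
  have h1 := Complex.mem_reProdIm.1 hz
  have h2 := hC z.re (Ioc_subset_Icc_self h1.1) z.im (Ioc_subset_Icc_self h1.2)
  rw [Complex.re_add_im] at h2
  push_cast
  gcongr
  rw [← ofReal_norm]
  exact ENNReal.ofReal_le_ofReal h2

theorem setLIntegral_translate (u : ℂ → ENNReal) (a b t : ℝ) :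
    ∫⁻ z in Ioc 0 (2 * π) ×ℂ Ioc a b, u (z + t * Complex.I) =
      ∫⁻ z in Ioc 0 (2 * π) ×ℂ Ioc (a + t) (b + t), u z := by
  have h := (measurePreserving_add_right volume ((t : ℂ) *
    Complex.I)).setLIntegral_comp_preimage_emb
    (measurableEmbedding_addRight _) u (Ioc 0 (2 * π) ×ℂ Ioc (a + t) (b + t))
  rw [← h]
  congr 2
  ext z
  simp [Complex.mem_reProdIm]

theorem boxEnergy_union_le (f : ℂ → ℂ) {a b c d a' b' : ℝ}
    (h : Ioc a b ⊆ Ioc c d ∪ Ioc a' b') :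
    boxEnergy f a b ≤ boxEnergy f c d + boxEnergy f a' b' := by
  refine le_trans (lintegral_mono_set fun z hz => ?_) (lintegral_union_le _ _ _)
  have h1 := Complex.mem_reProdIm.1 hz
  exact (h h1.2).imp (fun h2 => ⟨h1.1, h2⟩) fun h2 => ⟨h1.1, h2⟩

theorem boxEnergy_mono (f : ℂ → ℂ) {a b c d : ℝ} (h : Ioc a b ⊆ Ioc c d) :
    boxEnergy f a b ≤ boxEnergy f c d :=
  lintegral_mono_set fun _ hz => ⟨hz.1, h hz.2⟩

theorem integrableOn_translate_mul_conj (hf : DifferentiableOn ℂ f {z | 0 < z.im}) {a b t : ℝ}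
    (ha : 0 < a) (ht : 0 ≤ t) :
    IntegrableOn (fun z => f (z + t * Complex.I) * (starRingEnd ℂ) (f z))
      (Icc 0 (2 * π) ×ℂ Icc a b) := by
  refine ContinuousOn.integrableOn_compact (isCompact_Icc.reProdIm isCompact_Icc) ?_
  have h := (continuousOn_translate hf ht).mul
    (Complex.continuous_conj.comp_continuousOn hf.continuousOn)
  exact h.mono fun z hz => ha.trans_le (Complex.mem_reProdIm.1 hz).2.1

theorem enorm_integral_translate_mul_conj (hf : DifferentiableOn ℂ f {z | 0 < z.im})
    (hp : ∀ z : ℂ, 0 < z.im → f (z + 2 * π) = f z) {a b t : ℝ} (ha : 0 < a) (ht : 0 ≤ t) :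
    ‖∫ z in Ioc 0 (2 * π) ×ℂ Ioc a b, f (z + t * Complex.I) * (starRingEnd ℂ) (f z)‖ₑ =
      boxEnergy f (a + t / 2) (b + t / 2) := by
  have hd2 : DifferentiableOn ℂ (fun z => f (z + (t / 2 : ℝ) * Complex.I)) {z | 0 < z.im} := by
    intro z hz
    have hz : 0 < z.im := hz
    have h1 : DifferentiableAt ℂ f (z + (t / 2 : ℝ) * Complex.I) :=
      differentiableAt_of_upper hf (by simpa using by linarith)
    exact (DifferentiableAt.comp (f := fun u => u + (t / 2 : ℝ) * Complex.I) _ h1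
      (by fun_prop)).differentiableWithinAt
  have hi1 := (integrableOn_translate_mul_conj (b := b) hf ha ht).mono_set Ioc_reProdIm_subset
  have hi2 := (integrableOn_translate_mul_conj (b := b) hd2 ha le_rfl).mono_set Ioc_reProdIm_subset
  simp only [Complex.ofReal_zero, zero_mul, add_zero] at hi2
  have h1 : ∫ z in Ioc 0 (2 * π) ×ℂ Ioc a b, f (z + t * Complex.I) * (starRingEnd ℂ) (f z) =
      ∫ z in Ioc 0 (2 * π) ×ℂ Ioc a b, f (z + (t / 2 : ℝ) * Complex.I) *
        (starRingEnd ℂ) (f (z + (t / 2 : ℝ) * Complex.I)) := by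
    rw [integral_reProdIm_symm hi1, integral_reProdIm_symm hi2]
    refine setIntegral_congr_fun measurableSet_Ioc fun y hy => ?_
    rw [← intervalIntegral.integral_of_le (by positivity),
      ← intervalIntegral.integral_of_le (by positivity)]
    exact integral_mul_conj_translate hf hp (ha.trans hy.1) ht
  have h2 : ∀ z : ℂ, f (z + (t / 2 : ℝ) * Complex.I) *
        (starRingEnd ℂ) (f (z + (t / 2 : ℝ) * Complex.I)) =
      ((‖f (z + (t / 2 : ℝ) * Complex.I)‖ ^ 2 : ℝ) : ℂ) := by
    intro z
    rw [Complex.mul_conj, Complex.normSq_eq_norm_sq]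
  have hi3 := hi2.norm
  simp only [h2] at h1 hi3
  rw [h1, integral_complex_ofReal]
  simp only [Complex.norm_real, norm_pow, norm_norm] at hi3
  rw [← ofReal_norm, Complex.norm_real,
    Real.norm_of_nonneg (integral_nonneg fun _ => by positivity),
    ofReal_integral_eq_lintegral_ofReal hi3 (Eventually.of_forall fun _ => by positivity)]
  simp only [ofReal_norm_sq_eq]
  exact setLIntegral_translate (fun z => ‖f z‖ₑ ^ 2) a b (t / 2)

end

section

variable {f q K : ℂ → ℂ} {q' : ℂ → ℂ →L[ℝ] ℂ} {a b t : ℝ}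

theorem hasFDerivAt_translate_mul (hf : DifferentiableOn ℂ f {z | 0 < z.im}) {z : ℂ}
    (hz : 0 < z.im) (ht : 0 ≤ t) (hq : HasFDerivAt q (q' z) z)
    (hK : Complex.I * q' z 1 - q' z Complex.I = K z + Complex.I * (starRingEnd ℂ) (f z)) :
    ∃ D : ℂ →L[ℝ] ℂ, HasFDerivAt (fun z => f (z + t * Complex.I) * q z) D z ∧
      Complex.I • D 1 - D Complex.I = f (z + t * Complex.I) * K z +
        Complex.I * (f (z + t * Complex.I) * (starRingEnd ℂ) (f z)) := by
  have h1 : DifferentiableAt ℂ f (z + t * Complex.I) :=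
    differentiableAt_of_upper hf (by simpa using by linarith)
  have h2 : DifferentiableAt ℂ (fun z => f (z + t * Complex.I)) z :=
    DifferentiableAt.comp (f := fun u => u + t * Complex.I) _ h1 (by fun_prop)
  have h3 := h2.hasDerivAt.hasFDerivAt.restrictScalars ℝ
  refine ⟨_, h3.mul hq, ?_⟩
  simp only [add_apply, smul_apply, smul_eq_mul, ContinuousLinearMap.coe_restrictScalars',
    ContinuousLinearMap.toSpanSingleton_apply]
  linear_combination f (z + t * Complex.I) * hK

theorem integrableOn_translate_mul (hf : DifferentiableOn ℂ f {z | 0 < z.im}) (ha : 0 < a)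
    (ht : 0 ≤ t) (hKm : AEStronglyMeasurable K (volume.restrict (Icc 0 (2 * π) ×ℂ Icc a b)))
    (hKi : ∫⁻ z in Icc 0 (2 * π) ×ℂ Icc a b, ‖K z‖ₑ ^ 2 < ⊤) :
    IntegrableOn (fun z => f (z + t * Complex.I) * K z) (Icc 0 (2 * π) ×ℂ Icc a b) := by
  have hc : IsCompact (Icc 0 (2 * π) ×ℂ Icc a b) := isCompact_Icc.reProdIm isCompact_Icc
  have hfin : IsFiniteMeasure (volume.restrict (Icc 0 (2 * π) ×ℂ Icc a b)) :=
    ⟨by simpa using hc.measure_lt_top⟩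
  have h1 : MemLp K 2 (volume.restrict (Icc 0 (2 * π) ×ℂ Icc a b)) := by
    refine ⟨hKm, ?_⟩
    rw [eLpNorm_lt_top_iff_lintegral_rpow_enorm_lt_top (by norm_num) (by norm_num)]
    simpa using hKi
  refine IntegrableOn.continuousOn_mul ?_ (h1.integrable (by norm_num)) hc
  exact (continuousOn_translate hf ht).mono fun z hz => ha.trans_le (Complex.mem_reProdIm.1 hz).2.1

theorem rectangle_pairing (hf : DifferentiableOn ℂ f {z | 0 < z.im})
    (hp : ∀ z : ℂ, 0 < z.im → f (z + 2 * π) = f z) (ha : 0 < a) (hab : a ≤ b) (ht : 0 ≤ t)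
    (hq : ∀ z : ℂ, 0 < z.im → z.im ≤ b → HasFDerivAt q (q' z) z)
    (hqp : ∀ z : ℂ, 0 < z.im → z.im ≤ b → q (z + 2 * π) = q z)
    (hK : ∀ z : ℂ, 0 < z.im → z.im ≤ b →
      Complex.I * q' z 1 - q' z Complex.I = K z + Complex.I * (starRingEnd ℂ) (f z))
    (hKm : AEStronglyMeasurable K (volume.restrict (Icc 0 (2 * π) ×ℂ Icc a b)))
    (hKi : ∫⁻ z in Icc 0 (2 * π) ×ℂ Icc a b, ‖K z‖ₑ ^ 2 < ⊤) :
    (∫ x in (0 : ℝ)..2 * π, f (x + a * Complex.I + t * Complex.I) * q (x + a * Complex.I)) -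
      (∫ x in (0 : ℝ)..2 * π, f (x + b * Complex.I + t * Complex.I) * q (x + b * Complex.I)) =
      (∫ z in Ioc 0 (2 * π) ×ℂ Ioc a b, f (z + t * Complex.I) * K z) +
        Complex.I * ∫ z in Ioc 0 (2 * π) ×ℂ Ioc a b,
          f (z + t * Complex.I) * (starRingEnd ℂ) (f z) := by
  have hex : ∀ z : ℂ, 0 < z.im → z.im ≤ b → ∃ D : ℂ →L[ℝ] ℂ,
      HasFDerivAt (fun z => f (z + t * Complex.I) * q z) D z ∧
      Complex.I • D 1 - D Complex.I = f (z + t * Complex.I) * K z +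
        Complex.I * (f (z + t * Complex.I) * (starRingEnd ℂ) (f z)) := fun z h1 h2 =>
    hasFDerivAt_translate_mul hf h1 ht (hq z h1 h2) (hK z h1 h2)
  choose! D hD hDe using hex
  set g : ℂ → ℂ := fun z => f (z + t * Complex.I) * q z with hg
  have hπ : (0 : ℝ) ≤ 2 * π := by positivity
  have hu1 : uIcc (⟨0, a⟩ : ℂ).re (⟨2 * π, b⟩ : ℂ).re = Icc 0 (2 * π) := uIcc_of_le hπ
  have hu2 : uIcc (⟨0, a⟩ : ℂ).im (⟨2 * π, b⟩ : ℂ).im = Icc a b := uIcc_of_le hab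
  have hi1 := integrableOn_translate_mul hf ha ht hKm hKi
  have hi2 : IntegrableOn _ (Icc 0 (2 * π) ×ℂ Icc a b) :=
    (integrableOn_translate_mul_conj (b := b) hf ha ht).const_mul Complex.I
  have hi : IntegrableOn (fun z => Complex.I • D z 1 - D z Complex.I)
      (Icc 0 (2 * π) ×ℂ Icc a b) := by
    refine (hi1.add hi2).congr_fun (fun z hz => ?_)
      (measurableSet_reProdIm measurableSet_Icc measurableSet_Icc)
    have h1 := (Complex.mem_reProdIm.1 hz).2
    exact (hDe z (ha.trans_le h1.1) h1.2).symm
  have h := Complex.integral_boundary_rect_of_hasFDerivAt_real_off_countable g D ⟨0, a⟩ ⟨2 * π, b⟩ ∅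
    countable_empty ?_ ?_ (by rw [hu1, hu2]; exact hi)
  · simp only at h
    have hside : ∀ s : ℝ, s ∈ uIcc a b → g (((2 * π : ℝ) : ℂ) + s * Complex.I) =
        g (((0 : ℝ) : ℂ) + s * Complex.I) := by
      intro s hs
      rw [uIcc_of_le hab] at hs
      have hs0 : 0 < s := ha.trans_le hs.1
      simp only [hg]
      congr 1
      · rw [← hp (((0 : ℝ) : ℂ) + s * Complex.I + t * Complex.I) (by simpa using by linarith)]
        congr 1
        push_cast
        ring
      · rw [← hqp (((0 : ℝ) : ℂ) + s * Complex.I) (by simpa using hs0) (by simpa using hs.2)]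
        congr 1
        push_cast
        ring
    rw [intervalIntegral.integral_congr hside] at h
    have hr : ∫ x in (0 : ℝ)..2 * π, ∫ y in a..b,
        Complex.I • D (x + y * Complex.I) 1 - D (x + y * Complex.I) Complex.I =
        ∫ z in Ioc 0 (2 * π) ×ℂ Ioc a b, (Complex.I • D z 1 - D z Complex.I) := by
      rw [integral_reProdIm (hi.mono_set Ioc_reProdIm_subset), intervalIntegral.integral_of_le hπ]
      simp only [intervalIntegral.integral_of_le hab]
    rw [hr] at h
    have hsum : ∫ z in Ioc 0 (2 * π) ×ℂ Ioc a b, (Complex.I • D z 1 - D z Complex.I) =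
        (∫ z in Ioc 0 (2 * π) ×ℂ Ioc a b, f (z + t * Complex.I) * K z) +
        Complex.I * ∫ z in Ioc 0 (2 * π) ×ℂ Ioc a b,
          f (z + t * Complex.I) * (starRingEnd ℂ) (f z) := by
      rw [← integral_const_mul, ← integral_add (hi1.mono_set Ioc_reProdIm_subset)
        (hi2.mono_set Ioc_reProdIm_subset)]
      refine setIntegral_congr_fun (measurableSet_reProdIm measurableSet_Ioc measurableSet_Ioc)
        fun z hz => ?_
      have h1 := (Complex.mem_reProdIm.1 hz).2
      exact hDe z (ha.trans h1.1) h1.2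
    rw [← hsum, ← h]
    ring
  · intro z hz
    rw [hu1, hu2] at hz
    have h1 := (Complex.mem_reProdIm.1 hz).2
    exact (hD z (ha.trans_le h1.1) h1.2).continuousAt.continuousWithinAt
  · intro z hz
    have h1 := (Complex.mem_reProdIm.1 hz.1).2
    simp only [min_eq_left hab, max_eq_right hab] at h1
    exact hD z (ha.trans h1.1) h1.2.le

end

section

variable {f q K : ℂ → ℂ} {q' : ℂ → ℂ →L[ℝ] ℂ} {a b t : ℝ}

theorem enorm_integral_mul_sq_le (hf : DifferentiableOn ℂ f {z | 0 < z.im}) (ha : 0 < a)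
    (ht : 0 ≤ t) (hKm : AEStronglyMeasurable K (volume.restrict (Icc 0 (2 * π) ×ℂ Icc a b))) :
    ‖∫ z in Ioc 0 (2 * π) ×ℂ Ioc a b, f (z + t * Complex.I) * K z‖ₑ ^ 2 ≤
      boxEnergy f (a + t) (b + t) * ∫⁻ z in Icc 0 (2 * π) ×ℂ Icc a b, ‖K z‖ₑ ^ 2 := by
  have hfm : AEStronglyMeasurable (fun z => f (z + t * Complex.I))
      (volume.restrict (Ioc 0 (2 * π) ×ℂ Ioc a b)) := by
    refine ContinuousOn.aestronglyMeasurable ?_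
      (measurableSet_reProdIm measurableSet_Ioc measurableSet_Ioc)
    exact (continuousOn_translate hf ht).mono fun z hz => ha.trans (Complex.mem_reProdIm.1 hz).2.1
  have hKm' := hKm.mono_measure (Measure.restrict_mono (Ioc_reProdIm_subset) le_rfl)
  calc ‖∫ z in Ioc 0 (2 * π) ×ℂ Ioc a b, f (z + t * Complex.I) * K z‖ₑ ^ 2
      ≤ (∫⁻ z in Ioc 0 (2 * π) ×ℂ Ioc a b, ‖f (z + t * Complex.I)‖ₑ * ‖K z‖ₑ) ^ 2 := by
        gcongr
        refine (enorm_integral_le_lintegral_enorm _).trans_eq ?_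
        simp only [enorm_mul]
    _ ≤ (∫⁻ z in Ioc 0 (2 * π) ×ℂ Ioc a b, ‖f (z + t * Complex.I)‖ₑ ^ 2) *
        ∫⁻ z in Ioc 0 (2 * π) ×ℂ Ioc a b, ‖K z‖ₑ ^ 2 :=
        sq_lintegral_mul_le hfm.enorm hKm'.enorm
    _ ≤ _ := by
        refine mul_le_mul' (setLIntegral_translate (fun z => ‖f z‖ₑ ^ 2) a b t).le ?_
        exact lintegral_mono_set Ioc_reProdIm_subset

theorem boxEnergy_le_of_pairing (hf : DifferentiableOn ℂ f {z | 0 < z.im})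
    (hp : ∀ z : ℂ, 0 < z.im → f (z + 2 * π) = f z) (hb : 0 < b)
    (hq : ∀ z : ℂ, 0 < z.im → z.im ≤ b → HasFDerivAt q (q' z) z)
    (hqp : ∀ z : ℂ, 0 < z.im → z.im ≤ b → q (z + 2 * π) = q z)
    (hK : ∀ z : ℂ, 0 < z.im → z.im ≤ b →
      Complex.I * q' z 1 - q' z Complex.I = K z + Complex.I * (starRingEnd ℂ) (f z))
    (hKm : AEStronglyMeasurable K (volume.restrict (Icc 0 (2 * π) ×ℂ Ioc 0 b)))
    (hKi : ∫⁻ z in Icc 0 (2 * π) ×ℂ Ioc 0 b, ‖K z‖ₑ ^ 2 < ⊤)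
    (hq1 : ∀ z : ℂ, 0 < z.im → z.im ≤ b → ‖q z‖ ≤ 1)
    (hq0 : ∀ ε > 0, ∃ δ > 0, ∀ z : ℂ, 0 < z.im → z.im < δ → ‖q z‖ ≤ ε) :
    ∃ M : ℝ, ∀ s, 0 < s → s ≤ 1 → s ≤ b → boxEnergy f s b ≤ ENNReal.ofReal M := by
  obtain ⟨C, hC, hCb⟩ := exists_norm_le_of_continuousOn_upper (b := b + 1) hf.continuousOn hb
  have hc0 := boxEnergy_lt_top (b := b + 1) hf.continuousOn hb
  set c₀ := (boxEnergy f b (b + 1)).toReal with hc₀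
  set σ := (∫⁻ z in Icc 0 (2 * π) ×ℂ Ioc 0 b, ‖K z‖ₑ ^ 2).toReal with hσ
  have hπ : (0 : ℝ) ≤ 2 * π := by positivity
  refine ⟨2 * (1 + 2 * π * C) + c₀ + σ, fun s hs hs1 hsb => ?_⟩
  obtain ⟨C', hC', hCb'⟩ := exists_norm_le_of_continuousOn_upper (b := b + 1) hf.continuousOn hs
  obtain ⟨δ₁, hδ₁, hqδ⟩ := hq0 (1 / (2 * π * C')) (by positivity)
  set δ := min (δ₁ / 2) (s / 2) with hδ
  have hδ0 : 0 < δ := by positivity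
  have hδ1 : δ < δ₁ := (min_le_left _ _).trans_lt (by linarith)
  have hδ2 : δ ≤ s / 2 := min_le_right _ _
  have hsub : Icc 0 (2 * π) ×ℂ Icc δ b ⊆ Icc 0 (2 * π) ×ℂ Ioc 0 b :=
    fun z hz => ⟨hz.1, hδ0.trans_le hz.2.1, hz.2.2⟩
  have hKm' := hKm.mono_measure (Measure.restrict_mono hsub le_rfl)
  have hKi' : ∫⁻ z in Icc 0 (2 * π) ×ℂ Icc δ b, ‖K z‖ₑ ^ 2 ≤ ENNReal.ofReal σ :=
    (lintegral_mono_set hsub).trans (ENNReal.ofReal_toReal hKi.ne).ge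
  have hpair := rectangle_pairing hf hp hδ0 (by linarith) hs.le hq hqp hK hKm'
    (hKi'.trans_lt ENNReal.ofReal_lt_top)
  have hX := enorm_integral_mul_sq_le (b := b) (t := s) hf hδ0 hs.le hKm'
  have hJ := enorm_integral_translate_mul_conj (b := b) (t := s) hf hp hδ0 hs.le
  set X := ∫ z in Ioc 0 (2 * π) ×ℂ Ioc δ b, f (z + s * Complex.I) * K z with hXd
  set J := ∫ z in Ioc 0 (2 * π) ×ℂ Ioc δ b, f (z + s * Complex.I) * (starRingEnd ℂ) (f z) with hJd
  have hbot : ‖∫ x in (0 : ℝ)..2 * π, f (x + δ * Complex.I + s * Complex.I) *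
      q (x + δ * Complex.I)‖ ≤ 1 := by
    refine (intervalIntegral.norm_integral_le_of_norm_le_const
      (C := C' * (1 / (2 * π * C'))) fun x hx => ?_).trans_eq ?_
    · rw [uIoc_of_le hπ] at hx
      rw [norm_mul]
      have h1 := hCb' x (Ioc_subset_Icc_self hx) (δ + s) ⟨by linarith, by linarith⟩
      have h2 := hqδ (x + δ * Complex.I) (by simpa using hδ0) (by simpa using hδ1)
      push_cast at h1
      rw [add_mul, ← add_assoc] at h1
      gcongr
    · rw [sub_zero, abs_of_nonneg hπ]
      field_simp
  have htop : ‖∫ x in (0 : ℝ)..2 * π, f (x + b * Complex.I + s * Complex.I) *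
      q (x + b * Complex.I)‖ ≤ 2 * π * C := by
    refine (intervalIntegral.norm_integral_le_of_norm_le_const (C := C) fun x hx => ?_).trans_eq ?_
    · rw [uIoc_of_le hπ] at hx
      rw [norm_mul]
      have h1 := hCb x (Ioc_subset_Icc_self hx) (b + s) ⟨by linarith, by linarith⟩
      have h2 := hq1 (x + b * Complex.I) (by simpa using hb) (by simp)
      push_cast at h1
      rw [add_mul, ← add_assoc] at h1
      calc _ ≤ C * 1 := by gcongr
        _ = C := mul_one C
    · rw [sub_zero, abs_of_nonneg hπ]
      ring
  have hJn : ‖J‖ ≤ 1 + 2 * π * C + ‖X‖ := by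
    have h1 : Complex.I * J = (∫ x in (0 : ℝ)..2 * π, f (x + δ * Complex.I + s * Complex.I) *
        q (x + δ * Complex.I)) - (∫ x in (0 : ℝ)..2 * π,
        f (x + b * Complex.I + s * Complex.I) * q (x + b * Complex.I)) - X := by
      rw [hpair]
      ring
    have h2 := congrArg norm h1
    rw [norm_mul, Complex.norm_I, one_mul] at h2
    rw [h2]
    refine (norm_sub_le _ _).trans (add_le_add ((norm_sub_le _ _).trans
      (add_le_add hbot htop)) le_rfl)
  have hXn : ‖X‖ ^ 2 ≤ (‖J‖ + c₀) * σ := by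
    have h1 : boxEnergy f (δ + s) (b + s) ≤ ENNReal.ofReal (‖J‖ + c₀) := by
      rw [ENNReal.ofReal_add (norm_nonneg _) ENNReal.toReal_nonneg, ofReal_norm, hJ,
        ENNReal.ofReal_toReal hc0.ne]
      refine boxEnergy_union_le f fun y hy => ?_
      rcases le_or_gt y b with h | h
      · exact Or.inl ⟨by linarith [hy.1], by linarith⟩
      · exact Or.inr ⟨h, by linarith [hy.2]⟩
    have h2 : ENNReal.ofReal (‖X‖ ^ 2) ≤ ENNReal.ofReal ((‖J‖ + c₀) * σ) := by
      rw [ofReal_norm_sq_eq, ENNReal.ofReal_mul (by positivity)]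
      exact hX.trans (mul_le_mul' h1 hKi')
    exact (ENNReal.ofReal_le_ofReal_iff (by positivity)).1 h2
  have hXs : ‖X‖ ≤ (‖J‖ + c₀ + σ) / 2 := by
    refine le_of_sq_le_sq (hXn.trans ?_) (by positivity)
    nlinarith [sq_nonneg (‖J‖ + c₀ - σ)]
  calc boxEnergy f s b ≤ boxEnergy f (δ + s / 2) (b + s / 2) :=
        boxEnergy_mono f fun y hy => ⟨by linarith [hy.1], by linarith [hy.2]⟩
    _ = ENNReal.ofReal ‖J‖ := by rw [← hJ, ofReal_norm]
    _ ≤ _ := ENNReal.ofReal_le_ofReal (by linarith)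

theorem boxEnergy_zero_lt_top {M : ENNReal} (hM : M < ⊤) (hb : 0 < b)
    (h : ∀ s, 0 < s → s ≤ 1 → s ≤ b → boxEnergy f s b ≤ M) : boxEnergy f 0 b < ⊤ := by
  set u : ℕ → ℝ := fun n => min 1 b / (n + 1) with hu
  have hu0 : ∀ n, 0 < u n := fun n => by positivity
  have hu1 : ∀ n, u n ≤ min 1 b := fun n => div_le_self (by positivity) (by simp)
  have hanti : Antitone u := by
    intro m n hmn
    simp only [hu]
    gcongr
  have hun : Ioc 0 (2 * π) ×ℂ Ioc 0 b = ⋃ n, Ioc 0 (2 * π) ×ℂ Ioc (u n) b := by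
    ext z
    simp only [mem_iUnion, Complex.mem_reProdIm]
    constructor
    · intro hz
      have hlim : Tendsto u atTop (𝓝 0) := by
        have h1 := (tendsto_one_div_add_atTop_nhds_zero_nat (𝕜 := ℝ)).const_mul (min 1 b)
        rw [mul_zero] at h1
        exact h1.congr fun n => by rw [hu, mul_one_div]
      obtain ⟨n, hn⟩ := (hlim.eventually (gt_mem_nhds hz.2.1)).exists
      exact ⟨n, hz.1, hn, hz.2.2⟩
    · rintro ⟨n, hz⟩
      exact ⟨hz.1, (hu0 n).trans hz.2.1, hz.2.2⟩
  have hdir : Directed (· ⊆ ·) fun n => Ioc 0 (2 * π) ×ℂ Ioc (u n) b := by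
    refine Monotone.directed_le fun m n hmn => ?_
    exact fun z hz => ⟨hz.1, (hanti hmn).trans_lt hz.2.1, hz.2.2⟩
  rw [boxEnergy, hun, setLIntegral_iUnion_of_directed _ hdir]
  refine (iSup_le fun n => ?_).trans_lt hM
  exact h _ (hu0 n) ((hu1 n).trans (min_le_left _ _)) ((hu1 n).trans (min_le_right _ _))

end

namespace JordanMap

variable {γ w : ℝ → ℂ} {Ω Ωstar : Set ℂ} {F L : ℂ → ℂ} {v c : ℝ}

theorem lintegral_pullback_lt_top (J : JordanMap γ Ω Ωstar F)
    (hL : IsLift (fun ζ => F (toDisk ζ)) L) {u : ℂ → ENNReal} (hu : ∫⁻ p, u p < ⊤) (b : ℝ) :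
    ∫⁻ ζ in Icc 0 (2 * π) ×ℂ Ioc 0 b,
      ENNReal.ofReal (‖Complex.exp (L ζ)‖ ^ 2) * u (F (toDisk ζ)) < ⊤ := by
  have h1 : ∀ a : ℝ, ∫⁻ ζ in Ioc a (a + 2 * π) ×ℂ Ioc 0 b,
      ENNReal.ofReal (‖Complex.exp (L ζ)‖ ^ 2) * u (F (toDisk ζ)) < ⊤ := by
    intro a
    have hinj : InjOn (fun ζ => F (toDisk ζ)) (Ioc a (a + 2 * π) ×ℂ Ioc 0 b) := by
      intro x hx y hy hxy
      exact toDisk_injOn hx.1 hy.1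
        (J.bij.injOn (toDisk_mem_ball hx.2.1) (toDisk_mem_ball hy.2.1) hxy)
    rw [← lintegral_image_holomorphic (measurableSet_reProdIm measurableSet_Ioc measurableSet_Ioc)
      (fun z hz => hL.hasDerivAt z hz.2.1) hinj]
    exact (setLIntegral_le_lintegral _ _).trans_lt hu
  have h2 : Icc 0 (2 * π) ×ℂ Ioc 0 b ⊆ (Ioc (-(2 * π)) (-(2 * π) + 2 * π) ×ℂ Ioc 0 b) ∪
      (Ioc 0 (0 + 2 * π) ×ℂ Ioc 0 b) := by
    intro z hz
    have h3 : z.re ∈ Icc 0 (2 * π) := hz.1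
    rcases h3.1.eq_or_lt with h | h
    · refine Or.inl ⟨?_, hz.2⟩
      have := Real.pi_pos
      change z.re ∈ Ioc _ _
      exact ⟨by linarith, by linarith⟩
    · refine Or.inr ⟨?_, hz.2⟩
      change z.re ∈ Ioc _ _
      exact ⟨h, by linarith [h3.2]⟩
  exact ((lintegral_mono_set h2).trans (lintegral_union_le _ _ _)).trans_lt
    (ENNReal.add_lt_top.2 ⟨h1 _, h1 _⟩)

theorem stripEnergy_lt_top (J : JordanMap γ Ω Ωstar F) (H : ChordArcMap w v c)
    (hr : range w = range γ) (hS : sobolevSeminorm (1 / 2) (fun θ => deriv w θ) < ⊤)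
    (hL : IsLift (fun ζ => F (toDisk ζ)) L) : stripEnergy L 1 < ⊤ := by
  obtain ⟨a, ha⟩ := J.exists_phase_sub_one H hr hS hL
  set Ψ : ℂ → ℂ := fun ζ => F (toDisk ζ) with hΨ
  set m := phase w a Ψ L with hm
  obtain ⟨y₀, hy₀, h0⟩ := ha (1 / 2) (by norm_num)
  set b := y₀ / 2 with hb
  have hb0 : 0 < b := by positivity
  set q' : ℂ → ℂ →L[ℝ] ℂ := fun z =>
    ((ContinuousLinearMap.toSpanSingleton ℂ (m z)⁻¹).restrictScalars ℝ).comp (fderiv ℝ m z) with hq'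
  set K : ℂ → ℂ := fun z => Complex.I * q' z 1 - q' z Complex.I -
    Complex.I * (starRingEnd ℂ) (deriv L z) with hK
  have hq'a : ∀ z h, q' z h = fderiv ℝ m z h * (m z)⁻¹ := fun z h => by simp [hq']
  have hLd : DifferentiableOn ℂ L {z | 0 < z.im} :=
    fun z hz => (hL.diff z hz).differentiableAt.differentiableWithinAt
  have hfd : DifferentiableOn ℂ (deriv L) {z | 0 < z.im} := hLd.deriv isOpen_upper
  have hlog : ∀ z : ℂ, ‖m z - 1‖ ≤ 1 / 2 → ‖Complex.log (m z)‖ ≤ 3 / 2 * ‖m z - 1‖ := by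
    intro z hz
    have := Complex.norm_log_one_add_half_le_self hz
    rwa [add_sub_cancel] at this
  have hhalf : ∀ z : ℂ, ‖m z - 1‖ ≤ 1 / 2 → 1 / 2 ≤ ‖m z‖ := by
    intro z hz
    have h1 := norm_sub_norm_le (1 : ℂ) (m z)
    rw [norm_one, norm_sub_rev] at h1
    linarith
  have hslit : ∀ z : ℂ, ‖m z - 1‖ ≤ 1 / 2 → m z ∈ Complex.slitPlane := by
    intro z hz
    refine Or.inl ?_
    have h1 := (abs_le.1 ((Complex.abs_re_le_norm _).trans hz)).1
    simp only [Complex.sub_re, Complex.one_re] at h1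
    linarith
  have hKn : ∀ z : ℂ, 0 < z.im → z.im ≤ b → ‖K z‖ₑ ^ 2 ≤ 65536 *
      (ENNReal.ofReal (‖Complex.exp (L z)‖ ^ 2) * tangentDensity w c (F (toDisk z))) := by
    intro z hz hzb
    obtain ⟨h1, Q, hQ, hQn⟩ := h0 z hz (by linarith)
    have hm0 : m z ≠ 0 := norm_pos_iff.1 (by linarith [hhalf z h1])
    have hKe : K z = (Complex.I * Q 1 - Q Complex.I) * (m z)⁻¹ := by
      simp only [hK, hq'a, hQ.fderiv, sub_apply, ContinuousLinearMap.smulRight_apply, imDeriv_apply,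
        one_mul, Complex.real_smul]
      have e1 : (starRingEnd ℂ) (deriv L z) = (deriv L z).re - (deriv L z).im * Complex.I := by
        apply Complex.ext <;> simp
      have e2 : (Complex.I * deriv L z).im = (deriv L z).re := by simp
      rw [e1, e2]
      field_simp
      ring
    have hKb : ‖K z‖ ≤ 4 * ‖Q‖ := by
      rw [hKe, norm_mul, norm_inv]
      have e1 : ‖Complex.I * Q 1 - Q Complex.I‖ ≤ 2 * ‖Q‖ := by
        refine (norm_sub_le _ _).trans ?_
        have e2 := Q.le_opNorm 1
        have e3 := Q.le_opNorm Complex.I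
        rw [norm_one, mul_one] at e2
        rw [Complex.norm_I, mul_one] at e3
        rw [norm_mul, Complex.norm_I, one_mul]
        linarith
      have e4 : ‖m z‖⁻¹ ≤ 2 := by
        have := hhalf z h1
        exact inv_le_of_inv_le₀ (by norm_num) (by linarith)
      calc _ ≤ 2 * ‖Q‖ * 2 := by gcongr
        _ = _ := by ring
    calc ‖K z‖ₑ ^ 2 = ENNReal.ofReal (‖K z‖ ^ 2) := (ofReal_norm_sq_eq _).symm
      _ ≤ ENNReal.ofReal (16 * ‖Q‖ ^ 2) := by
        apply ENNReal.ofReal_le_ofReal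
        nlinarith [norm_nonneg (K z), norm_nonneg Q]
      _ = 16 * ENNReal.ofReal (‖Q‖ ^ 2) := by
        rw [ENNReal.ofReal_mul (by norm_num), ENNReal.ofReal_ofNat]
      _ ≤ 16 * (4096 * ENNReal.ofReal (‖Complex.exp (L z)‖ ^ 2) *
          tangentDensity w c (F (toDisk z))) := by gcongr
      _ = _ := by
        rw [← mul_assoc, ← mul_assoc, ← mul_assoc]
        norm_num
  have hKi : ∫⁻ z in Icc 0 (2 * π) ×ℂ Ioc 0 b, ‖K z‖ₑ ^ 2 < ⊤ := by
    have hms := measurableSet_reProdIm (measurableSet_Icc (a := (0 : ℝ)) (b := 2 * π))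
      (measurableSet_Ioc (a := 0) (b := b))
    refine (setLIntegral_mono' hms fun z hz => hKn z hz.2.1 hz.2.2).trans_lt ?_
    rw [lintegral_const_mul' _ _ (by norm_num)]
    exact ENNReal.mul_lt_top (by norm_num)
      (J.lintegral_pullback_lt_top hL (H.lintegral_tangentDensity_lt_top hS) b)
  have hmc : ContinuousOn m (Icc 0 (2 * π) ×ℂ Ioc 0 b) := by
    intro z hz
    have hz2 : z.im ∈ Ioc 0 b := hz.2
    obtain ⟨-, Q, hQ, -⟩ := h0 z hz2.1 (by linarith [hz2.2])
    exact hQ.continuousAt.continuousWithinAt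
  have hKm : AEStronglyMeasurable K (volume.restrict (Icc 0 (2 * π) ×ℂ Ioc 0 b)) := by
    have hms := measurableSet_reProdIm (measurableSet_Icc (a := (0 : ℝ)) (b := 2 * π))
      (measurableSet_Ioc (a := 0) (b := b))
    have e1 : AEStronglyMeasurable (fun z => (m z)⁻¹)
        (volume.restrict (Icc 0 (2 * π) ×ℂ Ioc 0 b)) := by
      refine ContinuousOn.aestronglyMeasurable (hmc.inv₀ fun z hz => ?_) hms
      have hz2 : z.im ∈ Ioc 0 b := hz.2
      have := hhalf z (h0 z hz2.1 (by linarith [hz2.2])).1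
      exact norm_pos_iff.1 (by linarith)
    have e2 : AEStronglyMeasurable (fun z => (starRingEnd ℂ) (deriv L z))
        (volume.restrict (Icc 0 (2 * π) ×ℂ Ioc 0 b)) :=
      ContinuousOn.aestronglyMeasurable ((Complex.continuous_conj.comp_continuousOn
        hfd.continuousOn).mono fun z hz => hz.2.1) hms
    have e3 : ∀ h, AEStronglyMeasurable (fun z => q' z h)
        (volume.restrict (Icc 0 (2 * π) ×ℂ Ioc 0 b)) := by
      intro h
      simp only [hq'a]
      exact (measurable_fderiv_apply_const ℝ m h).aestronglyMeasurable.mul e1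
    exact (((e3 1).const_mul _).sub (e3 _)).sub (e2.const_mul _)
  have hqd : ∀ z : ℂ, 0 < z.im → z.im ≤ b →
      HasFDerivAt (fun z => Complex.log (m z)) (q' z) z := by
    intro z hz hzb
    obtain ⟨h1, Q, hQ, -⟩ := h0 z hz (by linarith)
    exact ((Complex.hasDerivAt_log (hslit z h1)).hasFDerivAt.restrictScalars ℝ).comp z
      hQ.differentiableAt.hasFDerivAt
  have hq1 : ∀ z : ℂ, 0 < z.im → z.im ≤ b → ‖Complex.log (m z)‖ ≤ 1 := by
    intro z hz hzb
    have h1 := (h0 z hz (by linarith)).1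
    linarith [hlog z h1]
  have hq0 : ∀ ε > 0, ∃ δ > 0, ∀ z : ℂ, 0 < z.im → z.im < δ → ‖Complex.log (m z)‖ ≤ ε := by
    intro ε hε
    obtain ⟨δ, hδ, hδ1⟩ := ha (min (1 / 2) (ε / 2)) (by positivity)
    refine ⟨δ, hδ, fun z hz hzd => ?_⟩
    have h1 := (hδ1 z hz hzd).1
    have h2 := hlog z (h1.trans (min_le_left _ _))
    have h3 := h1.trans (min_le_right _ _)
    linarith
  obtain ⟨M, hM⟩ := boxEnergy_le_of_pairing (f := deriv L) (q := fun z => Complex.log (m z))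
    (q' := q') (K := K) hfd (fun z hz => hL.perL z hz) hb0 hqd
    (fun z hz hzb => by simp only [hm, hL.phase_per hz])
    (fun z hz hzb => by simp only [hK]; ring) hKm hKi hq1 hq0
  have h1 := boxEnergy_zero_lt_top ENNReal.ofReal_lt_top hb0 hM
  have h2 := boxEnergy_lt_top (b := 1) hfd.continuousOn hb0
  refine lt_of_le_of_lt ?_ (ENNReal.add_lt_top.2 ⟨h1, h2⟩)
  refine le_trans (lintegral_mono_set fun z hz => ?_) (boxEnergy_union_le (a := 0) (b := 1) _ ?_)
  · exact ⟨hz.1, hz.2.1, hz.2.2.le⟩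
  · intro y hy
    rcases le_or_gt y b with h | h
    · exact Or.inl ⟨hy.1, h⟩
    · exact Or.inr ⟨h, hy.2⟩

end JordanMap

end WeilPetersson

theorem wp_quasicircle_iff_chordarc_and_Hthreehalves
    -- the Jordan curve `Γ = range γ`, parametrized `2π`-periodically and injectively
    (γ : ℝ → ℂ) (hγc : Continuous γ) (hγp : ∀ θ, γ (θ + 2 * π) = γ θ)
    (hγi : Set.InjOn γ (Set.Ico 0 (2 * π)))
    -- `Γ` is a quasicircle: Ahlfors' bounded turning condition
    (hqc : ∃ C : ℝ, 0 < C ∧ ∀ s t : ℝ, s ≤ t → t ≤ s + 2 * π →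
      min (Metric.diam (γ '' Set.Icc s t)) (Metric.diam (γ '' Set.Icc t (s + 2 * π)))
        ≤ C * ‖γ s - γ t‖)
    -- interior `Ω` and exterior `Ωstar`
    (Ω Ωstar : Set ℂ)
    (hΩo : IsOpen Ω) (hΩconn : IsConnected Ω) (hΩso : IsOpen Ωstar)
    (hΩsconn : IsConnected Ωstar) (hdisj : Disjoint Ω Ωstar)
    (hunion : Ω ∪ Ωstar = (Set.range γ)ᶜ)
    (hΩbdd : Bornology.IsBounded Ω) (hΩsunbdd : ¬ Bornology.IsBounded Ωstar)
    -- the interior Riemann map `F : 𝔻 → Ω`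
    (F : ℂ → ℂ) (hF : DifferentiableOn ℂ F (ball (0 : ℂ) 1))
    (hFbij : Set.BijOn F (ball (0 : ℂ) 1) Ω) :
    (∫⁻ z in ball (0 : ℂ) 1,
        ENNReal.ofReal (‖deriv (deriv F) z / deriv F z‖ ^ 2)) < ⊤ ↔
      -- `Γ` is rectifiable, with arclength parametrization `w` and length `ℓ` …
      ∃ ℓ : ℝ, 0 < ℓ ∧ ∃ w : ℝ → ℂ,
        LipschitzWith (Real.toNNReal (ℓ / (2 * π))) w ∧
        (∀ θ, w (θ + 2 * π) = w θ) ∧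
        Set.InjOn w (Set.Ico 0 (2 * π)) ∧
        Set.range w = Set.range γ ∧
        (∀ᵐ θ : ℝ, ∃ v : ℂ, HasDerivAt w v θ ∧ ‖v‖ = ℓ / (2 * π)) ∧
        -- … `Γ` is chord-arc: arc length distance is at most `C` times chord distance …
        (∃ C : ℝ, 0 < C ∧ ∀ θ ∈ Set.Icc (0 : ℝ) (2 * π), ∀ σ ∈ Set.Icc (0 : ℝ) (2 * π),
          (ℓ / (2 * π)) * min |θ - σ| (2 * π - |θ - σ|) ≤ C * ‖w θ - w σ‖) ∧
        -- … and `w' ∈ Ḣ^{1/2}(S¹)`, i.e. `w ∈ H^{3/2}(S¹)`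
        sobolevSeminorm (1 / 2) (fun θ => deriv w θ) < ⊤ := by
  have J : WeilPetersson.JordanMap γ Ω Ωstar F :=
    ⟨hγc, hγp, hγi, hΩo, hΩconn, hΩso, hΩsconn, hdisj, hunion, hΩbdd, hΩsunbdd, hF, hFbij⟩
  constructor
  · intro hE
    obtain ⟨ℓ, w, hw, hS⟩ := J.exists_chordArcCurve hE
    exact ⟨ℓ, hw.length_pos, w, hw.lip, hw.per, hw.inj, hw.range_eq, hw.ae_speed, hw.chordArc, hS⟩
  · rintro ⟨ℓ, hℓ, w, h1, h2, h3, h4, h5, h6, hS⟩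
    obtain ⟨c, H⟩ := WeilPetersson.ChordArcCurve.exists_chordArcMap
      (⟨hℓ, h1, h2, h3, h4, h5, h6⟩ : WeilPetersson.ChordArcCurve γ ℓ w)
    obtain ⟨L, hL, -, hL2⟩ := WeilPetersson.exists_isLift J.diff J.bij.injOn
    exact (WeilPetersson.disk_energy_iff_stripEnergy J.diff J.bij.injOn hL2).2
      (J.stripEnergy_lt_top H h4 hS hL)
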